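/- Let k ≥ 4 be an integer and K0, C0 > 0. Let u0 : (0,∞) → (0,∞) be smooth with u0(x) = x + K0·x^{2(k−1)} + o(x^{2(k−1)}) as x → 0⁺, and such that for all x > 0: 0 ≤ u0'(x) ≤ C0, |u0''(x)| ≤ C0, and |u0''(x)| ≤ C0·x^{2k−4}. Set K1 = (2k+1)!!·K0. Then there exist t0 > 0 and a smooth function u : (0,∞) × (0,t0] → (0,∞) solving u_t = u_{xx}/(1+u_x²) + (3/x)·u_x − 3/u on (0,∞) × (0,t0], with u_x(x,t) → 0 as x → 0⁺ for each t ∈ (0,t0] and u(x,t) → u0(x) as t → 0⁺ uniformly in x > 0, and there exists a smooth W : (0,∞) → (0,∞) solving the Alencar equation W''(z)/(1+W'(z)²) + (3/z)·W'(z) − 3/W(z) = 0 with W(z) = z + K1·z^{−2} + o(z^{−2}) as z → ∞, such that for every Z > 0, t^{−k/3}·u(t^{k/3}·z, t) → W(z) as t → 0⁺, uniformly for z ∈ (0,Z]. -/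

import Mathlib

open Filter Asymptotics Topology Real ContDiff
open Set hiding range mem_range
open Finset (range mul_sum sum_nonneg sum_add_distrib sum_le_sum mem_range sum_congr mem_filter
  sum_range_succ' sum_range_succ sum_le_sum_of_subset_of_nonneg sum_mul sum_div sum_sub_distrib
  abs_sum_le_sum_abs sum_filter_of_ne)
open Metric (ball mem_ball ball_mem_nhds mem_ball_self)

theorem monotoneOn_of_hasDerivAt {f f' : ℝ → ℝ} {s : Set ℝ} (hs : Convex ℝ s)
    (hd : ∀ x ∈ s, HasDerivAt f (f' x) x) (h : ∀ x ∈ s, 0 ≤ f' x) : MonotoneOn f s :=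
  monotoneOn_of_hasDerivWithinAt_nonneg hs (HasDerivAt.continuousOn hd)
    (fun x hx => (hd x (interior_subset hx)).hasDerivWithinAt) fun x hx => h x (interior_subset hx)

theorem exists_sub_eq_deriv_mul {f f' : ℝ → ℝ} {a b : ℝ} (hab : a < b)
    (hd : ∀ x ∈ Icc a b, HasDerivAt f (f' x) x) : ∃ c ∈ Ioo a b, f b - f a = f' c * (b - a) := by
  obtain ⟨c, hc, e⟩ := exists_hasDerivAt_eq_slope f f' hab (HasDerivAt.continuousOn hd)
    fun x hx => hd x (Ioo_subset_Icc_self hx)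
  exact ⟨c, hc, by rw [e, div_mul_cancel₀ _ (sub_pos.2 hab).ne']⟩

theorem abs_mul_le_of_le {a b A B : ℝ} (ha : |a| ≤ A) (hb : |b| ≤ B) : |a * b| ≤ A * B :=
  norm_mul_le_of_le (show ‖a‖ ≤ A from ha) hb

/-- Existence on a whole interval for a bounded, Lipschitz time-dependent vector field. -/
theorem exists_ode_of_bounded {E : Type*} [NormedAddCommGroup E] [NormedSpace ℝ E]
    [CompleteSpace E] {f : ℝ → E → E} {s T : ℝ} (hsT : s ≤ T) {K : NNReal} {M : ℝ}
    (hK : ∀ t ∈ Icc s T, LipschitzWith K (f t))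
    (hc : ∀ x, ContinuousOn (fun t => f t x) (Icc s T))
    (hM : ∀ t ∈ Icc s T, ∀ x, ‖f t x‖ ≤ M) (x₀ : E) :
    ∃ α : ℝ → E, α s = x₀ ∧
      ∀ t ∈ Icc s T, HasDerivWithinAt α (f t (α t)) (Icc s T) t := by
  have hM0 : 0 ≤ M := (norm_nonneg _).trans (hM s ⟨le_rfl, hsT⟩ x₀)
  exact (⟨fun t ht => (hK t ht).lipschitzOnWith, fun x _ => hc x, fun t ht x _ => hM t ht x, by
    simp only [sub_self, NNReal.coe_zero, sub_zero]
    rw [max_eq_left (sub_nonneg.2 hsT)]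
    exact le_rfl⟩ : IsPicardLindelof f (⟨s, le_rfl, hsT⟩ : Icc s T) x₀
      (⟨M, hM0⟩ * ⟨T - s, sub_nonneg.2 hsT⟩ : NNReal) 0 ⟨M, hM0⟩ K
    ).exists_eq_forall_mem_Icc_hasDerivWithinAt₀

/-- A function nonnegative to the left of one of its zeros has nonpositive derivative there. -/
theorem deriv_nonpos_of_left_nonneg {g : ℝ → ℝ} {g' s T t : ℝ} (hst : s < t) (htT : t ≤ T)
    (hd : HasDerivWithinAt g g' (Icc s T) t) (h0 : g t ≤ 0)
    (hpos : ∀ r ∈ Ico s t, 0 ≤ g r) : g' ≤ 0 := by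
  have := right_nhdsWithin_Ico_neBot hst
  refine le_of_tendsto ((hasDerivWithinAt_iff_tendsto_slope' (s := Ico s t) (by simp)).1 (hd.mono fun r hr =>
    ⟨hr.1, hr.2.le.trans htT⟩)) (eventually_mem_nhdsWithin.mono fun r hr => ?_)
  rw [slope_def_field]
  exact div_nonpos_of_nonneg_of_nonpos (by linarith [hpos r hr]) (by linarith [hr.2])

/-- A nonempty closed set of times in `[s, T]` has a first element. -/
theorem exists_first_time {s T : ℝ} {B : Set ℝ} (hB : IsClosed B) (hne : (B ∩ Icc s T).Nonempty) :
    ∃ t ∈ B ∩ Icc s T, ∀ r ∈ Ico s t, r ∉ B := by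
  obtain ⟨t, ht, hmin⟩ := (isCompact_Icc.inter_left hB).exists_isLeast hne
  exact ⟨t, ht, fun r hr hrB => (hmin ⟨hrB, hr.1, hr.2.le.trans ht.2.2⟩).not_gt hr.2⟩

/-- Finitely many functions which start positive stay positive, if whenever one of them touches
zero (the others being nonnegative) its derivative is positive. -/
theorem pos_of_first_touch {ι : Type*} [Finite ι] {g g' : ι → ℝ → ℝ} {s T : ℝ}
    (hd : ∀ i, ∀ t ∈ Icc s T, HasDerivWithinAt (g i) (g' i t) (Icc s T) t)
    (h0 : ∀ i, 0 < g i s)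
    (h : ∀ t ∈ Ioc s T, (∀ j, 0 ≤ g j t) → ∀ i, g i t = 0 → 0 < g' i t) :
    ∀ t ∈ Icc s T, ∀ i, 0 < g i t := by
  by_contra! hcon
  obtain ⟨t₁, ht₁, i₁, hi₁⟩ := hcon
  have hcont : ∀ i, ContinuousOn (g i) (Icc s T) := fun i t ht => (hd i t ht).continuousWithinAt
  obtain ⟨t, ⟨htB, ht⟩, hfirst⟩ := exists_first_time (isClosed_iUnion_of_finite fun i =>
    (hcont i).preimage_isClosed_of_isClosed isClosed_Icc (isClosed_Iic (a := (0 : ℝ))))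
    ⟨t₁, mem_iUnion.2 ⟨i₁, ht₁, hi₁⟩, ht₁⟩
  obtain ⟨i, -, hi⟩ := mem_iUnion.1 htB
  have hst : s < t := ht.1.lt_of_ne fun h' => (h0 i).not_ge (h' ▸ hi)
  have hbefore : ∀ r ∈ Ico s t, ∀ j, 0 < g j r := fun r hr j => by
    by_contra! hneg
    exact hfirst r hr (mem_iUnion.2 ⟨j, ⟨hr.1, hr.2.le.trans ht.2⟩, hneg⟩)
  have hge : ∀ j, 0 ≤ g j t := fun j => by
    have := right_nhdsWithin_Ico_neBot hst
    exact ge_of_tendsto ((hcont j t ht).mono fun r hr => ⟨hr.1, hr.2.le.trans ht.2⟩)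
      (eventually_mem_nhdsWithin.mono fun r hr => (hbefore r hr j).le)
  exact (deriv_nonpos_of_left_nonneg hst ht.2 (hd i t ht) hi fun r hr => (hbefore r hr i).le).not_gt
    (h t ⟨hst, ht.2⟩ hge i (le_antisymm hi (hge i)))

/-- Locally uniform convergence on an open set to a continuous limit implies continuous
convergence. -/
theorem TendstoLocallyUniformlyOn.tendsto_prod {X : Type*} [TopologicalSpace X] {Ω : Set X}
    (hΩ : IsOpen Ω) {f : ℕ → X → ℝ} {F : X → ℝ} (h : TendstoLocallyUniformlyOn f F atTop Ω)
    (hF : ContinuousOn F Ω) {x : X} (hx : x ∈ Ω) :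
    Tendsto (fun q : ℕ × X => f q.1 q.2) (atTop ×ˢ nhds x) (nhds (F x)) :=
  TendstoLocallyUniformlyOn.tendsto_comp (F := fun q : ℕ × X => f q.1) (g := Prod.snd)
    (fun u hu y hy => let ⟨t, ht, h1⟩ := h u hu y hy; ⟨t, ht, tendsto_fst.eventually h1⟩)
    (hF x hx) hx (hΩ.nhdsWithin_eq hx ▸ tendsto_snd)

/-- Continuous convergence on a set is locally uniform, with continuous limit. -/
theorem tendstoLocallyUniformlyOn_of_prod {X : Type*} [TopologicalSpace X] {Ω : Set X}
    {f : ℕ → X → ℝ} {F : X → ℝ} (h : ∀ x ∈ Ω,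
      Tendsto (fun q : ℕ × X => f q.1 q.2) (atTop ×ˢ nhds x) (nhds (F x))) :
    ContinuousOn F Ω ∧ TendstoLocallyUniformlyOn f F atTop Ω := by
  have key : ∀ x ∈ Ω, ∀ ε > 0, ∃ t ∈ nhds x, (∀ y ∈ t, y ∈ Ω → dist (F y) (F x) ≤ ε) ∧
      ∀ᶠ n in atTop, ∀ y ∈ t, dist (f n y) (F x) < ε := fun x hx ε hε => by
    obtain ⟨pa, ha, pb, hb, hab⟩ := eventually_prod_iff.1 (Metric.tendsto_nhds.1 (h x hx) ε hε)
    exact ⟨{y | pb y}, hb, fun y hy hyΩ => le_of_tendsto (((h y hyΩ).comp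
      (tendsto_id.prodMk tendsto_const_nhds)).dist tendsto_const_nhds)
      (ha.mono fun n hn => (hab hn hy).le), ha.mono fun n hn y hy => hab hn hy⟩
  refine ⟨fun x hx => Metric.tendsto_nhds.2 fun ε hε => ?_,
    Metric.tendstoLocallyUniformlyOn_iff.2 fun ε hε x hx => ?_⟩ <;>
    obtain ⟨t, ht, h1, h2⟩ := key x hx _ (half_pos hε)
  · filter_upwards [mem_nhdsWithin_of_mem_nhds ht, self_mem_nhdsWithin] with y hy hyΩ
    exact (h1 y hy hyΩ).trans_lt (half_lt_self hε)
  · exact ⟨_, inter_mem_nhdsWithin Ω ht, h2.mono fun n hn y hy => by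
      linarith [h1 y hy.2 hy.1, hn y hy.2, dist_triangle_right (F y) (f n y) (F x)]⟩

/-- Arzelà–Ascoli extraction for countably many sequences of functions on an open set which are
locally bounded and locally Lipschitz up to a vanishing error. -/
theorem exists_subseq_locallyUniform {X ι : Type*} [PseudoMetricSpace X]
    [TopologicalSpace.SeparableSpace X] [Countable ι] {Ω : Set X} (hΩ : IsOpen Ω)
    (f : ℕ → ι → X → ℝ)
    (hf : ∀ i, ∀ x ∈ Ω, ∃ C : ℝ, ∃ r > 0, ∃ e : ℕ → ℝ, Tendsto e atTop (nhds 0) ∧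
      ∀ᶠ n in atTop, ∀ y ∈ ball x r, ∀ z ∈ ball x r,
        |f n i y| ≤ C ∧ |f n i y - f n i z| ≤ C * dist y z + e n) :
    ∃ φ : ℕ → ℕ, StrictMono φ ∧ ∃ F : ι → X → ℝ, ∀ i, ContinuousOn (F i) Ω ∧
      TendstoLocallyUniformlyOn (fun n => f (φ n) i) (F i) atTop Ω := by
  classical
  obtain ⟨D, hDc, hDd⟩ := TopologicalSpace.exists_countable_dense X
  have := (hDc.mono (inter_subset_left (t := Ω))).to_subtype
  have hb : ∀ j : ι × ↥(D ∩ Ω), ∃ C : ℝ, ∀ᶠ n in atTop, |f n j.1 j.2| ≤ C := fun ⟨i, d, hd⟩ => by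
    obtain ⟨C, r, hr, e, -, h⟩ := hf i d hd.2
    exact ⟨C, h.mono fun n hn => (hn d (mem_ball_self hr) d (mem_ball_self hr)).1⟩
  choose C hC using hb
  obtain ⟨a, -, φ, hφ, hlim⟩ := (isCompact_univ_pi fun j : ι × ↥(D ∩ Ω) =>
    isCompact_Icc (a := -|C j|) (b := |C j|)).tendsto_subseq
    (x := fun n j => if |f n j.1 j.2| ≤ C j then f n j.1 j.2 else 0) fun n j _ => by
      dsimp only
      split_ifs with h
      · exact abs_le.1 (h.trans (le_abs_self _))
      · simp
  have heq : ∀ i, ∀ x ∈ Ω, ∀ ε > 0, ∃ t ∈ nhds x, ∀ᶠ n in atTop, ∀ y ∈ t,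
      |f (φ n) i y - f (φ n) i x| < ε := fun i x hx ε hε => by
    obtain ⟨C, r, hr, e, he, h⟩ := hf i x hx
    refine ⟨ball x r ∩ {y | C * dist y x < ε / 2}, inter_mem (ball_mem_nhds x hr)
      (ContinuousAt.eventually_lt (by fun_prop) continuousAt_const (by simpa using hε)), ?_⟩
    filter_upwards [hφ.tendsto_atTop.eventually (h.and (he.eventually (gt_mem_nhds (half_pos hε))))]
      with n hn y hy
    linarith [(hn.1 y hy.1 x (mem_ball_self hr)).2, hy.2.out]
  have hpt : ∀ i, ∀ x ∈ Ω, ∃ l, Tendsto (fun n => f (φ n) i x) atTop (nhds l) := fun i x hx => by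
    refine cauchySeq_tendsto_of_complete (Metric.cauchySeq_iff'.2 fun ε hε => ?_)
    obtain ⟨t, ht, h⟩ := heq i x hx (ε / 4) (by linarith)
    obtain ⟨d, hd, hdt, hdΩ⟩ := hDd.inter_nhds_nonempty (inter_mem ht (hΩ.mem_nhds hx))
    have hl := (tendsto_pi_nhds.1 hlim (i, ⟨d, hd, hdΩ⟩)).congr'
      ((hφ.tendsto_atTop.eventually (hC (i, ⟨d, hd, hdΩ⟩))).mono fun n hn => if_pos hn)
    obtain ⟨N, hN⟩ := eventually_atTop.1
      (h.and (Metric.tendsto_nhds.1 hl (ε / 4) (by linarith)))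
    refine ⟨N, fun n hn => ?_⟩
    have h1 := hN n hn
    have h2 := hN N le_rfl
    simp only [Real.dist_eq, abs_lt] at *
    constructor <;> linarith [h1.1 d hdt, h2.1 d hdt]
  choose! F hF using hpt
  refine ⟨φ, hφ, F, fun i => tendstoLocallyUniformlyOn_of_prod fun x hx =>
    Metric.tendsto_nhds.2 fun ε hε => ?_⟩
  obtain ⟨t, ht, h⟩ := heq i x hx (ε / 2) (half_pos hε)
  filter_upwards [(h.and (Metric.tendsto_nhds.1 (hF i x hx) _ (half_pos hε))).prod_mk
    (show ∀ᶠ y in nhds x, y ∈ t from ht)] with q hq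
  linarith [hq.1.1 q.2 hq.2, hq.1.2, dist_triangle (f (φ q.1) i q.2) (f (φ q.1) i x) (F i x),
    Real.dist_eq (f (φ q.1) i q.2) (f (φ q.1) i x)]

/-- Passing to the limit in a derivative under continuous convergence. -/
theorem hasDerivAt_of_tendsto_prod {Ω : Set ℝ} (hΩ : IsOpen Ω) {f f' : ℕ → ℝ → ℝ}
    {F F' : ℝ → ℝ} (h : ∀ x ∈ Ω, Tendsto (fun n => f n x) atTop (nhds (F x)))
    (h' : ∀ x ∈ Ω, Tendsto (fun q : ℕ × ℝ => f' q.1 q.2) (atTop ×ˢ nhds x) (nhds (F' x)))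
    (hd : ∀ x ∈ Ω, ∀ᶠ q : ℕ × ℝ in atTop ×ˢ nhds x, HasDerivAt (f q.1) (f' q.1 q.2) q.2)
    {x : ℝ} (hx : x ∈ Ω) : HasDerivAt F (F' x) x := by
  obtain ⟨pa, ha, pb, hb, hab⟩ := eventually_prod_iff.1 (hd x hx)
  obtain ⟨r, hr, hrb⟩ := Metric.eventually_nhds_iff_ball.1 (hb.and (hΩ.mem_nhds hx))
  exact hasDerivAt_of_tendstoLocallyUniformlyOn (Metric.isOpen_ball (x := x) (ε := r))
    ((tendstoLocallyUniformlyOn_of_prod h').2.mono fun y hy => (hrb y hy).2)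
    (ha.mono fun n hn y hy => hab hn (hrb y hy).1) (fun y hy => h y (hrb y hy).2) (mem_ball_self hr)

namespace Alencar

/-- Truncation to the unit interval. -/
noncomputable def cl (p : ℝ) : ℝ := max 0 (min 1 p)

theorem cl_nonneg (p : ℝ) : 0 ≤ cl p := le_max_left _ _
theorem cl_le_one (p : ℝ) : cl p ≤ 1 := max_le zero_le_one (min_le_left _ _)
theorem cl_eq {p : ℝ} (h0 : 0 ≤ p) (h1 : p ≤ 1) : cl p = p := by
  rw [cl, min_eq_right h1, max_eq_right h0]

theorem abs_cl_sub_le (p q : ℝ) : |cl p - cl q| ≤ |p - q| :=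
  (abs_max_sub_max_le_max _ _ _ _).trans (by simpa using abs_min_sub_min_le_max 1 p 1 q)

theorem poly_ineq {q : ℝ} (h0 : 0 < q) (h1 : q < 1) :
    5 * q ^ 3 * (1 - q ^ 7) < 6 * (1 + q ^ 10) * (1 - q ^ 3) := by
  obtain ⟨d, hd⟩ := exists_eq (a' := (1 - q) ^ 2 / q)
  have hd0 : 0 ≤ d := hd ▸ by positivity
  have : 6 * (1 + q ^ 10) * (1 - q ^ 3) - 5 * q ^ 3 * (1 - q ^ 7) = (1 - q) * (q ^ 6 *
      (1 + 392 * d + 1015 * d ^ 2 + 925 * d ^ 3 + 390 * d ^ 4 + 78 * d ^ 5 + 6 * d ^ 6)) := by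
    rw [hd]; field_simp; ring
  exact sub_pos.1 (this ▸ mul_pos (sub_pos.2 h1) (by positivity))

/-- The slope condition `p ^ 2 W ^ 5 ≥ z ^ 5` linearised at the cone. -/
theorem slope_lower {z W p : ℝ} (hz : 0 < z) (hW : z ≤ W) (hp : 0 ≤ p) (h : z ^ 5 ≤ p ^ 2 * W ^ 5) :
    z * (1 - p) ≤ 5 / 2 * (W - z) := by
  by_contra! hcon
  obtain ⟨ρ, hρ⟩ := exists_eq (a' := (W - z) / z)
  have hW' : W = z * (1 + ρ) := by rw [hρ]; field_simp; ring
  have h1 : p < exp (-(5 / 2 * ρ)) := by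
    have : 5 / 2 * ρ < 1 - p := by rw [hρ, ← mul_div_assoc, div_lt_iff₀ hz]; linarith
    linarith [add_one_le_exp (-(5 / 2 * ρ))]
  have hρ0 : 0 ≤ ρ := hρ ▸ div_nonneg (sub_nonneg.2 hW) hz.le
  have h2 := mul_lt_mul (pow_lt_pow_left₀ h1 hp two_ne_zero)
    (pow_le_pow_left₀ (by linarith) (add_one_le_exp ρ) 5) (by positivity) (by positivity)
  rw [← exp_nat_mul, ← exp_nat_mul, ← exp_add, show ((2:ℕ):ℝ) * -(5 / 2 * ρ) + ((5:ℕ):ℝ) * ρ = 0 by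
    push_cast; ring, exp_zero] at h2
  rw [hW'] at h
  nlinarith [pow_pos hz 5]

/-- The truncated Alencar system is solvable on compact intervals. -/
theorem exists_truncated {δ R : ℝ} (hδ : 0 < δ) (hR : δ ≤ R) :
    ∃ W p : ℝ → ℝ, W δ = 1 ∧ p δ = δ / 2 ∧ ∀ z ∈ Icc δ R,
      HasDerivWithinAt W (cl (p z)) (Icc δ R) z ∧
      HasDerivWithinAt p ((1 + cl (p z) ^ 2) * (3 / max (W z) 1 - 3 * cl (p z) / z))
        (Icc δ R) z := by
  let f : ℝ → ℝ × ℝ → ℝ × ℝ := fun z y =>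
    (cl y.2, (1 + cl y.2 ^ 2) * (3 / max y.1 1 - 3 * cl y.2 / z))
  have hz3 : ∀ z ∈ Icc δ R, |3 / z| ≤ 3 / δ := fun z hz => by
    have : 0 < z := hδ.trans_le hz.1
    rw [abs_of_pos (by positivity)]
    exact div_le_div_of_nonneg_left (by norm_num) hδ hz.1
  have hm3 : ∀ w : ℝ, |3 / max w 1| ≤ 3 := fun w => by
    have : 1 ≤ max w 1 := le_max_right _ _
    rw [abs_of_pos (by positivity), div_le_iff₀ (by linarith)]; linarith
  have hlip : ∀ z ∈ Icc δ R, LipschitzWith ⟨12 + 12 / δ, by positivity⟩ (f z) := fun z hz => by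
    refine LipschitzWith.of_dist_le_mul fun ⟨x, y⟩ ⟨x', y'⟩ => ?_
    simp only [Prod.dist_eq, Real.dist_eq, f]
    obtain ⟨d, hd⟩ := exists_eq (a' := max |x - x'| |y - y'|)
    rw [← hd]
    change _ ≤ (12 + 12 / δ) * d
    have hc : |cl y - cl y'| ≤ d := (abs_cl_sub_le _ _).trans (hd ▸ le_max_right _ _)
    have hd0 := (abs_nonneg _).trans hc
    have hm : |3 / max x 1 - 3 / max x' 1| ≤ 3 * d := by
      have h1 : 1 ≤ max x 1 := le_max_right _ _
      have h2 : 1 ≤ max x' 1 := le_max_right _ _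
      rw [show 3 / max x 1 - 3 / max x' 1 = 3 * (max x' 1 - max x 1) / (max x 1 * max x' 1) by
        field_simp, abs_div, abs_mul, abs_sub_comm, abs_of_pos (show (0:ℝ) < 3 by norm_num),
        abs_of_pos (show 0 < max x 1 * max x' 1 by positivity), div_le_iff₀ (by positivity)]
      have h3 : |max x 1 - max x' 1| ≤ d :=
        (abs_max_sub_max_le_abs _ _ _).trans (hd ▸ le_max_left _ _)
      linarith [mul_le_mul_of_nonneg_left (one_le_mul_of_one_le_of_one_le h1 h2) hd0]
    have := cl_nonneg y
    have := cl_le_one y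
    have := cl_nonneg y'
    have := cl_le_one y'
    refine max_le (by nlinarith [show 0 ≤ 12 / δ * d by positivity]) ?_
    generalize cl y = a, cl y' = a' at *
    have e1 := abs_mul_le_of_le (show |1 + a ^ 2| ≤ 2 by rw [abs_le]; constructor <;> nlinarith) hm
    have e2 := abs_mul_le_of_le hc (abs_mul_le_of_le (show |a + a'| ≤ 2 by
      rw [abs_le]; constructor <;> linarith) (hm3 x'))
    have e3 := abs_mul_le_of_le (hz3 z hz) (abs_mul_le_of_le hc (show |1 + a ^ 2 + a * a' + a' ^ 2|
      ≤ 4 by rw [abs_le]; constructor <;> nlinarith))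
    rw [show (1 + a ^ 2) * (3 / max x 1 - 3 * a / z) - (1 + a' ^ 2) * (3 / max x' 1 - 3 * a' / z) =
      (1 + a ^ 2) * (3 / max x 1 - 3 / max x' 1) + (a - a') * ((a + a') * (3 / max x' 1)) -
      3 / z * ((a - a') * (1 + a ^ 2 + a * a' + a' ^ 2)) by ring]
    refine ((abs_sub _ _).trans (add_le_add ((abs_add_le _ _).trans (add_le_add e1 e2)) e3)).trans
      (le_of_eq ?_)
    ring
  have hcont : ∀ y, ContinuousOn (fun z => f z y) (Icc δ R) := fun y =>
    continuousOn_const.prodMk (continuousOn_const.mul (continuousOn_const.sub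
      (continuousOn_const.div continuousOn_id fun z hz => (hδ.trans_le hz.1).ne')))
  have hbd : ∀ z ∈ Icc δ R, ∀ y, ‖f z y‖ ≤ 2 * (3 + 3 / δ * 1) := fun z hz y => by
    have c0 := cl_nonneg y.2
    have c1 := cl_le_one y.2
    have h1 : |cl y.2| ≤ 1 := by rwa [abs_of_nonneg c0]
    refine max_le (h1.trans (by linarith [div_pos three_pos hδ])) (abs_mul_le_of_le ?_ ?_)
    · rw [abs_le]; constructor <;> nlinarith
    · rw [mul_div_right_comm]
      exact (abs_sub _ _).trans (add_le_add (hm3 y.1) (abs_mul_le_of_le (hz3 z hz) h1))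
  obtain ⟨α, h0, hα⟩ := exists_ode_of_bounded hR hlip hcont hbd (1, δ / 2)
  refine ⟨fun z => (α z).1, fun z => (α z).2, by simp [h0], by simp [h0], fun z hz =>
    ⟨((hα z hz).fst : _), ((hα z hz).snd : _)⟩⟩

/-- Solutions of the Alencar system trapped in the invariant region. -/
theorem exists_trapped {δ R : ℝ} (hδ : 0 < δ) (hδ4 : δ ≤ 1 / 4) (hR : δ ≤ R) :
    ∃ W p : ℝ → ℝ, ∀ z ∈ Icc δ R,
      HasDerivWithinAt W (p z) (Icc δ R) z ∧
      HasDerivWithinAt p ((1 + p z ^ 2) * (3 / W z - 3 * p z / z)) (Icc δ R) z ∧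
      1 ≤ W z ∧ W z ≤ 1 + z ^ 2 / 2 ∧ z < W z ∧ 0 < p z ∧ p z ≤ 1 ∧ p z * W z ≤ z ∧
      z ^ 5 ≤ p z ^ 2 * W z ^ 5 := by
  obtain ⟨W, p, hW0, hp0, hd⟩ := exists_truncated hδ hR
  have mono : ∀ {f f' : ℝ → ℝ}, (∀ z ∈ Icc δ R, HasDerivWithinAt f (f' z) (Icc δ R) z) →
      (∀ z ∈ Icc δ R, 0 ≤ f' z) → ∀ z ∈ Icc δ R, f δ ≤ f z := fun hf h z hz =>
    monotoneOn_of_hasDerivWithinAt_nonneg (convex_Icc _ _) (HasDerivWithinAt.continuousOn hf)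
      (fun z hz => (hf z (interior_subset hz)).mono interior_subset)
      (fun z hz => h z (interior_subset hz)) (left_mem_Icc.2 hR) hz hz.1
  have hW1 : ∀ z ∈ Icc δ R, 1 ≤ W z := fun z hz =>
    hW0 ▸ mono (fun z hz => (hd z hz).1) (fun z _ => cl_nonneg _) z hz
  have hc0 : 0 < δ ^ 3 * (1 - δ) / 2 := half_pos (mul_pos (pow_pos hδ 3) (by linarith))
  let g : Fin 4 → ℝ → ℝ := ![fun z => z - p z * W z, fun z => p z ^ 2 * W z ^ 5 - z ^ 5,
    fun z => z ^ 3 * (W z - z) - δ ^ 3 * (1 - δ) / 2, p]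
  let P : ℝ → ℝ := fun z => (1 + cl (p z) ^ 2) * (3 / max (W z) 1 - 3 * cl (p z) / z)
  let g' : Fin 4 → ℝ → ℝ := ![fun z => 1 - (P z * W z + p z * cl (p z)),
    fun z => 2 * p z * P z * W z ^ 5 + p z ^ 2 * (5 * W z ^ 4 * cl (p z)) - 5 * z ^ 4,
    fun z => 3 * z ^ 2 * (W z - z) + z ^ 3 * (cl (p z) - 1), P]
  have reg : ∀ z ∈ Icc δ R, (∀ i, 0 ≤ g i z) → 1 ≤ W z ∧ z < W z ∧ 0 < p z ∧ p z ≤ 1 ∧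
      p z * W z ≤ z ∧ z ^ 5 ≤ p z ^ 2 * W z ^ 5 ∧ cl (p z) = p z ∧
      P z = (1 + p z ^ 2) * (3 / W z - 3 * p z / z) := fun z hz hg => by
    have hz0 : 0 < z := hδ.trans_le hz.1
    have a0 : 0 ≤ z - p z * W z := hg 0
    have a1 : 0 ≤ p z ^ 2 * W z ^ 5 - z ^ 5 := hg 1
    have a2 : 0 ≤ z ^ 3 * (W z - z) - δ ^ 3 * (1 - δ) / 2 := hg 2
    have hw := hW1 z hz
    have hzw : z < W z := sub_pos.1 ((mul_pos_iff_of_pos_left (pow_pos hz0 3)).1 (by linarith))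
    have hp : 0 < p z := (hg 3).lt_of_ne' fun h => by
      simp only [show p z = 0 from h] at a1
      linarith [pow_pos hz0 5]
    have hp1 : p z ≤ 1 := by by_contra! h; nlinarith
    have hcl := cl_eq hp.le hp1
    refine ⟨hw, hzw, hp, hp1, by linarith, by linarith, hcl, ?_⟩
    simp only [P, hcl, max_eq_left hw]
  have main := pos_of_first_touch (g := g) (g' := g') (fun i z hz => by
    have hid := hasDerivWithinAt_id z (Icc δ R)
    obtain ⟨h1, h2⟩ := hd z hz
    fin_cases i
    · exact hid.sub (h2.mul h1)
    · refine (((h2.pow 2).mul (h1.pow 5)).sub (hid.pow 5)).congr_deriv ?_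
      simp [g', P]
    · refine (((hid.pow 3).mul (h1.sub hid)).sub_const _).congr_deriv ?_
      simp [g']
    · exact h2) (fun i => by
    have : δ ^ 3 ≤ (1 / 4) ^ 3 := pow_le_pow_left₀ hδ.le hδ4 3
    fin_cases i <;> simp [g, hW0, hp0] <;> nlinarith [pow_pos hδ 2]) (fun z hz hge i hi => by
    have hz0 : 0 < z := hδ.trans hz.1
    obtain ⟨hw, hzw, hp, hp1, h1, h2, hcl, hP⟩ := reg z ⟨hz.1.le, hz.2⟩ hge
    have hw0 : 0 < W z := by linarith
    fin_cases i <;> simp only [g, g', Fin.zero_eta, Fin.mk_one, Fin.reduceFinMk, Matrix.cons_val,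
      hcl, hP] at hi ⊢
    · rw [show 3 / W z - 3 * p z / z = 0 by field_simp; linarith]
      have : p z < 1 := by by_contra! h; nlinarith
      nlinarith
    · obtain ⟨q, hq0, hq⟩ : ∃ q, 0 < q ∧ q ^ 2 = z / W z :=
        ⟨√(z / W z), sqrt_pos.2 (by positivity), sq_sqrt (by positivity)⟩
      have hq1 : q < 1 := by
        have : z / W z < 1 := (div_lt_one hw0).2 hzw
        by_contra! h; nlinarith
      have hzq : z = q ^ 2 * W z := by rw [hq]; field_simp
      have hyq : p z = q ^ 5 := (pow_left_inj₀ hp.le (by positivity) two_ne_zero).1 (by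
        rw [pow_right_comm, hq, div_pow, eq_div_iff (by positivity)]; linarith)
      rw [show 2 * p z * ((1 + p z ^ 2) * (3 / W z - 3 * p z / z)) * W z ^ 5
          + p z ^ 2 * (5 * W z ^ 4 * p z) - 5 * z ^ 4
          = W z ^ 4 * q ^ 5 * (6 * (1 + q ^ 10) * (1 - q ^ 3) - 5 * q ^ 3 * (1 - q ^ 7)) by
        rw [hyq]; generalize W z = w at *; subst hzq; field_simp; ring]
      exact mul_pos (by positivity) (sub_pos.2 (poly_ineq hq0 hq1))
    · nlinarith [slope_lower hz0 hzw.le hp.le h2, pow_pos hz0 2]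
    · exact absurd hi hp.ne')
  refine ⟨W, p, fun z hz => ?_⟩
  have hub := mono (f := fun z => z ^ 2 / 2 - W z) (fun z hz =>
    (((hasDerivAt_pow 2 z).div_const 2).hasDerivWithinAt.sub (hd z hz).1)) (fun z hz => by
      obtain ⟨hw, -, hp, -, h1, -, hcl, -⟩ := reg z hz fun i => (main z hz i).le
      rw [hcl]; norm_num; nlinarith) z hz
  obtain ⟨hw, hzw, hp, hp1, h1, h2, hcl, -⟩ := reg z hz fun i => (main z hz i).le
  have h := hd z hz
  rw [hcl, max_eq_left hw] at h
  exact ⟨h.1, h.2, hw, by nlinarith, hzw, hp, hp1, h1, h2⟩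

/-- A solution of the Alencar equation, with slope `p`, in the trapping region. -/
def Trapped (W p : ℝ → ℝ) : Prop := ∀ z > 0, HasDerivAt W (p z) z ∧
  HasDerivAt p ((1 + p z ^ 2) * (3 / W z - 3 * p z / z)) z ∧
  1 ≤ W z ∧ W z ≤ 1 + z ^ 2 / 2 ∧ z ≤ W z ∧ 0 ≤ p z ∧ p z ≤ 1 ∧ p z * W z ≤ z ∧
  z ^ 5 ≤ p z ^ 2 * W z ^ 5

theorem exists_halfline :
    ∃ W p : ℝ → ℝ, Trapped W p := by
  have hδ : ∀ n : ℕ, (0:ℝ) < 1 / (n + 4) := fun n => by positivity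
  have hδ4 : ∀ n : ℕ, (1:ℝ) / (n + 4) ≤ 1 / 4 := fun n => by
    apply one_div_le_one_div_of_le (by norm_num)
    linarith [Nat.cast_nonneg (α := ℝ) n]
  have hR : ∀ n : ℕ, (1:ℝ) / (n + 4) ≤ n + 4 := fun n =>
    (hδ4 n).trans (by linarith [Nat.cast_nonneg (α := ℝ) n])
  choose W p h using fun n => exists_trapped (hδ n) (hδ4 n) (hR n)
  have hpb : ∀ n : ℕ, ∀ z ∈ Icc ((1:ℝ) / (n + 4)) (n + 4),
      |(1 + p n z ^ 2) * (3 / W n z - 3 * p n z / z)| ≤ 6 := by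
    intro n z hz
    obtain ⟨-, -, h1, h2, h3, h4, h5, h6, -⟩ := h n z hz
    have hz0 : 0 < z := (hδ n).trans_le hz.1
    have hw : 0 < W n z := by linarith
    have e1 : 3 * p n z / z ≤ 3 / W n z := by
      rw [div_le_div_iff₀ hz0 hw]; nlinarith
    have e2 : 3 / W n z ≤ 3 := (div_le_iff₀ hw).2 (by linarith)
    have e3 : 0 ≤ 3 * p n z / z := by positivity
    rw [abs_of_nonneg (mul_nonneg (by positivity) (by linarith))]
    have : 1 + p n z ^ 2 ≤ 2 := by nlinarith
    calc _ ≤ 2 * (3:ℝ) := mul_le_mul this (by linarith) (by linarith) (by norm_num)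
      _ = 6 := by norm_num
  have hWl : ∀ n : ℕ, ∀ y ∈ Icc ((1:ℝ) / (n + 4)) (n + 4), ∀ z ∈ Icc ((1:ℝ) / (n + 4)) (n + 4),
      |W n y - W n z| ≤ 6 * |y - z| := by
    intro n y hy z hz
    refine Convex.norm_image_sub_le_of_norm_hasDerivWithin_le (fun x hx => (h n x hx).1)
      (fun x hx => ?_) (convex_Icc _ _) hz hy
    obtain ⟨-, -, h1, h2, h3, h4, h5, h6, -⟩ := h n x hx
    rw [norm_eq_abs, abs_of_pos h4]; linarith
  have hpl : ∀ n : ℕ, ∀ y ∈ Icc ((1:ℝ) / (n + 4)) (n + 4), ∀ z ∈ Icc ((1:ℝ) / (n + 4)) (n + 4),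
      |p n y - p n z| ≤ 6 * |y - z| := by
    intro n y hy z hz
    exact Convex.norm_image_sub_le_of_norm_hasDerivWithin_le (fun x hx => (h n x hx).2.1)
      (fun x hx => hpb n x hx) (convex_Icc _ _) hz hy
  have hlarge : ∀ x > (0:ℝ), ∀ᶠ n : ℕ in atTop,
      ball x (x / 2) ⊆ Ioo ((1:ℝ) / (n + 4)) (n + 4) := by
    intro x hx
    have e1 : Tendsto (fun n : ℕ => (n : ℝ) + 4) atTop atTop :=
      tendsto_atTop_add_const_right _ _ tendsto_natCast_atTop_atTop
    have e2 : Tendsto (fun n : ℕ => (1:ℝ) / (n + 4)) atTop (nhds 0) :=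
      tendsto_const_nhds.div_atTop e1
    filter_upwards [e1.eventually_ge_atTop (2 * x), e2.eventually (gt_mem_nhds (half_pos hx))]
      with n h1 h2 y hy
    rw [mem_ball, dist_eq, abs_lt] at hy
    exact ⟨by linarith, by linarith⟩
  obtain ⟨φ, hφ, F, hF⟩ := exists_subseq_locallyUniform (isOpen_Ioi (a := (0:ℝ)))
    (fun n (i : Bool) => if i then W n else p n) (by
      intro i x hx
      refine ⟨max 6 (1 + (2 * x) ^ 2), x / 2, half_pos hx, fun _ => 0, tendsto_const_nhds, ?_⟩
      filter_upwards [hlarge x hx] with n hn y hy z hz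
      have hyI := Ioo_subset_Icc_self (hn hy)
      have hzI := Ioo_subset_Icc_self (hn hz)
      obtain ⟨-, -, h1, h2, h3, h4, h5, h6, -⟩ := h n y hyI
      have e1 : 6 * |y - z| ≤ max 6 (1 + (2 * x) ^ 2) * dist y z + 0 := by
        rw [dist_eq, add_zero]
        exact mul_le_mul_of_nonneg_right (le_max_left _ _) (abs_nonneg _)
      rw [mem_ball, dist_eq, abs_lt] at hy
      have hx' : 0 < x := hx
      cases i
      · simp only [Bool.false_eq_true, if_false]
        exact ⟨by rw [abs_of_pos h4]; exact le_max_of_le_left (by linarith),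
          (hpl n y hyI z hzI).trans e1⟩
      · simp only [if_true]
        refine ⟨?_, (hWl n y hyI z hzI).trans e1⟩
        rw [abs_of_pos (by linarith)]
        exact le_max_of_le_right (h2.trans (by nlinarith)))
  have cc : ∀ i, ∀ x ∈ Ioi (0:ℝ), Tendsto (fun q : ℕ × ℝ =>
      (if i then W (φ q.1) else p (φ q.1)) q.2) (atTop ×ˢ nhds x) (nhds (F i x)) :=
    fun i x hx => (hF i).2.tendsto_prod isOpen_Ioi (hF i).1 hx
  have ccW : ∀ x ∈ Ioi (0:ℝ), Tendsto (fun q : ℕ × ℝ => W (φ q.1) q.2)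
      (atTop ×ˢ nhds x) (nhds (F true x)) := fun x hx => by simpa using cc true x hx
  have ccp : ∀ x ∈ Ioi (0:ℝ), Tendsto (fun q : ℕ × ℝ => p (φ q.1) q.2)
      (atTop ×ˢ nhds x) (nhds (F false x)) := fun x hx => by simpa using cc false x hx
  have ptW : ∀ x ∈ Ioi (0:ℝ), Tendsto (fun n => W (φ n) x) atTop (nhds (F true x)) :=
    fun x hx => (ccW x hx).comp (tendsto_id.prodMk tendsto_const_nhds)
  have ptp : ∀ x ∈ Ioi (0:ℝ), Tendsto (fun n => p (φ n) x) atTop (nhds (F false x)) :=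
    fun x hx => (ccp x hx).comp (tendsto_id.prodMk tendsto_const_nhds)
  have hev : ∀ x ∈ Ioi (0:ℝ), ∀ᶠ q : ℕ × ℝ in atTop ×ˢ nhds x,
      q.2 ∈ Ioo ((1:ℝ) / (φ q.1 + 4)) (φ q.1 + 4) := by
    intro x hx
    filter_upwards [(hφ.tendsto_atTop.eventually (hlarge x hx)).prod_mk
      (ball_mem_nhds x (half_pos hx))] with q hq
    exact hq.1 hq.2
  have hev' : ∀ x ∈ Ioi (0:ℝ), ∀ᶠ n in atTop, x ∈ Icc ((1:ℝ) / (φ n + 4)) (φ n + 4) := by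
    intro x hx
    filter_upwards [hφ.tendsto_atTop.eventually (hlarge x hx)] with n hn
    exact Ioo_subset_Icc_self (hn (mem_ball_self (half_pos hx)))
  have hbd : ∀ z > 0, 1 ≤ F true z ∧ F true z ≤ 1 + z ^ 2 / 2 ∧ z ≤ F true z ∧
      0 ≤ F false z ∧ F false z ≤ 1 ∧ F false z * F true z ≤ z ∧
      z ^ 5 ≤ F false z ^ 2 * F true z ^ 5 := by
    intro z hz
    have e := hev' z hz
    refine ⟨ge_of_tendsto (ptW z hz) (e.mono fun n hn => (h _ z hn).2.2.1),
      le_of_tendsto (ptW z hz) (e.mono fun n hn => (h _ z hn).2.2.2.1),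
      ge_of_tendsto (ptW z hz) (e.mono fun n hn => (h _ z hn).2.2.2.2.1.le),
      ge_of_tendsto (ptp z hz) (e.mono fun n hn => (h _ z hn).2.2.2.2.2.1.le),
      le_of_tendsto (ptp z hz) (e.mono fun n hn => (h _ z hn).2.2.2.2.2.2.1),
      le_of_tendsto ((ptp z hz).mul (ptW z hz)) (e.mono fun n hn => (h _ z hn).2.2.2.2.2.2.2.1),
      ge_of_tendsto (((ptp z hz).pow 2).mul ((ptW z hz).pow 5))
        (e.mono fun n hn => (h _ z hn).2.2.2.2.2.2.2.2)⟩
  refine ⟨F true, F false, fun z hz => ⟨?_, ?_, hbd z hz⟩⟩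
  · refine hasDerivAt_of_tendsto_prod (f' := fun n => p (φ n)) isOpen_Ioi ptW ccp (fun x hx => ?_) hz
    filter_upwards [hev x hx] with q hq
    exact (h _ _ (Ioo_subset_Icc_self hq)).1.hasDerivAt (Icc_mem_nhds hq.1 hq.2)
  · refine hasDerivAt_of_tendsto_prod (F' := fun z => (1 + F false z ^ 2) *
      (3 / F true z - 3 * F false z / z)) (f' := fun n z => (1 + p (φ n) z ^ 2) *
      (3 / W (φ n) z - 3 * p (φ n) z / z)) isOpen_Ioi ptp (fun x hx => ?_) (fun x hx => ?_) hz
    · have hx0 : x ≠ 0 := (show (0:ℝ) < x from hx).ne'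
      have hW0 : F true x ≠ 0 := by linarith [(hbd x hx).1]
      exact (tendsto_const_nhds.add ((ccp x hx).pow 2)).mul
        ((tendsto_const_nhds.div (ccW x hx) hW0).sub
          (((ccp x hx).const_mul 3).div tendsto_snd hx0))
    · filter_upwards [hev x hx] with q hq
      exact (h _ _ (Ioo_subset_Icc_self hq)).2.1.hasDerivAt (Icc_mem_nhds hq.1 hq.2)

/-- Behaviour of the slope of a trapped solution at the axis. -/
theorem slope_axis {W p : ℝ → ℝ} (h : Trapped W p) :
    ∀ z > 0, |p z / z - 3 / 4| ≤ 3 / 2 * z ^ 2 := fun z hz => by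
  have hp : ∀ z > 0, p z ≤ z := fun z hz => by
    obtain ⟨-, -, h1, h2, h3, h4, h5, h6, -⟩ := h z hz
    nlinarith
  have key : ∀ σ : ℝ, σ = 1 ∨ σ = -1 →
      0 ≤ 3 / 2 * z ^ 6 + σ * (z ^ 3 * p z - 3 / 4 * z ^ 4) := fun σ hσ => by
    have hm : MonotoneOn (fun z => 3 / 2 * z ^ 6 + σ * (z ^ 3 * p z - 3 / 4 * z ^ 4)) (Ioi 0) := by
      refine monotoneOn_of_hasDerivAt (convex_Ioi 0) (f' := fun z => 9 * z ^ 5 +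
        σ * (3 * z ^ 3 * ((1 + p z ^ 2) / W z - 1) - 3 * z ^ 2 * p z ^ 3)) (fun y hy => ?_) fun y hy => ?_
      all_goals obtain ⟨-, hd, h1, h2, h3, h4, h5, h6, -⟩ := h y hy
      · have hw : W y ≠ 0 := by linarith
        have hy0 : y ≠ 0 := ne_of_gt hy
        refine (((hasDerivAt_pow 6 y).const_mul (3 / 2)).add ((((hasDerivAt_pow 3 y).mul hd).sub
          ((hasDerivAt_pow 4 y).const_mul (3 / 4))).const_mul σ)).congr_deriv ?_
        field_simp; ring
      · have hy0 : 0 < y := hy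
        have h7 := pow_le_pow_left₀ h4 (hp y hy)
        have hw : 0 < W y := by linarith
        obtain ⟨a, ha⟩ := exists_eq (a' := (1 + p y ^ 2) / W y - 1)
        have ha1 : -y ^ 2 ≤ a ∧ a ≤ y ^ 2 := by
          rw [ha, le_sub_iff_add_le, sub_le_iff_le_add, le_div_iff₀ hw, div_le_iff₀ hw]
          constructor <;> nlinarith [h7 2]
        have h8 : 0 ≤ y ^ 2 * (y ^ 3 - p y ^ 3) := mul_nonneg (by positivity) (sub_nonneg.2 (h7 3))
        have h9 : 0 ≤ y ^ 2 * p y ^ 3 := by positivity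
        have h10 := mul_nonneg (pow_pos hy0 3).le (sub_nonneg.2 ha1.1)
        have h11 := mul_nonneg (pow_pos hy0 3).le (sub_nonneg.2 ha1.2)
        simp only [← ha]
        rcases hσ with rfl | rfl <;> linarith
    refine le_of_tendsto (((continuous_pow 4).neg.tendsto' 0 0 (by simp)).mono_left
      (nhdsWithin_le_nhds (s := Ioi 0))) ?_
    filter_upwards [Ioo_mem_nhdsGT hz] with y hy
    refine le_trans ?_ (hm hy.1 hz hy.2.le)
    have h3 := pow_pos hy.1 3
    have h4 := mul_nonneg h3.le (h y hy.1).2.2.2.2.2.1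
    have h5 := mul_le_mul_of_nonneg_left (hp y hy.1) h3.le
    have h6 := pow_pos hy.1 6
    have h7 := pow_pos hy.1 4
    rcases hσ with rfl | rfl <;> simp only [Pi.neg_apply] <;> linarith
  have hz4 : 0 < z ^ 4 := by positivity
  rw [show p z / z - 3 / 4 = (z ^ 3 * p z - 3 / 4 * z ^ 4) / z ^ 4 by field_simp, abs_div,
    abs_of_pos hz4, div_le_iff₀ hz4, abs_le]
  constructor <;> linarith [key 1 (.inl rfl), key (-1) (.inr rfl)]

/-- `z ^ 2 (W - z)` converges to a positive limit, and `W - z p` is comparable to `W - z`. -/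
theorem asymptotics {W p : ℝ → ℝ} (h : Trapped W p) :
    (∀ z > 0, z < W z) ∧ (∀ z > 0, z * (1 - p z) ≤ 5 / 2 * (W z - z)) ∧
      ∃ K > 0, Tendsto (fun z => z ^ 2 * (W z - z)) atTop (nhds K) := by
  have hsl : ∀ z > 0, z * (1 - p z) ≤ 5 / 2 * (W z - z) := fun z hz =>
    let ⟨_, _, _, _, h3, h4, _, _, h7⟩ := h z hz
    slope_lower hz h3 h4 h7
  -- the flux `X = (z f)'` with `f = z ^ 2 (W - z)`
  let X : ℝ → ℝ := fun z => 3 * z ^ 2 * (W z - z) + z ^ 3 * (p z - 1)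
  let X' : ℝ → ℝ := fun z => 6 * z * (W z - z) + 6 * z ^ 2 * (p z - 1)
      + z ^ 3 * ((1 + p z ^ 2) * (3 / W z - 3 * p z / z))
  have hfd : ∀ z > 0, HasDerivAt (fun z => z ^ 3 * (W z - z)) (X z) z := fun z hz =>
    ((hasDerivAt_pow 3 z).mul ((h z hz).1.sub (hasDerivAt_id z))).congr_deriv (by simp [X])
  have hXd : ∀ z > 0, HasDerivAt X (X' z) z := fun z hz => by
    refine ((((hasDerivAt_pow 2 z).const_mul 3).mul ((h z hz).1.sub (hasDerivAt_id z))).add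
      ((hasDerivAt_pow 3 z).mul ((h z hz).2.1.sub_const 1))).congr_deriv ?_
    simp [X']; ring
  have hX : ∀ z > 0, z ^ 2 * (W z - z) / 2 ≤ X z := fun z hz => by
    simp only [X]; nlinarith [hsl z hz, pow_pos hz 2]
  have hgt : ∀ z > 0, z < W z := fun z hz => by
    have hm := monotoneOn_of_hasDerivAt (convex_Ioi 0) hfd fun z hz => le_trans
      (div_nonneg (mul_nonneg (sq_nonneg z) (sub_nonneg.2 (h z hz).2.2.2.2.1)) two_pos.le) (hX z hz)
    by_contra! hw
    have h1 := hm (a := 1 / 2) (by simp) hz (by linarith [(h z hz).2.2.1])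
    have h2 := (h (1 / 2) (by simp)).2.2.1
    have h3 := mul_nonneg (pow_pos hz 3).le (sub_nonneg.2 hw)
    simp only at h1
    linarith
  refine ⟨hgt, hsl, ?_⟩
  have hX'b : ∀ z ≥ 1, |X' z| * z ^ 2 ≤ 117 * X z := fun z hz => by
    have hz0 : 0 < z := by linarith
    obtain ⟨-, -, -, -, h3, h4, h5, -⟩ := h z hz0
    have hw1 : W z - z ≤ 1 := by
      have h1 := monotoneOn_of_hasDerivAt (convex_Ioi 0)
        (fun z hz => (hasDerivAt_id z).sub (h z hz).1)
        (fun z hz => sub_nonneg.2 (h z hz).2.2.2.2.2.2.1) (mem_Ioi.2 one_pos) hz0 hz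
      have h2 := (h 1 one_pos).2.2.2.1
      simp only [Pi.sub_apply, id] at h1
      linarith
    obtain ⟨ρ, hρ⟩ := exists_eq (a' := (W z - z) / z)
    obtain ⟨π', hπ⟩ := exists_eq (a' := 1 - p z)
    have hρ0 : 0 ≤ ρ := hρ ▸ div_nonneg (sub_nonneg.2 h3) hz0.le
    have hWρ : W z = z * (1 + ρ) := by rw [hρ]; field_simp; ring
    have hpπ : p z = 1 - π' := by rw [hπ]; ring
    have hπρ : π' ≤ 5 / 2 * ρ := by
      have hs := hsl z hz0
      rw [hWρ, hpπ] at hs; nlinarith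
    obtain ⟨s, hs'⟩ := exists_eq (a' := ρ ^ 2 / (1 + ρ))
    have hs0 : 0 ≤ s := by rw [hs']; positivity
    have hsρ : s ≤ ρ ^ 2 := hs' ▸ div_le_self (by positivity) (by linarith)
    have hsρ1 : s ≤ ρ := by rw [hs', div_le_iff₀ (by linarith)]; nlinarith
    have hX'eq : X' z = 3 * z ^ 2 * (2 * s + (π' ^ 2 - 2 * π') * (π' - ρ + s)) := by
      simp only [X']; rw [hWρ, hpπ, hs']; field_simp; ring
    have e1 : |(π' ^ 2 - 2 * π') * (π' - ρ + s)| ≤ 5 * ρ * (7 / 2 * ρ) := by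
      rw [abs_mul]
      refine mul_le_mul ?_ ?_ (abs_nonneg _) (by positivity) <;> rw [abs_le] <;>
        constructor <;> nlinarith
    have e2 : |X' z| ≤ 3 * z ^ 2 * (39 / 2 * ρ ^ 2) := by
      rw [hX'eq, abs_mul, abs_of_pos (by positivity)]
      gcongr
      rw [abs_le] at *
      constructor <;> linarith
    have e3 : 3 * z ^ 2 * (39 / 2 * ρ ^ 2) ≤ 117 / 2 * (W z - z) := by
      rw [hWρ] at hw1 ⊢; nlinarith [mul_nonneg hz0.le hρ0]
    nlinarith [hX z hz0, sq_nonneg z]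
  have hX0 : ∀ z > 0, 0 < X z := fun z hz => lt_of_lt_of_le
    (half_pos (mul_pos (pow_pos hz 2) (sub_pos.2 (hgt z hz)))) (hX z hz)
  have hl : ∀ z ∈ Ioi (1:ℝ), HasDerivAt (fun z => log (X z)) (X' z / X z) z := fun z hz =>
    have hz := one_pos.trans hz
    (hXd z hz).log (hX0 z hz).ne'
  have ht := MeasureTheory.tendsto_limUnder_of_hasDerivAt_of_integrableOn_Ioi hl
    (MeasureTheory.Integrable.mono'
      ((integrableOn_Ioi_rpow_of_lt (show (-2:ℝ) < -1 by norm_num) one_pos).const_mul 117)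
      ((measurable_deriv _).aestronglyMeasurable.congr
        ((MeasureTheory.ae_restrict_mem measurableSet_Ioi).mono fun z hz => (hl z hz).deriv))
      ((MeasureTheory.ae_restrict_mem measurableSet_Ioi).mono fun z hz => by
        have hz0 : 0 < z := one_pos.trans hz
        rw [norm_eq_abs, abs_div, abs_of_pos (hX0 z hz0), div_le_iff₀ (hX0 z hz0), rpow_neg hz0.le,
          rpow_two, ← div_eq_mul_inv, div_mul_eq_mul_div, le_div_iff₀ (pow_pos hz0 2)]
        exact hX'b z (le_of_lt hz)))
  have hXK := ((continuous_exp.tendsto _).comp ht).congr'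
    ((eventually_gt_atTop 0).mono fun z hz => exp_log (hX0 z hz))
  obtain ⟨K, hK, hXK⟩ : ∃ K > 0, Tendsto X atTop (nhds K) := ⟨_, exp_pos _, hXK⟩
  refine ⟨K, hK, ?_⟩
  have hG : (fun z => z ^ 3 * (W z - z) - K * z) =o[atTop] fun z : ℝ => z := by
    refine isLittleO_iff.2 fun ε hε => ?_
    obtain ⟨Z, hZ⟩ := eventually_atTop.1 ((Metric.tendsto_nhds.1 hXK (ε / 2) (half_pos hε)).and
      (eventually_gt_atTop 0))
    filter_upwards [eventually_ge_atTop Z,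
      eventually_ge_atTop (|Z ^ 3 * (W Z - Z) - K * Z| / (ε / 2))] with z hz h2
    have h1 := (convex_Ici Z).norm_image_sub_le_of_norm_hasDerivWithin_le (fun y hy =>
      ((hfd y (hZ y hy).2).sub ((hasDerivAt_id y).const_mul K)).hasDerivWithinAt)
      (fun y hy => by simpa [Real.dist_eq] using (hZ y hy).1.le) self_mem_Ici hz
    have hZ0 := (hZ Z le_rfl).2
    rw [div_le_iff₀ (half_pos hε)] at h2
    have h3 := (abs_sub_abs_le_abs_sub _ _).trans h1
    simp only [Pi.sub_apply, id, norm_eq_abs, abs_of_nonneg (sub_nonneg.2 hz)] at h3 ⊢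
    rw [abs_of_pos (hZ0.trans_le hz)]
    nlinarith
  refine tendsto_sub_nhds_zero_iff.1 (hG.tendsto_div_nhds_zero.congr' ?_)
  filter_upwards [eventually_gt_atTop 0] with z hz
  field_simp

end Alencar

/-- An even solution `W` of the Alencar equation with slope `p = W'`, `B = p / z`, and
asymptotics `W = z + K z⁻² + o(z⁻²)`. -/
structure AlencarProfile (K : ℝ) (W p p' B : ℝ → ℝ) : Prop where
  hasDerivAt : ∀ z, HasDerivAt W (p z) z
  hasDerivAt_slope : ∀ z, HasDerivAt p (p' z) z
  continuous_curv : Continuous p'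
  continuous_quot : Continuous B
  slope_eq : ∀ z, p z = z * B z
  even : ∀ z, W (-z) = W z
  equation : ∀ z, p' z / (1 + p z ^ 2) + 3 * B z - 3 / W z = 0
  smooth : ContDiffOn ℝ ∞ W (Ioi 0)
  gt : ∀ z ≥ 0, z < W z
  slope_nonneg : ∀ z ≥ 0, 0 ≤ p z
  slope_le : ∀ z ≥ 0, p z ≤ 1
  slope_defect : ∀ z ≥ 0, z * (1 - p z) ≤ 5 / 2 * (W z - z)
  tendsto : Tendsto (fun z => z ^ 2 * (W z - z)) atTop (nhds K)

namespace Alencar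

theorem smooth_of_system {W p : ℝ → ℝ}
    (h : ∀ z > 0, HasDerivAt W (p z) z ∧
      HasDerivAt p ((1 + p z ^ 2) * (3 / W z - 3 * p z / z)) z ∧ 0 < W z) :
    ContDiffOn ℝ ∞ W (Ioi 0) := by
  refine contDiffOn_infty.2 fun n => (?_ : _ ∧ ContDiffOn ℝ n p (Ioi 0)).1
  induction n with
  | zero =>
    simp only [Nat.cast_zero, contDiffOn_zero]
    exact ⟨HasDerivAt.continuousOn fun z hz => (h z hz).1,
      HasDerivAt.continuousOn fun z hz => (h z hz).2.1⟩
  | succ n ih =>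
    simp only [Nat.cast_add, Nat.cast_one, contDiffOn_succ_iff_deriv_of_isOpen isOpen_Ioi]
    exact ⟨⟨fun z hz => (h z hz).1.differentiableAt.differentiableWithinAt, by simp,
        ih.2.congr fun z hz => (h z hz).1.deriv⟩,
      fun z hz => (h z hz).2.1.differentiableAt.differentiableWithinAt, by simp,
      ((contDiffOn_const.add (ih.2.pow 2)).mul
        ((contDiffOn_const.div ih.1 fun z hz => (h z hz).2.2.ne').sub ((contDiffOn_const.mul ih.2).div
          contDiffOn_id fun z hz => ne_of_gt hz))).congr fun z hz => (h z hz).2.1.deriv⟩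

theorem exists_profile_aux : ∃ K > 0, ∃ W p p' B : ℝ → ℝ, AlencarProfile K W p p' B := by
  obtain ⟨W, p, h⟩ := exists_halfline
  obtain ⟨hgt, hsl, K, hK, hlim⟩ := asymptotics h
  let w : ℝ → ℝ := fun z => if z = 0 then 1 else W |z|
  let B : ℝ → ℝ := fun z => if z = 0 then 3 / 4 else p |z| / |z|
  let p' : ℝ → ℝ := fun z => (1 + (z * B z) ^ 2) * (3 / w z - 3 * B z)
  have hw0 : w 0 = 1 := if_pos rfl
  have hwe : ∀ z, w (-z) = w z := fun z => by simp [w]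
  have hBe : ∀ z, B (-z) = B z := fun z => by simp [B]
  have hwp : ∀ z > 0, w z = W z := fun z hz => by simp [w, hz.ne', abs_of_pos hz]
  have hBp : ∀ z > 0, z * B z = p z := fun z hz => by
    simp only [B, if_neg hz.ne', abs_of_pos hz]; field_simp
  have hd1p : ∀ z > 0, HasDerivAt w (z * B z) z := fun z hz =>
    hBp z hz ▸ (h z hz).1.congr_of_eventuallyEq ((lt_mem_nhds hz).mono hwp)
  have hd2p : ∀ z > 0, HasDerivAt (fun z => z * B z) (p' z) z := fun z hz => by
    have e : p' z = (1 + p z ^ 2) * (3 / W z - 3 * p z / z) := by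
      simp only [p', hwp z hz, ← hBp z hz]; field_simp
    exact e ▸ (h z hz).2.1.congr_of_eventuallyEq ((lt_mem_nhds hz).mono hBp)
  have hd1 : ∀ z ≠ 0, HasDerivAt w (z * B z) z := fun z hz => hz.lt_or_gt.elim (fun hz => by
    simpa [Function.comp_def, hwe, hBe] using (hd1p (-z) (neg_pos.2 hz)).comp z (hasDerivAt_neg z))
    (hd1p z)
  have hd2 : ∀ z ≠ 0, HasDerivAt (fun z => z * B z) (p' z) z := fun z hz =>
    hz.lt_or_gt.elim (fun hz => by
      simpa [Function.comp_def, Pi.neg_def, p', hwe, hBe] using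
        ((hd2p (-z) (neg_pos.2 hz)).comp z (hasDerivAt_neg z)).neg) (hd2p z)
  have hc : ∀ f : ℝ → ℝ, (∀ z ≠ 0, |f z - f 0| ≤ 3 / 2 * |z| ^ 2) → (∀ z ≠ 0, ContinuousAt f z) →
      Continuous f := fun f h0 h1 => continuous_iff_continuousAt.2 fun z => by
    rcases eq_or_ne z 0 with rfl | hz
    · refine tendsto_iff_norm_sub_tendsto_zero.2 (squeeze_zero (fun _ => norm_nonneg _) (fun z => ?_)
        (Continuous.tendsto' (f := fun z : ℝ => 3 / 2 * |z| ^ 2) (by fun_prop) _ _ (by simp)))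
      rcases eq_or_ne z 0 with rfl | hz
      · simp
      · exact h0 z hz
    · exact h1 z hz
  have hwc : Continuous w := hc w (fun z hz => by
    obtain ⟨-, -, h1, h3, -⟩ := h _ (abs_pos.2 hz)
    simp only [w, if_neg hz, if_true]
    rw [abs_of_nonneg (by linarith)]; linarith [sq_nonneg |z|]) fun z hz => (hd1 z hz).continuousAt
  have hBc : Continuous B := hc B (fun z hz => by
    simpa only [B, if_neg hz, if_true] using slope_axis h _ (abs_pos.2 hz)) fun z hz =>
      ((hd2 z hz).continuousAt.div continuousAt_id hz).congr
        ((eventually_ne_nhds hz).mono fun y hy => mul_div_cancel_left₀ _ hy)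
  have hw1 : ∀ z, w z ≠ 0 := fun z => by
    rcases eq_or_ne z 0 with rfl | hz
    · simp [hw0]
    · simp only [w, if_neg hz]; linarith [(h _ (abs_pos.2 hz)).2.2.1]
  have hpc : Continuous p' := (continuous_const.add ((continuous_id.mul hBc).pow 2)).mul
    ((continuous_const.div hwc hw1).sub (continuous_const.mul hBc))
  have hf : ∀ z ≥ 0, z < w z ∧ 0 ≤ z * B z ∧ z * B z ≤ 1 ∧
      z * (1 - z * B z) ≤ 5 / 2 * (w z - z) := fun z hz => by
    rcases hz.eq_or_lt with rfl | h0
    · norm_num [hw0]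
    · rw [hwp z h0, hBp z h0]
      exact ⟨hgt z h0, (h z h0).2.2.2.2.2.1, (h z h0).2.2.2.2.2.2.1, hsl z h0⟩
  exact ⟨K, hK, w, fun z => z * B z, p', B,
    hasDerivAt_of_hasDerivAt_of_ne' hd1 hwc.continuousAt (continuous_id.mul hBc).continuousAt,
    hasDerivAt_of_hasDerivAt_of_ne' hd2 (continuous_id.mul hBc).continuousAt hpc.continuousAt,
    hpc, hBc, fun _ => rfl, hwe,
    fun z => by
      have : (1 + (z * B z) ^ 2) ≠ 0 := by positivity
      simp only [p']; field_simp; ring,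
    (smooth_of_system fun z hz => ⟨(h z hz).1, (h z hz).2.1,
      one_pos.trans_le (h z hz).2.2.1⟩).congr hwp,
    fun z hz => (hf z hz).1, fun z hz => (hf z hz).2.1, fun z hz => (hf z hz).2.2.1,
    fun z hz => (hf z hz).2.2.2,
    hlim.congr' ((eventually_gt_atTop 0).mono fun z hz => by simp only [hwp z hz])⟩

theorem scale {K μ : ℝ} (hμ : 0 < μ) {W p p' B : ℝ → ℝ} (h : AlencarProfile K W p p' B) :
    AlencarProfile (K * μ ^ 3) (fun z => μ * W (z / μ)) (fun z => p (z / μ))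
      (fun z => p' (z / μ) / μ) (fun z => B (z / μ) / μ) := by
  have hdiv : ∀ z : ℝ, HasDerivAt (fun z : ℝ => z / μ) (1 / μ) z := fun z =>
    (hasDerivAt_id z).div_const μ
  have hge : ∀ z ≥ 0, z / μ ≥ 0 := fun z hz => div_nonneg hz hμ.le
  exact ⟨fun z => (((h.hasDerivAt _).comp z (hdiv z)).const_mul μ).congr_deriv (by field_simp),
    fun z => ((h.hasDerivAt_slope _).comp z (hdiv z)).congr_deriv (by field_simp),
    (h.continuous_curv.comp (continuous_id.div_const μ)).div_const μ,
    (h.continuous_quot.comp (continuous_id.div_const μ)).div_const μ,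
    fun z => by rw [h.slope_eq]; field_simp,
    fun z => by rw [neg_div, h.even],
    fun z => by
      rw [← zero_div μ, ← h.equation (z / μ)]
      field_simp,
    contDiffOn_const.mul (h.smooth.comp (contDiffOn_id.div_const μ) fun z hz => div_pos hz hμ),
    fun z hz => (div_lt_iff₀' hμ).1 (h.gt _ (hge z hz)),
    fun z hz => h.slope_nonneg _ (hge z hz), fun z hz => h.slope_le _ (hge z hz),
    fun z hz => by
      have := mul_le_mul_of_nonneg_left (h.slope_defect _ (hge z hz)) hμ.le
      field_simp at this ⊢
      linarith,
    ((h.tendsto.comp (tendsto_id.atTop_div_const hμ)).mul_const (μ ^ 3)).congr fun z => by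
      simp only [Function.comp, id]; field_simp⟩

/-- Alencar profiles exist for every positive constant in the asymptotics. -/
theorem exists_profile {K : ℝ} (hK : 0 < K) :
    ∃ W p p' B : ℝ → ℝ, AlencarProfile K W p p' B := by
  obtain ⟨K', hK', W, p, p', B, h⟩ := exists_profile_aux
  have hμ : 0 < (K / K') ^ ((1:ℝ) / 3) := rpow_pos_of_pos (by positivity) _
  have h3 : ((K / K') ^ ((1:ℝ) / 3)) ^ 3 = K / K' := by
    rw [← rpow_natCast, ← rpow_mul (by positivity)]; norm_num
  have := scale hμ h
  rw [h3, show K' * (K / K') = K by field_simp] at this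
  exact ⟨_, _, _, _, this⟩

end Alencar

namespace AlencarProfile

variable {K : ℝ} {W p p' B : ℝ → ℝ}

/-- The height above the cone decays quadratically. -/
theorem gap_bounds (h : AlencarProfile K W p p' B) (hK : 0 < K) : ∃ c > 0, ∃ C > 0, ∀ z ≥ 0,
    c ≤ (1 + z ^ 2) * (W z - z) ∧ (1 + z ^ 2) * (W z - z) ≤ C := by
  have hWc : Continuous W := continuous_iff_continuousAt.2 fun z => (h.hasDerivAt z).continuousAt
  have hgc : Continuous fun z => (1 + z ^ 2) * (W z - z) := by fun_prop
  have hl : Tendsto (fun z => (1 + z ^ 2) * (W z - z)) atTop (nhds ((0 + 1) * K)) := by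
    have h1 : Tendsto (fun z : ℝ => 1 / z ^ 2 + 1) atTop (nhds (0 + 1)) :=
      (tendsto_const_nhds.div_atTop (tendsto_pow_atTop (by norm_num))).add_const 1
    refine (h1.mul h.tendsto).congr' ?_
    filter_upwards [eventually_gt_atTop 0] with z hz
    field_simp
  rw [zero_add, one_mul] at hl
  obtain ⟨Z, hZ⟩ := eventually_atTop.1 ((hl.eventually (lt_mem_nhds (half_lt_self hK))).and
    (hl.eventually (gt_mem_nhds (show K < 2 * K by linarith))))
  have hne : (Icc 0 (max Z 0)).Nonempty := ⟨0, le_rfl, le_max_right _ _⟩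
  obtain ⟨a, ha, hmin⟩ := isCompact_Icc.exists_isMinOn hne hgc.continuousOn
  obtain ⟨b, hb, hmax⟩ := isCompact_Icc.exists_isMaxOn hne hgc.continuousOn
  have hpos : ∀ z ≥ 0, 0 < (1 + z ^ 2) * (W z - z) := fun z hz =>
    mul_pos (by positivity) (by linarith [h.gt z hz])
  refine ⟨min (K / 2) ((1 + a ^ 2) * (W a - a)), lt_min (by linarith) (hpos a ha.1),
    max (2 * K) ((1 + b ^ 2) * (W b - b)), lt_max_of_lt_left (by linarith), fun z hz => ?_⟩
  by_cases hzZ : Z ≤ z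
  · exact ⟨min_le_of_left_le (hZ z hzZ).1.le, le_max_of_le_left (hZ z hzZ).2.le⟩
  · have hmem : z ∈ Icc 0 (max Z 0) := ⟨hz, le_max_of_le_left (not_le.1 hzZ).le⟩
    exact ⟨min_le_of_right_le (hmin hmem), le_max_of_le_right (hmax hmem)⟩

end AlencarProfile

namespace Lattice

/-- Backward difference quotients on a lattice of mesh `h`, with a reflecting left end. -/
noncomputable def slope (h : ℝ) (w : ℕ → ℝ) : ℕ → ℝ
  | 0 => 0
  | j + 1 => (w (j + 1) - w j) / h

/-- Truncation to `[-L, L]`. -/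
noncomputable def clamp (L p : ℝ) : ℝ := max (-L) (min L p)

/-- The semi-discrete profile operator at the lattice point `(j + 1/2) h`, with truncated drift
and zero-order term `f`. -/
noncomputable def rhs (h L : ℝ) (f : ℝ → ℝ) (w : ℕ → ℝ) (j : ℕ) : ℝ :=
  (arctan (slope h w (j + 1)) - arctan (slope h w j)) / h
    + 3 * clamp L (slope h w (j + 1)) / ((j + 1) * h) - f (w j)

/-- Solutions of the semi-discrete profile equation on `N` lattice points, with slope `d`
prescribed at the right end. -/
structure Solution (N : ℕ) (h d L : ℝ) (f : ℝ → ℝ) (s T : ℝ) (u : ℕ → ℝ → ℝ) : Prop where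
  ghost : ∀ t, u N t = u (N - 1) t + h * d
  deriv : ∀ j < N, ∀ t ∈ Icc s T,
    HasDerivWithinAt (u j) (rhs h L f (fun i => u i t) j) (Icc s T) t

theorem clamp_mono (L : ℝ) : Monotone (clamp L) := fun _ _ h =>
  max_le_max le_rfl (min_le_min le_rfl h)

theorem clamp_eq {L p : ℝ} (h : |p| ≤ L) : clamp L p = p := by
  obtain ⟨h1, h2⟩ := abs_le.1 h
  rw [clamp, min_eq_right h2, max_eq_right h1]

theorem clamp_neg (L p : ℝ) (hL : 0 ≤ L) : clamp L (-p) = -clamp L p := by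
  simp only [clamp, max_def, min_def]; split_ifs <;> linarith

theorem abs_clamp_le {L : ℝ} (hL : 0 ≤ L) (p : ℝ) : |clamp L p| ≤ L :=
  abs_le.2 ⟨le_max_left _ _, max_le (by linarith) (min_le_left _ _)⟩

theorem abs_clamp_sub_le (L p q : ℝ) : |clamp L p - clamp L q| ≤ |p - q| := by
  rcases abs_cases (p - q) with ⟨h, _⟩ | ⟨h, _⟩ <;> rw [h, abs_le] <;>
    simp only [clamp, max_def, min_def] <;> constructor <;> split_ifs <;> linarith

theorem abs_arctan_sub_le (p q : ℝ) : |arctan p - arctan q| ≤ |p - q| := by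
  have := Convex.norm_image_sub_le_of_norm_hasDerivWithin_le (f := arctan) (C := 1)
    (s := univ) (x := q) (y := p) (fun x _ => (hasDerivAt_arctan x).hasDerivWithinAt)
    (fun x _ => by
      rw [norm_eq_abs, abs_of_nonneg (by positivity), div_le_one (by positivity)]
      nlinarith [sq_nonneg x]) convex_univ (mem_univ _) (mem_univ _)
  simpa using this

theorem abs_arctan_le (p : ℝ) : |arctan p| ≤ 2 :=
  abs_le.2 ⟨by linarith [neg_pi_div_two_lt_arctan p, pi_le_four],
    by linarith [arctan_lt_pi_div_two p, pi_le_four]⟩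

theorem slope_neg (h : ℝ) (w : ℕ → ℝ) (j : ℕ) : slope h (fun i => -w i) j = -slope h w j := by
  cases j with
  | zero => simp [slope]
  | succ j => simp only [slope]; ring

theorem rhs_neg {h L : ℝ} (hL : 0 ≤ L) (f : ℝ → ℝ) (w : ℕ → ℝ) (j : ℕ) :
    rhs h L (fun v => -f (-v)) (fun i => -w i) j = -rhs h L f w j := by
  simp only [rhs, slope_neg, arctan_neg, clamp_neg _ _ hL, neg_neg]; ring

theorem Solution.neg {N : ℕ} {h d L : ℝ} (hL : 0 ≤ L) {f : ℝ → ℝ} {s T : ℝ} {u : ℕ → ℝ → ℝ}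
    (H : Solution N h d L f s T u) :
    Solution N h (-d) L (fun v => -f (-v)) s T (fun i t => -u i t) where
  ghost t := by rw [H.ghost]; ring
  deriv j hj t ht := by
    rw [rhs_neg hL f (fun i => u i t)]
    exact (H.deriv j hj t ht).neg

theorem abs_slope_sub_le {h : ℝ} (hh : 0 < h) {w w' : ℕ → ℝ} {D : ℝ}
    (hD : ∀ i, |w i - w' i| ≤ D) (j : ℕ) : |slope h w j - slope h w' j| ≤ 2 * D / h := by
  have hD0 : 0 ≤ D := (abs_nonneg _).trans (hD 0)
  cases j with
  | zero => simp only [slope, sub_zero, abs_zero]; positivity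
  | succ j =>
    simp only [slope]
    rw [← sub_div, abs_div, abs_of_pos hh]
    refine div_le_div_of_nonneg_right ?_ hh.le
    have h1 := abs_le.1 (hD j)
    have h2 := abs_le.1 (hD (j + 1))
    rw [abs_le]; constructor <;> linarith [h1.1, h1.2, h2.1, h2.2]

theorem abs_rhs_le {h L : ℝ} (hh : 0 < h) (hL : 0 ≤ L) {f : ℝ → ℝ} {Mf : ℝ}
    (hf : ∀ x, |f x| ≤ Mf) (w : ℕ → ℝ) (j : ℕ) : |rhs h L f w j| ≤ (4 + 3 * L) / h + Mf := by
  have h1 := abs_arctan_le (slope h w (j + 1))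
  have h2 := abs_arctan_le (slope h w j)
  have h3 := abs_clamp_le hL (slope h w (j + 1))
  have e1 : |(arctan (slope h w (j + 1)) - arctan (slope h w j)) / h| ≤ 4 / h := by
    rw [abs_div, abs_of_pos hh]
    exact div_le_div_of_nonneg_right ((abs_sub _ _).trans (by linarith)) hh.le
  have e2 : |3 * clamp L (slope h w (j + 1)) / ((j + 1) * h)| ≤ 3 * L / h := by
    rw [abs_div, abs_mul, abs_of_pos (show (0:ℝ) < 3 by norm_num),
      abs_of_pos (show 0 < ((j:ℝ) + 1) * h by positivity)]
    refine div_le_div₀ (by positivity) (by linarith) hh ?_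
    nlinarith [Nat.cast_nonneg (α := ℝ) j]
  rw [rhs]
  calc _ ≤ 4 / h + 3 * L / h + Mf :=
        (abs_sub _ _).trans (add_le_add ((abs_add_le _ _).trans (add_le_add e1 e2)) (hf _))
    _ = _ := by ring

theorem abs_rhs_sub_le {h L : ℝ} (hh : 0 < h) {f : ℝ → ℝ} {K : ℝ}
    (hf : ∀ x y, |f x - f y| ≤ K * |x - y|) {w w' : ℕ → ℝ} {D : ℝ}
    (hD : ∀ i, |w i - w' i| ≤ D) (hK : 0 ≤ K) (j : ℕ) :
    |rhs h L f w j - rhs h L f w' j| ≤ (10 / h ^ 2 + K) * D := by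
  have hD0 : 0 ≤ D := (abs_nonneg _).trans (hD 0)
  have s1 := abs_slope_sub_le hh hD (j + 1)
  have s2 := abs_slope_sub_le hh hD j
  have e1 := (abs_arctan_sub_le _ _).trans s1
  have e2 := (abs_arctan_sub_le _ _).trans s2
  have e3 := (abs_clamp_sub_le L _ _).trans s1
  have e4 : |f (w j) - f (w' j)| ≤ K * D := (hf _ _).trans (mul_le_mul_of_nonneg_left (hD j) hK)
  have hj : 0 < (j:ℝ) + 1 := by positivity
  have e : rhs h L f w j - rhs h L f w' j
      = ((arctan (slope h w (j + 1)) - arctan (slope h w' (j + 1)))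
        - (arctan (slope h w j) - arctan (slope h w' j))) / h
        + 3 * (clamp L (slope h w (j + 1)) - clamp L (slope h w' (j + 1))) / ((j + 1) * h)
        - (f (w j) - f (w' j)) := by
    simp only [rhs]; ring
  have b1 : |((arctan (slope h w (j + 1)) - arctan (slope h w' (j + 1)))
        - (arctan (slope h w j) - arctan (slope h w' j))) / h| ≤ 4 * D / h ^ 2 := by
    rw [abs_div, abs_of_pos hh, div_le_iff₀ hh]
    refine (abs_sub _ _).trans ((add_le_add e1 e2).trans (le_of_eq ?_))
    field_simp; ring
  have b2 : |3 * (clamp L (slope h w (j + 1)) - clamp L (slope h w' (j + 1))) / ((j + 1) * h)|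
      ≤ 6 * D / h ^ 2 := by
    rw [abs_div, abs_mul, abs_of_pos (show (0:ℝ) < 3 by norm_num),
      abs_of_pos (show 0 < ((j:ℝ) + 1) * h by positivity)]
    calc _ ≤ 3 * (2 * D / h) / h := by
          refine div_le_div₀ (by positivity) (by linarith) hh ?_
          nlinarith [Nat.cast_nonneg (α := ℝ) j]
      _ = _ := by field_simp; ring
  rw [e]
  calc _ ≤ 4 * D / h ^ 2 + 6 * D / h ^ 2 + K * D :=
        (abs_sub _ _).trans (add_le_add ((abs_add_le _ _).trans (add_le_add b1 b2)) e4)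
    _ = _ := by ring

/-- The semi-discrete problem is globally solvable. -/
theorem exists_solution {N : ℕ} (hN : 0 < N) {h L : ℝ} (hh : 0 < h) (hL : 0 ≤ L) (d : ℝ)
    {f : ℝ → ℝ} {K Mf : ℝ} (hK : 0 ≤ K) (hf : ∀ x y, |f x - f y| ≤ K * |x - y|)
    (hM : ∀ x, |f x| ≤ Mf) (g : ℕ → ℝ) {s T : ℝ} (hsT : s ≤ T) :
    ∃ u, Solution N h d L f s T u ∧ ∀ j < N, u j s = g j := by
  let ext : (Fin N → ℝ) → ℕ → ℝ := fun v j =>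
    if hj : j < N then v ⟨j, hj⟩ else v ⟨N - 1, Nat.sub_lt hN one_pos⟩ + h * d
  have hext : ∀ v v' : Fin N → ℝ, ∀ i, |ext v i - ext v' i| ≤ dist v v' := by
    intro v v' i
    simp only [ext]
    split_ifs with hi
    · exact dist_le_pi_dist v v' ⟨i, hi⟩
    · rw [add_sub_add_right_eq_sub]; exact dist_le_pi_dist v v' _
  let F : ℝ → (Fin N → ℝ) → (Fin N → ℝ) := fun _ v j => rhs h L f (ext v) j
  have hMf : 0 ≤ Mf := (abs_nonneg _).trans (hM 0)
  obtain ⟨α, h0, hα⟩ := exists_ode_of_bounded (f := F) hsT (K := (10 / h ^ 2 + K).toNNReal)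
    (M := (4 + 3 * L) / h + Mf)
    (fun t _ => LipschitzWith.of_dist_le_mul fun v v' => by
      rw [coe_toNNReal _ (by positivity), dist_pi_le_iff (by positivity)]
      intro j
      exact abs_rhs_sub_le hh hf (hext v v') hK j)
    (fun v => continuousOn_const)
    (fun t _ v => by
      rw [pi_norm_le_iff_of_nonneg (by positivity)]
      intro j
      exact abs_rhs_le hh hL hM _ _)
    (fun j => g j)
  refine ⟨fun j t => ext (α t) j, ⟨fun t => ?_, fun j hj t ht => ?_⟩, fun j hj => ?_⟩
  · simp only [ext, dif_neg (lt_irrefl N), dif_pos (Nat.sub_lt hN one_pos)]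
  · have := (hasDerivWithinAt_pi.1 (hα t ht)) ⟨j, hj⟩
    simpa only [ext, dif_pos hj] using this
  · simp only [ext, dif_pos hj, h0]

/-- `P` is, near `(x, t)`, a `C²` strict supersolution of `P_t = P_xx/(1+P_x²) + 3P_x/x - f(P)`;
the quotient `P_x/x` is represented by the continuous function `B`, and `P` is even if `x = 0`. -/
def StrictSuper (L : ℝ) (f : ℝ → ℝ) (P : ℝ → ℝ → ℝ) (x t : ℝ) : Prop :=
  ∃ Px Pxx B Pt : ℝ → ℝ → ℝ,
    (∀ᶠ q : ℝ × ℝ in nhds (x, t), HasDerivAt (fun y => P y q.2) (Px q.1 q.2) q.1 ∧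
      HasDerivAt (fun y => Px y q.2) (Pxx q.1 q.2) q.1 ∧
      HasDerivAt (fun r => P q.1 r) (Pt q.1 q.2) q.2 ∧ Px q.1 q.2 = q.1 * B q.1 q.2) ∧
    ContinuousAt (fun q : ℝ × ℝ => P q.1 q.2) (x, t) ∧
    ContinuousAt (fun q : ℝ × ℝ => Px q.1 q.2) (x, t) ∧
    ContinuousAt (fun q : ℝ × ℝ => Pxx q.1 q.2) (x, t) ∧
    ContinuousAt (fun q : ℝ × ℝ => B q.1 q.2) (x, t) ∧
    ContinuousAt (fun q : ℝ × ℝ => Pt q.1 q.2) (x, t) ∧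
    (x = 0 → ∀ᶠ q : ℝ × ℝ in nhds (x, t), P (-q.1) q.2 = P q.1 q.2) ∧
    |Px x t| < L ∧
    Pxx x t / (1 + Px x t ^ 2) + 3 * B x t - f (P x t) < Pt x t

/-- Near `(x, t)` the function `b` is the minimum of finitely many strict supersolutions. -/
def BarrierAt (L : ℝ) (f : ℝ → ℝ) (b : ℝ → ℝ → ℝ) (x t : ℝ) : Prop :=
  ∃ S : Finset (ℝ → ℝ → ℝ), (∀ P ∈ S, StrictSuper L f P x t) ∧
    ∀ᶠ q : ℝ × ℝ in nhds (x, t), 0 < q.1 →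
      (∃ P ∈ S, b q.1 q.2 = P q.1 q.2) ∧ ∀ P ∈ S, b q.1 q.2 ≤ P q.1 q.2

/-- The lattice point `(j + 1/2) h`. -/
noncomputable def pt (h : ℝ) (j : ℕ) : ℝ := (j + 1 / 2) * h

theorem pt_pos {h : ℝ} (hh : 0 < h) (j : ℕ) : 0 < pt h j := by unfold pt; positivity

theorem pt_succ (h : ℝ) (j : ℕ) : pt h (j + 1) = pt h j + h := by unfold pt; grind

theorem exists_arctan_diff (a b : ℝ) :
    ∃ η ∈ uIcc a b, arctan b - arctan a = (b - a) / (1 + η ^ 2) := by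
  rcases lt_trichotomy a b with h | h | h
  · obtain ⟨c, hc, e⟩ := exists_hasDerivAt_eq_slope arctan (fun x => 1 / (1 + x ^ 2)) h
      (by fun_prop) (fun x _ => hasDerivAt_arctan x)
    refine ⟨c, uIcc_of_le h.le ▸ (by grind), ?_⟩
    grind
  · subst h; simp
  · obtain ⟨c, hc, e⟩ := exists_hasDerivAt_eq_slope arctan (fun x => 1 / (1 + x ^ 2)) h
      continuous_arctan.continuousOn (fun x _ => hasDerivAt_arctan x)
    refine ⟨c, uIcc_of_ge h.le ▸ (by grind), ?_⟩
    grind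

theorem exists_mean_values {g g' g'' B : ℝ → ℝ} {x h : ℝ} (hh : 0 < h) (hx : 0 < x)
    (h1 : ∀ y ∈ Icc (x - h) (x + h), HasDerivAt g (g' y) y)
    (h2 : ∀ y ∈ Icc (x - h) (x + h), HasDerivAt g' (g'' y) y)
    (hB : ∀ y ∈ Icc (x - h) (x + h), g' y = y * B y) :
    ∃ ξ ∈ Icc (x - h) (x + h), ∃ ξ' ∈ Icc (x - h) (x + h), ∃ ζ ∈ Icc (x - h) (x + h),
      ∃ β ∈ Icc (x - h) (x + h), (g (x + h) - g x) / h = g' ξ ∧ (g x - g (x - h)) / h = g' ξ' ∧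
        (g (x + h) - g x) / h - (g x - g (x - h)) / h = h * g'' ζ ∧
        (g (x + h) - g x) / h = (x + h / 2) * B β := by
  have hc : ContinuousOn g (Icc (x - h) (x + h)) := fun y hy =>
    (h1 y hy).continuousAt.continuousWithinAt
  have hc' : ContinuousOn g' (Icc (x - h) (x + h)) := fun y hy =>
    (h2 y hy).continuousAt.continuousWithinAt
  have sub1 : Icc x (x + h) ⊆ Icc (x - h) (x + h) := by grind
  have sub2 : Icc (x - h) x ⊆ Icc (x - h) (x + h) := by grind
  obtain ⟨ξ, hξ, e1⟩ := exists_hasDerivAt_eq_slope g g' (by linarith)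
    (hc.mono sub1) (by grind)
  obtain ⟨ξ', hξ', e2⟩ := exists_hasDerivAt_eq_slope g g' (by linarith)
    (hc.mono sub2) (by grind)
  obtain ⟨η, hη, e3⟩ := exists_hasDerivAt_eq_slope (fun y => g (y + h) - g y)
    (fun y => g' (y + h) - g' y) (by linarith)
    (((hc.comp (by fun_prop) fun y hy => (by grind) :
      ContinuousOn (fun y => g (y + h)) (Icc (x - h) x))).sub (hc.mono sub2))
    (fun y hy => by
      refine HasDerivAt.sub ?_ (by grind)
      exact HasDerivAt.comp_add_const y h (by grind))
  obtain ⟨ζ, hζ, e4⟩ := exists_hasDerivAt_eq_slope g' g'' (show η < η + h by linarith)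
    (hc'.mono (Icc_subset_Icc (by grind) (by grind)))
    (by grind)
  obtain ⟨β, hβ, e5⟩ := exists_ratio_hasDerivAt_eq_ratio_slope g g'
    (by linarith) (hc.mono sub1)
    (by grind) (fun y => y ^ 2) (fun y => 2 * y)
    (by fun_prop) (fun y _ => by simpa using hasDerivAt_pow 2 y)
  have hβ0 : 0 < β := hx.trans hβ.1
  refine ⟨ξ, by grind, ξ', by grind, ζ,
    by grind, β, by grind,
    ?_, ?_, ?_, ?_⟩
  · grind
  · grind
  · have e4' : g' (η + h) - g' η = h * g'' ζ := by
      rw [e4, add_sub_cancel_left]; field_simp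
    grind
  · rw [hB β (by grind)] at e5
    have : β * (2 * h * ((x + h / 2) * B β)) = β * (2 * (g (x + h) - g x)) := by linarith
    have := mul_left_cancel₀ hβ0.ne' this
    grind

/-- Consistency: sampling a strict supersolution gives a strict supersolution on fine lattices. -/
theorem StrictSuper.lattice {L : ℝ} {f : ℝ → ℝ} (hf : Continuous f) {P : ℝ → ℝ → ℝ} {x₀ t₀ : ℝ}
    (hx₀ : 0 ≤ x₀) (H : StrictSuper L f P x₀ t₀) :
    ∃ δ > 0, ∀ h, 0 < h → h < δ → ∀ j : ℕ, ∀ t, |pt h j - x₀| < δ → |t - t₀| < δ →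
      ∃ P', HasDerivAt (fun r => P (pt h j) r) P' t ∧
        rhs h L f (fun i => P (pt h i) t) j < P' := by
  obtain ⟨Px, Pxx, B, Pt, hD, cP, cPx, cPxx, cB, cPt, hev, hL, hlt⟩ := H
  have hΦ : ContinuousAt (fun v : ℝ × ℝ × ℝ × ℝ × ℝ =>
      v.2.1 / (1 + v.1 ^ 2) + 3 * v.2.2.1 - f v.2.2.2.1 - v.2.2.2.2)
      (Px x₀ t₀, Pxx x₀ t₀, B x₀ t₀, P x₀ t₀, Pt x₀ t₀) := by
    refine Continuous.continuousAt (((Continuous.add ?_ (by fun_prop)).sub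
      (by fun_prop)).sub (by fun_prop))
    exact Continuous.div (by fun_prop) (by fun_prop) fun v => by positivity
  have hneg := hΦ.eventually_lt continuousAt_const (show _ < (0:ℝ) by grind)
  obtain ⟨ε, hε, hball⟩ := Metric.eventually_nhds_iff.1 hneg
  have hLε : 0 < min ε (L - |Px x₀ t₀|) := by positivity
  have n1 := Metric.tendsto_nhds.1 cP ε hε
  have n2 := Metric.tendsto_nhds.1 cPx _ hLε
  have n3 := Metric.tendsto_nhds.1 cPxx ε hε
  have n4 := Metric.tendsto_nhds.1 cB ε hε
  have n5 := Metric.tendsto_nhds.1 cPt ε hε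
  obtain ⟨ρ, hρ, hall⟩ := Metric.eventually_nhds_iff.1 (((((hD.and n1).and n2).and n3).and n4).and n5)
  obtain ⟨ρ', hρ', heven⟩ : ∃ ρ' > 0, ∀ h, 0 < h → h < ρ' → |h / 2 - x₀| < ρ' → ∀ t, |t - t₀| < ρ' →
      P (-(h / 2)) t = P (h / 2) t := by
    rcases hx₀.eq_or_lt with h0 | h0
    · obtain ⟨ρ', hρ', h'⟩ := Metric.eventually_nhds_iff.1 (hev h0.symm)
      refine ⟨ρ', hρ', fun h _ _ hx t ht => h' (y := (h / 2, t)) ?_⟩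
      rw [Prod.dist_eq, max_lt_iff]; exact ⟨hx, ht⟩
    · refine ⟨x₀ / 2, by linarith, fun h _ hh hx => ?_⟩
      exact absurd (abs_lt.1 hx).1 (by linarith)
  refine ⟨min (ρ / 2) ρ', by positivity, fun h hh hhδ j t hj ht => ?_⟩
  obtain ⟨hh1, hh2⟩ := lt_min_iff.1 hhδ
  obtain ⟨hj1, hj2⟩ := lt_min_iff.1 hj
  obtain ⟨ht1, ht2⟩ := lt_min_iff.1 ht
  set x := pt h j with hx
  have hxpos : 0 < x := pt_pos hh j
  have hnear : ∀ y ∈ Icc (x - h) (x + h), dist (y, t) (x₀, t₀) < ρ := by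
    intro y hy
    rw [Prod.dist_eq, max_lt_iff]
    refine ⟨?_, by rw [dist_eq]; linarith⟩
    obtain ⟨a1, a2⟩ := abs_lt.1 hj1
    change |y - x₀| < ρ
    grind
  have hxI : x ∈ Icc (x - h) (x + h) := by grind
  obtain ⟨ξ, hξ, ξ', hξ', ζ, hζ, β, hβ, e1, e2, e3, e4⟩ :=
    exists_mean_values (g := fun y => P y t) (g' := fun y => Px y t) (g'' := fun y => Pxx y t)
      (B := fun y => B y t) hh hxpos
      (by grind) (by grind)
      (by grind)
  refine ⟨Pt x t, by grind, ?_⟩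
  have s1 : slope h (fun i => P (pt h i) t) (j + 1) = Px ξ t := by
    rw [← e1]; simp only [slope, pt_succ, ← hx]
  have s2 : slope h (fun i => P (pt h i) t) j = Px ξ' t := by
    rw [← e2]
    cases j with
    | zero =>
      have hx2 : x = h / 2 := by rw [hx, pt]; grind
      rw [hx2, show h / 2 - h = -(h / 2) by ring, heven h hh hh2 (hx2 ▸ hj2) t ht2]
      simp [slope]
    | succ j =>
      have hx2 : x - h = pt h j := by rw [hx, pt_succ]; ring
      simp only [slope, hx2, ← hx]
  obtain ⟨η, hη, e5⟩ := exists_arctan_diff (Px ξ' t) (Px ξ t)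
  have b1 := (hall (hnear ξ hξ)).1.1.1.2
  have b1' := (hall (hnear ξ' hξ')).1.1.1.2
  simp only [dist_eq] at b1 b1'
  have hηε : |η - Px x₀ t₀| < ε := by
    obtain ⟨c1, c2⟩ := abs_lt.1 (b1.trans_le (min_le_left _ _))
    obtain ⟨c3, c4⟩ := abs_lt.1 (b1'.trans_le (min_le_left _ _))
    rcases mem_uIcc.1 hη with h' | h' <;> rw [abs_lt] <;> constructor <;> linarith [h'.1, h'.2]
  have hcl : clamp L (Px ξ t) = Px ξ t := by
    refine clamp_eq ?_
    have := abs_sub_abs_le_abs_sub (Px ξ t) (Px x₀ t₀)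
    linarith [b1.trans_le (min_le_right _ _)]
  have hval : rhs h L f (fun i => P (pt h i) t) j
      = Pxx ζ t / (1 + η ^ 2) + 3 * B β t - f (P x t) := by
    have hj0 : (0:ℝ) < (j + 1) * h := by positivity
    have e6 : Px ξ t = ((j + 1) * h) * B β t := by
      rw [← e1, e4]; congr 1; rw [hx, pt]; ring
    rw [rhs, s1, s2, hcl, e5, ← e1, ← e2, e3, e1]
    rw [show 3 * Px ξ t / ((j + 1) * h) = 3 * B β t by rw [e6]; field_simp]
    rw [← hx, div_right_comm, mul_comm h, mul_div_cancel_right₀ _ hh.ne']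
  rw [hval]
  have := hball (y := (η, Pxx ζ t, B β t, P x t, Pt x t)) (by
    simp only [Prod.dist_eq, max_lt_iff]
    exact ⟨hηε, by grind, by grind,
      by grind, by grind⟩)
  linarith

theorem rhs_mono {h L : ℝ} (hh : 0 < h) (f : ℝ → ℝ) {w w' : ℕ → ℝ} {j : ℕ} (h0 : w j = w' j)
    (h1 : ∀ i, (i = j + 1 ∨ i + 1 = j) → w i ≤ w' i) : rhs h L f w j ≤ rhs h L f w' j := by
  have s1 : slope h w (j + 1) ≤ slope h w' (j + 1) := by
    simp only [slope]
    exact div_le_div_of_nonneg_right (by grind) hh.le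
  have s2 : slope h w' j ≤ slope h w j := by
    cases j with
    | zero => exact le_rfl
    | succ j =>
      simp only [slope]
      exact div_le_div_of_nonneg_right (by grind) hh.le
  have a1 := arctan_strictMono.monotone s1
  have a2 := arctan_strictMono.monotone s2
  have a3 := clamp_mono L s1
  rw [rhs, rhs, h0]
  gcongr

/-- Comparison on fine lattices with a function which is locally a minimum of strict
supersolutions. -/
theorem lt_barrier {L : ℝ} {f : ℝ → ℝ} (hf : Continuous f) {b : ℝ → ℝ → ℝ} {R s T : ℝ}
    (hb : ∀ x ∈ Icc 0 R, ∀ t ∈ Icc s T, BarrierAt L f b x t) :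
    ∃ h₀ > 0, ∀ h, 0 < h → h < h₀ → ∀ (N : ℕ) (d : ℝ) (u : ℕ → ℝ → ℝ), 0 < N → pt h N ≤ R →
      Solution N h d L f s T u → (∀ j < N, u j s < b (pt h j) s) →
      (∀ t ∈ Icc s T, b (pt h (N - 1)) t + h * d ≤ b (pt h N) t) →
      ∀ t ∈ Icc s T, ∀ j < N, u j t < b (pt h j) t := by
  have key : ∃ h₀ > 0, ∀ h, 0 < h → h < h₀ → ∀ (j : ℕ) (t : ℝ),
      (pt h j, t) ∈ Icc 0 R ×ˢ Icc s T → ∀ w : ℕ → ℝ, w j = b (pt h j) t →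
      (∀ i, (i = j + 1 ∨ i + 1 = j) → w i ≤ b (pt h i) t) →
      ∃ (P : ℝ → ℝ) (P' : ℝ), (∀ᶠ r in nhds t, b (pt h j) r ≤ P r) ∧ b (pt h j) t = P t ∧
        HasDerivAt P P' t ∧ rhs h L f w j < P' := by
    refine (isCompact_Icc.prod isCompact_Icc).induction_on (p := fun S => ∃ h₀ > 0, ∀ h, 0 < h →
      h < h₀ → ∀ (j : ℕ) (t : ℝ), (pt h j, t) ∈ S → ∀ w : ℕ → ℝ, w j = b (pt h j) t →
      (∀ i, (i = j + 1 ∨ i + 1 = j) → w i ≤ b (pt h i) t) →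
      ∃ (P : ℝ → ℝ) (P' : ℝ), (∀ᶠ r in nhds t, b (pt h j) r ≤ P r) ∧ b (pt h j) t = P t ∧
        HasDerivAt P P' t ∧ rhs h L f w j < P') ⟨1, one_pos, by simp⟩ ?_ ?_ ?_
    · rintro S S' hSS' ⟨h₀, hh₀, H⟩
      exact ⟨h₀, hh₀, fun h h1 h2 j t hm => H h h1 h2 j t (hSS' hm)⟩
    · rintro S S' ⟨h₀, hh₀, H⟩ ⟨h₁, hh₁, H'⟩
      refine ⟨min h₀ h₁, by grind, fun h h1 h2 j t hm => ?_⟩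
      obtain ⟨h3, h4⟩ := lt_min_iff.1 h2
      rcases hm with hm | hm
      · exact H h h1 h3 j t hm
      · exact H' h h1 h4 j t hm
    · rintro ⟨x₀, t₀⟩ ⟨hx₀, ht₀⟩
      obtain ⟨S, hS, hloc⟩ := hb x₀ hx₀ t₀ ht₀
      obtain ⟨ρ, hρ, hloc⟩ := Metric.eventually_nhds_iff.1 hloc
      have hδ : ∃ δ > 0, ∀ P ∈ S, ∀ h, 0 < h → h < δ → ∀ j : ℕ, ∀ t, |pt h j - x₀| < δ →
          |t - t₀| < δ → ∃ P', HasDerivAt (fun r => P (pt h j) r) P' t ∧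
            rhs h L f (fun i => P (pt h i) t) j < P' := by
        have h1 : ∀ P ∈ S, ∀ᶠ δ in 𝓝[>] (0:ℝ), ∀ h, 0 < h → h < δ → ∀ j : ℕ, ∀ t,
            |pt h j - x₀| < δ → |t - t₀| < δ → ∃ P', HasDerivAt (fun r => P (pt h j) r) P' t ∧
            rhs h L f (fun i => P (pt h i) t) j < P' := by
          intro P hP
          obtain ⟨δ, hδ, H⟩ := (hS P hP).lattice hf hx₀.1
          filter_upwards [Ioo_mem_nhdsGT hδ] with δ' hδ' h h1 h2 j t h3 h4
          grind
        have h2 := (eventually_all_finset S).2 h1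
        obtain ⟨δ, h3, h4⟩ := (h2.and self_mem_nhdsWithin).exists
        grind
      obtain ⟨δ, hδ, hcons⟩ := hδ
      have hm : 0 < min (ρ / 2) δ := by positivity
      refine ⟨_, mem_nhdsWithin_of_mem_nhds (ball_mem_nhds _ hm), min (ρ / 2) δ, hm,
        fun h hh hhm j t hmem w hwj hw => ?_⟩
      rw [mem_ball, Prod.dist_eq, max_lt_iff] at hmem
      obtain ⟨m1, m2⟩ := hmem
      simp only [dist_eq] at m1 m2
      obtain ⟨m1a, m1b⟩ := lt_min_iff.1 m1
      obtain ⟨m2a, m2b⟩ := lt_min_iff.1 m2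
      obtain ⟨h1, h2⟩ := lt_min_iff.1 hhm
      have hnear : ∀ y, |y - pt h j| ≤ h → dist (y, t) (x₀, t₀) < ρ := by
        intro y hy
        rw [Prod.dist_eq, max_lt_iff, dist_eq, dist_eq]
        grind
      obtain ⟨P, hPS, hP⟩ := (hloc (hnear (pt h j) (by grind)) (pt_pos hh j)).1
      obtain ⟨P', hP', hlt⟩ := hcons P hPS h hh h2 j t m1b m2b
      refine ⟨fun r => P (pt h j) r, P', ?_, hP, hP', lt_of_le_of_lt ?_ hlt⟩
      · filter_upwards [ball_mem_nhds t (show 0 < ρ / 2 by linarith)] with r hr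
        refine (hloc (y := (pt h j, r)) ?_ (pt_pos hh j)).2 P hPS
        rw [Prod.dist_eq, max_lt_iff, dist_eq, dist_eq]
        rw [mem_ball, dist_eq] at hr
        have := abs_sub_le r t t₀
        grind
      · refine rhs_mono hh f (by rw [hwj, hP]) fun i hi => (hw i hi).trans ?_
        refine (hloc (hnear (pt h i) ?_) (pt_pos hh i)).2 P hPS
        rcases hi with rfl | rfl
        · rw [pt_succ, add_sub_cancel_left, abs_of_pos hh]
        · rw [pt_succ, sub_add_cancel_left, abs_neg, abs_of_pos hh]
  obtain ⟨h₀, hh₀, key⟩ := key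
  refine ⟨h₀, hh₀, fun h hh hhm N d u hN hNR hu hinit hghost => ?_⟩
  have hptR : ∀ j < N, pt h j ∈ Icc 0 R := fun j hj => by
    refine ⟨(pt_pos hh j).le, le_trans ?_ hNR⟩
    unfold pt
    gcongr
  have hcb : ∀ j < N, ContinuousOn (fun t => b (pt h j) t) (Icc s T) := by
    intro j hj t ht
    refine ContinuousAt.continuousWithinAt ?_
    obtain ⟨S, hS, hloc⟩ := hb _ (hptR j hj) t ht
    have hloc' : ∀ᶠ r in nhds t, (∃ P ∈ S, b (pt h j) r = P (pt h j) r) ∧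
        ∀ P ∈ S, b (pt h j) r ≤ P (pt h j) r := by
      have : Tendsto (fun r : ℝ => (pt h j, r)) (nhds t) (nhds (pt h j, t)) :=
        (Continuous.prodMk_right _).tendsto t
      exact (this.eventually hloc).mono fun r hr => hr (pt_pos hh j)
    have hPc : ∀ P ∈ S, ContinuousAt (fun r => P (pt h j) r) t := by
      intro P hP
      obtain ⟨_, _, _, _, hD, -⟩ := hS P hP
      exact hD.self_of_nhds.2.2.1.continuousAt
    rw [ContinuousAt, Metric.tendsto_nhds]
    intro ε hε
    have h1 : ∀ᶠ r in nhds t, ∀ P ∈ S, dist (P (pt h j) r) (P (pt h j) t) < ε :=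
      (eventually_all_finset S).2 fun P hP => Metric.tendsto_nhds.1 (hPc P hP) ε hε
    obtain ⟨⟨P₀, hP₀, e₀⟩, hle₀⟩ := hloc'.self_of_nhds
    filter_upwards [h1, hloc'] with r hr1 hr2
    obtain ⟨⟨P₁, hP₁, e₁⟩, hle₁⟩ := hr2
    have a1 := abs_lt.1 (hr1 P₀ hP₀)
    have a2 := abs_lt.1 (hr1 P₁ hP₁)
    have a3 := hle₀ P₁ hP₁
    have a4 := hle₁ P₀ hP₀
    rw [dist_eq, abs_lt]
    grind
  by_contra! hcon
  obtain ⟨t₁, ht₁, j₁, hj₁, hbad⟩ := hcon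
  have hcu : ∀ j < N, ContinuousOn (u j) (Icc s T) := fun j hj t ht =>
    (hu.deriv j hj t ht).continuousWithinAt
  have hclosed : IsClosed (⋃ j : Fin N, {t | t ∈ Icc s T ∧ b (pt h j) t - u j t ≤ 0}) := by
    refine isClosed_iUnion_of_finite fun j => ?_
    exact ((hcb j j.2).sub (hcu j j.2)).preimage_isClosed_of_isClosed isClosed_Icc
      (isClosed_Iic (a := (0 : ℝ)))
  obtain ⟨t, ⟨htB, ht⟩, hfirst⟩ := exists_first_time (s := s) (T := T) hclosed
    ⟨t₁, mem_iUnion.2 ⟨⟨j₁, hj₁⟩, ht₁, by linarith⟩, ht₁⟩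
  obtain ⟨⟨j, hj⟩, -, hjt⟩ := mem_iUnion.1 htB
  simp only at hjt
  have hst : s < t := by grind
  have hbefore : ∀ r ∈ Ico s t, ∀ i < N, u i r < b (pt h i) r := by
    intro r hr i hi
    by_contra hneg
    exact hfirst r hr (mem_iUnion.2 ⟨⟨i, hi⟩, ⟨hr.1, hr.2.le.trans ht.2⟩, by linarith⟩)
  have hle : ∀ i < N, u i t ≤ b (pt h i) t := by
    intro i hi
    have hc : ContinuousWithinAt (fun r => b (pt h i) r - u i r) (Ico s t) t :=
      (((hcb i hi).sub (hcu i hi)) t ht).mono (by grind)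
    have : (nhdsWithin t (Ico s t)).NeBot := by
      rw [← mem_closure_iff_nhdsWithin_neBot, closure_Ico hst.ne]; grind
    have h0 : 0 ≤ b (pt h i) t - u i t := by
      refine ge_of_tendsto hc ?_
      filter_upwards [self_mem_nhdsWithin] with r hr
      grind
    linarith
  have heq : u j t = b (pt h j) t := by grind
  obtain ⟨P, P', hPb, hPt, hPd, hlt⟩ := key h hh hhm j t (by grind) (fun i => u i t) heq (by
    intro i hi
    by_cases hiN : i < N
    · grind
    · have hi1 : i = N := by omega
      have hj1 : j = N - 1 := by omega
      subst hi1
      rw [hu.ghost t, ← hj1, heq, hj1]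
      grind)
  obtain ⟨ρ, hρ, hρb⟩ := Metric.eventually_nhds_iff.1 hPb
  set s' := max s (t - ρ / 2) with hs'
  have hs't : s' < t := by grind
  have hsub : Icc s' T ⊆ Icc s T := Icc_subset_Icc (le_max_left _ _) le_rfl
  have hd : HasDerivWithinAt (fun r => P r - u j r) (P' - rhs h L f (fun i => u i t) j)
      (Icc s' T) t := hPd.hasDerivWithinAt.sub ((hu.deriv j hj t ht).mono hsub)
  have := deriv_nonpos_of_left_nonneg hs't ht.2 hd (by grind) (fun r hr => by
    have h1 : r ∈ Ico s t := ⟨(le_max_left _ _).trans hr.1, hr.2⟩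
    have h2 := hbefore r h1 j hj
    have h3 : b (pt h j) r ≤ P r := hρb (by
      have : t - ρ / 2 ≤ r := (le_max_right _ _).trans hr.1
      rw [dist_eq, abs_lt]; grind)
    linarith)
  linarith

theorem Solution.hasDerivWithinAt_slope {N : ℕ} {h d L : ℝ} {f : ℝ → ℝ} {s T : ℝ}
    {u : ℕ → ℝ → ℝ} (H : Solution N h d L f s T u) {i : ℕ} (hi : i + 1 < N) {t : ℝ}
    (ht : t ∈ Icc s T) :
    HasDerivWithinAt (fun t => slope h (fun j => u j t) (i + 1))
      ((rhs h L f (fun j => u j t) (i + 1) - rhs h L f (fun j => u j t) i) / h) (Icc s T) t :=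
  ((H.deriv (i + 1) hi t ht).sub (H.deriv i (by omega) t ht)).div_const h

theorem rhs_sub_rhs {h L : ℝ} (hh : 0 < h) {f : ℝ → ℝ} {w : ℕ → ℝ} {i : ℕ}
    (h0 : 0 < w i) (h1 : 0 < w (i + 1)) (f0 : f (w i) = 3 / w i)
    (f1 : f (w (i + 1)) = 3 / w (i + 1)) (p1 : |slope h w (i + 1)| ≤ L)
    (p2 : |slope h w (i + 2)| ≤ L) :
    (rhs h L f w (i + 1) - rhs h L f w i) / h
      = (arctan (slope h w (i + 2)) + arctan (slope h w i)
          - 2 * arctan (slope h w (i + 1))) / h ^ 2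
        + 3 / ((i + 2) * h ^ 2) * (slope h w (i + 2) - slope h w (i + 1))
        + 3 * slope h w (i + 1) * (1 / (w i * w (i + 1)) - 1 / ((i + 1) * (i + 2) * h ^ 2)) := by
  have e : w (i + 1) - w i = h * slope h w (i + 1) := by simp only [slope]; field_simp
  have e' : 3 / w (i + 1) - 3 / w i = -(3 * h * slope h w (i + 1) / (w i * w (i + 1))) := by grind
  have hi : (0:ℝ) < i + 1 := by positivity
  have hi' : (0:ℝ) < i + 2 := by positivity
  simp only [rhs, f0, f1, clamp_eq p1, clamp_eq p2, Nat.cast_add, Nat.cast_one]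
  have hsplit : ∀ a b c d' x y : ℝ, (a + b - x - (c + d' - y)) / h = (a - c) / h + (b - d') / h
      - (x - y) / h := by grind
  rw [hsplit, e']
  have hii : (i:ℝ) + 1 + 1 = i + 2 := by ring
  rw [hii]
  field_simp
  ring

theorem arctan_sign {σ : ℝ} (hσ : σ = 1 ∨ σ = -1) (p : ℝ) :
    arctan (σ * p) = σ * arctan p := by
  rcases hσ with rfl | rfl <;> simp

theorem sign_mul_le {σ : ℝ} (hσ : σ = 1 ∨ σ = -1) (p : ℝ) : σ * p ≤ |p| := by
  rcases hσ with rfl | rfl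
  · grind
  grind

/-- Maximum principle for the slopes of a lattice solution. -/
theorem Solution.slope_bound {N : ℕ} {h d L M Λ : ℝ} {f : ℝ → ℝ} {s T : ℝ} {u : ℕ → ℝ → ℝ}
    (H : Solution N h d L f s T u) (hN : 0 < N) (hh : 0 < h) (hΛ : 0 ≤ Λ) (hM : 0 < M)
    (hf : ∀ j < N, ∀ t ∈ Icc s T, 0 < u j t ∧ f (u j t) = 3 / u j t)
    (hc : ∀ i, i + 1 < N → ∀ t ∈ Icc s T,
      1 / (u i t * u (i + 1) t) ≤ 1 / ((i + 1) * (i + 2) * h ^ 2) + Λ)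
    (h0 : ∀ i < N, |slope h (fun j => u j s) (i + 1)| < M)
    (hL : M * exp ((3 * Λ + 1) * (T - s)) ≤ L) :
    ∀ t ∈ Icc s T, ∀ i ≤ N, |slope h (fun j => u j t) i|
      ≤ M * exp ((3 * Λ + 1) * (t - s)) := by
  set m : ℝ → ℝ := fun t => M * exp ((3 * Λ + 1) * (t - s)) with hm
  have hm' : ∀ t, HasDerivAt m ((3 * Λ + 1) * m t) t := fun t => by
    have := (((hasDerivAt_id t).sub_const s).const_mul (3 * Λ + 1)).exp.const_mul M
    grind
  have hmpos : ∀ t, 0 < m t := fun t => by positivity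
  have hms : m s = M := by simp [hm]
  have hmM : ∀ t ∈ Icc s T, M ≤ m t := fun t ht => by
    have : 1 ≤ exp ((3 * Λ + 1) * (t - s)) :=
      one_le_exp (mul_nonneg (by linarith) (by grind))
    simpa using mul_le_mul_of_nonneg_left this hM.le
  have hmL : ∀ t ∈ Icc s T, m t ≤ L := fun t ht => by
    refine le_trans ?_ hL
    refine mul_le_mul_of_nonneg_left (exp_le_exp.2 ?_) hM.le
    exact mul_le_mul_of_nonneg_left (by grind) (by linarith)
  have hend : ∀ t, |slope h (fun j => u j t) N| < M := fun t => by
    obtain ⟨n, rfl⟩ : ∃ n, N = n + 1 := ⟨N - 1, by omega⟩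
    have e : ∀ t, slope h (fun j => u j t) (n + 1) = d := fun t => by
      simp only [slope]
      rw [H.ghost t, add_tsub_cancel_right, add_sub_cancel_left, mul_div_cancel_left₀ _ hh.ne']
    rw [e t, ← e s]; grind
  set sg : Bool → ℝ := fun b => if b then 1 else -1 with hsg
  have hsg' : ∀ b, sg b = 1 ∨ sg b = -1 := by grind
  have key := pos_of_first_touch (ι := Fin (N - 1) × Bool) (s := s) (T := T)
    (g := fun k t => m t - sg k.2 * slope h (fun j => u j t) (k.1 + 1))
    (g' := fun k t => (3 * Λ + 1) * m t - sg k.2 *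
      ((rhs h L f (fun j => u j t) (k.1 + 1) - rhs h L f (fun j => u j t) k.1) / h))
    (fun k t ht => (hm' t).hasDerivWithinAt.sub
      ((H.hasDerivWithinAt_slope (by omega) ht).const_mul _))
    (fun k => by
      rw [hms]
      linarith [sign_mul_le (hsg' k.2) (slope h (fun j => u j s) (k.1 + 1)),
        h0 k.1 (by omega)])
    (fun t ht hnn k hk => by
      have htI := Ioc_subset_Icc_self ht
      obtain ⟨⟨i, hi⟩, b⟩ := k
      have hall : ∀ j ≤ N, |slope h (fun j => u j t) j| ≤ m t := by
        intro j hj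
        rcases j with _ | j
        · simpa [slope] using (hmpos t).le
        · rcases Nat.lt_or_ge (j + 1) N with hj' | hj'
          · have a1 := hnn (⟨j, by omega⟩, true)
            have a2 := hnn (⟨j, by omega⟩, false)
            simp only [hsg] at a1 a2
            rw [abs_le]; grind
          · obtain rfl : N = j + 1 := by omega
            exact (hend t).le.trans (hmM t htI)
      simp only at hk ⊢
      rw [rhs_sub_rhs hh (by grind) (by grind)
        (by grind) (by grind)
        (by grind) (by grind)]
      set p0 := slope h (fun j => u j t) i
      set p1 := slope h (fun j => u j t) (i + 1)
      set p2 := slope h (fun j => u j t) (i + 2)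
      have q1 : sg b * p1 = m t := by linarith
      have q0 : sg b * p0 ≤ m t := (sign_mul_le (hsg' b) _).trans (by grind)
      have q2 : sg b * p2 ≤ m t := (sign_mul_le (hsg' b) _).trans (by grind)
      have r0 := arctan_strictMono.monotone q0
      have r2 := arctan_strictMono.monotone q2
      rw [← q1, arctan_sign (hsg' b), arctan_sign (hsg' b)] at r0 r2
      have e : sg b * ((arctan p2 + arctan p0 - 2 * arctan p1) / h ^ 2
          + 3 / ((i + 2) * h ^ 2) * (p2 - p1) + 3 * p1 * (1 / (u i t * u (i + 1) t)
          - 1 / ((i + 1) * (i + 2) * h ^ 2)))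
          = (sg b * arctan p2 + sg b * arctan p0 - 2 * (sg b * arctan p1)) / h ^ 2
          + 3 / ((i + 2) * h ^ 2) * (sg b * p2 - sg b * p1) + 3 * (sg b * p1) *
            (1 / (u i t * u (i + 1) t) - 1 / ((i + 1) * (i + 2) * h ^ 2)) := by ring
      rw [e]
      have t1 : (sg b * arctan p2 + sg b * arctan p0 - 2 * (sg b * arctan p1))
          / h ^ 2 ≤ 0 := div_nonpos_of_nonpos_of_nonneg (by linarith) (by positivity)
      have t2 : 3 / (((i:ℝ) + 2) * h ^ 2) * (sg b * p2 - sg b * p1) ≤ 0 :=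
        mul_nonpos_of_nonneg_of_nonpos (by positivity) (by linarith)
      have t3 : 3 * (sg b * p1) * (1 / (u i t * u (i + 1) t)
          - 1 / ((i + 1) * (i + 2) * h ^ 2)) ≤ 3 * m t * Λ := by
        rw [q1]
        exact mul_le_mul_of_nonneg_left (by grind)
          (by positivity)
      grind)
  intro t ht j hj
  rcases j with _ | j
  · simpa [slope] using (hmpos t).le
  · rcases Nat.lt_or_ge (j + 1) N with hj' | hj'
    · have a1 := key t ht (⟨j, by omega⟩, true)
      have a2 := key t ht (⟨j, by omega⟩, false)
      simp only [hsg] at a1 a2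
      rw [abs_le]; grind
    · obtain rfl : N = j + 1 := by omega
      exact (hend t).le.trans (hmM t ht)

/-- Quantitative concavity of `arctan` on the half line. -/
theorem arctan_concave_defect {y δ R : ℝ} (hδ : 0 ≤ δ) (hδy : δ ≤ y) (hR : y + δ ≤ R) :
    arctan (y + δ) + arctan (y - δ) - 2 * arctan y
      ≤ -(2 * y * δ ^ 2 / (1 + R ^ 2) ^ 2) := by
  set F : ℝ → ℝ := fun e => -(2 * y * e ^ 2 / (1 + R ^ 2) ^ 2) -
    (arctan (y + e) + arctan (y - e)) with hF
  have hd : ∀ e, HasDerivAt F (-(4 * y * e / (1 + R ^ 2) ^ 2) -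
      (1 / (1 + (y + e) ^ 2) - 1 / (1 + (y - e) ^ 2))) e := fun e => by
    have a1 := ((hasDerivAt_id e).const_add y).arctan
    have a2 := ((hasDerivAt_id e).const_sub y).arctan
    have a3 := ((((hasDerivAt_id e).pow 2).const_mul (2 * y)).div_const ((1 + R ^ 2) ^ 2)).neg
    refine (a3.sub (a1.add a2)).congr_deriv ?_
    simp; ring
  have hmono : MonotoneOn F (Icc 0 δ) := by
    refine monotoneOn_of_hasDerivWithinAt_nonneg (convex_Icc 0 δ)
      (fun e _ => (hd e).continuousAt.continuousWithinAt)
      (fun e _ => (hd e).hasDerivWithinAt) fun e he => ?_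
    rw [interior_Icc] at he
    have hy : 0 ≤ y := hδ.trans hδy
    have b1 : (y + e) ^ 2 ≤ R ^ 2 := pow_le_pow_left₀ (by grind) (by grind) 2
    have b2 : (y - e) ^ 2 ≤ R ^ 2 := pow_le_pow_left₀ (by grind) (by grind) 2
    have e1 : 1 / (1 + (y + e) ^ 2) - 1 / (1 + (y - e) ^ 2)
        = -(4 * y * e / ((1 + (y + e) ^ 2) * (1 + (y - e) ^ 2))) := by
      field_simp; ring
    have e2 : 4 * y * e / (1 + R ^ 2) ^ 2 ≤ 4 * y * e / ((1 + (y + e) ^ 2) * (1 + (y - e) ^ 2)) := by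
      refine div_le_div_of_nonneg_left (by have := he.1; positivity) (by positivity) ?_
      rw [sq (1 + R ^ 2)]
      gcongr
    linarith
  have := hmono (by grind) (by grind) hδ
  grind

/-- Smoothing at the axis: slopes become linearly small there. -/
theorem Solution.slope_axis {N : ℕ} {h d L M c r : ℝ} {f : ℝ → ℝ} {s T : ℝ} {u : ℕ → ℝ → ℝ}
    (H : Solution N h d L f s T u) (hh : 0 < h) (hM : 0 < M) (hML : M ≤ L) (hc : 0 < c)
    (hf : ∀ j < N, ∀ t ∈ Icc s T, c ≤ u j t ∧ f (u j t) = 3 / u j t)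
    (hp : ∀ t ∈ Icc s T, ∀ i ≤ N, |slope h (fun j => u j t) i| ≤ M)
    {K : ℝ} (hK : 0 < K) (hK1 : M * √(T - s + 1) < K * (r / 2))
    (hK2 : K / 2 + 3 / c ^ 2 * K * (T - s + 1) < 2 * K ^ 3 / (1 + (2 * M) ^ 2) ^ 2)
    {n : ℕ} (hnN : n + 1 < N) (hn : r / 2 ≤ (n + 1) * h) :
    ∀ t ∈ Ioc s T, ∀ i ≤ n, |slope h (fun j => u j t) i| ≤ K / √(t - s) * (i * h) := by
  intro t₁ ht₁ i hi
  obtain ⟨ε, hε, hε1, hε2⟩ : ∃ ε > 0, ε ≤ 1 ∧ M * √ε < K * h := by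
    refine ⟨min 1 ((K * h / (2 * M)) ^ 2), by positivity, min_le_left _ _, ?_⟩
    calc M * √(min 1 ((K * h / (2 * M)) ^ 2)) ≤ M * √((K * h / (2 * M)) ^ 2) := by
          gcongr; simp
      _ = K * h / 2 := by rw [sqrt_sq (by positivity)]; field_simp
      _ < K * h := by have : 0 < K * h := by positivity
                      linarith
  set m : ℝ → ℝ := fun t => K / √(t - s + ε) with hm
  have hpos : ∀ t ∈ Icc s T, 0 < t - s + ε := by grind
  have hmpos : ∀ t ∈ Icc s T, 0 < m t := fun t ht => by
    have := hpos t ht; positivity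
  have hm3 : ∀ t ∈ Icc s T, m t = m t ^ 3 * (t - s + ε) / K ^ 2 := by grind
  have hm' : ∀ t ∈ Icc s T, HasDerivAt m (-(m t ^ 3 / (2 * K ^ 2))) t := fun t ht => by
    have h3 := sqrt_pos.2 (hpos t ht)
    have h2 := sq_sqrt (hpos t ht).le
    have := (((((hasDerivAt_id t).sub_const s).add_const ε).sqrt (hpos t ht).ne').inv
      h3.ne').const_mul K
    refine this.congr_deriv ?_
    grind
  have hin : ∀ t ∈ Icc s T, ∀ y, r / 2 ≤ y → M < m t * y := fun t ht y hy => by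
    have h3 := sqrt_pos.2 (hpos t ht)
    have h4 : √(t - s + ε) ≤ √(T - s + 1) := sqrt_le_sqrt (by grind)
    simp only [hm]
    rw [div_mul_eq_mul_div, lt_div_iff₀ h3]
    calc M * √(t - s + ε) ≤ M * √(T - s + 1) := by gcongr
      _ < K * (r / 2) := hK1
      _ ≤ K * y := by gcongr
  set sg : Bool → ℝ := fun b => if b then 1 else -1 with hsg
  have hsg' : ∀ b, sg b = 1 ∨ sg b = -1 := by grind
  have hsT : s ≤ T := by grind
  have key := pos_of_first_touch (ι := Fin n × Bool) (s := s) (T := T)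
    (g := fun k t => m t * ((k.1 + 1) * h) - sg k.2 * slope h (fun j => u j t) (k.1 + 1))
    (g' := fun k t => -(m t ^ 3 / (2 * K ^ 2)) * ((k.1 + 1) * h) - sg k.2 *
      ((rhs h L f (fun j => u j t) (k.1 + 1) - rhs h L f (fun j => u j t) k.1) / h))
    (fun k t ht => ((hm' t ht).mul_const _).hasDerivWithinAt.sub
      ((H.hasDerivWithinAt_slope (by omega) ht).const_mul _))
    (fun k => by
      have hs : s ∈ Icc s T := by grind
      have a1 := sign_mul_le (hsg' k.2) (slope h (fun j => u j s) (k.1 + 1))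
      have a2 := hp s hs (k.1 + 1) (by omega)
      have a3 : M < m s * h := by
        simp only [hm]
        rw [sub_self, zero_add, div_mul_eq_mul_div, lt_div_iff₀ (sqrt_pos.2 hε)]
        exact hε2
      have a4 : m s * h ≤ m s * (((k.1 : ℕ) + 1) * h) := by
        refine mul_le_mul_of_nonneg_left ?_ (hmpos s hs).le
        have : (0:ℝ) ≤ (k.1 : ℕ) := by grind
        nlinarith
      linarith)
    (fun t ht hnn k hk => by
      have htI := Ioc_subset_Icc_self ht
      obtain ⟨⟨i, hi⟩, b⟩ := k
      have hall : ∀ j ≤ n + 1, |slope h (fun j => u j t) j| ≤ m t * (j * h) := by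
        intro j hj
        rcases j with _ | j
        · simp [slope]
        · rcases Nat.lt_or_ge j n with hj' | hj'
          · have a1 := hnn (⟨j, by omega⟩, true)
            have a2 := hnn (⟨j, by omega⟩, false)
            grind
          grind
      simp only at hk ⊢
      have hf0 := hf i (by omega) t htI
      have hf1 := hf (i + 1) (by omega) t htI
      rw [rhs_sub_rhs hh (by linarith) (by linarith) hf0.2 hf1.2
        (by grind) (by grind)]
      have hq0 := hall i (by omega)
      have hq2 := hall (i + 2) (by omega)
      have hq1 := hp t htI (i + 1) (by omega)
      push_cast at hq2
      set p0 := slope h (fun j => u j t) i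
      set p1 := slope h (fun j => u j t) (i + 1)
      set p2 := slope h (fun j => u j t) (i + 2)
      have hmt := hmpos t htI
      set y : ℝ := m t * ((i + 1) * h) with hy
      have hypos : 0 < y := by positivity
      have q1 : sg b * p1 = y := by linarith
      have q0 : sg b * p0 ≤ y - m t * h :=
        (sign_mul_le (hsg' b) _).trans (by linarith)
      have q2 : sg b * p2 ≤ y + m t * h :=
        (sign_mul_le (hsg' b) _).trans (by linarith)
      have r0 := arctan_strictMono.monotone q0
      have r2 := arctan_strictMono.monotone q2
      have hδ : m t * h ≤ y := by
        rw [hy]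
        refine mul_le_mul_of_nonneg_left ?_ hmt.le
        have : (0:ℝ) ≤ i := by grind
        nlinarith
      have hyM : y ≤ M := by rw [← q1]; exact (sign_mul_le (hsg' b) _).trans hq1
      have hA := arctan_concave_defect (R := 2 * M) (by positivity) hδ (by linarith)
      rw [arctan_sign (hsg' b)] at r0 r2
      have r1 : arctan y = sg b * arctan p1 := by rw [← q1, arctan_sign (hsg' b)]
      have e : sg b * ((arctan p2 + arctan p0 - 2 * arctan p1) / h ^ 2
          + 3 / ((i + 2) * h ^ 2) * (p2 - p1) + 3 * p1 * (1 / (u i t * u (i + 1) t)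
          - 1 / ((i + 1) * (i + 2) * h ^ 2)))
          = (sg b * arctan p2 + sg b * arctan p0 - 2 * (sg b * arctan p1)) / h ^ 2
          + 3 / ((i + 2) * h ^ 2) * (sg b * p2 - sg b * p1) + 3 * (sg b * p1) *
            (1 / (u i t * u (i + 1) t) - 1 / ((i + 1) * (i + 2) * h ^ 2)) := by ring
      rw [e, q1, ← r1]
      have t1 : (sg b * arctan p2 + sg b * arctan p0 - 2 * arctan y)
          / h ^ 2 ≤ -(2 * y * m t ^ 2 / (1 + (2 * M) ^ 2) ^ 2) := by
        rw [div_le_iff₀ (by positivity)]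
        grind
      have t2 : 3 / (((i:ℝ) + 2) * h ^ 2) * (sg b * p2 - y) ≤
          3 * y * (1 / ((i + 1) * (i + 2) * h ^ 2)) := by
        have : 3 / (((i:ℝ) + 2) * h ^ 2) * (sg b * p2 - y) ≤
            3 / (((i:ℝ) + 2) * h ^ 2) * (m t * h) :=
          mul_le_mul_of_nonneg_left (by linarith) (by positivity)
        refine this.trans_eq ?_
        rw [hy]
        have : (i:ℝ) + 1 ≠ 0 := by positivity
        have : (i:ℝ) + 2 ≠ 0 := by positivity
        field_simp
      have t3 : 3 * y * (1 / (u i t * u (i + 1) t)) ≤ 3 * y * (1 / c ^ 2) := by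
        refine mul_le_mul_of_nonneg_left ?_ (by positivity)
        refine one_div_le_one_div_of_le (by positivity) ?_
        rw [sq]; exact mul_le_mul hf0.1 hf1.1 hc.le (by linarith)
      have e3 : 3 * y * (1 / c ^ 2) = y * m t ^ 2 * (3 / c ^ 2 * (t - s + ε) / K ^ 2) := by grind
      have e4 : m t ^ 3 / (2 * K ^ 2) * ((i + 1) * h) = y * m t ^ 2 * (1 / (2 * K ^ 2)) := by
        rw [hy]; ring
      have fin : y * m t ^ 2 * (1 / (2 * K ^ 2)) + y * m t ^ 2 * (3 / c ^ 2 * (t - s + ε) / K ^ 2)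
          < 2 * y * m t ^ 2 / (1 + (2 * M) ^ 2) ^ 2 := by
        rw [← mul_add, show 2 * y * m t ^ 2 / (1 + (2 * M) ^ 2) ^ 2
          = y * m t ^ 2 * (2 / (1 + (2 * M) ^ 2) ^ 2) by ring]
        refine mul_lt_mul_of_pos_left ?_ (by positivity)
        have k1 : 3 / c ^ 2 * K * (t - s + ε) ≤ 3 / c ^ 2 * K * (T - s + 1) := by
          gcongr; exact ht.2
        have k2 : 1 / (2 * K ^ 2) + 3 / c ^ 2 * (t - s + ε) / K ^ 2
            = (K / 2 + 3 / c ^ 2 * K * (t - s + ε)) / K ^ 3 := by field_simp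
        rw [k2, div_lt_iff₀ (by positivity)]
        grind
      linarith)
  have ht₁' := Ioc_subset_Icc_self ht₁
  have hle : m t₁ ≤ K / √(t₁ - s) :=
    div_le_div_of_nonneg_left hK.le (sqrt_pos.2 (by grind))
      (sqrt_le_sqrt (by linarith))
  have hfin : |slope h (fun j => u j t₁) i| ≤ m t₁ * (i * h) := by
    rcases i with _ | j
    · simp [slope]
    · have a1 := key t₁ ht₁' (⟨j, by omega⟩, true)
      have a2 := key t₁ ht₁' (⟨j, by omega⟩, false)
      grind
  exact hfin.trans (by gcongr)

end Lattice

/-- Leibniz expansion of an iterated derivative of a composition. -/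
theorem iteratedDeriv_succ_comp {O : Set ℝ} (hO : IsOpen O) {g : ℝ → ℝ}
    (hg : ContDiffOn ℝ ∞ g O) {f : ℝ → ℝ} {t : ℝ} (hf : ContDiffAt ℝ ∞ f t)
    (ht : f t ∈ O) (m : ℕ) :
    iteratedDeriv (m + 1) (fun r => g (f r)) t = deriv g (f t) * iteratedDeriv (m + 1) f t +
      ∑ i ∈ range m, (m.choose (i + 1) : ℝ) *
        iteratedDeriv (i + 1) (fun r => deriv g (f r)) t * iteratedDeriv (m - i) f t := by
  have hev : deriv (fun r => g (f r)) =ᶠ[nhds t] (fun r => deriv g (f r)) * deriv f := by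
    have h1 : ∀ᶠ r in nhds t, ContDiffAt ℝ 1 f r :=
      (hf.of_le (by exact_mod_cast le_top)).eventually (by simp)
    filter_upwards [h1, hf.continuousAt.eventually_mem (hO.mem_nhds ht)] with r h1 h2
    have a1 := (h1.differentiableAt (by simp)).hasDerivAt
    have a2 := ((hg.contDiffAt (hO.mem_nhds h2)).differentiableAt (by simp)).hasDerivAt
    exact (a2.comp r a1).deriv
  have hg' : ContDiffOn ℝ ∞ (deriv g) O :=
    ((contDiffOn_infty_iff_deriv_of_isOpen hO).1 hg).2
  have c1 : ContDiffAt ℝ m (fun r => deriv g (f r)) t :=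
    ((hg'.contDiffAt (hO.mem_nhds ht)).comp t hf).of_le (by exact_mod_cast le_top)
  have c2 : ContDiffAt ℝ m (deriv f) t :=
    (hf.of_le (by exact_mod_cast le_top) : ContDiffAt ℝ (m + 1) f t).fderiv_right_succ.clm_apply
      contDiffAt_const
  rw [iteratedDeriv_succ', hev.iteratedDeriv_eq, iteratedDeriv_mul c1 c2, sum_range_succ']
  simp only [Nat.choose_zero_right, Nat.cast_one, one_mul, Nat.sub_zero, iteratedDeriv_zero]
  rw [← iteratedDeriv_succ', add_comm]
  congr 1
  refine sum_congr rfl fun i hi => ?_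
  rw [← iteratedDeriv_succ', show m - (i + 1) + 1 = m - i by
    have := mem_range.1 hi; omega]

theorem chain_remainder_aux {O K : Set ℝ} (hO : IsOpen O) (hKO : K ⊆ O)
    {B : ℝ} {m : ℕ} {g : ℝ → ℝ} (hg : ContDiffOn ℝ ∞ g O)
    (hb : ∀ n ≤ m, ∃ C : ℝ, 0 ≤ C ∧ ∀ f : ℝ → ℝ, ∀ t, ContDiffAt ℝ ∞ f t → f t ∈ K →
      (∀ i, 1 ≤ i → i < n → |iteratedDeriv i f t| ≤ B) →
      |iteratedDeriv n (fun r => deriv g (f r)) t| ≤ C * (1 + |iteratedDeriv n f t|)) :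
    ∃ C : ℝ, 0 ≤ C ∧ ∀ f : ℝ → ℝ, ∀ t, ContDiffAt ℝ ∞ f t → f t ∈ K →
      (∀ i, 1 ≤ i → i < m → |iteratedDeriv i f t| ≤ B) →
      |iteratedDeriv (m + 1) (fun r => g (f r)) t - deriv g (f t) * iteratedDeriv (m + 1) f t|
        ≤ C * ((1 + |iteratedDeriv m f t|) * (1 + |deriv f t|)) := by
  choose! C hC0 hC using hb
  refine ⟨∑ i ∈ range m, (m.choose (i + 1) : ℝ) * (C (i + 1) * (1 + |B|) * (1 + |B|)),
    sum_nonneg fun i hi => ?_, fun f t hf ht hB => ?_⟩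
  · have := hC0 (i + 1) (by have := mem_range.1 hi; omega)
    positivity
  rw [iteratedDeriv_succ_comp hO hg hf (hKO ht) m, add_sub_cancel_left, sum_mul]
  refine (abs_sum_le_sum_abs _ _).trans (sum_le_sum fun i hi => ?_)
  have hi := mem_range.1 hi
  have h0 := hC0 (i + 1) (by omega)
  have h1 := hC (i + 1) (by omega) f t hf ht fun i' a b => hB i' a (by omega)
  rw [abs_mul, abs_mul, Nat.abs_cast, mul_assoc, mul_assoc]
  refine mul_le_mul_of_nonneg_left ?_ (Nat.cast_nonneg _)
  have hBB : ∀ i, 1 ≤ i → i < m → |iteratedDeriv i f t| ≤ |B| := fun i a b =>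
    (hB i a b).trans (le_abs_self _)
  have hm0 := abs_nonneg (iteratedDeriv m f t)
  have hf0 := abs_nonneg (deriv f t)
  have hb0 := abs_nonneg B
  calc _ ≤ (C (i + 1) * (1 + |iteratedDeriv (i + 1) f t|)) * |iteratedDeriv (m - i) f t| := by gcongr
    _ = C (i + 1) * ((1 + |iteratedDeriv (i + 1) f t|) * |iteratedDeriv (m - i) f t|) := by ring
    _ ≤ C (i + 1) * (((1 + |B|) * (1 + |B|)) * ((1 + |iteratedDeriv m f t|) * (1 + |deriv f t|))) := by
        refine mul_le_mul_of_nonneg_left ?_ h0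
        have key : ∀ a b : ℝ, 0 ≤ a → 0 ≤ b → a ≤ (1 + |B|) * (1 + |iteratedDeriv m f t|) →
            b ≤ (1 + |B|) * (1 + |deriv f t|) →
            a * b ≤ ((1 + |B|) * (1 + |B|)) * ((1 + |iteratedDeriv m f t|) * (1 + |deriv f t|)) := by
          intro a b ha hb h1 h2
          calc a * b ≤ ((1 + |B|) * (1 + |iteratedDeriv m f t|)) * ((1 + |B|) * (1 + |deriv f t|)) :=
                mul_le_mul h1 h2 hb (by positivity)
            _ = _ := by ring
        rcases Nat.lt_or_ge (i + 1) m with him | him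
        · rw [mul_comm]
          rw [mul_comm (1 + |iteratedDeriv m f t|), mul_comm (|iteratedDeriv (m - i) f t|)]
          have k1 := hBB (i + 1) (by omega) him
          have k2 : |iteratedDeriv (m - i) f t| ≤ |B| + |iteratedDeriv m f t| := by
            rcases Nat.eq_zero_or_pos i with rfl | hi0
            · simp
            · exact (hBB (m - i) (by omega) (by omega)).trans (by linarith)
          calc _ ≤ (1 + |B|) * (|B| + |iteratedDeriv m f t|) := by gcongr
            _ ≤ (1 + |B|) * ((1 + |B|) * (1 + |iteratedDeriv m f t|)) := by
                gcongr; nlinarith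
            _ ≤ _ := by
                have : 0 ≤ (1 + |B|) * ((1 + |B|) * (1 + |iteratedDeriv m f t|)) := by positivity
                nlinarith
        · obtain rfl : m = i + 1 := by omega
          rw [show i + 1 - i = 1 by omega, iteratedDeriv_one]
          refine key _ _ (by positivity) hf0 ?_ ?_
          · nlinarith
          · nlinarith
    _ = _ := by ring

/-- The `m`-th derivative of `g ∘ f` is controlled linearly by that of `f` when the lower
derivatives of `f` are bounded. -/
theorem chain_bound {O K : Set ℝ} (hO : IsOpen O) (hK : IsCompact K) (hKO : K ⊆ O) (B : ℝ) (m : ℕ) :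
    ∀ g : ℝ → ℝ, ContDiffOn ℝ ∞ g O →
    ∃ C : ℝ, 0 ≤ C ∧ ∀ f : ℝ → ℝ, ∀ t, ContDiffAt ℝ ∞ f t → f t ∈ K →
      (∀ i, 1 ≤ i → i < m → |iteratedDeriv i f t| ≤ B) →
      |iteratedDeriv m (fun r => g (f r)) t| ≤ C * (1 + |iteratedDeriv m f t|) := by
  induction m using Nat.strong_induction_on with
  | _ m ih =>
    intro g hg
    have hg' : ContDiffOn ℝ ∞ (deriv g) O :=
      ((contDiffOn_infty_iff_deriv_of_isOpen hO).1 hg).2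
    rcases m with _ | m
    · obtain ⟨C, hC⟩ := hK.exists_bound_of_continuousOn (hg.continuousOn.mono hKO)
      refine ⟨|C|, abs_nonneg _, fun f t _ ht _ => ?_⟩
      have := hC _ ht
      simp only [iteratedDeriv_zero, norm_eq_abs] at *
      nlinarith [abs_nonneg (f t), le_abs_self C, abs_nonneg C]
    · obtain ⟨C, hC0, hC⟩ := chain_remainder_aux (B := B) (m := m) hO hKO hg
        fun n hn => ih n (by omega) _ hg'
      obtain ⟨D, hD⟩ := hK.exists_bound_of_continuousOn (hg'.continuousOn.mono hKO)
      refine ⟨|D| + C * ((2 + |B|) * (2 + |B|)), by positivity, fun f t hf ht hB => ?_⟩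
      rcases Nat.eq_zero_or_pos m with rfl | hm
      · have := iteratedDeriv_succ_comp hO hg hf (hKO ht) 0
        simp only [Finset.range_zero, Finset.sum_empty, add_zero] at this
        rw [this, abs_mul]
        have h1 := (hD _ ht).trans (le_abs_self D)
        rw [norm_eq_abs] at h1
        set y := |iteratedDeriv (0 + 1) f t|
        have hy : 0 ≤ y := abs_nonneg _
        calc _ ≤ |D| * y := by gcongr
          _ ≤ |D| * (1 + y) := by gcongr; linarith
          _ ≤ _ := by gcongr; simp only [le_add_iff_nonneg_right]; positivity
      · have h1 := hC f t hf ht fun i a b => hB i a (by omega)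
        have b1 := (hB m hm (by omega)).trans (le_abs_self B)
        have b2 : |deriv f t| ≤ |B| := by
          rw [← iteratedDeriv_one]; exact (hB 1 le_rfl (by omega)).trans (le_abs_self B)
        have h2 := (hD _ ht).trans (le_abs_self D)
        rw [norm_eq_abs] at h2
        set y := iteratedDeriv (m + 1) f t
        have hy := abs_nonneg y
        have h3 : |deriv g (f t) * y| ≤ |D| * |y| := by rw [abs_mul]; gcongr
        have h4 : C * ((1 + |iteratedDeriv m f t|) * (1 + |deriv f t|))
            ≤ C * ((2 + |B|) * (2 + |B|)) := by
          gcongr <;> linarith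
        have h5 := abs_sub_abs_le_abs_sub (iteratedDeriv (m + 1) (fun r => g (f r)) t)
          (deriv g (f t) * y)
        have h6 : 0 ≤ C * ((2 + |B|) * (2 + |B|)) := by positivity
        have h7 : 0 ≤ |D| := abs_nonneg D
        nlinarith

theorem chain_remainder {O K : Set ℝ} (hO : IsOpen O) (hK : IsCompact K) (hKO : K ⊆ O) (B : ℝ)
    (m : ℕ) {g : ℝ → ℝ} (hg : ContDiffOn ℝ ∞ g O) :
    ∃ C : ℝ, 0 ≤ C ∧ ∀ f : ℝ → ℝ, ∀ t, ContDiffAt ℝ ∞ f t → f t ∈ K →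
      (∀ i, 1 ≤ i → i < m → |iteratedDeriv i f t| ≤ B) →
      |iteratedDeriv (m + 1) (fun r => g (f r)) t - deriv g (f t) * iteratedDeriv (m + 1) f t|
        ≤ C * ((1 + |iteratedDeriv m f t|) * (1 + |deriv f t|)) :=
  chain_remainder_aux hO hKO hg fun n _ => chain_bound hO hK hKO B n _
    ((contDiffOn_infty_iff_deriv_of_isOpen hO).1 hg).2

/-- `g` is integrable on `[t₁, t₂]` up to a constant: it is dominated by the derivative of a
bounded function. -/
def IntBdd (C t₁ t₂ : ℝ) (g : ℝ → ℝ) : Prop :=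
  ∃ Y Y' : ℝ → ℝ, ∀ t ∈ Icc t₁ t₂, HasDerivAt Y (Y' t) t ∧ |Y t| ≤ C ∧ g t ≤ Y' t + C

theorem IntBdd.of_le {C t₁ t₂ : ℝ} {g : ℝ → ℝ} (h : ∀ t ∈ Icc t₁ t₂, g t ≤ C) (hC : 0 ≤ C) :
    IntBdd C t₁ t₂ g :=
  ⟨fun _ => 0, fun _ => 0, fun t ht => ⟨hasDerivAt_const _ _, by simpa, by linarith [h t ht]⟩⟩

theorem IntBdd.add {C D t₁ t₂ : ℝ} {g k : ℝ → ℝ} (hg : IntBdd C t₁ t₂ g) (hk : IntBdd D t₁ t₂ k) :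
    IntBdd (C + D) t₁ t₂ (fun t => g t + k t) := by
  obtain ⟨Y, Y', hY⟩ := hg
  obtain ⟨X, X', hX⟩ := hk
  exact ⟨fun t => Y t + X t, fun t => Y' t + X' t, fun t ht =>
    ⟨(hY t ht).1.add (hX t ht).1, by grind,
      by grind⟩⟩

theorem IntBdd.const_mul {C a t₁ t₂ : ℝ} {g : ℝ → ℝ} (hg : IntBdd C t₁ t₂ g) (ha : 0 ≤ a) :
    IntBdd (a * C) t₁ t₂ (fun t => a * g t) := by
  obtain ⟨Y, Y', hY⟩ := hg
  refine ⟨fun t => a * Y t, fun t => a * Y' t, fun t ht => ⟨(hY t ht).1.const_mul a, ?_, ?_⟩⟩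
  · rw [abs_mul, abs_of_nonneg ha]; exact mul_le_mul_of_nonneg_left (hY t ht).2.1 ha
  · rw [← mul_add]; exact mul_le_mul_of_nonneg_left (hY t ht).2.2 ha

theorem IntBdd.mono {C D t₁ t₂ s₁ s₂ : ℝ} {g k : ℝ → ℝ} (hg : IntBdd C t₁ t₂ g)
    (h1 : t₁ ≤ s₁) (h2 : s₂ ≤ t₂) (hCD : C ≤ D) (hk : ∀ t ∈ Icc s₁ s₂, k t ≤ g t) :
    IntBdd D s₁ s₂ k := by
  obtain ⟨Y, Y', hY⟩ := hg
  refine ⟨Y, Y', fun t ht => ?_⟩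
  grind

/-- A differential inequality `y' ≤ -d + C (1 + g) (1 + y)` with `y` and `g` integrable bounds `y`
after a positive time, and makes `d` integrable. -/
theorem energy_gain {C t₁ s₁ t₂ : ℝ} (hC : 0 ≤ C) (h1 : t₁ < s₁) (h2 : s₁ ≤ t₂) :
    ∃ D : ℝ, 0 ≤ D ∧ ∀ y y' d g : ℝ → ℝ,
      (∀ t ∈ Icc t₁ t₂, HasDerivAt y (y' t) t ∧ 0 ≤ y t ∧ 0 ≤ d t ∧ 0 ≤ g t ∧
        y' t ≤ -d t + C * ((1 + g t) * (1 + y t))) →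
      IntBdd C t₁ t₂ y → IntBdd C t₁ t₂ g →
      (∀ t ∈ Icc s₁ t₂, y t ≤ D) ∧ IntBdd D s₁ t₂ d := by
  set ℓ := t₂ - t₁ with hℓ
  have hℓ0 : 0 < ℓ := by linarith
  set C₁ := C * (ℓ + 1)
  have hC₁ : 0 ≤ C₁ := by positivity
  set C₂ := C₁ + C₁ * C + C
  have hC₂ : 0 ≤ C₂ := by positivity
  set Λ := 2 * C₁ * C + 2 * C + C₂ * ℓ
  set D₁ := exp Λ / (s₁ - t₁)
  have hD₁ : 0 ≤ D₁ := div_nonneg (exp_pos _).le (by linarith)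
  refine ⟨D₁ + C * (1 + D₁) * C + C * (1 + D₁) * (1 + C), by positivity,
    fun y y' d g hy hY hg => ?_⟩
  obtain ⟨Y, Y', hY⟩ := hY
  obtain ⟨G, G', hG⟩ := hg
  have hbound : ∀ t ∈ Icc s₁ t₂, y t ≤ D₁ := by
    intro t ht
    set w : ℝ → ℝ := fun t => log (1 + (t - t₁) * y t) - C₁ * G t - Y t - C₂ * t with hw
    have hpos : ∀ t ∈ Icc t₁ t₂, 0 < 1 + (t - t₁) * y t := fun t ht => by
      have := mul_nonneg (sub_nonneg.2 ht.1) (hy t ht).2.1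
      linarith
    have hd : ∀ t ∈ Icc t₁ t₂, HasDerivAt w ((1 * y t + (t - t₁) * y' t) / (1 + (t - t₁) * y t)
        - C₁ * G' t - Y' t - C₂ * 1) t := fun t ht =>
      (((((((hasDerivAt_id t).sub_const t₁).mul (hy t ht).1).const_add 1).log (hpos t ht).ne').sub
        ((hG t ht).1.const_mul C₁)).sub (hY t ht).1).sub ((hasDerivAt_id t).const_mul C₂)
    have hanti : AntitoneOn w (Icc t₁ t₂) := by
      refine antitoneOn_of_hasDerivWithinAt_nonpos (convex_Icc _ _)
        (fun t ht => (hd t ht).continuousAt.continuousWithinAt)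
        (fun t ht => (hd t (interior_subset ht)).hasDerivWithinAt) fun t ht => ?_
      have ht := interior_subset ht
      obtain ⟨-, a1, a2, a3, a4⟩ := hy t ht
      have b1 := (hG t ht).2.2
      have b2 := (hY t ht).2.2
      have c0 : 0 ≤ t - t₁ := sub_nonneg.2 ht.1
      have c1 : t - t₁ ≤ ℓ := by linarith [ht.2]
      have e1 : (1 * y t + (t - t₁) * y' t) / (1 + (t - t₁) * y t)
          ≤ y t + C₁ * (1 + g t) := by
        rw [div_le_iff₀ (hpos t ht)]
        have e2 : (t - t₁) * y' t ≤ (t - t₁) * (C * ((1 + g t) * (1 + y t))) :=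
          mul_le_mul_of_nonneg_left (by linarith) c0
        have e3 : (t - t₁) * (1 + y t) ≤ (ℓ + 1) * (1 + (t - t₁) * y t) := by
          nlinarith [mul_nonneg c0 a1, mul_nonneg hℓ0.le (mul_nonneg c0 a1)]
        have e4 : C * (1 + g t) * ((t - t₁) * (1 + y t))
            ≤ C * (1 + g t) * ((ℓ + 1) * (1 + (t - t₁) * y t)) :=
          by gcongr
        have e5 : 0 ≤ y t * ((t - t₁) * y t) := by positivity
        linarith
      have e6 : C₁ * g t ≤ C₁ * (G' t + C) := by gcongr
      linarith
    have ht' : t ∈ Icc t₁ t₂ := by grind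
    have ht₁ : t₁ ∈ Icc t₁ t₂ := by grind
    have hle := hanti ht₁ ht' ht'.1
    simp only [hw, sub_self, zero_mul, add_zero, log_one] at hle
    have g1 := abs_le.1 (hG t ht').2.1
    have g2 := abs_le.1 (hG t₁ ht₁).2.1
    have g3 := abs_le.1 (hY t ht').2.1
    have g4 := abs_le.1 (hY t₁ ht₁).2.1
    have g5 : C₁ * G t ≤ C₁ * C := mul_le_mul_of_nonneg_left g1.2 hC₁
    have g6 : C₁ * -C ≤ C₁ * G t₁ := mul_le_mul_of_nonneg_left g2.1 hC₁
    have g7 : C₂ * (t - t₁) ≤ C₂ * ℓ := mul_le_mul_of_nonneg_left (by linarith [ht'.2]) hC₂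
    have hlog : log (1 + (t - t₁) * y t) ≤ Λ := by simp only [Λ]; linarith
    have hexp := (log_le_iff_le_exp (hpos t ht')).1 hlog
    have hyt := (hy t ht').2.1
    rw [le_div_iff₀ (by linarith)]
    nlinarith [ht.1]
  have hC1 : 0 ≤ C * (1 + D₁) := by positivity
  refine ⟨fun t ht => (hbound t ht).trans ?_, fun t => -y t + C * (1 + D₁) * G t,
    fun t => -y' t + C * (1 + D₁) * G' t, fun t ht => ?_⟩
  · have : 0 ≤ C * (1 + D₁) * C + C * (1 + D₁) * (1 + C) := by positivity
    linarith
  have ht' : t ∈ Icc t₁ t₂ := by grind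
  obtain ⟨a0, a1, a2, a3, a4⟩ := hy t ht'
  have b := hbound t ht
  refine ⟨a0.neg.add ((hG t ht').1.const_mul _), ?_, ?_⟩
  · refine (abs_add_le _ _).trans ?_
    rw [abs_neg, abs_mul, abs_of_nonneg a1, abs_of_nonneg hC1]
    have := mul_le_mul_of_nonneg_left (hG t ht').2.1 hC1
    have : 0 ≤ C * (1 + D₁) * (1 + C) := by positivity
    linarith
  · have c1 : C * ((1 + g t) * (1 + y t)) ≤ C * ((1 + g t) * (1 + D₁)) := by gcongr
    have c2 := mul_le_mul_of_nonneg_left (hG t ht').2.2 hC1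
    have c3 : 0 ≤ C * (1 + D₁) * C := by positivity
    nlinarith

namespace Lattice

/-- A lattice cutoff function. -/
structure Cutoff (h κ ℓ : ℝ) (N : ℕ) (J : Finset ℕ) (w : ℕ → ℝ) : Prop where
  h_pos : 0 < h
  h_le : h ≤ 1
  κ_nonneg : 0 ≤ κ
  nonneg : ∀ j, 0 ≤ w j
  le_one : ∀ j, w j ≤ 1
  lip : ∀ j, |w (j + 1) - w j| ≤ κ * h
  zero_left : w 0 = 0
  zero_right : ∀ j, N ≤ j → w j = 0
  supp : ∀ j, (w j ≠ 0 ∨ w (j + 1) ≠ 0) → j ∈ J ∧ j + 1 ∈ J ∧ j + 2 ∈ J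
  length : h * J.card ≤ ℓ

variable {h κ ℓ : ℝ} {N : ℕ} {J : Finset ℕ} {w : ℕ → ℝ}

theorem sum_shift_le {J : Finset ℕ} {g : ℕ → ℝ} (hg : ∀ j, 0 ≤ g j) (A : Finset ℕ) (i : ℕ)
    (hA : ∀ j ∈ A, j + i ∈ J) : ∑ j ∈ A, g (j + i) ≤ ∑ j ∈ J, g j := by
  have := Finset.sum_map A (addRightEmbedding i) g
  simp only [addRightEmbedding_apply] at this
  rw [← this]
  refine sum_le_sum_of_subset_of_nonneg (fun k hk => ?_) fun j _ _ => hg j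
  grind

theorem Cutoff.sum_le (H : Cutoff h κ ℓ N J w) {f g : ℕ → ℝ} (hg : ∀ j, 0 ≤ g j)
    (h0 : ∀ j, w j = 0 → w (j + 1) = 0 → f j ≤ 0)
    (h1 : ∀ j, (w j ≠ 0 ∨ w (j + 1) ≠ 0) → f j ≤ g j + g (j + 1) + g (j + 2)) :
    h * ∑ j ∈ range N, f j ≤ 3 * (h * ∑ j ∈ J, g j) := by
  classical
  set A := (range N).filter fun j => w j ≠ 0 ∨ w (j + 1) ≠ 0
  have hA : ∀ j ∈ A, j ∈ J ∧ j + 1 ∈ J ∧ j + 2 ∈ J := fun j hj => H.supp j (mem_filter.1 hj).2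
  have e1 : ∑ j ∈ range N, f j ≤ ∑ j ∈ A, f j := by
    rw [← Finset.sum_filter_add_sum_filter_not (range N)
      (fun j => w j ≠ 0 ∨ w (j + 1) ≠ 0) f]
    have : ∑ j ∈ (range N).filter (fun j => ¬(w j ≠ 0 ∨ w (j + 1) ≠ 0)), f j ≤ 0 := by
      refine Finset.sum_nonpos fun j hj => ?_
      grind
    linarith
  have e2 : ∑ j ∈ A, f j ≤ ∑ j ∈ A, (g j + g (j + 1) + g (j + 2)) :=
    sum_le_sum (by grind)
  rw [sum_add_distrib, sum_add_distrib] at e2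
  have s0 := sum_shift_le hg A 0 fun j hj => (hA j hj).1
  have s1 := sum_shift_le hg A 1 fun j hj => (hA j hj).2.1
  have s2 := sum_shift_le hg A 2 fun j hj => (hA j hj).2.2
  simp only [add_zero] at s0
  have := mul_le_mul_of_nonneg_left (e1.trans (e2.trans (add_le_add (add_le_add s0 s1) s2)))
    H.h_pos.le
  linarith

theorem sum_by_parts (G F : ℕ → ℝ) (N : ℕ) (h0 : G 0 = 0) (hN : G N = 0) :
    ∑ j ∈ range N, G (j + 1) * (F (j + 1) - F j)
      = -∑ j ∈ range N, F j * (G (j + 1) - G j) := by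
  have : ∑ j ∈ range N, (G (j + 1) * F (j + 1) - G j * F j) = 0 := by
    rw [Finset.sum_range_sub (fun j => G j * F j)]; simp [h0, hN]
  rw [← Finset.sum_neg_distrib, ← sub_eq_zero, ← sum_sub_distrib, ← this]
  grind

theorem young {a b ε : ℝ} (hε : 0 < ε) : a * b ≤ ε * a ^ 2 + b ^ 2 / (4 * ε) := by
  have : ε * a ^ 2 + b ^ 2 / (4 * ε) - a * b = ε * (a - b / (2 * ε)) ^ 2 := by field_simp; ring
  nlinarith [mul_nonneg hε.le (sq_nonneg (a - b / (2 * ε)))]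

set_option maxHeartbeats 600000 in
theorem flux_term {α κ h a P R U U' x x' : ℝ} (hα : 0 < α) (ha : α ≤ a) (ha1 : a ≤ 1)
    (hh : 0 < h) (hP : h * P = U' - U) (hx' : 0 ≤ x')
    (hx1' : x' ≤ 1) (hx : 0 ≤ x) (hx1 : x ≤ 1) (hκ : 0 ≤ κ) (hlip : |x' - x| ≤ κ * h) :
    -((a * P + R) * (x' ^ 2 * U' - x ^ 2 * U)) / h ≤ -(α / 2) * (x' ^ 2 * P ^ 2) +
      (8 * κ ^ 2 / α + 4 * κ ^ 2 + 2 / α + 1) * (U ^ 2 + U' ^ 2 + R ^ 2) := by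
  obtain ⟨e, he⟩ : ∃ e, e = (x' - x) / h := ⟨_, rfl⟩
  have hex : x = x' - h * e := by grind
  have heκ : e ^ 2 ≤ κ ^ 2 := by
    rw [sq_le_sq, abs_of_nonneg hκ, he, abs_div, abs_of_pos hh, div_le_iff₀ hh]; exact hlip
  have hU' : U' = U + h * P := by linarith
  have key : -((a * P + R) * (x' ^ 2 * U' - x ^ 2 * U)) / h
      = -a * (x' ^ 2 * P ^ 2) - x' * P * (x' * R) - (x' * P) * (2 * a * e * U)
        + a * e ^ 2 * (U' - U) * U - R * (e * (x' + x) * U) := by grind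
  have t1 : -(x' * P * (x' * R)) ≤ α / 4 * (x' * P) ^ 2 + R ^ 2 / α := by
    have := young (a := x' * P) (b := -(x' * R)) (ε := α / 4) (by positivity)
    have h2 : (-(x' * R)) ^ 2 / (4 * (α / 4)) ≤ R ^ 2 / α := by
      rw [show 4 * (α / 4) = α by ring]
      gcongr ?_ / _
      rw [neg_sq, mul_pow]
      exact mul_le_of_le_one_left (sq_nonneg R) (pow_le_one₀ hx' hx1')
    linarith
  have t2 : -((x' * P) * (2 * a * e * U)) ≤ α / 4 * (x' * P) ^ 2 + 4 * κ ^ 2 / α * U ^ 2 := by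
    have := young (a := x' * P) (b := -(2 * a * e * U)) (ε := α / 4) (by positivity)
    have h2 : (-(2 * a * e * U)) ^ 2 / (4 * (α / 4)) ≤ 4 * κ ^ 2 / α * U ^ 2 := by
      rw [show 4 * (α / 4) = α by ring, div_mul_eq_mul_div]
      gcongr ?_ / _
      have h3 : a ^ 2 ≤ 1 := pow_le_one₀ (by linarith) ha1
      have h4 : a ^ 2 * e ^ 2 ≤ κ ^ 2 := by nlinarith only [sq_nonneg e, h3, heκ]
      nlinarith only [mul_le_mul_of_nonneg_right h4 (sq_nonneg U)]
    linarith
  have t3 : a * e ^ 2 * (U' - U) * U ≤ κ ^ 2 * (U ^ 2 + U' ^ 2) := by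
    have h1 : (U' - U) * U ≤ U ^ 2 + U' ^ 2 := by nlinarith only [sq_nonneg (U' - U), sq_nonneg (U' + U)]
    have h2 : a * e ^ 2 ≤ κ ^ 2 := by nlinarith only [sq_nonneg e, heκ, ha1]
    have h3 : 0 ≤ a * e ^ 2 := by have : 0 ≤ a := by linarith
                                  positivity
    rw [mul_assoc (a * e ^ 2)]
    exact (mul_le_mul_of_nonneg_left h1 h3).trans
      (by gcongr)
  have t4 : -(R * (e * (x' + x) * U)) ≤ R ^ 2 + κ ^ 2 * U ^ 2 := by
    have h1 : (x' + x) ^ 2 ≤ 4 := by nlinarith only [hx, hx', hx1, hx1']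
    have h2 : (e * (x' + x) * U) ^ 2 ≤ 4 * (κ ^ 2 * U ^ 2) := by
      rw [mul_pow, mul_pow]
      have : e ^ 2 * (x' + x) ^ 2 ≤ κ ^ 2 * 4 := by gcongr
      nlinarith only [mul_le_mul_of_nonneg_right this (sq_nonneg U)]
    generalize e * (x' + x) * U = X at h2 ⊢
    nlinarith only [sq_nonneg (R + X / 2), h2]
  have t5 : -a * (x' ^ 2 * P ^ 2) ≤ -α * (x' ^ 2 * P ^ 2) := by gcongr
  have t6 : 0 ≤ κ ^ 2 / α := by positivity
  have t7 : 0 ≤ 1 / α := by positivity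
  have t8 : R ^ 2 / α = 1 / α * R ^ 2 := by ring
  have t9 : 4 * κ ^ 2 / α * U ^ 2 = 4 * (κ ^ 2 / α * U ^ 2) := by ring
  have t10 : (8 * κ ^ 2 / α + 4 * κ ^ 2 + 2 / α + 1) * (U ^ 2 + U' ^ 2 + R ^ 2)
      = 8 * (κ ^ 2 / α * (U ^ 2 + U' ^ 2 + R ^ 2)) + 4 * (κ ^ 2 * (U ^ 2 + U' ^ 2 + R ^ 2))
        + 2 * (1 / α * (U ^ 2 + U' ^ 2 + R ^ 2)) + (U ^ 2 + U' ^ 2 + R ^ 2) := by ring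
  have u1 : κ ^ 2 / α * U ^ 2 ≤ κ ^ 2 / α * (U ^ 2 + U' ^ 2 + R ^ 2) :=
    mul_le_mul_of_nonneg_left (by linarith [sq_nonneg U', sq_nonneg R]) t6
  have u2 : κ ^ 2 * (U ^ 2 + U' ^ 2) ≤ κ ^ 2 * (U ^ 2 + U' ^ 2 + R ^ 2) :=
    mul_le_mul_of_nonneg_left (by linarith [sq_nonneg R]) (sq_nonneg κ)
  have u2' : κ ^ 2 * U ^ 2 ≤ κ ^ 2 * (U ^ 2 + U' ^ 2 + R ^ 2) :=
    mul_le_mul_of_nonneg_left (by linarith [sq_nonneg U', sq_nonneg R]) (sq_nonneg κ)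
  have u3 : 1 / α * R ^ 2 ≤ 1 / α * (U ^ 2 + U' ^ 2 + R ^ 2) :=
    mul_le_mul_of_nonneg_left (by linarith [sq_nonneg U', sq_nonneg U]) t7
  have u4 : 0 ≤ κ ^ 2 / α * (U ^ 2 + U' ^ 2 + R ^ 2) := by positivity
  have u5 : 0 ≤ κ ^ 2 * (U ^ 2 + U' ^ 2 + R ^ 2) := by positivity
  have u6 : 0 ≤ 1 / α * (U ^ 2 + U' ^ 2 + R ^ 2) := by positivity
  have v1 : 0 ≤ U ^ 2 + U' ^ 2 + R ^ 2 := by positivity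
  have v2 : R ^ 2 ≤ U ^ 2 + U' ^ 2 + R ^ 2 := by linarith [sq_nonneg U, sq_nonneg U']
  linarith

variable {h κ ℓ : ℝ} {N : ℕ} {J : Finset ℕ} {w : ℕ → ℝ}

theorem Cutoff.shift_sq_le (H : Cutoff h κ ℓ N J w) {U P : ℕ → ℝ} {j : ℕ}
    (hP : h * P j = U (j + 1) - U j) :
    w j ^ 2 * P j ^ 2 ≤ 2 * (w (j + 1) ^ 2 * P j ^ 2) + 4 * κ ^ 2 * (U j ^ 2 + U (j + 1) ^ 2) := by
  have h1 : (w j * P j) ^ 2 ≤ 2 * (w (j + 1) * P j) ^ 2 + 2 * ((w (j + 1) - w j) * P j) ^ 2 := by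
    nlinarith only [sq_nonneg (w (j + 1) * P j + (w (j + 1) - w j) * P j)]
  have h2 : ((w (j + 1) - w j) * P j) ^ 2 ≤ κ ^ 2 * (h * P j) ^ 2 := by
    rw [mul_pow, mul_pow, ← mul_assoc]
    refine mul_le_mul_of_nonneg_right ?_ (sq_nonneg _)
    rw [← mul_pow, ← sq_abs]
    exact pow_le_pow_left₀ (abs_nonneg _) (H.lip j) 2
  have h3 : (h * P j) ^ 2 ≤ 2 * (U j ^ 2 + U (j + 1) ^ 2) := by
    rw [hP]; nlinarith only [sq_nonneg (U (j + 1) + U j)]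
  have h4 := mul_le_mul_of_nonneg_left h3 (sq_nonneg κ)
  rw [mul_pow] at h1
  rw [mul_pow (w (j + 1))] at h1
  linarith

theorem lower_order_term {α B w U P b G : ℝ} (hα : 0 < α) (hb : |b| ≤ B)
    (hw : 0 ≤ w) (hw1 : w ≤ 1) :
    w ^ 2 * (U * (b * P + G)) ≤
      α / 16 * (w ^ 2 * P ^ 2) + (4 * B ^ 2 / α + 1) * (U ^ 2 + G ^ 2) := by
  have t1 := young (a := w * P) (b := w * (b * U)) (ε := α / 16) (by positivity)
  have h1 : w ^ 2 ≤ 1 := pow_le_one₀ hw hw1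
  have h2 : (w * (b * U)) ^ 2 / (4 * (α / 16)) ≤ 4 * B ^ 2 / α * U ^ 2 := by
    rw [show 4 * (α / 16) = α / 4 by ring, div_div_eq_mul_div, div_mul_eq_mul_div]
    gcongr ?_ / _
    have h3 : b ^ 2 ≤ B ^ 2 := by
      rw [← sq_abs]; exact pow_le_pow_left₀ (abs_nonneg _) hb 2
    have h4 : w ^ 2 * (b ^ 2 * U ^ 2) ≤ b ^ 2 * U ^ 2 := mul_le_of_le_one_left (by positivity) h1
    have h5 := mul_le_mul_of_nonneg_right h3 (sq_nonneg U)
    rw [mul_pow, mul_pow]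
    linarith
  have t2 : w ^ 2 * (U * G) ≤ U ^ 2 + G ^ 2 := by
    have h3 : U * G ≤ U ^ 2 + G ^ 2 := by nlinarith only [sq_nonneg (U - G), sq_nonneg (U + G)]
    have h4 : w ^ 2 * (U ^ 2 + G ^ 2) ≤ U ^ 2 + G ^ 2 := mul_le_of_le_one_left (by positivity) h1
    exact (mul_le_mul_of_nonneg_left h3 (sq_nonneg w)).trans h4
  have t3 : 0 ≤ 4 * B ^ 2 / α * G ^ 2 := by positivity
  rw [mul_pow] at t1
  linarith

/-- Energy estimate for a discrete conservation law with flux `F = a P + R`. -/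
theorem Cutoff.flux_sum_le (H : Cutoff h κ ℓ N J w) {α B : ℝ} (hα : 0 < α) {U V P F R G a b : ℕ → ℝ}
    (hF : ∀ j ∈ J, F j = a j * P j + R j ∧ α ≤ a j ∧ a j ≤ 1 ∧ |b j| ≤ B)
    (hP : ∀ j ∈ J, h * P j = U (j + 1) - U j)
    (hV : ∀ j ∈ J, V (j + 1) = (F (j + 1) - F j) / h + (b (j + 1) * P (j + 1) + G (j + 1))) :
    h * ∑ j ∈ range N, w (j + 1) ^ 2 * (U (j + 1) * V (j + 1)) ≤
      -(α / 4) * (h * ∑ j ∈ range N, w (j + 1) ^ 2 * P j ^ 2) +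
      6 * (8 * κ ^ 2 / α + 4 * κ ^ 2 + 2 / α + 1 + (4 * B ^ 2 / α + 1) + α * κ ^ 2) *
        (h * ∑ j ∈ J, (U j ^ 2 + R j ^ 2 + G j ^ 2)) := by
  have hh := H.h_pos
  set C₀ := 8 * κ ^ 2 / α + 4 * κ ^ 2 + 2 / α + 1 with hC₀
  set C₁ := 4 * B ^ 2 / α + 1 with hC₁
  have hC₀' : 0 ≤ C₀ := by positivity
  have hC₁' : 0 ≤ C₁ := by positivity
  have hακ : 0 ≤ α * κ ^ 2 := by positivity
  set C := C₀ + C₁ + α * κ ^ 2 with hC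
  set g : ℕ → ℝ := fun j => C * (U j ^ 2 + R j ^ 2 + G j ^ 2) with hg
  have hg0 : ∀ j, 0 ≤ g j := fun j => by positivity
  set D : ℕ → ℝ := fun j => w (j + 1) ^ 2 * P j ^ 2 with hD
  have e1 := H.sum_le (f := fun j => -(F j * (w (j + 1) ^ 2 * U (j + 1) - w j ^ 2 * U j)) / h
      + α / 2 * D j) hg0 (fun j h0 h1 => by simp [hD, h0, h1]) fun j hj => by
    obtain ⟨j0, j1, -⟩ := H.supp j hj
    obtain ⟨f1, f2, f3, -⟩ := hF j j0
    have := flux_term (R := R j) hα f2 f3 hh (hP j j0) (H.nonneg (j + 1)) (H.le_one (j + 1))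
      (H.nonneg j) (H.le_one j) H.κ_nonneg (H.lip j)
    rw [← f1] at this
    have k1 : C₀ * (U j ^ 2 + U (j + 1) ^ 2 + R j ^ 2) ≤ g j + g (j + 1) := by
      have : C₀ * (U j ^ 2 + U (j + 1) ^ 2 + R j ^ 2)
          ≤ C * (U j ^ 2 + U (j + 1) ^ 2 + R j ^ 2) :=
        mul_le_mul_of_nonneg_right (by linarith) (by positivity)
      have h2 : 0 ≤ C * (G j ^ 2 + R (j + 1) ^ 2 + G (j + 1) ^ 2) := by positivity
      simp only [hg]
      linarith
    have := hg0 (j + 2)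
    simp only [hD]
    linarith
  have e2 := H.sum_le (f := fun j => w (j + 1) ^ 2 * (U (j + 1) * (b (j + 1) * P (j + 1)
      + G (j + 1))) - α / 8 * D (j + 1)) hg0 (fun j h0 h1 => by
        simp only [hD, h1]
        have : 0 ≤ α / 8 * (w (j + 1 + 1) ^ 2 * P (j + 1) ^ 2) := by positivity
        linarith) fun j hj => by
    obtain ⟨j0, j1, -⟩ := H.supp j hj
    obtain ⟨-, -, -, f4⟩ := hF _ j1
    have k1 := lower_order_term (U := U (j + 1)) (P := P (j + 1)) (G := G (j + 1)) hα f4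
      (H.nonneg (j + 1)) (H.le_one (j + 1))
    have k2 := mul_le_mul_of_nonneg_left (H.shift_sq_le (hP _ j1)) (show 0 ≤ α / 16 by positivity)
    have k3 : C₁ * (U (j + 1) ^ 2 + G (j + 1) ^ 2)
        ≤ C₁ * (U (j + 1) ^ 2 + R (j + 1) ^ 2 + G (j + 1) ^ 2) :=
      mul_le_mul_of_nonneg_left (by linarith [sq_nonneg (R (j + 1))]) hC₁'
    have k4 : 0 ≤ C₀ * (U (j + 1) ^ 2 + R (j + 1) ^ 2 + G (j + 1) ^ 2) := by positivity
    have k5 : α * κ ^ 2 * U (j + 1) ^ 2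
        ≤ α * κ ^ 2 * (U (j + 1) ^ 2 + R (j + 1) ^ 2 + G (j + 1) ^ 2) :=
      mul_le_mul_of_nonneg_left (by linarith [sq_nonneg (R (j + 1)), sq_nonneg (G (j + 1))]) hακ
    have k6 : α * κ ^ 2 * U (j + 2) ^ 2 ≤ g (j + 2) := by
      simp only [hg, hC]
      have q1 : α * κ ^ 2 * U (j + 2) ^ 2
          ≤ α * κ ^ 2 * (U (j + 2) ^ 2 + R (j + 2) ^ 2 + G (j + 2) ^ 2) :=
        mul_le_mul_of_nonneg_left (by linarith [sq_nonneg (R (j + 2)), sq_nonneg (G (j + 2))]) hακ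
      have q2 : 0 ≤ (C₀ + C₁) * (U (j + 2) ^ 2 + R (j + 2) ^ 2 + G (j + 2) ^ 2) := by positivity
      linarith
    have k7 : g (j + 1) = C₀ * (U (j + 1) ^ 2 + R (j + 1) ^ 2 + G (j + 1) ^ 2)
        + C₁ * (U (j + 1) ^ 2 + R (j + 1) ^ 2 + G (j + 1) ^ 2)
        + α * κ ^ 2 * (U (j + 1) ^ 2 + R (j + 1) ^ 2 + G (j + 1) ^ 2) := by
      simp only [hg, hC]; ring
    have k8 := hg0 j
    have k9 : 0 ≤ α * κ ^ 2 * U (j + 1) ^ 2 := by positivity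
    have k10 : 0 ≤ α * κ ^ 2 * U (j + 2) ^ 2 := by positivity
    have k11 : D (j + 1) = w (j + 1 + 1) ^ 2 * P (j + 1) ^ 2 := rfl
    rw [k11, k7]
    linarith
  have e3 : ∑ j ∈ range N, D (j + 1) ≤ ∑ j ∈ range N, D j := by
    have h1 := sum_range_succ D N
    have h2 := sum_range_succ' D N
    have h3 : D N = 0 := by simp [hD, H.zero_right (N + 1) (by omega)]
    have h4 : 0 ≤ D 0 := by positivity
    linarith
  have e4 := sum_by_parts (fun j => w j ^ 2 * U j) F N (by simp [H.zero_left])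
    (by simp [H.zero_right N le_rfl])
  have e5 : ∑ j ∈ range N, w (j + 1) ^ 2 * (U (j + 1) * V (j + 1))
      = (∑ j ∈ range N, w (j + 1) ^ 2 * U (j + 1) * (F (j + 1) - F j)) / h
        + ∑ j ∈ range N,
          w (j + 1) ^ 2 * (U (j + 1) * (b (j + 1) * P (j + 1) + G (j + 1))) := by
    rw [sum_div, ← sum_add_distrib]
    refine sum_congr rfl fun j _ => ?_
    by_cases h0 : w (j + 1) = 0
    · simp [h0]
    · rw [hV j (H.supp j (Or.inr h0)).1]; ring
  simp only [neg_div] at e1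
  rw [sum_add_distrib, Finset.sum_neg_distrib, ← sum_div, ← mul_sum] at e1
  rw [sum_sub_distrib, ← mul_sum] at e2
  rw [e4] at e5
  rw [e5]
  have e6 := mul_le_mul_of_nonneg_left e3 (show 0 ≤ h * (α / 8) by positivity)
  have e7 : ∑ j ∈ J, g j = C * ∑ j ∈ J, (U j ^ 2 + R j ^ 2 + G j ^ 2) := by
    rw [mul_sum]
  have e8 : 0 ≤ ∑ j ∈ range N, D j :=
    sum_nonneg fun j _ => by simp only [hD]; positivity
  have e9 : 0 ≤ h * (α / 8) * ∑ j ∈ range N, D j := by positivity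
  rw [e7] at e1 e2
  rw [neg_div]
  change _ ≤ -(α / 4) * (h * ∑ j ∈ range N, D j) + _
  linarith

/-- Discrete Sobolev inequality. -/
theorem Cutoff.sobolev (H : Cutoff h κ ℓ N J w) {F P : ℕ → ℝ}
    (hP : ∀ j ∈ J, h * P j = F (j + 1) - F j) (i : ℕ) :
    (w i * F i) ^ 2 ≤ 2 * ℓ * (h * ∑ j ∈ range N, w (j + 1) ^ 2 * P j ^ 2)
      + 2 * ℓ * κ ^ 2 * (h * ∑ j ∈ J, F j ^ 2) := by
  classical
  have hh := H.h_pos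
  have hℓ : 0 ≤ ℓ := le_trans (by positivity) H.length
  have s1 : 0 ≤ ∑ j ∈ range N, w (j + 1) ^ 2 * P j ^ 2 :=
    sum_nonneg fun j _ => by positivity
  have s2 : 0 ≤ ∑ j ∈ J, F j ^ 2 := sum_nonneg fun j _ => by positivity
  rcases le_or_gt N i with hi | hi
  · rw [H.zero_right i hi, zero_mul, zero_pow two_ne_zero]; positivity
  set A := (range i).filter fun j => w j ≠ 0 ∨ w (j + 1) ≠ 0
  have hA : ∀ j ∈ A, j ∈ J := fun j hj => (H.supp j (mem_filter.1 hj).2).1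
  set c : ℕ → ℝ := fun j => w (j + 1) * P j + (w (j + 1) - w j) / h * F j
  have e1 : w i * F i = h * ∑ j ∈ A, c j := by
    have t := Finset.sum_range_sub (fun j => w j * F j) i
    simp only [H.zero_left, zero_mul, sub_zero] at t
    rw [← t, mul_sum, Finset.sum_filter]
    refine sum_congr rfl fun j _ => ?_
    split_ifs with hj
    · have := hP j (H.supp j hj).1
      have e : h * c j = w (j + 1) * (h * P j) + (w (j + 1) - w j) * F j := by
        simp only [c]; field_simp
      rw [e, this]; ring
    · push Not at hj; simp [hj.1, hj.2]
  have e2 : (∑ j ∈ A, c j) ^ 2 ≤ A.card * ∑ j ∈ A, c j ^ 2 := sq_sum_le_card_mul_sum_sq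
  have e3 : ∑ j ∈ A, c j ^ 2
      ≤ 2 * ∑ j ∈ range N, w (j + 1) ^ 2 * P j ^ 2 + 2 * κ ^ 2 * ∑ j ∈ J, F j ^ 2 := by
    have q1 : ∑ j ∈ A, c j ^ 2 ≤ ∑ j ∈ A, (2 * (w (j + 1) ^ 2 * P j ^ 2) + 2 * κ ^ 2 * F j ^ 2) := by
      refine sum_le_sum fun j _ => ?_
      have r1 : ((w (j + 1) - w j) / h) ^ 2 ≤ κ ^ 2 := by
        rw [sq_le_sq, abs_of_nonneg H.κ_nonneg, abs_div, abs_of_pos hh, div_le_iff₀ hh]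
        exact H.lip j
      have r2 := mul_le_mul_of_nonneg_right r1 (sq_nonneg (F j))
      have r3 : c j ^ 2 ≤ 2 * (w (j + 1) * P j) ^ 2 + 2 * ((w (j + 1) - w j) / h * F j) ^ 2 := by
        simp only [c]
        nlinarith only [sq_nonneg (w (j + 1) * P j - (w (j + 1) - w j) / h * F j)]
      rw [mul_pow, mul_pow ((w (j + 1) - w j) / h)] at r3
      linarith
    rw [sum_add_distrib, ← mul_sum, ← mul_sum] at q1
    have q2 : ∑ j ∈ A, w (j + 1) ^ 2 * P j ^ 2 ≤ ∑ j ∈ range N, w (j + 1) ^ 2 * P j ^ 2 :=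
      sum_le_sum_of_subset_of_nonneg (fun j hj => mem_range.2
        ((mem_range.1 (mem_filter.1 hj).1).trans hi)) fun j _ _ => by positivity
    have q3 : ∑ j ∈ A, F j ^ 2 ≤ ∑ j ∈ J, F j ^ 2 :=
      sum_le_sum_of_subset_of_nonneg (fun j hj => hA j hj) fun j _ _ => by positivity
    have q4 := mul_le_mul_of_nonneg_left q3 (show 0 ≤ 2 * κ ^ 2 by positivity)
    linarith
  have e4 : h * A.card ≤ ℓ := le_trans (mul_le_mul_of_nonneg_left
    (Nat.cast_le.2 (Finset.card_le_card fun j hj => hA j hj)) hh.le) H.length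
  have e5 : 0 ≤ ∑ j ∈ A, c j ^ 2 := sum_nonneg fun j _ => sq_nonneg _
  calc (w i * F i) ^ 2 = h ^ 2 * (∑ j ∈ A, c j) ^ 2 := by rw [e1, mul_pow]
    _ ≤ h ^ 2 * (A.card * ∑ j ∈ A, c j ^ 2) := by gcongr
    _ = (h * A.card) * (h * ∑ j ∈ A, c j ^ 2) := by ring
    _ ≤ ℓ * (h * ∑ j ∈ A, c j ^ 2) := mul_le_mul_of_nonneg_right e4 (by positivity)
    _ ≤ ℓ * (h * (2 * ∑ j ∈ range N, w (j + 1) ^ 2 * P j ^ 2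
        + 2 * κ ^ 2 * ∑ j ∈ J, F j ^ 2)) := by gcongr
    _ = _ := by ring

/-- Control of a cubic error term by the supremum of the energy density. -/
theorem cubic_sum_le {h S : ℝ} {A : Finset ℕ} {f g : ℕ → ℝ} (hh : 0 < h)
    (hS0 : 0 ≤ S) (hS : ∀ j ∈ A, f j ^ 2 ≤ S) {ε : ℝ} (hε : 0 < ε) :
    h * ∑ j ∈ A, f j ^ 2 * |g j| ≤
      ε * S + (h * ∑ j ∈ A, f j ^ 2) * (h * ∑ j ∈ A, g j ^ 2) / (4 * ε) := by
  have e1 : h * ∑ j ∈ A, f j ^ 2 * |g j| ≤ √S * (h * ∑ j ∈ A, |f j| * |g j|) := by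
    rw [mul_left_comm, mul_sum (a := √S)]
    refine mul_le_mul_of_nonneg_left (sum_le_sum fun j hj => ?_) hh.le
    have : |f j| ≤ √S := abs_le_sqrt (hS j hj)
    have h2 := mul_le_mul_of_nonneg_right this (by positivity : 0 ≤ |f j| * |g j|)
    rw [← sq_abs]
    linarith
  have e2 := Finset.sum_mul_sq_le_sq_mul_sq A (fun j => |f j|) (fun j => |g j|)
  simp only [sq_abs] at e2
  have e3 := young (a := √S) (b := h * ∑ j ∈ A, |f j| * |g j|) hε
  rw [sq_sqrt hS0, mul_pow] at e3
  have e4 : h ^ 2 * (∑ j ∈ A, |f j| * |g j|) ^ 2 / (4 * ε)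
      ≤ (h * ∑ j ∈ A, f j ^ 2) * (h * ∑ j ∈ A, g j ^ 2) / (4 * ε) := by
    gcongr ?_ / _
    calc _ ≤ h ^ 2 * ((∑ j ∈ A, f j ^ 2) * ∑ j ∈ A, g j ^ 2) := by gcongr
      _ = _ := by ring
  linarith

/-- A space-time box compactly contained in `(0, ∞) × (0, T)`. -/
structure Box (T : ℝ) where
  (X₁ X₂ t₁ t₂ : ℝ)
  X₁_pos : 0 < X₁
  X₁_le : X₁ ≤ X₂
  t₁_pos : 0 < t₁
  t₁_le : t₁ ≤ t₂
  t₂_lt : t₂ < T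

variable {T : ℝ}

namespace Box

/-- The lattice indices of a box. -/
noncomputable def idx (b : Box T) (h : ℝ) : Finset ℕ :=
  (range (⌊b.X₂ / h⌋₊ + 1)).filter fun j => b.X₁ ≤ j * h

theorem mem_idx {b : Box T} {h : ℝ} (hh : 0 < h) {j : ℕ} :
    j ∈ b.idx h ↔ b.X₁ ≤ j * h ∧ j * h ≤ b.X₂ := by
  have : 0 ≤ b.X₂ / h := div_nonneg (b.X₁_pos.le.trans b.X₁_le) hh.le
  rw [idx, mem_filter, mem_range, Nat.lt_succ_iff, Nat.le_floor_iff this,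
    le_div_iff₀ hh, and_comm]

theorem card_idx_le (b : Box T) {h : ℝ} (hh : 0 < h) (h1 : h ≤ 1) :
    h * (b.idx h).card ≤ b.X₂ + 1 := by
  have h0 : 0 ≤ b.X₂ / h := div_nonneg (b.X₁_pos.le.trans b.X₁_le) hh.le
  have h2 : ((b.idx h).card : ℝ) ≤ b.X₂ / h + 1 := by
    refine le_trans (Nat.cast_le.2 (Finset.card_filter_le _ _)) ?_
    rw [Finset.card_range, Nat.cast_add, Nat.cast_one]
    linarith [Nat.floor_le h0]
  calc _ ≤ h * (b.X₂ / h + 1) := by gcongr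
    _ = b.X₂ + h := by field_simp
    _ ≤ _ := by linarith

/-- A slightly larger box, with the same final time. -/
noncomputable def wide (b : Box T) : Box T where
  X₁ := b.X₁ / 2
  X₂ := b.X₂ + 1
  t₁ := b.t₁ / 2
  t₂ := b.t₂
  X₁_pos := half_pos b.X₁_pos
  X₁_le := by linarith [b.X₁_pos, b.X₁_le]
  t₁_pos := half_pos b.t₁_pos
  t₁_le := by linarith [b.t₁_pos, b.t₁_le]
  t₂_lt := b.t₂_lt

theorem Icc_subset_wide (b : Box T) : Icc b.t₁ b.t₂ ⊆ Icc b.wide.t₁ b.wide.t₂ :=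
  Icc_subset_Icc (by simp only [wide]; linarith [b.t₁_pos]) le_rfl

theorem idx_subset_wide (b : Box T) {h : ℝ} (hh : 0 < h) : b.idx h ⊆ b.wide.idx h := fun j hj => by
  rw [mem_idx hh] at hj ⊢
  exact ⟨by simp only [wide]; linarith [b.X₁_pos], by simp only [wide]; linarith⟩

theorem succ_mem_wide (b : Box T) {h : ℝ} (hh : 0 < h) (h1 : h ≤ 1) {j : ℕ} (hj : j ∈ b.idx h) :
    j + 1 ∈ b.wide.idx h := by
  rw [mem_idx hh] at hj ⊢
  push_cast
  exact ⟨by simp only [wide]; linarith [b.X₁_pos], by simp only [wide]; linarith⟩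

end Box

/-- A sequence of lattices whose mesh tends to zero and which exhaust the half-line. -/
structure Mesh (h : ℕ → ℝ) (N : ℕ → ℕ) : Prop where
  pos : ∀ n, 0 < h n
  tendsto : Tendsto h atTop (nhds 0)
  top : Tendsto (fun n => N n * h n) atTop atTop

variable {h : ℕ → ℝ} {N : ℕ → ℕ}

theorem Mesh.le (H : Mesh h N) {ε : ℝ} (hε : 0 < ε) : ∀ᶠ n in atTop, h n ≤ ε :=
  (H.tendsto.eventually (gt_mem_nhds hε)).mono fun _ hn => hn.le

variable (T h) in
/-- A property which eventually holds on every box. -/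
def Ev (p : ℕ → ℕ → ℝ → Prop) : Prop :=
  ∀ b : Box T, ∀ᶠ n in atTop, ∀ j ∈ b.idx (h n), ∀ t ∈ Icc b.t₁ b.t₂, p n j t

variable (T h) in
/-- Local uniform boundedness. -/
def LB (F : ℕ → ℕ → ℝ → ℝ) : Prop :=
  ∀ b : Box T, ∃ C, 0 ≤ C ∧ ∀ᶠ n in atTop, ∀ j ∈ b.idx (h n), ∀ t ∈ Icc b.t₁ b.t₂, |F n j t| ≤ C

variable (T h) in
/-- Local boundedness in `L^∞_t L²_x`. -/
def L2 (F : ℕ → ℕ → ℝ → ℝ) : Prop :=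
  ∀ b : Box T, ∃ C, 0 ≤ C ∧ ∀ᶠ n in atTop, ∀ t ∈ Icc b.t₁ b.t₂,
    h n * ∑ j ∈ b.idx (h n), F n j t ^ 2 ≤ C

variable (T h) in
/-- Local boundedness in `L²_t L²_x`. -/
def ST (F : ℕ → ℕ → ℝ → ℝ) : Prop :=
  ∀ b : Box T, ∃ C, 0 ≤ C ∧ ∀ᶠ n in atTop,
    IntBdd C b.t₁ b.t₂ (fun t => h n * ∑ j ∈ b.idx (h n), F n j t ^ 2)

variable (T h) in
/-- Local domination of `F` by `1 + |G| + |K|`. -/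
def Dom (F G K : ℕ → ℕ → ℝ → ℝ) : Prop :=
  ∀ b : Box T, ∃ C, 0 ≤ C ∧ ∀ᶠ n in atTop, ∀ j ∈ b.idx (h n), ∀ t ∈ Icc b.t₁ b.t₂,
    |F n j t| ≤ C * (1 + |G n j t| + |K n j t|)

variable {F G K : ℕ → ℕ → ℝ → ℝ}

theorem Ev.and {p q : ℕ → ℕ → ℝ → Prop} (hp : Ev T h p) (hq : Ev T h q) :
    Ev T h fun n j t => p n j t ∧ q n j t := fun b => by
  filter_upwards [hp b, hq b] with n h1 h2 j hj t ht using ⟨h1 j hj t ht, h2 j hj t ht⟩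

theorem Ev.mono {p q : ℕ → ℕ → ℝ → Prop} (hp : Ev T h p) (hq : ∀ n j t, p n j t → q n j t) :
    Ev T h q := fun b => by
  filter_upwards [hp b] with n h1 j hj t ht using hq _ _ _ (h1 j hj t ht)

theorem Ev.shift {p : ℕ → ℕ → ℝ → Prop} (H : Mesh h N) (hp : Ev T h p) :
    Ev T h fun n j t => p n (j + 1) t := fun b => by
  filter_upwards [hp b.wide, H.le one_pos] with n h1 h2 j hj t ht
    using h1 _ (b.succ_mem_wide (H.pos n) h2 hj) t (b.Icc_subset_wide ht)

theorem LB.shift (H : Mesh h N) (hF : LB T h F) : LB T h fun n j => F n (j + 1) := fun b => by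
  obtain ⟨C, hC, h0⟩ := hF b.wide
  refine ⟨C, hC, ?_⟩
  filter_upwards [h0, H.le one_pos] with n h1 h2 j hj t ht
    using h1 _ (b.succ_mem_wide (H.pos n) h2 hj) t (b.Icc_subset_wide ht)

theorem shift_sum_le (H : Mesh h N) (b : Box T) {n : ℕ} (hn : h n ≤ 1) (t : ℝ) :
    h n * ∑ j ∈ b.idx (h n), F n (j + 1) t ^ 2 ≤ h n * ∑ j ∈ b.wide.idx (h n), F n j t ^ 2 :=
  mul_le_mul_of_nonneg_left (sum_shift_le (g := fun j => F n j t ^ 2) (fun j => sq_nonneg _) _ 1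
    fun j hj => b.succ_mem_wide (H.pos n) hn hj) (H.pos n).le

theorem L2.shift (H : Mesh h N) (hF : L2 T h F) : L2 T h fun n j => F n (j + 1) := fun b => by
  obtain ⟨C, hC, h0⟩ := hF b.wide
  refine ⟨C, hC, ?_⟩
  filter_upwards [h0, H.le one_pos] with n h1 h2 t ht
    using (shift_sum_le H b h2 t).trans (h1 t (b.Icc_subset_wide ht))

theorem ST.shift (H : Mesh h N) (hF : ST T h F) : ST T h fun n j => F n (j + 1) := fun b => by
  obtain ⟨C, hC, h0⟩ := hF b.wide
  refine ⟨C, hC, ?_⟩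
  filter_upwards [h0, H.le one_pos] with n h1 h2
  exact h1.mono (by simp only [Box.wide]; linarith [b.t₁_pos]) le_rfl le_rfl
    fun t _ => shift_sum_le H b h2 t

theorem L2.st (hF : L2 T h F) : ST T h F := fun b => by
  obtain ⟨C, hC, h0⟩ := hF b
  exact ⟨C, hC, h0.mono fun n hn => IntBdd.of_le hn hC⟩

theorem sum_sq_le_of_abs_le (H : Mesh h N) (b : Box T) {n : ℕ} (hn : h n ≤ 1) {C : ℝ}
    (hC : 0 ≤ C) {f g k : ℕ → ℝ} (hf : ∀ j ∈ b.idx (h n), |f j| ≤ C * (1 + |g j| + |k j|)) :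
    h n * ∑ j ∈ b.idx (h n), f j ^ 2 ≤ 3 * C ^ 2 * ((b.X₂ + 1)
      + (h n * ∑ j ∈ b.idx (h n), g j ^ 2 + h n * ∑ j ∈ b.idx (h n), k j ^ 2)) := by
  have h1 : ∑ j ∈ b.idx (h n), f j ^ 2
      ≤ ∑ j ∈ b.idx (h n), 3 * C ^ 2 * (1 + (g j ^ 2 + k j ^ 2)) := by
    refine sum_le_sum fun j hj => ?_
    have h2 := pow_le_pow_left₀ (abs_nonneg _) (hf j hj) 2
    rw [sq_abs, mul_pow] at h2
    refine h2.trans ?_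
    rw [mul_comm 3, mul_assoc]
    refine mul_le_mul_of_nonneg_left ?_ (sq_nonneg C)
    rw [← sq_abs (g j), ← sq_abs (k j)]
    nlinarith only [sq_nonneg (1 - |g j|), sq_nonneg (1 - |k j|), sq_nonneg (|g j| - |k j|)]
  rw [← mul_sum, sum_add_distrib, sum_add_distrib, Finset.sum_const,
    nsmul_eq_mul, mul_one] at h1
  have h2 := mul_le_mul_of_nonneg_left h1 (H.pos n).le
  have h3 := mul_le_mul_of_nonneg_left (b.card_idx_le (H.pos n) hn)
    (show 0 ≤ 3 * C ^ 2 by positivity)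
  linarith

theorem LB.l2 (H : Mesh h N) (hF : LB T h F) : L2 T h F := fun b => by
  obtain ⟨C, hC, h0⟩ := hF b
  have hX : 0 ≤ b.X₂ + 1 := by linarith [b.X₁_pos, b.X₁_le]
  refine ⟨3 * C ^ 2 * (b.X₂ + 1), by positivity, ?_⟩
  filter_upwards [h0, H.le one_pos] with n h1 h2 t ht
  have := sum_sq_le_of_abs_le H b h2 hC (f := fun j => F n j t) (g := fun _ => 0)
    (k := fun _ => 0) fun j hj => by simpa using h1 j hj t ht
  simpa using this

theorem L2.dom (H : Mesh h N) (hF : Dom T h F G K) (hG : L2 T h G) (hK : L2 T h K) :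
    L2 T h F := fun b => by
  obtain ⟨C, hC, h0⟩ := hF b
  obtain ⟨D, hD, h1⟩ := hG b
  obtain ⟨E, hE, h2⟩ := hK b
  have hX : 0 ≤ b.X₂ + 1 := by linarith [b.X₁_pos, b.X₁_le]
  refine ⟨3 * C ^ 2 * ((b.X₂ + 1) + (D + E)), by positivity, ?_⟩
  filter_upwards [h0, h1, h2, H.le one_pos] with n h0 h1 h2 h3 t ht
  refine (sum_sq_le_of_abs_le H b h3 hC (f := fun j => F n j t) (g := fun j => G n j t)
    (k := fun j => K n j t) fun j hj => h0 j hj t ht).trans ?_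
  have := h1 t ht
  have := h2 t ht
  gcongr

theorem ST.dom (H : Mesh h N) (hF : Dom T h F G K) (hG : ST T h G) (hK : ST T h K) :
    ST T h F := fun b => by
  obtain ⟨C, hC, h0⟩ := hF b
  obtain ⟨D, hD, h1⟩ := hG b
  obtain ⟨E, hE, h2⟩ := hK b
  have hX : 0 ≤ b.X₂ + 1 := by linarith [b.X₁_pos, b.X₁_le]
  refine ⟨3 * C ^ 2 * ((b.X₂ + 1) + (D + E)), by positivity, ?_⟩
  filter_upwards [h0, h1, h2, H.le one_pos] with n h0 h1 h2 h3
  have := ((IntBdd.of_le (t₁ := b.t₁) (t₂ := b.t₂) (g := fun _ => b.X₂ + 1) (fun t _ => le_rfl)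
    hX).add (h1.add h2)).const_mul (show 0 ≤ 3 * C ^ 2 by positivity)
  exact this.mono le_rfl le_rfl le_rfl fun t ht =>
    sum_sq_le_of_abs_le H b h3 hC (f := fun j => F n j t) (g := fun j => G n j t)
    (k := fun j => K n j t) fun j hj => h0 j hj t ht

theorem LB.dom (hF : Dom T h F G K) (hG : LB T h G) (hK : LB T h K) : LB T h F := fun b => by
  obtain ⟨C, hC, h0⟩ := hF b
  obtain ⟨D, hD, h1⟩ := hG b
  obtain ⟨E, hE, h2⟩ := hK b
  refine ⟨C * (1 + D + E), by positivity, ?_⟩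
  filter_upwards [h0, h1, h2] with n h0 h1 h2 j hj t ht
  refine (h0 j hj t ht).trans ?_
  have := h1 j hj t ht
  have := h2 j hj t ht
  gcongr

theorem Box.exists_cutoff (b : Box T) (H : Mesh h N) : ∃ κ ℓ : ℝ, ∀ᶠ n in atTop, ∃ w : ℕ → ℝ,
    Cutoff (h n) κ ℓ (N n) (b.wide.idx (h n)) w ∧
      ∀ j ∈ b.idx (h n), w j = 1 ∧ w (j + 1) = 1 ∧ j < N n := by
  have hX := b.X₁_pos
  set κ := 8 / b.X₁ + 4
  have hκ : 0 ≤ κ := by positivity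
  refine ⟨κ, b.wide.X₂ + 1, ?_⟩
  filter_upwards [H.le (show 0 < b.X₁ / 8 by positivity), H.le (show (0 : ℝ) < 1 / 8 by norm_num),
    H.top.eventually_gt_atTop (b.X₂ + 1)] with n h1 h2 h3
  have hh := H.pos n
  set φ : ℝ → ℝ := fun x => max 0 (min 1 (min (8 / b.X₁ * (x - b.X₁ / 2) - 1)
    (4 * (b.X₂ + 1 - x) - 1))) with hφ
  have hlip : ∀ x y, |φ x - φ y| ≤ κ * |x - y| := by
    intro x y
    have hκx : 0 ≤ κ * |x - y| := by positivity
    have e1 := abs_max_sub_max_le_max 0 (min 1 (min (8 / b.X₁ * (x - b.X₁ / 2) - 1)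
      (4 * (b.X₂ + 1 - x) - 1))) 0 (min 1 (min (8 / b.X₁ * (y - b.X₁ / 2) - 1)
      (4 * (b.X₂ + 1 - y) - 1)))
    have e2 := abs_min_sub_min_le_max 1 (min (8 / b.X₁ * (x - b.X₁ / 2) - 1)
      (4 * (b.X₂ + 1 - x) - 1)) 1 (min (8 / b.X₁ * (y - b.X₁ / 2) - 1)
      (4 * (b.X₂ + 1 - y) - 1))
    have e3 := abs_min_sub_min_le_max (8 / b.X₁ * (x - b.X₁ / 2) - 1)
      (4 * (b.X₂ + 1 - x) - 1) (8 / b.X₁ * (y - b.X₁ / 2) - 1) (4 * (b.X₂ + 1 - y) - 1)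
    rw [sub_self, abs_zero] at e1 e2
    have e4 : |8 / b.X₁ * (x - b.X₁ / 2) - 1 - (8 / b.X₁ * (y - b.X₁ / 2) - 1)| ≤ κ * |x - y| := by
      rw [show 8 / b.X₁ * (x - b.X₁ / 2) - 1 - (8 / b.X₁ * (y - b.X₁ / 2) - 1)
        = 8 / b.X₁ * (x - y) by ring, abs_mul, abs_of_pos (by positivity : 0 < 8 / b.X₁)]
      exact mul_le_mul_of_nonneg_right (by simp only [κ]; linarith) (abs_nonneg _)
    have e5 : |4 * (b.X₂ + 1 - x) - 1 - (4 * (b.X₂ + 1 - y) - 1)| ≤ κ * |x - y| := by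
      rw [show 4 * (b.X₂ + 1 - x) - 1 - (4 * (b.X₂ + 1 - y) - 1)
        = -4 * (x - y) by ring, abs_mul]
      refine mul_le_mul_of_nonneg_right ?_ (abs_nonneg _)
      have : 0 ≤ 8 / b.X₁ := by positivity
      rw [abs_neg, abs_of_pos (by norm_num : (0 : ℝ) < 4)]
      simp only [κ]; linarith
    exact e1.trans (max_le hκx (e2.trans (max_le hκx (e3.trans (max_le e4 e5)))))
  have hne : ∀ x, φ x ≠ 0 → b.X₁ / 2 + b.X₁ / 8 < x ∧ x < b.X₂ + 3 / 4 := by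
    intro x hx
    by_contra! hc
    refine hx (max_eq_left ?_)
    rcases le_or_gt x (b.X₁ / 2 + b.X₁ / 8) with h4 | h4
    · refine (min_le_right _ _).trans ((min_le_left _ _).trans ?_)
      have : 8 / b.X₁ * (x - b.X₁ / 2) ≤ 8 / b.X₁ * (b.X₁ / 8) := by gcongr; linarith
      have e : 8 / b.X₁ * (b.X₁ / 8) = 1 := by field_simp
      linarith
    · refine (min_le_right _ _).trans ((min_le_right _ _).trans ?_)
      linarith [hc h4]
  have hone : ∀ x, b.X₁ ≤ x → x ≤ b.X₂ + 1 / 8 → φ x = 1 := by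
    intro x hx1 hx2
    have h5 : 8 / b.X₁ * (b.X₁ / 2) ≤ 8 / b.X₁ * (x - b.X₁ / 2) := by gcongr; linarith
    have e : 8 / b.X₁ * (b.X₁ / 2) = 4 := by field_simp; norm_num
    have : min 1 (min (8 / b.X₁ * (x - b.X₁ / 2) - 1) (4 * (b.X₂ + 1 - x) - 1)) = 1 :=
      min_eq_left (le_min (by linarith) (by linarith))
    simp only [hφ, this]
    norm_num
  refine ⟨fun j => φ (j * h n), ⟨hh, by linarith, hκ, fun j => le_max_left _ _,
    fun j => max_le zero_le_one (min_le_left _ _), fun j => ?_, ?_, fun j hj => ?_, fun j hj => ?_,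
    b.wide.card_idx_le hh (by linarith)⟩, fun j hj => ?_⟩
  · have := hlip ((j + 1 : ℕ) * h n) (j * h n)
    rwa [show ((j + 1 : ℕ) * h n - j * h n : ℝ) = h n by push_cast; ring, abs_of_pos hh] at this
  · by_contra hc
    have := (hne _ hc).1
    simp at this
    linarith
  · by_contra hc
    have := (hne _ hc).2
    have : (N n : ℝ) * h n ≤ j * h n := by gcongr
    linarith
  · rw [Box.mem_idx hh, Box.mem_idx hh, Box.mem_idx hh]
    simp only [Box.wide]
    push_cast
    rcases hj with hj | hj
    · have := hne _ hj
      exact ⟨⟨by linarith, by linarith⟩, ⟨by linarith, by linarith⟩, by linarith, by linarith⟩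
    · have := hne _ hj
      push_cast at this
      exact ⟨⟨by linarith, by linarith⟩, ⟨by linarith, by linarith⟩, by linarith, by linarith⟩
  · rw [Box.mem_idx hh] at hj
    refine ⟨hone _ hj.1 (by linarith), hone _ (by push_cast; linarith) (by push_cast; linarith), ?_⟩
    by_contra! hc
    have : (N n : ℝ) * h n ≤ j * h n := by gcongr
    linarith

section FixedTime

variable {h κ ℓ : ℝ} {N : ℕ} {J : Finset ℕ} {w : ℕ → ℝ}

theorem Cutoff.sum_weight_le (H : Cutoff h κ ℓ N J w) (P : ℕ → ℝ) :
    h * ∑ j ∈ range N, w (j + 1) ^ 2 * P j ^ 2 ≤ h * ∑ j ∈ J, P j ^ 2 := by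
  classical
  refine mul_le_mul_of_nonneg_left ?_ H.h_pos.le
  have e : ∑ j ∈ range N, w (j + 1) ^ 2 * P j ^ 2
      = ∑ j ∈ (range N).filter (fun j => w (j + 1) ≠ 0), w (j + 1) ^ 2 * P j ^ 2 := by
    rw [sum_filter_of_ne]
    intro j _ hj h0
    exact hj (by simp [h0])
  rw [e]
  refine (sum_le_sum fun j _ => mul_le_of_le_one_left (sq_nonneg _)
    (pow_le_one₀ (H.nonneg _) (H.le_one _))).trans ?_
  exact sum_le_sum_of_subset_of_nonneg
    (fun j hj => (H.supp j (Or.inr (mem_filter.1 hj).2)).1) fun j _ _ => sq_nonneg _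

theorem Cutoff.sum_weight_succ_le (H : Cutoff h κ ℓ N J w) {f g : ℕ → ℝ} (hg : ∀ j, 0 ≤ g j)
    (hf : ∀ j, w (j + 1) ≠ 0 → f (j + 1) ≤ g (j + 1)) :
    h * ∑ j ∈ range N, w (j + 1) ^ 2 * f (j + 1) ≤ h * ∑ j ∈ J, g j := by
  classical
  refine mul_le_mul_of_nonneg_left ?_ H.h_pos.le
  have e : ∑ j ∈ range N, w (j + 1) ^ 2 * f (j + 1)
      = ∑ j ∈ (range N).filter (fun j => w (j + 1) ≠ 0), w (j + 1) ^ 2 * f (j + 1) := by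
    rw [sum_filter_of_ne]
    intro j _ hj h0
    exact hj (by simp [h0])
  rw [e]
  refine (sum_le_sum fun j hj => (mul_le_mul_of_nonneg_left
    (hf j (mem_filter.1 hj).2) (sq_nonneg _)).trans (mul_le_of_le_one_left (hg _)
    (pow_le_one₀ (H.nonneg _) (H.le_one _)))).trans ?_
  exact sum_shift_le hg _ 1 fun j hj => (H.supp j (Or.inr (mem_filter.1 hj).2)).2.1

/-- Energy estimate for `Q' = ∂ F + err`, `F = ∂ Q + R`, with cubic error terms. -/
theorem Cutoff.cubic_energy (H : Cutoff h κ ℓ N J w) {C : ℝ} (hC : 1 ≤ C)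
    {Q D V F R E Y P : ℕ → ℝ}
    (hF : ∀ j ∈ J, F j = D j + R j) (hD : ∀ j ∈ J, h * D j = Q (j + 1) - Q j)
    (hV : ∀ j ∈ J, V (j + 1) = (F (j + 1) - F j) / h)
    (hE : ∀ j ∈ J, |E j| ≤ C * ((1 + Q j ^ 2) * (1 + |P j|)))
    (hY : ∀ j ∈ J, Q j ^ 2 ≤ C * (1 + Y j)) (hY0 : ∀ j, 0 ≤ Y j) :
    h * ∑ j ∈ range N, w (j + 1) ^ 2 * (Q (j + 1) * V (j + 1) + E (j + 1)) ≤
      -(1 / 8) * (h * ∑ j ∈ range N, w (j + 1) ^ 2 * D j ^ 2) +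
      (6 * (13 * κ ^ 2 + 4) + C * (2 * ℓ + 1 + κ ^ 2 + 4 * C ^ 2 * (ℓ + 1) ^ 2)) *
        ((1 + (h * ∑ j ∈ J, Q j ^ 2 + h * ∑ j ∈ J, R j ^ 2 + h * ∑ j ∈ J, P j ^ 2)) *
          (1 + h * ∑ j ∈ range N, w (j + 1) ^ 2 * Y (j + 1))) := by
  classical
  have hh := H.h_pos
  have hℓ : 0 ≤ ℓ := le_trans (by positivity) H.length
  set X := h * ∑ j ∈ J, Q j ^ 2 with hX
  set R2 := h * ∑ j ∈ J, R j ^ 2 with hR2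
  set P2 := h * ∑ j ∈ J, P j ^ 2 with hP2
  set d := h * ∑ j ∈ range N, w (j + 1) ^ 2 * D j ^ 2 with hd
  set y := h * ∑ j ∈ range N, w (j + 1) ^ 2 * Y (j + 1) with hy
  have X0 : 0 ≤ X := mul_nonneg hh.le (sum_nonneg fun j _ => sq_nonneg _)
  have R0 : 0 ≤ R2 := mul_nonneg hh.le (sum_nonneg fun j _ => sq_nonneg _)
  have P0 : 0 ≤ P2 := mul_nonneg hh.le (sum_nonneg fun j _ => sq_nonneg _)
  have d0 : 0 ≤ d := mul_nonneg hh.le (sum_nonneg fun j _ => by positivity)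
  have y0 : 0 ≤ y := mul_nonneg hh.le
    (sum_nonneg fun j _ => mul_nonneg (sq_nonneg _) (hY0 _))
  have e1 := H.flux_sum_le (α := 1) (B := 0) one_pos (U := Q) (V := V) (P := D) (F := F) (R := R)
    (G := fun _ => 0) (a := fun _ => 1) (b := fun _ => 0)
    (fun j hj => ⟨by rw [one_mul]; exact hF j hj, le_rfl, le_rfl, by simp⟩) hD
    (fun j hj => by rw [hV j hj]; simp)
  have e2 : h * ∑ j ∈ J, (Q j ^ 2 + R j ^ 2 + (0 : ℝ) ^ 2) = X + R2 := by
    rw [hX, hR2, ← mul_add, ← sum_add_distrib]; simp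
  rw [e2] at e1
  set A := (range N).filter fun j => w (j + 1) ≠ 0
  have hA : ∀ j ∈ A, j + 1 ∈ J := fun j hj =>
    (H.supp j (Or.inr (mem_filter.1 hj).2)).2.1
  have filt : ∀ f : ℕ → ℝ, (∀ j, w (j + 1) = 0 → f j = 0) →
      ∑ j ∈ range N, f j = ∑ j ∈ A, f j := fun f hf => by
    rw [sum_filter_of_ne]
    exact fun j _ hj h0 => hj (hf j h0)
  have hcard : h * (∑ j ∈ A, (1 : ℝ)) ≤ ℓ := by
    have := sum_shift_le (J := J) (g := fun _ => (1 : ℝ)) (fun _ => zero_le_one) A 1 hA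
    refine (mul_le_mul_of_nonneg_left this hh.le).trans ?_
    simpa using H.length
  have sX : h * ∑ j ∈ A, Q (j + 1) ^ 2 ≤ X := mul_le_mul_of_nonneg_left
    (sum_shift_le (g := fun j => Q j ^ 2) (fun _ => sq_nonneg _) A 1 hA) hh.le
  have sP : h * ∑ j ∈ A, P (j + 1) ^ 2 ≤ P2 := mul_le_mul_of_nonneg_left
    (sum_shift_le (g := fun j => P j ^ 2) (fun _ => sq_nonneg _) A 1 hA) hh.le
  set S := 2 * ℓ * d + 2 * ℓ * κ ^ 2 * X
  have S0 : 0 ≤ S := by positivity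
  set ε := 1 / (16 * C * (ℓ + 1))
  have hε : 0 < ε := by positivity
  have e3 := cubic_sum_le (A := A) (f := fun j => w (j + 1) * Q (j + 1)) (g := fun j => P (j + 1))
    hh S0 (fun j hj => H.sobolev hD (j + 1)) hε
  have e4 : h * ∑ j ∈ A, (w (j + 1) * Q (j + 1)) ^ 2 ≤ C * (ℓ + y) := by
    have q1 : ∑ j ∈ A, (w (j + 1) * Q (j + 1)) ^ 2
        ≤ ∑ j ∈ A, C * (1 + w (j + 1) ^ 2 * Y (j + 1)) := by
      refine sum_le_sum fun j hj => ?_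
      have q2 := mul_le_mul_of_nonneg_left (hY _ (hA j hj)) (sq_nonneg (w (j + 1)))
      have q3 : C * w (j + 1) ^ 2 ≤ C * 1 :=
        mul_le_mul_of_nonneg_left (pow_le_one₀ (H.nonneg _) (H.le_one _)) (by linarith)
      rw [mul_pow]
      linarith
    rw [← mul_sum, sum_add_distrib,
      ← filt (fun j => w (j + 1) ^ 2 * Y (j + 1)) fun j hj => by simp [hj]] at q1
    have q2 := mul_le_mul_of_nonneg_left q1 hh.le
    have q3 := mul_le_mul_of_nonneg_left hcard (show 0 ≤ C by linarith)
    linarith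
  have e5 : h * ∑ j ∈ range N, w (j + 1) ^ 2 * E (j + 1) ≤
      C * (2 * ℓ + X + P2 + h * ∑ j ∈ A, (w (j + 1) * Q (j + 1)) ^ 2 * |P (j + 1)|) := by
    rw [filt _ fun j hj => by simp [hj]]
    have q1 : ∑ j ∈ A, w (j + 1) ^ 2 * E (j + 1) ≤ ∑ j ∈ A, C * (2 * 1 + Q (j + 1) ^ 2
        + P (j + 1) ^ 2 + (w (j + 1) * Q (j + 1)) ^ 2 * |P (j + 1)|) := by
      refine sum_le_sum fun j hj => ?_
      have q2 := mul_le_mul_of_nonneg_left ((le_abs_self _).trans (hE _ (hA j hj)))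
        (sq_nonneg (w (j + 1)))
      refine q2.trans ?_
      rw [mul_left_comm]
      refine mul_le_mul_of_nonneg_left ?_ (by linarith)
      have q3 : w (j + 1) ^ 2 * (1 + Q (j + 1) ^ 2 + |P (j + 1)|)
          ≤ 1 * (1 + Q (j + 1) ^ 2 + |P (j + 1)|) :=
        mul_le_mul_of_nonneg_right (pow_le_one₀ (H.nonneg _) (H.le_one _)) (by positivity)
      have q4 : |P (j + 1)| ≤ 1 + P (j + 1) ^ 2 := by
        rw [← sq_abs]; nlinarith only [sq_nonneg (|P (j + 1)| - 1), abs_nonneg (P (j + 1))]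
      linarith
    rw [← mul_sum, sum_add_distrib, sum_add_distrib, sum_add_distrib,
      ← mul_sum] at q1
    have q2 := mul_le_mul_of_nonneg_left q1 hh.le
    have q3 := mul_le_mul_of_nonneg_left hcard (show 0 ≤ 2 * C by linarith)
    have q4 := mul_le_mul_of_nonneg_left sX (show 0 ≤ C by linarith)
    have q5 := mul_le_mul_of_nonneg_left sP (show 0 ≤ C by linarith)
    linarith
  have e6 : h * ∑ j ∈ range N, w (j + 1) ^ 2 * (Q (j + 1) * V (j + 1) + E (j + 1))
      = h * ∑ j ∈ range N, w (j + 1) ^ 2 * (Q (j + 1) * V (j + 1))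
        + h * ∑ j ∈ range N, w (j + 1) ^ 2 * E (j + 1) := by
    rw [← mul_add, ← sum_add_distrib]
    simp only [mul_add]
  have e7 : (h * ∑ j ∈ A, (w (j + 1) * Q (j + 1)) ^ 2) * (h * ∑ j ∈ A, P (j + 1) ^ 2) / (4 * ε)
      ≤ 4 * C ^ 2 * (ℓ + 1) ^ 2 * ((1 + y) * P2) := by
    have q1 : (h * ∑ j ∈ A, (w (j + 1) * Q (j + 1)) ^ 2) * (h * ∑ j ∈ A, P (j + 1) ^ 2)
        ≤ (C * (ℓ + y)) * P2 :=
      mul_le_mul e4 sP (mul_nonneg hh.le (sum_nonneg fun j _ => sq_nonneg _)) (by positivity)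
    have q2 : ℓ + y ≤ (ℓ + 1) * (1 + y) := by nlinarith only [mul_nonneg hℓ y0, hℓ, y0]
    have q3 : (C * (ℓ + y)) * P2 ≤ (C * ((ℓ + 1) * (1 + y))) * P2 := by gcongr
    have e : (C * ((ℓ + 1) * (1 + y))) * P2 / (4 * ε) = 4 * C ^ 2 * (ℓ + 1) ^ 2 * ((1 + y) * P2) := by
      simp only [ε]; field_simp; norm_num
    exact (div_le_div_of_nonneg_right (q1.trans q3) (by positivity)).trans_eq e
  have e8 : C * (ε * S) ≤ 1 / 8 * d + κ ^ 2 * X := by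
    have q1 : C * (ε * S) = ℓ / (ℓ + 1) * (1 / 8 * d + κ ^ 2 * X / 8) := by
      simp only [ε, S]; field_simp; ring
    rw [q1]
    have q2 : ℓ / (ℓ + 1) ≤ 1 := by rw [div_le_one (by positivity)]; linarith
    have q3 : 0 ≤ κ ^ 2 * X := by positivity
    calc _ ≤ 1 * (1 / 8 * d + κ ^ 2 * X / 8) := by gcongr
      _ ≤ _ := by linarith
  have e9 : C * (h * ∑ j ∈ A, (w (j + 1) * Q (j + 1)) ^ 2 * |P (j + 1)|)
      ≤ C * (ε * S + 4 * C ^ 2 * (ℓ + 1) ^ 2 * ((1 + y) * P2)) :=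
    mul_le_mul_of_nonneg_left (by linarith) (by linarith)
  have f1 : (X + R2) ≤ (1 + (X + R2 + P2)) * (1 + y) := by
    nlinarith only [mul_nonneg X0 y0, mul_nonneg R0 y0, mul_nonneg P0 y0, P0, y0]
  have f2 : 1 ≤ (1 + (X + R2 + P2)) * (1 + y) := by
    nlinarith only [mul_nonneg X0 y0, mul_nonneg R0 y0, mul_nonneg P0 y0, P0, y0, X0, R0]
  have f3 : X + P2 ≤ (1 + (X + R2 + P2)) * (1 + y) := by
    nlinarith only [mul_nonneg X0 y0, mul_nonneg R0 y0, mul_nonneg P0 y0, P0, y0, X0, R0]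
  have f4 : (1 + y) * P2 ≤ (1 + (X + R2 + P2)) * (1 + y) := by
    nlinarith only [mul_nonneg X0 y0, mul_nonneg R0 y0, mul_nonneg P0 y0, P0, y0, X0, R0]
  set Z := (1 + (X + R2 + P2)) * (1 + y)
  have f5 : X ≤ Z := by linarith
  have g1 := mul_le_mul_of_nonneg_left f1 (show 0 ≤ 6 * (13 * κ ^ 2 + 4) by positivity)
  have g2 := mul_le_mul_of_nonneg_left f2 (show 0 ≤ C * (2 * ℓ) by positivity)
  have g3 := mul_le_mul_of_nonneg_left f3 (show 0 ≤ C by positivity)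
  have g4 := mul_le_mul_of_nonneg_left f4 (show 0 ≤ C * (4 * C ^ 2 * (ℓ + 1) ^ 2) by positivity)
  have g5 : κ ^ 2 * X ≤ C * κ ^ 2 * Z := by
    have : κ ^ 2 * X ≤ C * (κ ^ 2 * X) := le_mul_of_one_le_left (by positivity) hC
    have := mul_le_mul_of_nonneg_left f5 (show 0 ≤ C * κ ^ 2 by positivity)
    linarith
  have g6 : 6 * (8 * κ ^ 2 / 1 + 4 * κ ^ 2 + 2 / 1 + 1 + (4 * (0 : ℝ) ^ 2 / 1 + 1) + 1 * κ ^ 2)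
      = 6 * (13 * κ ^ 2 + 4) := by ring
  rw [g6] at e1
  rw [e6]
  clear_value S Z ε d y X R2 P2
  linarith

end FixedTime

variable {T : ℝ} {h : ℕ → ℝ} {N : ℕ → ℕ} {F G K : ℕ → ℕ → ℝ → ℝ}

variable (T h) in
/-- Local boundedness in `L²_t L^∞_x`. -/
def SB (F : ℕ → ℕ → ℝ → ℝ) : Prop :=
  ∀ b : Box T, ∃ C, 0 ≤ C ∧ ∀ᶠ n in atTop, ∃ g : ℝ → ℝ, IntBdd C b.t₁ b.t₂ g ∧
    ∀ t ∈ Icc b.t₁ b.t₂, 0 ≤ g t ∧ ∀ j ∈ b.idx (h n), F n j t ^ 2 ≤ g t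

theorem sobolev_box (H : Mesh h N) {P : ℕ → ℕ → ℝ → ℝ}
    (hP : Ev T h fun n j t => h n * P n j t = F n (j + 1) t - F n j t) (b : Box T) :
    ∃ C, 0 ≤ C ∧ ∀ᶠ n in atTop, ∀ t ∈ Icc b.t₁ b.t₂, ∀ j ∈ b.idx (h n), F n j t ^ 2 ≤
      C * (h n * ∑ j ∈ b.wide.idx (h n), F n j t ^ 2 + h n * ∑ j ∈ b.wide.idx (h n), P n j t ^ 2) := by
  obtain ⟨κ, ℓ, hw⟩ := b.exists_cutoff H
  refine ⟨2 * |ℓ| * (1 + κ ^ 2), by positivity, ?_⟩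
  filter_upwards [hw, hP b.wide] with n ⟨w, hw, hw1⟩ hP t ht i hi
  have ht' := b.Icc_subset_wide ht
  have hh := H.pos n
  have hℓ : 0 ≤ ℓ := le_trans (by positivity) hw.length
  have := hw.sobolev (F := fun j => F n j t) (P := fun j => P n j t)
    (fun j hj => hP j hj t ht') i
  rw [(hw1 i hi).1, one_mul] at this
  have h1 := mul_le_mul_of_nonneg_left (hw.sum_weight_le fun j => P n j t)
    (show 0 ≤ 2 * ℓ by positivity)
  have s1 : 0 ≤ h n * ∑ j ∈ b.wide.idx (h n), F n j t ^ 2 :=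
    mul_nonneg hh.le (sum_nonneg fun j _ => sq_nonneg _)
  have s2 : 0 ≤ h n * ∑ j ∈ b.wide.idx (h n), P n j t ^ 2 :=
    mul_nonneg hh.le (sum_nonneg fun j _ => sq_nonneg _)
  rw [abs_of_nonneg hℓ]
  have s3 := mul_nonneg (show 0 ≤ 2 * ℓ by positivity) s1
  have s4 := mul_nonneg (show 0 ≤ 2 * ℓ * κ ^ 2 by positivity) s2
  linarith

theorem LB.of_sobolev (H : Mesh h N) {P : ℕ → ℕ → ℝ → ℝ}
    (hP : Ev T h fun n j t => h n * P n j t = F n (j + 1) t - F n j t)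
    (hF : L2 T h F) (hP2 : L2 T h P) : LB T h F := fun b => by
  obtain ⟨C, hC, h0⟩ := sobolev_box H hP b
  obtain ⟨D, hD, h1⟩ := hF b.wide
  obtain ⟨E, hE, h2⟩ := hP2 b.wide
  refine ⟨√(C * (D + E)), sqrt_nonneg _, ?_⟩
  filter_upwards [h0, h1, h2] with n h0 h1 h2 j hj t ht
  have ht' := b.Icc_subset_wide ht
  exact abs_le_sqrt ((h0 t ht j hj).trans
    (mul_le_mul_of_nonneg_left (add_le_add (h1 t ht') (h2 t ht')) hC))

theorem SB.of_sobolev (H : Mesh h N) {P : ℕ → ℕ → ℝ → ℝ}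
    (hP : Ev T h fun n j t => h n * P n j t = F n (j + 1) t - F n j t)
    (hF : ST T h F) (hP2 : ST T h P) : SB T h F := fun b => by
  obtain ⟨C, hC, h0⟩ := sobolev_box H hP b
  obtain ⟨D, hD, h1⟩ := hF b.wide
  obtain ⟨E, hE, h2⟩ := hP2 b.wide
  refine ⟨C * (D + E), by positivity, ?_⟩
  filter_upwards [h0, h1, h2] with n h0 h1 h2
  refine ⟨_, ((h1.add h2).const_mul hC).mono (by simp only [Box.wide]; linarith [b.t₁_pos]) le_rfl
    le_rfl fun t _ => le_rfl, fun t ht => ⟨?_, fun j hj => h0 t ht j hj⟩⟩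
  have s1 : 0 ≤ h n * ∑ j ∈ b.wide.idx (h n), F n j t ^ 2 :=
    mul_nonneg (H.pos n).le (sum_nonneg fun j _ => sq_nonneg _)
  have s2 : 0 ≤ h n * ∑ j ∈ b.wide.idx (h n), P n j t ^ 2 :=
    mul_nonneg (H.pos n).le (sum_nonneg fun j _ => sq_nonneg _)
  positivity

theorem SB.dom (hF : Dom T h F G K) (hG : SB T h G) (hK : LB T h K) : SB T h F := fun b => by
  obtain ⟨C, hC, h0⟩ := hF b
  obtain ⟨D, hD, h1⟩ := hG b
  obtain ⟨E, hE, h2⟩ := hK b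
  refine ⟨2 * C ^ 2 * ((1 + E) ^ 2 + D), by positivity, ?_⟩
  filter_upwards [h0, h1, h2] with n h0 ⟨g, hg, h1⟩ h2
  refine ⟨_, ((IntBdd.of_le (g := fun _ => (1 + E) ^ 2) (fun t _ => le_rfl)
    (by positivity)).add hg).const_mul (show 0 ≤ 2 * C ^ 2 by positivity), fun t ht => ⟨?_, ?_⟩⟩
  · have := (h1 t ht).1; positivity
  intro j hj
  have e1 := h0 j hj t ht
  have e2 := h2 j hj t ht
  have e3 := (h1 t ht).2 j hj
  have e4 : |F n j t| ≤ C * ((1 + E) + |G n j t|) := e1.trans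
    (mul_le_mul_of_nonneg_left (by linarith) hC)
  have e5 := pow_le_pow_left₀ (abs_nonneg _) e4 2
  rw [sq_abs, mul_pow] at e5
  rw [← sq_abs (G n j t)] at e3
  have e6 : (1 + E + |G n j t|) ^ 2 ≤ 2 * ((1 + E) ^ 2 + g t) := by
    nlinarith only [sq_nonneg (1 + E - |G n j t|), e3]
  have e7 := mul_le_mul_of_nonneg_left e6 (sq_nonneg C)
  linarith

theorem SB.mul (H : Mesh h N) (hF : SB T h F) (hG : L2 T h G) :
    ST T h fun n j t => F n j t * G n j t := fun b => by
  obtain ⟨C, hC, h0⟩ := hF b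
  obtain ⟨D, hD, h1⟩ := hG b
  refine ⟨D * C, by positivity, ?_⟩
  filter_upwards [h0, h1] with n ⟨g, hg, h0⟩ h1
  refine (hg.const_mul hD).mono le_rfl le_rfl le_rfl fun t ht => ?_
  obtain ⟨g0, h2⟩ := h0 t ht
  have e : ∑ j ∈ b.idx (h n), (F n j t * G n j t) ^ 2
      ≤ ∑ j ∈ b.idx (h n), g t * G n j t ^ 2 := sum_le_sum fun j hj => by
    rw [mul_pow]; exact mul_le_mul_of_nonneg_right (h2 j hj) (sq_nonneg _)
  rw [← mul_sum] at e
  calc _ ≤ h n * (g t * ∑ j ∈ b.idx (h n), G n j t ^ 2) :=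
        mul_le_mul_of_nonneg_left e (H.pos n).le
    _ = (h n * ∑ j ∈ b.idx (h n), G n j t ^ 2) * g t := by ring
    _ ≤ D * g t := mul_le_mul_of_nonneg_right (h1 t ht) g0

/-- Local energy estimate on a box. -/
theorem energy_box (b : Box T) {C : ℝ} (hC : 0 ≤ C) {e k : ℕ → ℝ → ℝ}
    (H : ∀ᶠ n in atTop, ∃ y y' d g : ℝ → ℝ,
      (∀ t ∈ Icc b.wide.t₁ b.wide.t₂, HasDerivAt y (y' t) t ∧ 0 ≤ y t ∧ 0 ≤ d t ∧ 0 ≤ g t ∧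
        y' t ≤ -d t + C * ((1 + g t) * (1 + y t)) ∧ y t ≤ C * (1 + g t)) ∧
      IntBdd C b.wide.t₁ b.wide.t₂ g ∧
      ∀ t ∈ Icc b.t₁ b.t₂, e n t ≤ C * (1 + y t) ∧ k n t ≤ C * (d t + g t)) :
    ∃ D, 0 ≤ D ∧ ∀ᶠ n in atTop, (∀ t ∈ Icc b.t₁ b.t₂, e n t ≤ D) ∧
      IntBdd D b.t₁ b.t₂ (k n) := by
  have h1 : b.wide.t₁ < b.t₁ := by simp only [Box.wide]; linarith [b.t₁_pos]
  obtain ⟨D, hD, key⟩ := energy_gain (C := C * (1 + C) + C) (by positivity) h1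
    (show b.t₁ ≤ b.wide.t₂ from b.t₁_le)
  refine ⟨C * (1 + D) + C * (D + C), by positivity, ?_⟩
  filter_upwards [H] with n ⟨y, y', d, g, hy, hg, hek⟩
  have hCC : C ≤ C * (1 + C) + C := by have : 0 ≤ C * (1 + C) := by positivity
                                       linarith
  obtain ⟨k1, k2⟩ := key y y' d g (fun t ht => by
      obtain ⟨a0, a1, a2, a3, a4, -⟩ := hy t ht
      refine ⟨a0, a1, a2, a3, a4.trans ?_⟩
      gcongr)
    (((((IntBdd.of_le (g := fun _ => 1) (fun t _ => le_rfl) zero_le_one).add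
      hg).const_mul hC).mono le_rfl le_rfl (by linarith) fun t ht => (hy t ht).2.2.2.2.2))
    (hg.mono le_rfl le_rfl hCC fun t _ => le_rfl)
  refine ⟨fun t ht => (hek t ht).1.trans ?_, ?_⟩
  · have : C * (1 + y t) ≤ C * (1 + D) := by gcongr; exact k1 t ht
    have : 0 ≤ C * (D + C) := by positivity
    linarith
  · refine ((k2.add (hg.mono h1.le le_rfl le_rfl fun t _ => le_rfl)).const_mul hC).mono
      le_rfl le_rfl ?_ fun t ht => (hek t ht).2
    have : 0 ≤ C * (1 + D) := by positivity
    linarith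

theorem le_sum_weight (H : Mesh h N) {b : Box T} {n : ℕ} {w f : ℕ → ℝ}
    (hw : ∀ j ∈ b.idx (h n), w (j + 1) = 1 ∧ j < N n) (hf : ∀ j, 0 ≤ f j) :
    h n * ∑ j ∈ b.idx (h n), f j ≤ h n * ∑ j ∈ range (N n), w (j + 1) ^ 2 * f j := by
  refine mul_le_mul_of_nonneg_left ?_ (H.pos n).le
  calc _ = ∑ j ∈ b.idx (h n), w (j + 1) ^ 2 * f j :=
        sum_congr rfl fun j hj => by rw [(hw j hj).1]; ring
    _ ≤ _ := sum_le_sum_of_subset_of_nonneg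
        (fun j hj => mem_range.2 (hw j hj).2) fun j _ _ => mul_nonneg (sq_nonneg _) (hf j)

theorem le_sum_weight_succ (H : Mesh h N) {b : Box T} {n : ℕ} {w f : ℕ → ℝ} (h0 : w 0 = 0)
    (hw : ∀ j ∈ b.idx (h n), w j = 1 ∧ j < N n) (hf : ∀ j, 0 ≤ f j) :
    h n * ∑ j ∈ b.idx (h n), f j
      ≤ h n * ∑ j ∈ range (N n), w (j + 1) ^ 2 * f (j + 1) := by
  refine mul_le_mul_of_nonneg_left ?_ (H.pos n).le
  have e := sum_range_succ' (fun j => w j ^ 2 * f j) (N n)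
  simp only [h0] at e
  calc _ = ∑ j ∈ b.idx (h n), w j ^ 2 * f j :=
        sum_congr rfl fun j hj => by rw [(hw j hj).1]; ring
    _ ≤ ∑ j ∈ range (N n + 1), w j ^ 2 * f j := sum_le_sum_of_subset_of_nonneg
        (fun j hj => mem_range.2 ((hw j hj).2.trans (Nat.lt_succ_self _)))
        fun j _ _ => mul_nonneg (sq_nonneg _) (hf j)
    _ = _ := by rw [e]; ring

theorem energy_flux (H : Mesh h N) {U V P F R G a c : ℕ → ℕ → ℝ → ℝ}
    (hder : Ev T h fun n j t => HasDerivAt (U n j) (V n j t) t)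
    (hflux : ∀ b : Box T, ∃ α B : ℝ, 0 < α ∧ ∀ᶠ n in atTop, ∀ j ∈ b.idx (h n),
      ∀ t ∈ Icc b.t₁ b.t₂, F n j t = a n j t * P n j t + R n j t ∧ α ≤ a n j t ∧ a n j t ≤ 1 ∧
        |c n j t| ≤ B)
    (hP : Ev T h fun n j t => h n * P n j t = U n (j + 1) t - U n j t)
    (hV : Ev T h fun n j t => V n (j + 1) t = (F n (j + 1) t - F n j t) / h n
      + (c n (j + 1) t * P n (j + 1) t + G n (j + 1) t))
    (hU : ST T h U) (hR : ST T h R) (hG : ST T h G) : L2 T h U ∧ ST T h P := by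
  suffices key : ∀ b : Box T, ∃ D, 0 ≤ D ∧ ∀ᶠ n in atTop,
      (∀ t ∈ Icc b.t₁ b.t₂, h n * ∑ j ∈ b.idx (h n), U n j t ^ 2 ≤ D) ∧
      IntBdd D b.t₁ b.t₂ (fun t => h n * ∑ j ∈ b.idx (h n), P n j t ^ 2) from
    ⟨fun b => (key b).imp fun D hD => ⟨hD.1, hD.2.mono fun n hn => hn.1⟩,
      fun b => (key b).imp fun D hD => ⟨hD.1, hD.2.mono fun n hn => hn.2⟩⟩
  intro b
  obtain ⟨κ, ℓ, hw⟩ := b.exists_cutoff H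
  obtain ⟨α, B, hα, hflux⟩ := hflux b.wide
  obtain ⟨C1, hC1, h1⟩ := hU b.wide
  obtain ⟨C2, hC2, h2⟩ := hR b.wide
  obtain ⟨C3, hC3, h3⟩ := hG b.wide
  set K := 6 * (8 * κ ^ 2 / α + 4 * κ ^ 2 + 2 / α + 1 + (4 * B ^ 2 / α + 1) + α * κ ^ 2)
  have hK : 0 ≤ K := by positivity
  refine energy_box b (C := K + (C1 + (C2 + C3)) + 4 / α + 2) (by positivity) ?_
  filter_upwards [hw, hflux, h1, h2, h3, hder b.wide, hP b.wide, hV b.wide] with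
    n ⟨w, hw, hw1⟩ hflux h1 h2 h3 hder hP hV
  have hh := H.pos n
  have hg : ∀ t, h n * ∑ j ∈ b.wide.idx (h n), (U n j t ^ 2 + R n j t ^ 2 + G n j t ^ 2)
      = h n * ∑ j ∈ b.wide.idx (h n), U n j t ^ 2 + (h n * ∑ j ∈ b.wide.idx (h n), R n j t ^ 2
        + h n * ∑ j ∈ b.wide.idx (h n), G n j t ^ 2) := fun t => by
    rw [← mul_add, ← mul_add, ← sum_add_distrib, ← sum_add_distrib]
    simp only [add_assoc]
  have hα4 : 0 ≤ 4 / α := by positivity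
  refine ⟨fun t => 1 / 2 * (h n * ∑ j ∈ range (N n), w (j + 1) ^ 2 * U n (j + 1) t ^ 2),
    fun t => h n * ∑ j ∈ range (N n), w (j + 1) ^ 2 * (U n (j + 1) t * V n (j + 1) t),
    fun t => α / 4 * (h n * ∑ j ∈ range (N n), w (j + 1) ^ 2 * P n j t ^ 2),
    fun t => h n * ∑ j ∈ b.wide.idx (h n), (U n j t ^ 2 + R n j t ^ 2 + G n j t ^ 2),
    fun t ht => ?_, ?_, fun t ht => ?_⟩
  · have y0 : 0 ≤ 1 / 2 * (h n * ∑ j ∈ range (N n), w (j + 1) ^ 2 * U n (j + 1) t ^ 2) :=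
      mul_nonneg (by norm_num) (mul_nonneg hh.le (sum_nonneg fun j _ => by positivity))
    have g0 : 0 ≤ h n * ∑ j ∈ b.wide.idx (h n), (U n j t ^ 2 + R n j t ^ 2 + G n j t ^ 2) :=
      mul_nonneg hh.le (sum_nonneg fun j _ => by positivity)
    refine ⟨?_, y0, mul_nonneg (by positivity) (mul_nonneg hh.le
      (sum_nonneg fun j _ => by positivity)), g0, ?_, ?_⟩
    · have hs : HasDerivAt (fun t => ∑ j ∈ range (N n), w (j + 1) ^ 2 * U n (j + 1) t ^ 2)
          (∑ j ∈ range (N n), w (j + 1) ^ 2 * (2 * (U n (j + 1) t * V n (j + 1) t))) t := by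
        refine HasDerivAt.fun_sum fun j _ => ?_
        by_cases h0 : w (j + 1) = 0
        · simpa [h0] using hasDerivAt_const t (0 : ℝ)
        · refine (((hder _ (hw.supp j (Or.inr h0)).2.1 t ht).pow 2).const_mul _).congr_deriv ?_
          push_cast; ring
      refine ((hs.const_mul (h n)).const_mul (1 / 2)).congr_deriv ?_
      simp only [mul_left_comm _ (2 : ℝ), ← mul_sum]
      ring
    · have := hw.flux_sum_le hα (U := fun j => U n j t) (V := fun j => V n j t)
        (P := fun j => P n j t) (F := fun j => F n j t) (R := fun j => R n j t)
        (G := fun j => G n j t) (a := fun j => a n j t) (b := fun j => c n j t)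
        (fun j hj => hflux j hj t ht) (fun j hj => hP j hj t ht) (fun j hj => hV j hj t ht)
      refine this.trans ?_
      rw [neg_mul]
      refine add_le_add_right ?_ _
      have q1 := mul_nonneg g0 y0
      have q2 : h n * ∑ j ∈ b.wide.idx (h n), (U n j t ^ 2 + R n j t ^ 2 + G n j t ^ 2) ≤
        (1 + h n * ∑ j ∈ b.wide.idx (h n), (U n j t ^ 2 + R n j t ^ 2 + G n j t ^ 2)) *
        (1 + 1 / 2 * (h n * ∑ j ∈ range (N n), w (j + 1) ^ 2 * U n (j + 1) t ^ 2)) := by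
        linarith
      exact mul_le_mul (by simp only [K]; linarith) q2 g0 (by positivity)
    · have q1 := hw.sum_weight_succ_le (f := fun j => U n j t ^ 2) (g := fun j => U n j t ^ 2)
        (fun j => sq_nonneg _) fun j _ => le_rfl
      have q2 : 0 ≤ h n * ∑ j ∈ b.wide.idx (h n), R n j t ^ 2 :=
        mul_nonneg hh.le (sum_nonneg fun j _ => sq_nonneg _)
      have q3 : 0 ≤ h n * ∑ j ∈ b.wide.idx (h n), G n j t ^ 2 :=
        mul_nonneg hh.le (sum_nonneg fun j _ => sq_nonneg _)
      have q4 := hg t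
      have q5 : (1 : ℝ) ≤ K + (C1 + (C2 + C3)) + 4 / α + 2 := by linarith
      have q6 := mul_le_mul_of_nonneg_right q5 g0
      linarith
  · refine (h1.add (h2.add h3)).mono le_rfl le_rfl (by linarith) fun t _ => (hg t).le
  · have ht' := b.Icc_subset_wide ht
    have g0 : 0 ≤ h n * ∑ j ∈ b.wide.idx (h n), (U n j t ^ 2 + R n j t ^ 2 + G n j t ^ 2) :=
      mul_nonneg hh.le (sum_nonneg fun j _ => by positivity)
    constructor
    · have := le_sum_weight_succ H hw.zero_left (fun j hj => ⟨(hw1 j hj).1, (hw1 j hj).2.2⟩)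
        (f := fun j => U n j t ^ 2) fun j => sq_nonneg _
      set s := h n * ∑ j ∈ range (N n), w (j + 1) ^ 2 * U n (j + 1) t ^ 2
      have s0 : 0 ≤ s := mul_nonneg hh.le (sum_nonneg fun j _ => by positivity)
      have q5 : (2 : ℝ) ≤ K + (C1 + (C2 + C3)) + 4 / α + 2 := by linarith
      have q6 := mul_le_mul_of_nonneg_right q5 (show 0 ≤ 1 + 1 / 2 * s by positivity)
      linarith
    · have := le_sum_weight H (fun j hj => ⟨(hw1 j hj).2.1, (hw1 j hj).2.2⟩)
        (f := fun j => P n j t ^ 2) fun j => sq_nonneg _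
      set s := h n * ∑ j ∈ range (N n), w (j + 1) ^ 2 * P n j t ^ 2
      have s0 : 0 ≤ s := mul_nonneg hh.le (sum_nonneg fun j _ => by positivity)
      have q5 : 4 / α ≤ K + (C1 + (C2 + C3)) + 4 / α + 2 := by linarith
      have q6 := mul_le_mul_of_nonneg_right q5 (show 0 ≤ α / 4 * s by positivity)
      have q7 : 4 / α * (α / 4 * s) = s := by field_simp
      have q8 := mul_nonneg (show 0 ≤ K + (C1 + (C2 + C3)) + 4 / α + 2 by linarith) g0
      linarith

variable {T : ℝ} {h : ℕ → ℝ} {N : ℕ → ℕ}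

theorem energy_cubic (H : Mesh h N) {Q D V F R E Y P : ℕ → ℕ → ℝ → ℝ}
    (hder : Ev T h fun n j t => HasDerivAt (Y n j) (Q n j t * V n j t + E n j t) t)
    (hF : Ev T h fun n j t => F n j t = D n j t + R n j t)
    (hD : Ev T h fun n j t => h n * D n j t = Q n (j + 1) t - Q n j t)
    (hV : Ev T h fun n j t => V n (j + 1) t = (F n (j + 1) t - F n j t) / h n)
    (hE : ∀ b : Box T, ∃ C : ℝ, ∀ᶠ n in atTop, ∀ j ∈ b.idx (h n), ∀ t ∈ Icc b.t₁ b.t₂,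
      |E n j t| ≤ C * ((1 + Q n j t ^ 2) * (1 + |P n j t|)) ∧
      Q n j t ^ 2 ≤ C * (1 + Y n j t) ∧ Y n j t ≤ C * (1 + Q n j t ^ 2))
    (hY : ∀ n j t, 0 ≤ Y n j t) (hQ2 : ST T h Q) (hR2 : ST T h R) (hP2 : ST T h P) :
    L2 T h Q ∧ ST T h F := by
  suffices key : ∀ b : Box T, ∃ D, 0 ≤ D ∧ ∀ᶠ n in atTop,
      (∀ t ∈ Icc b.t₁ b.t₂, h n * ∑ j ∈ b.idx (h n), Q n j t ^ 2 ≤ D) ∧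
      IntBdd D b.t₁ b.t₂ (fun t => h n * ∑ j ∈ b.idx (h n), F n j t ^ 2) from
    ⟨fun b => (key b).imp fun D hD => ⟨hD.1, hD.2.mono fun n hn => hn.1⟩,
      fun b => (key b).imp fun D hD => ⟨hD.1, hD.2.mono fun n hn => hn.2⟩⟩
  intro b
  obtain ⟨κ, ℓ₀, hw⟩ := b.exists_cutoff H
  obtain ⟨C₀, hE⟩ := hE b.wide
  obtain ⟨C1, hC1, h1⟩ := hQ2 b.wide
  obtain ⟨C2, hC2, h2⟩ := hR2 b.wide
  obtain ⟨C3, hC3, h3⟩ := hP2 b.wide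
  set C := max C₀ 1
  have hC : 1 ≤ C := le_max_right _ _
  set K := 6 * (13 * κ ^ 2 + 4) + C * (2 * |ℓ₀| + 1 + κ ^ 2 + 4 * C ^ 2 * (|ℓ₀| + 1) ^ 2)
  have hK : 0 ≤ K := by positivity
  have hL : 0 ≤ C * (|ℓ₀| + 1) := by positivity
  refine energy_box b (C := K + (C1 + (C2 + C3)) + 16 + 2 * (C * (|ℓ₀| + 1))) (by positivity) ?_
  filter_upwards [hw, hE, h1, h2, h3, hder b.wide, hF b.wide, hD b.wide, hV b.wide, hF b] with
    n ⟨w, hw, hw1⟩ hE h1 h2 h3 hder hF hD hV hFb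
  have hh := H.pos n
  have hℓ : 0 ≤ ℓ₀ := le_trans (by positivity) hw.length
  have sn : ∀ (X : ℕ → ℝ) (A : Finset ℕ), 0 ≤ h n * ∑ j ∈ A, X j ^ 2 := fun X A =>
    mul_nonneg hh.le (sum_nonneg fun j _ => sq_nonneg _)
  have hQC : ∀ t ∈ Icc b.wide.t₁ b.wide.t₂, ∀ j ∈ b.wide.idx (h n),
      Q n j t ^ 2 ≤ C * (1 + Y n j t) := fun t ht j hj => (hE j hj t ht).2.1.trans
    (mul_le_mul_of_nonneg_right (le_max_left _ _) (by linarith [hY n j t]))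
  refine ⟨fun t => h n * ∑ j ∈ range (N n), w (j + 1) ^ 2 * Y n (j + 1) t,
    fun t => h n * ∑ j ∈ range (N n),
      w (j + 1) ^ 2 * (Q n (j + 1) t * V n (j + 1) t + E n (j + 1) t),
    fun t => 1 / 8 * (h n * ∑ j ∈ range (N n), w (j + 1) ^ 2 * D n j t ^ 2),
    fun t => h n * ∑ j ∈ b.wide.idx (h n), Q n j t ^ 2
      + (h n * ∑ j ∈ b.wide.idx (h n), R n j t ^ 2 + h n * ∑ j ∈ b.wide.idx (h n), P n j t ^ 2),
    fun t ht => ?_, ?_, fun t ht => ?_⟩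
  · have y0 : 0 ≤ h n * ∑ j ∈ range (N n), w (j + 1) ^ 2 * Y n (j + 1) t :=
      mul_nonneg hh.le (sum_nonneg fun j _ => mul_nonneg (sq_nonneg _) (hY _ _ _))
    have a1 := sn (fun j => Q n j t) (b.wide.idx (h n))
    have a2 := sn (fun j => R n j t) (b.wide.idx (h n))
    have a3 := sn (fun j => P n j t) (b.wide.idx (h n))
    refine ⟨?_, y0, mul_nonneg (by positivity) (mul_nonneg hh.le
      (sum_nonneg fun j _ => by positivity)), by positivity, ?_, ?_⟩
    · refine (HasDerivAt.fun_sum fun j _ => ?_).const_mul (h n)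
      by_cases h0 : w (j + 1) = 0
      · simpa [h0] using hasDerivAt_const t (0 : ℝ)
      · exact (hder _ (hw.supp j (Or.inr h0)).2.1 t ht).const_mul _
    · have := hw.cubic_energy hC (Q := fun j => Q n j t) (D := fun j => D n j t)
        (V := fun j => V n j t) (F := fun j => F n j t) (R := fun j => R n j t)
        (E := fun j => E n j t) (Y := fun j => Y n j t) (P := fun j => P n j t)
        (fun j hj => hF j hj t ht) (fun j hj => hD j hj t ht) (fun j hj => hV j hj t ht)
        (fun j hj => (hE j hj t ht).1.trans
          (mul_le_mul_of_nonneg_right (le_max_left _ _) (by positivity)))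
        (fun j hj => hQC t ht j hj) (fun j => hY n j t)
      refine this.trans ?_
      beta_reduce
      rw [neg_mul, ← add_assoc (h n * ∑ j ∈ b.wide.idx (h n), Q n j t ^ 2)]
      refine add_le_add_right (mul_le_mul_of_nonneg_right ?_ (by positivity)) _
      simp only [K, abs_of_nonneg hℓ]
      have : 0 ≤ C * (ℓ₀ + 1) := by positivity
      linarith
    · have q1 := hw.sum_weight_succ_le (f := fun j => Y n j t) (g := fun j => C * (1 + Q n j t ^ 2))
        (fun j => by positivity) fun j hj => (hE _ (hw.supp j (Or.inr hj)).2.1 t ht).2.2.trans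
          (mul_le_mul_of_nonneg_right (le_max_left _ _) (by positivity))
      rw [← mul_sum, sum_add_distrib] at q1
      have q2 : h n * ∑ j ∈ b.wide.idx (h n), (1 : ℝ) ≤ |ℓ₀| := by
        rw [abs_of_nonneg hℓ]; simpa using hw.length
      have q3 := mul_le_mul_of_nonneg_left q2 (show 0 ≤ C by linarith)
      set X := h n * ∑ j ∈ b.wide.idx (h n), Q n j t ^ 2
      set g := X + (h n * ∑ j ∈ b.wide.idx (h n), R n j t ^ 2
        + h n * ∑ j ∈ b.wide.idx (h n), P n j t ^ 2)
      have hg : X ≤ g := by simp only [g]; linarith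
      have q4 : C * (|ℓ₀| + g) ≤ C * (|ℓ₀| + 1) * (1 + g) := by
        have : 0 ≤ |ℓ₀| * g := mul_nonneg (abs_nonneg _) (a1.trans hg)
        rw [mul_assoc]
        exact mul_le_mul_of_nonneg_left (by linarith) (by linarith)
      have q5 := mul_le_mul_of_nonneg_left hg (show 0 ≤ C by linarith)
      have q6 := mul_le_mul_of_nonneg_right (show C * (|ℓ₀| + 1) ≤ K + (C1 + (C2 + C3)) + 16
        + 2 * (C * (|ℓ₀| + 1)) by linarith) (show 0 ≤ 1 + g by linarith)
      linarith
  · exact (h1.add (h2.add h3)).mono le_rfl le_rfl (by linarith) fun t _ => le_rfl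
  · have ht' := b.Icc_subset_wide ht
    have a1 := sn (fun j => Q n j t) (b.wide.idx (h n))
    have a2 := sn (fun j => R n j t) (b.wide.idx (h n))
    have a3 := sn (fun j => P n j t) (b.wide.idx (h n))
    constructor
    · have q1 := le_sum_weight_succ H hw.zero_left (fun j hj => ⟨(hw1 j hj).1, (hw1 j hj).2.2⟩)
        (f := fun j => Q n j t ^ 2) fun j => sq_nonneg _
      have q2 := hw.sum_weight_succ_le (f := fun j => 1) (g := fun _ => 1) (fun _ => zero_le_one)
        fun _ _ => le_rfl
      have q3 : h n * ∑ j ∈ b.wide.idx (h n), (1 : ℝ) ≤ |ℓ₀| := by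
        rw [abs_of_nonneg hℓ]; simpa using hw.length
      have q4 : ∑ j ∈ range (N n), w (j + 1) ^ 2 * Q n (j + 1) t ^ 2
          ≤ ∑ j ∈ range (N n), C * (w (j + 1) ^ 2 * 1 + w (j + 1) ^ 2 * Y n (j + 1) t) := by
        refine sum_le_sum fun j _ => ?_
        by_cases h0 : w (j + 1) = 0
        · simp [h0]
        · have := mul_le_mul_of_nonneg_left (hQC t ht' _ (hw.supp j (Or.inr h0)).2.1)
            (sq_nonneg (w (j + 1)))
          linarith
      rw [← mul_sum, sum_add_distrib] at q4
      have q5 := mul_le_mul_of_nonneg_left q4 hh.le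
      set y := h n * ∑ j ∈ range (N n), w (j + 1) ^ 2 * Y n (j + 1) t
      have y0 : 0 ≤ y :=
        mul_nonneg hh.le (sum_nonneg fun j _ => mul_nonneg (sq_nonneg _) (hY _ _ _))
      have q6 := mul_le_mul_of_nonneg_left (q2.trans q3) (show 0 ≤ C by linarith)
      have q7 : C * (|ℓ₀| + y) ≤ C * (|ℓ₀| + 1) * (1 + y) := by
        have : 0 ≤ |ℓ₀| * y := mul_nonneg (abs_nonneg _) y0
        rw [mul_assoc]
        exact mul_le_mul_of_nonneg_left (by linarith) (by linarith)
      have q8 := mul_le_mul_of_nonneg_right (show C * (|ℓ₀| + 1) ≤ K + (C1 + (C2 + C3)) + 16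
        + 2 * (C * (|ℓ₀| + 1)) by linarith) (show 0 ≤ 1 + y by linarith)
      linarith
    · have q1 := le_sum_weight H (fun j hj => ⟨(hw1 j hj).2.1, (hw1 j hj).2.2⟩)
        (f := fun j => D n j t ^ 2) fun j => sq_nonneg _
      have q2 : h n * ∑ j ∈ b.idx (h n), F n j t ^ 2 ≤ 2 * (h n * ∑ j ∈ b.idx (h n), D n j t ^ 2)
          + 2 * (h n * ∑ j ∈ b.idx (h n), R n j t ^ 2) := by
        have : ∑ j ∈ b.idx (h n), F n j t ^ 2
            ≤ 2 * ∑ j ∈ b.idx (h n), D n j t ^ 2 + 2 * ∑ j ∈ b.idx (h n), R n j t ^ 2 := by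
          rw [mul_sum, mul_sum, ← sum_add_distrib]
          refine sum_le_sum fun j hj => ?_
          rw [hFb j hj t ht]
          nlinarith only [sq_nonneg (D n j t - R n j t)]
        linarith [mul_le_mul_of_nonneg_left this hh.le]
      have q3 : h n * ∑ j ∈ b.idx (h n), R n j t ^ 2
          ≤ h n * ∑ j ∈ b.wide.idx (h n), R n j t ^ 2 := mul_le_mul_of_nonneg_left
        (sum_le_sum_of_subset_of_nonneg (b.idx_subset_wide hh) fun j _ _ => sq_nonneg _) hh.le
      set s := h n * ∑ j ∈ range (N n), w (j + 1) ^ 2 * D n j t ^ 2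
      have s0 : 0 ≤ s := mul_nonneg hh.le (sum_nonneg fun j _ => by positivity)
      set g := h n * ∑ j ∈ b.wide.idx (h n), Q n j t ^ 2
        + (h n * ∑ j ∈ b.wide.idx (h n), R n j t ^ 2 + h n * ∑ j ∈ b.wide.idx (h n), P n j t ^ 2)
      have g0 : 0 ≤ g := by positivity
      have hg : h n * ∑ j ∈ b.wide.idx (h n), R n j t ^ 2 ≤ g := by simp only [g]; linarith
      have q6 := mul_le_mul_of_nonneg_right (show (16 : ℝ) ≤ K + (C1 + (C2 + C3)) + 16
        + 2 * (C * (|ℓ₀| + 1)) by linarith) (show 0 ≤ 1 / 8 * s + g by positivity)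
      linarith

end Lattice

theorem ContDiffAt.iteratedDeriv_top {f : ℝ → ℝ} {t : ℝ} (hf : ContDiffAt ℝ ∞ f t) (m : ℕ) :
    ContDiffAt ℝ ∞ (iteratedDeriv m f) t := by
  induction m with
  | zero => simpa using hf
  | succ m ih =>
    rw [iteratedDeriv_succ]
    exact (ih.fderiv_right (m := (∞ : WithTop ℕ∞)) (by simp)).clm_apply contDiffAt_const

theorem ContDiffAt.hasDerivAt_iteratedDeriv {f : ℝ → ℝ} {t : ℝ}
    (hf : ContDiffAt ℝ ∞ f t) (m : ℕ) :
    HasDerivAt (iteratedDeriv m f) (iteratedDeriv (m + 1) f t) t := by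
  rw [iteratedDeriv_succ]
  exact ((hf.iteratedDeriv_top m).differentiableAt (by simp)).hasDerivAt

namespace Lattice

/-- Time derivatives of a lattice family. -/
noncomputable def tD (u : ℕ → ℕ → ℝ → ℝ) (m n j : ℕ) (t : ℝ) : ℝ := iteratedDeriv m (u n j) t

/-- Space differences of the time derivatives of a lattice family. -/
noncomputable def tP (h : ℕ → ℝ) (u : ℕ → ℕ → ℝ → ℝ) (m n j : ℕ) (t : ℝ) : ℝ :=
  (tD u m n (j + 1) t - tD u m n j t) / h n

/-- Time derivatives of the flux of a lattice family. -/
noncomputable def tQ (h : ℕ → ℝ) (u : ℕ → ℕ → ℝ → ℝ) (m n j : ℕ) (t : ℝ) : ℝ :=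
  iteratedDeriv m (fun r => arctan (tP h u 0 n j r)) t

/-- Time derivatives of the zero-order term of a lattice family. -/
noncomputable def tZ (u : ℕ → ℕ → ℝ → ℝ) (m n j : ℕ) (t : ℝ) : ℝ :=
  iteratedDeriv m (fun r => 3 / u n j r) t

/-- Time derivatives of the lower-order terms of a lattice family. -/
noncomputable def tB (h : ℕ → ℝ) (u : ℕ → ℕ → ℝ → ℝ) (m n j : ℕ) (t : ℝ) : ℝ :=
  3 / ((j + 1) * h n) * tP h u m n j t - tZ u m n j t

/-- A sequence of solutions of semi-discrete profile equations on finer and finer lattices,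
with bounded slopes. -/
structure Approx (T : ℝ) (h : ℕ → ℝ) (N : ℕ → ℕ) (u : ℕ → ℕ → ℝ → ℝ) (M : ℝ) : Prop where
  mesh : Mesh h N
  smooth : Ev T h fun n j t => ContDiffAt ℝ ∞ (u n j) t
  eqn : Ev T h fun n j t => deriv (u n (j + 1)) =ᶠ[nhds t] fun r =>
    (arctan (tP h u 0 n (j + 1) r) - arctan (tP h u 0 n j r)) / h n
      + tB h u 0 n (j + 1) r
  slope_le : Ev T h fun n j t => |tP h u 0 n j t| ≤ M
  range : ∀ b : Box T, ∃ c C : ℝ, 0 < c ∧ ∀ᶠ n in atTop, ∀ j ∈ b.idx (h n),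
    ∀ t ∈ Icc b.t₁ b.t₂, c ≤ u n j t ∧ u n j t ≤ C

namespace Approx

variable {T M : ℝ} {h : ℕ → ℝ} {N : ℕ → ℕ} {u : ℕ → ℕ → ℝ → ℝ}

theorem tP_eq_iteratedDeriv {m n j : ℕ} {t : ℝ} (h0 : ContDiffAt ℝ ∞ (u n j) t)
    (h1 : ContDiffAt ℝ ∞ (u n (j + 1)) t) :
    tP h u m n j t = iteratedDeriv m (tP h u 0 n j) t := by
  have : tP h u 0 n j = fun r => (u n (j + 1) r - u n j r) / h n := by
    funext r; simp [tP, tD]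
  rw [this, iteratedDeriv_div_const, iteratedDeriv_fun_sub (h1.of_le (by exact_mod_cast le_top))
    (h0.of_le (by exact_mod_cast le_top))]
  rfl

theorem contDiffAt_slope {n j : ℕ} {t : ℝ} (h0 : ContDiffAt ℝ ∞ (u n j) t)
    (h1 : ContDiffAt ℝ ∞ (u n (j + 1)) t) : ContDiffAt ℝ ∞ (tP h u 0 n j) t := by
  have : tP h u 0 n j = fun r => (u n (j + 1) r - u n j r) / h n := by
    funext r; simp [tP, tD]
  rw [this]
  exact (h1.sub h0).div_const _

theorem smooth_slope (H : Approx T h N u M) :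
    Ev T h fun n j t => ContDiffAt ℝ ∞ (tP h u 0 n j) t :=
  (H.smooth.and (H.smooth.shift H.mesh)).mono fun _ _ _ h => contDiffAt_slope h.1 h.2

theorem smooth_flux (H : Approx T h N u M) :
    Ev T h fun n j t => ContDiffAt ℝ ∞ (fun r => arctan (tP h u 0 n j r)) t :=
  H.smooth_slope.mono fun _ _ _ h => contDiff_arctan.contDiffAt.comp _ h

theorem ne_zero (H : Approx T h N u M) : Ev T h fun n j t => u n j t ≠ 0 := fun b => by
  obtain ⟨c, C, hc, hn⟩ := H.range b
  exact hn.mono fun n hn j hj t ht => (hc.trans_le (hn j hj t ht).1).ne'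

theorem smooth_zero_order (H : Approx T h N u M) :
    Ev T h fun n j t => ContDiffAt ℝ ∞ (fun r => 3 / u n j r) t :=
  (H.smooth.and H.ne_zero).mono fun _ _ _ h => contDiffAt_const.div h.1 h.2

theorem hasDerivAt_tD (H : Approx T h N u M) (m : ℕ) :
    Ev T h fun n j t => HasDerivAt (tD u m n j) (tD u (m + 1) n j t) t :=
  H.smooth.mono fun _ _ _ h => h.hasDerivAt_iteratedDeriv m

theorem hasDerivAt_tQ (H : Approx T h N u M) (m : ℕ) :
    Ev T h fun n j t => HasDerivAt (tQ h u m n j) (tQ h u (m + 1) n j t) t :=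
  H.smooth_flux.mono fun _ _ _ h => h.hasDerivAt_iteratedDeriv m

theorem hasDerivAt_tZ (H : Approx T h N u M) (m : ℕ) :
    Ev T h fun n j t => HasDerivAt (tZ u m n j) (tZ u (m + 1) n j t) t :=
  H.smooth_zero_order.mono fun _ _ _ h => h.hasDerivAt_iteratedDeriv m

theorem hasDerivAt_tP (H : Approx T h N u M) (m : ℕ) :
    Ev T h fun n j t => HasDerivAt (tP h u m n j) (tP h u (m + 1) n j t) t :=
  ((H.hasDerivAt_tD m).and ((H.hasDerivAt_tD m).shift H.mesh)).mono
    fun _ _ _ h => (h.2.sub h.1).div_const _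

theorem eqn_tD (H : Approx T h N u M) (m : ℕ) :
    Ev T h fun n j t => tD u (m + 1) n (j + 1) t
      = (tQ h u m n (j + 1) t - tQ h u m n j t) / h n + tB h u m n (j + 1) t := by
  have h1 := ((H.smooth_flux.and (H.smooth_flux.shift H.mesh)).and
    ((H.smooth_slope.and H.smooth_zero_order).shift H.mesh)).and
      (H.eqn.and ((H.smooth.and (H.smooth.shift H.mesh)).shift H.mesh))
  refine h1.mono fun n j t ⟨⟨⟨a0, a1⟩, a2, a3⟩, a4, a5, a6⟩ => ?_
  have le : ((m : ℕ∞) : WithTop ℕ∞) ≤ (∞ : WithTop ℕ∞) := by exact_mod_cast le_top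
  replace a0 := a0.of_le le
  replace a1 := a1.of_le le
  have a2' := a2.of_le le
  replace a3 := a3.of_le le
  have e1 := (a1.sub a0).div_const (h n)
  have e2 : ContDiffAt ℝ m (fun r => 3 / (((j + 1 : ℕ) : ℝ) + 1) / h n * tP h u 0 n (j + 1) r) t :=
    contDiffAt_const.mul a2'
  have eB : ∀ r, tB h u 0 n (j + 1) r = 3 / (((j + 1 : ℕ) : ℝ) + 1) / h n * tP h u 0 n (j + 1) r
      - 3 / u n (j + 1) r := fun r => by
    simp only [tB, tZ, iteratedDeriv_zero, div_div]
  rw [tD, iteratedDeriv_succ', a4.iteratedDeriv_eq]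
  simp only [eB]
  rw [iteratedDeriv_fun_add e1 (e2.sub a3), iteratedDeriv_fun_sub e2 a3, iteratedDeriv_div_const,
    iteratedDeriv_fun_sub a1 a0, iteratedDeriv_const_mul_field, ← tP_eq_iteratedDeriv a5 a6, tB,
    div_div]
  rfl

end Approx

variable {T M : ℝ} {h : ℕ → ℝ} {N : ℕ → ℕ} {u : ℕ → ℕ → ℝ → ℝ}

theorem LB.uniform {F : ℕ → ℕ → ℕ → ℝ → ℝ} {m : ℕ} (hF : ∀ i, 1 ≤ i → i < m → LB T h (F i))
    (b : Box T) : ∃ B : ℝ, ∀ᶠ n in atTop, ∀ j ∈ b.idx (h n), ∀ t ∈ Icc b.t₁ b.t₂,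
      ∀ i, 1 ≤ i → i < m → |F i n j t| ≤ B := by
  induction m with
  | zero => exact ⟨0, Eventually.of_forall fun n j _ t _ i _ hi => absurd hi (Nat.not_lt_zero i)⟩
  | succ m ih =>
    obtain ⟨B, hB⟩ := ih fun i h1 h2 => hF i h1 (by omega)
    rcases Nat.eq_zero_or_pos m with rfl | hm
    · exact ⟨B, Eventually.of_forall fun n j _ t _ i _ hi => by omega⟩
    obtain ⟨C, -, hC⟩ := hF m hm (by omega) b
    refine ⟨max B C, ?_⟩
    filter_upwards [hB, hC] with n h1 h2 j hj t ht i hi hi'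
    rcases Nat.lt_succ_iff_lt_or_eq.1 hi' with h | rfl
    · exact (h1 j hj t ht i hi h).trans (le_max_left _ _)
    · exact (h2 j hj t ht).trans (le_max_right _ _)

/-- The part of the differentiated flux which does not involve the highest derivative. -/
noncomputable def tR (h : ℕ → ℝ) (u : ℕ → ℕ → ℝ → ℝ) (m n j : ℕ) (t : ℝ) : ℝ :=
  tQ h u m n j t - 1 / (1 + tP h u 0 n j t ^ 2) * tP h u m n j t

theorem LB.zero : LB T h fun _ _ _ => 0 := fun _ => ⟨0, le_rfl, by simp⟩

theorem ST.zero (H : Mesh h N) : ST T h fun _ _ _ => 0 := (LB.l2 H LB.zero).st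

namespace Approx

theorem dom_tZ (H : Approx T h N u M) {m : ℕ} (hU : ∀ i, 1 ≤ i → i < m → LB T h (tD u i)) :
    Dom T h (tZ u m) (tD u m) fun _ _ _ => 0 := fun b => by
  obtain ⟨B, hB⟩ := LB.uniform hU b
  obtain ⟨c, C, hc, hr⟩ := H.range b
  obtain ⟨D, hD, h0⟩ := chain_bound (isOpen_Ioi (a := 0)) (isCompact_Icc (a := c) (b := C))
    (fun x hx => hc.trans_le hx.1) B m (fun x => 3 / x)
    (contDiffOn_const.div contDiffOn_id fun x hx => (mem_Ioi.1 hx).ne')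
  refine ⟨D, hD, ?_⟩
  filter_upwards [hB, hr, H.smooth b] with n h1 h2 h3 j hj t ht
  rw [abs_zero, add_zero]
  exact h0 _ t (h3 j hj t ht) (h2 j hj t ht) (h1 j hj t ht)

theorem dom_tQ (H : Approx T h N u M) {m : ℕ} (hP : ∀ i, 1 ≤ i → i < m → LB T h (tP h u i)) :
    Dom T h (tQ h u m) (tP h u m) fun _ _ _ => 0 := fun b => by
  obtain ⟨B, hB⟩ := LB.uniform hP b
  obtain ⟨D, hD, h0⟩ := chain_bound isOpen_univ (isCompact_Icc (a := -M) (b := M))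
    (subset_univ _) B m arctan contDiff_arctan.contDiffOn
  refine ⟨D, hD, ?_⟩
  filter_upwards [hB, H.slope_le b, H.smooth_slope b, H.smooth b, H.smooth.shift H.mesh b] with
    n h1 h2 h3 h4 h5 j hj t ht
  have e := fun i => tP_eq_iteratedDeriv (h := h) (m := i) (h4 j hj t ht) (h5 j hj t ht)
  rw [abs_zero, add_zero, e]
  exact h0 _ t (h3 j hj t ht) (abs_le.1 (h2 j hj t ht)) fun i hi hi' => e i ▸ h1 j hj t ht i hi hi'

theorem dom_tP (H : Approx T h N u M) {m : ℕ} (hP : ∀ i, 1 ≤ i → i < m → LB T h (tP h u i)) :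
    Dom T h (tP h u m) (tQ h u m) fun _ _ _ => 0 := fun b => by
  have hQ : ∀ i, 1 ≤ i → i < m → LB T h (tQ h u i) := fun i hi hi' =>
    LB.dom (H.dom_tQ fun k hk hk' => hP k hk (hk'.trans hi')) (hP i hi hi') LB.zero
  obtain ⟨B, hB⟩ := LB.uniform hQ b
  have hsub : Icc (arctan (-M)) (arctan M) ⊆ Ioo (-(π / 2)) (π / 2) :=
    fun x hx => ⟨(neg_pi_div_two_lt_arctan _).trans_le hx.1,
      hx.2.trans_lt (arctan_lt_pi_div_two _)⟩
  obtain ⟨D, hD, h0⟩ := chain_bound isOpen_Ioo isCompact_Icc hsub B m tan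
    fun x hx => (contDiffAt_tan.2 (cos_pos_of_mem_Ioo hx).ne').contDiffWithinAt
  refine ⟨D, hD, ?_⟩
  filter_upwards [hB, H.slope_le b, H.smooth_flux b, H.smooth b, H.smooth.shift H.mesh b] with
    n h1 h2 h3 h4 h5 j hj t ht
  rw [abs_zero, add_zero, tP_eq_iteratedDeriv (h4 j hj t ht) (h5 j hj t ht)]
  have h6 := abs_le.1 (h2 j hj t ht)
  have := h0 _ t (h3 j hj t ht) ⟨arctan_strictMono.monotone h6.1,
    arctan_strictMono.monotone h6.2⟩ (h1 j hj t ht)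
  simp only [tan_arctan] at this
  exact this

theorem tR_le (H : Approx T h N u M) {m : ℕ} (hP : ∀ i, 1 ≤ i → i < m → LB T h (tP h u i))
    (b : Box T) : ∃ C, 0 ≤ C ∧ ∀ᶠ n in atTop, ∀ j ∈ b.idx (h n), ∀ t ∈ Icc b.t₁ b.t₂,
      |tR h u (m + 1) n j t| ≤ C * ((1 + |tP h u m n j t|) * (1 + |tP h u 1 n j t|)) := by
  obtain ⟨B, hB⟩ := LB.uniform hP b
  obtain ⟨D, hD, h0⟩ := chain_remainder isOpen_univ (isCompact_Icc (a := -M) (b := M))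
    (subset_univ _) B m contDiff_arctan.contDiffOn
  refine ⟨D, hD, ?_⟩
  filter_upwards [hB, H.slope_le b, H.smooth_slope b, H.smooth b, H.smooth.shift H.mesh b] with
    n h1 h2 h3 h4 h5 j hj t ht
  have e := fun i => tP_eq_iteratedDeriv (h := h) (m := i) (h4 j hj t ht) (h5 j hj t ht)
  have := h0 _ t (h3 j hj t ht) (abs_le.1 (h2 j hj t ht))
    fun i hi hi' => e i ▸ h1 j hj t ht i hi hi'
  rwa [← e, ← e, ← iteratedDeriv_one (f := tP h u 0 n j), ← e,
    (hasDerivAt_arctan _).deriv] at this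

theorem dom_tB (H : Approx T h N u M) (m : ℕ) : Dom T h (tB h u m) (tP h u m) (tZ u m) :=
  fun b => by
  refine ⟨3 / b.X₁ + 1, by have := b.X₁_pos; positivity, ?_⟩
  refine Eventually.of_forall fun n j hj t _ => ?_
  have hh := H.mesh.pos n
  have hx := b.X₁_pos
  have h1 := ((Box.mem_idx hh).1 hj).1
  have h2 : |3 / ((j + 1) * h n)| ≤ 3 / b.X₁ := by
    rw [abs_of_nonneg (by positivity)]
    gcongr
    linarith
  have h3 := abs_sub (3 / ((j + 1) * h n) * tP h u m n j t) (tZ u m n j t)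
  rw [abs_mul] at h3
  have h4 := mul_le_mul_of_nonneg_right h2 (abs_nonneg (tP h u m n j t))
  have h5 : 0 ≤ 3 / b.X₁ := by positivity
  have h6 := mul_nonneg h5 (abs_nonneg (tZ u m n j t))
  have h7 := abs_nonneg (tP h u m n j t)
  simp only [tB]
  nlinarith only [h3, h4, h5, h6, h7]

/-- Parabolic energy estimate for the differentiated equation. -/
theorem l2_tD (H : Approx T h N u M) {m : ℕ} (hU : ST T h (tD u m)) (hR : ST T h (tR h u m))
    (hZ : ST T h (tZ u m)) : L2 T h (tD u m) ∧ ST T h (tP h u m) := by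
  refine energy_flux H.mesh (V := tD u (m + 1)) (F := tQ h u m) (R := tR h u m)
    (G := fun n j t => -tZ u m n j t) (a := fun n j t => 1 / (1 + tP h u 0 n j t ^ 2))
    (c := fun n j _ => 3 / ((j + 1) * h n)) (H.hasDerivAt_tD m) (fun b => ?_) (fun b => ?_)
    ?_ hU hR ?_
  · refine ⟨1 / (1 + M ^ 2), 3 / b.X₁, by positivity, ?_⟩
    filter_upwards [H.slope_le b] with n h1 j hj t ht
    have hh := H.mesh.pos n
    have hx := b.X₁_pos
    have h2 := ((Box.mem_idx hh).1 hj).1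
    refine ⟨by simp only [tR]; ring, ?_, ?_, ?_⟩
    · have := sq_le_sq.2 ((h1 j hj t ht).trans (le_abs_self M))
      gcongr
    · rw [div_le_one (by positivity)]
      linarith [sq_nonneg (tP h u 0 n j t)]
    · rw [abs_of_nonneg (by positivity)]
      gcongr
      linarith
  · refine Eventually.of_forall fun n j _ t _ => ?_
    simp only [tP]
    have := (H.mesh.pos n).ne'
    field_simp
  · refine (H.eqn_tD m).mono fun n j t e => ?_
    simp only [e, tB, sub_eq_add_neg]
  · intro b
    simpa using hZ b

end Approx

end Lattice

/-- The primitive of `arctan` vanishing at zero is nonnegative. -/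
theorem half_log_le_mul_arctan (p : ℝ) :
    1 / 2 * log (1 + p ^ 2) ≤ p * arctan p := by
  wlog hp : 0 ≤ p generalizing p
  · have := this (-p) (by linarith)
    rwa [neg_sq, arctan_neg, neg_mul_neg] at this
  have hd : ∀ q : ℝ, HasDerivAt (fun q => q * arctan q - 1 / 2 * log (1 + q ^ 2))
      (arctan q) q := fun q => by
    have h1 : (1 + q ^ 2) ≠ 0 := by positivity
    have := ((hasDerivAt_id q).mul (hasDerivAt_arctan q)).sub
      ((((hasDerivAt_pow 2 q).const_add 1).log h1).const_mul (1 / 2))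
    refine this.congr_deriv ?_
    simp only [id]
    field_simp
    ring
  have hm := monotoneOn_of_hasDerivWithinAt_nonneg (convex_Ici (0 : ℝ))
    (fun q _ => (hd q).continuousAt.continuousWithinAt) (fun q _ => (hd q).hasDerivWithinAt)
    fun q hq => arctan_nonneg.2 (interior_subset hq)
  have := hm self_mem_Ici hp hp
  simp at this
  linarith

namespace Lattice

variable {T M : ℝ} {h : ℕ → ℝ} {N : ℕ → ℕ} {u F : ℕ → ℕ → ℝ → ℝ}

theorem ST.unshift (H : Mesh h N) (hF : ST T h fun n j => F n (j + 1)) : ST T h F := fun b => by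
  obtain ⟨C, hC, h0⟩ := hF b.wide
  refine ⟨C, hC, ?_⟩
  filter_upwards [h0, H.le (half_pos b.X₁_pos)] with n h1 h2
  have hh := H.pos n
  refine h1.mono (by simp only [Box.wide]; linarith [b.t₁_pos]) le_rfl le_rfl fun t _ =>
    mul_le_mul_of_nonneg_left ?_ hh.le
  have hpos : ∀ j ∈ b.idx (h n), 1 ≤ j := fun j hj => by
    by_contra h0
    have := ((Box.mem_idx hh).1 hj).1
    simp only [Nat.lt_one_iff.1 (not_le.1 h0), Nat.cast_zero, zero_mul] at this
    linarith [b.X₁_pos]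
  calc ∑ j ∈ b.idx (h n), F n j t ^ 2 = ∑ j ∈ b.idx (h n), F n (j - 1 + 1) t ^ 2 :=
        sum_congr rfl fun j hj => by rw [Nat.sub_add_cancel (hpos j hj)]
    _ = ∑ i ∈ (b.idx (h n)).image (· - 1), F n (i + 1) t ^ 2 := by
        rw [Finset.sum_image]
        intro i hi j hj hij
        have := hpos i hi
        have := hpos j hj
        simp only at hij
        omega
    _ ≤ _ := by
        refine sum_le_sum_of_subset_of_nonneg (fun i hi => ?_) fun _ _ _ => sq_nonneg _
        obtain ⟨j, hj, rfl⟩ := Finset.mem_image.1 hi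
        have h3 := (Box.mem_idx hh).1 hj
        rw [Box.mem_idx hh, Nat.cast_sub (hpos j hj), Nat.cast_one]
        simp only [Box.wide]
        constructor <;> nlinarith

namespace Approx

theorem hmul_flux (H : Approx T h N u M) (m : ℕ) : Ev T h fun n j t =>
    h n * ((tQ h u m n (j + 1) t - tQ h u m n j t) / h n) = tQ h u m n (j + 1) t - tQ h u m n j t :=
  fun b => Eventually.of_forall fun n j _ t _ => mul_div_cancel₀ _ (H.mesh.pos n).ne'

theorem hmul_tP (H : Approx T h N u M) (m : ℕ) : Ev T h fun n j t =>
    h n * tP h u m n j t = tD u m n (j + 1) t - tD u m n j t :=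
  fun b => Eventually.of_forall fun n j _ t _ => mul_div_cancel₀ _ (H.mesh.pos n).ne'

theorem slope_lb (H : Approx T h N u M) : LB T h (tP h u 0) := fun b =>
  ⟨|M|, abs_nonneg _, (H.slope_le b).mono fun n hn j hj t ht => (hn j hj t ht).trans (le_abs_self M)⟩

theorem st_tB (H : Approx T h N u M) {m : ℕ} (hP : ST T h (tP h u m)) (hZ : ST T h (tZ u m)) :
    ST T h fun n j => tB h u m n (j + 1) :=
  ST.shift H.mesh (ST.dom H.mesh (H.dom_tB m) hP hZ)

theorem l2_tB (H : Approx T h N u M) {m : ℕ} (hP : L2 T h (tP h u m)) (hZ : L2 T h (tZ u m)) :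
    L2 T h fun n j => tB h u m n (j + 1) :=
  L2.shift H.mesh (L2.dom H.mesh (H.dom_tB m) hP hZ)

theorem tD_lb_zero (H : Approx T h N u M) : LB T h (tD u 0) := fun b => by
  obtain ⟨c, C, hc, hn⟩ := H.range b
  refine ⟨|C|, abs_nonneg _, hn.mono fun n hn j hj t ht => ?_⟩
  have := hn j hj t ht
  simp only [tD, iteratedDeriv_zero]
  exact abs_le_abs (by linarith) (by linarith)

theorem st_tD_one (H : Approx T h N u M) : ST T h (tD u 1) := by
  have hQ : LB T h (tQ h u 0) := LB.dom (H.dom_tQ fun i h1 h2 => by omega) H.slope_lb LB.zero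
  have hZ : LB T h (tZ u 0) := LB.dom (H.dom_tZ fun i h1 h2 => by omega) H.tD_lb_zero LB.zero
  refine ST.unshift H.mesh (energy_cubic H.mesh (Q := tQ h u 0) (V := tP h u 1)
    (D := fun n j t => (tQ h u 0 n (j + 1) t - tQ h u 0 n j t) / h n)
    (F := fun n j => tD u 1 n (j + 1)) (R := fun n j => tB h u 0 n (j + 1)) (E := fun _ _ _ => 0)
    (Y := fun n j t => tP h u 0 n j t * arctan (tP h u 0 n j t)
      - 1 / 2 * log (1 + tP h u 0 n j t ^ 2)) (P := fun _ _ _ => 0)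
    ?_ (H.eqn_tD 0) (H.hmul_flux 0) ?_ (fun b => ?_) (fun n j t => ?_) (hQ.l2 H.mesh).st
    (H.st_tB (H.slope_lb.l2 H.mesh).st (hZ.l2 H.mesh).st) (ST.zero H.mesh)).2
  · refine (H.hasDerivAt_tP 0).mono fun n j t hd => ?_
    have h1 : (1 + tP h u 0 n j t ^ 2) ≠ 0 := by positivity
    have := (hd.mul hd.arctan).sub ((((hd.pow 2).const_add 1).log h1).const_mul (1 / 2))
    refine this.congr_deriv ?_
    simp only [tQ, iteratedDeriv_zero, Pi.pow_apply]
    field_simp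
    ring
  · exact fun b => Eventually.of_forall fun n j _ t _ => rfl
  · refine ⟨4 + 2 * |M|, ?_⟩
    filter_upwards [H.slope_le b] with n hn j hj t ht
    have h1 := abs_arctan_le (tP h u 0 n j t)
    have h2 := half_log_le_mul_arctan (tP h u 0 n j t)
    have h3 : 0 ≤ log (1 + tP h u 0 n j t ^ 2) :=
      log_nonneg (by linarith [sq_nonneg (tP h u 0 n j t)])
    have h4 : |tP h u 0 n j t * arctan (tP h u 0 n j t)| ≤ |M| * 2 := by
      rw [abs_mul]
      exact mul_le_mul ((hn j hj t ht).trans (le_abs_self M)) h1 (abs_nonneg _) (abs_nonneg _)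
    have h5 := (abs_le.1 h4).2
    have h6 := abs_nonneg M
    have h7 : tQ h u 0 n j t ^ 2 ≤ 4 := by
      have := pow_le_pow_left₀ (abs_nonneg _) h1 2
      rw [sq_abs] at this
      simp only [tQ, iteratedDeriv_zero]
      linarith
    refine ⟨by rw [abs_zero]; positivity, ?_, ?_⟩
    · have := mul_nonneg (show 0 ≤ 4 + 2 * |M| by positivity) (sub_nonneg.2 h2)
      linarith
    · have := mul_nonneg (show 0 ≤ 4 + 2 * |M| by positivity) (sq_nonneg (tQ h u 0 n j t))
      linarith
  · exact sub_nonneg.2 (half_log_le_mul_arctan _)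

/-- Energy estimate for the differentiated flux. -/
theorem l2_tQ (H : Approx T h N u M) {m : ℕ} (hP : ∀ i, 1 ≤ i → i < m → LB T h (tP h u i))
    (hPm : ST T h (tP h u m)) (hP1 : ST T h (tP h u 1)) (hZ : ST T h (tZ u m)) :
    L2 T h (tQ h u m) ∧ ST T h (tD u (m + 1)) := by
  have hQ := ST.dom H.mesh (H.dom_tQ hP) hPm (ST.zero H.mesh)
  refine (energy_cubic H.mesh (Q := tQ h u m) (V := tP h u (m + 1))
    (D := fun n j t => (tQ h u m n (j + 1) t - tQ h u m n j t) / h n)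
    (F := fun n j => tD u (m + 1) n (j + 1)) (R := fun n j => tB h u m n (j + 1))
    (E := fun n j t => (1 + tP h u 0 n j t ^ 2) * tQ h u m n j t * tR h u (m + 1) n j t
      + tQ h u m n j t ^ 2 * (tP h u 0 n j t * tP h u 1 n j t))
    (Y := fun n j t => 1 / 2 * ((1 + tP h u 0 n j t ^ 2) * tQ h u m n j t ^ 2)) (P := tP h u 1)
    ?_ (H.eqn_tD m) (H.hmul_flux m) ?_ (fun b => ?_) (fun n j t => by positivity) hQ
    (H.st_tB hPm hZ) hP1).imp_right (ST.unshift H.mesh)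
  · refine ((H.hasDerivAt_tP 0).and (H.hasDerivAt_tQ m)).mono fun n j t ⟨hp, hq⟩ => ?_
    refine ((((hp.pow 2).const_add 1).mul (hq.pow 2)).const_mul (1 / 2)).congr_deriv ?_
    simp only [tR, Pi.pow_apply]
    field_simp
    ring
  · exact fun b => Eventually.of_forall fun n j _ t _ => rfl
  · obtain ⟨C, hC, h1⟩ := H.tR_le hP b
    obtain ⟨D, hD, h2⟩ := H.dom_tP hP b
    set K := |M|
    refine ⟨(1 + K ^ 2) * C * (2 * (1 + D)) + K + 2 * (1 + K ^ 2), ?_⟩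
    filter_upwards [H.slope_le b, h1, h2] with n h0 h1 h2 j hj t ht
    have e0 := (h0 j hj t ht).trans (le_abs_self M)
    have e1 := h1 j hj t ht
    have e2 := h2 j hj t ht
    rw [abs_zero, add_zero] at e2
    have e3 : tP h u 0 n j t ^ 2 ≤ K ^ 2 := by
      rw [← sq_abs]; exact pow_le_pow_left₀ (abs_nonneg _) e0 2
    set p := tP h u 0 n j t
    set q := tQ h u m n j t
    set r := tR h u (m + 1) n j t
    set s := tP h u m n j t
    set v := tP h u 1 n j t
    have hK : 0 ≤ K := abs_nonneg M
    have hs := abs_nonneg s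
    have hv := abs_nonneg v
    have hq := abs_nonneg q
    have hpos : 0 ≤ (1 + K ^ 2) * C * (2 * (1 + D)) := by positivity
    refine ⟨?_, ?_, ?_⟩
    · have b1 : |(1 + p ^ 2) * q * r| ≤ (1 + K ^ 2) * C * (2 * (1 + D)) * ((1 + q ^ 2) * (1 + |v|)) := by
        have f1 : |q| * (1 + |s|) ≤ 2 * (1 + D) * (1 + q ^ 2) := by
          rw [← sq_abs q]
          have : |q| * |s| ≤ |q| * (D * (1 + |q|)) := mul_le_mul_of_nonneg_left e2 hq
          nlinarith only [this, sq_nonneg (|q| - 1), hD, hq, mul_nonneg hD (sq_nonneg (|q| - 1)),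
            mul_nonneg hD hq, mul_nonneg hD (sq_nonneg |q|)]
        calc |(1 + p ^ 2) * q * r| = (1 + p ^ 2) * |q| * |r| := by
              rw [abs_mul, abs_mul, abs_of_nonneg (show 0 ≤ 1 + p ^ 2 by positivity)]
          _ ≤ (1 + K ^ 2) * |q| * (C * ((1 + |s|) * (1 + |v|))) := by gcongr
          _ = (1 + K ^ 2) * C * (|q| * (1 + |s|)) * (1 + |v|) := by ring
          _ ≤ (1 + K ^ 2) * C * (2 * (1 + D) * (1 + q ^ 2)) * (1 + |v|) := by gcongr
          _ = _ := by ring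
      have b2 : |q ^ 2 * (p * v)| ≤ K * ((1 + q ^ 2) * (1 + |v|)) := by
        rw [abs_mul, abs_mul, abs_of_nonneg (sq_nonneg q)]
        calc q ^ 2 * (|p| * |v|) ≤ (1 + q ^ 2) * (K * (1 + |v|)) := by gcongr <;> linarith
          _ = _ := by ring
      have b3 : 0 ≤ 2 * (1 + K ^ 2) * ((1 + q ^ 2) * (1 + |v|)) := by positivity
      refine (abs_add_le _ _).trans ?_
      linarith
    · have b1 : q ^ 2 ≤ (1 + p ^ 2) * q ^ 2 := le_mul_of_one_le_left (sq_nonneg q)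
        (by linarith [sq_nonneg p])
      have b2 : 0 ≤ 1 + 1 / 2 * ((1 + p ^ 2) * q ^ 2) := by positivity
      have b3 := mul_le_mul_of_nonneg_right (show 2 ≤ (1 + K ^ 2) * C * (2 * (1 + D)) + K
        + 2 * (1 + K ^ 2) by nlinarith only [hpos, hK, sq_nonneg K]) b2
      linarith
    · have b1 : (1 + p ^ 2) * q ^ 2 ≤ (1 + K ^ 2) * q ^ 2 := by gcongr
      have b2 := mul_nonneg hpos (show 0 ≤ 1 + q ^ 2 by positivity)
      have b3 := mul_nonneg hK (show 0 ≤ 1 + q ^ 2 by positivity)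
      nlinarith only [b1, b2, b3, sq_nonneg K, sq_nonneg q, mul_nonneg (sq_nonneg K) (sq_nonneg q)]

end Approx

variable {T M : ℝ} {h : ℕ → ℝ} {N : ℕ → ℕ} {u F G : ℕ → ℕ → ℝ → ℝ}

theorem Dom.of_le (C : ℝ) {K : ℕ → ℕ → ℝ → ℝ}
    (hF : ∀ n j t, |F n j t| ≤ C * (1 + |G n j t| + |K n j t|)) : Dom T h F G K := fun b =>
  ⟨|C|, abs_nonneg _, Eventually.of_forall fun n j _ t _ => (hF n j t).trans
    (mul_le_mul_of_nonneg_right (le_abs_self C) (by positivity))⟩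

namespace Approx

theorem flux_difference (H : Approx T h N u M) (m : ℕ) : Dom T h
    (fun n j t => (tQ h u m n (j + 1) t - tQ h u m n j t) / h n)
    (fun n j => tD u (m + 1) n (j + 1)) fun n j => tB h u m n (j + 1) := fun b => by
  refine ⟨1, zero_le_one, (H.eqn_tD m b).mono fun n hn j hj t ht => ?_⟩
  have := hn j hj t ht
  beta_reduce at this ⊢
  rw [← sub_eq_iff_eq_add] at this
  rw [← this]
  linarith [abs_sub (tD u (m + 1) n (j + 1) t) (tB h u m n (j + 1) t)]

theorem st_tR (H : Approx T h N u M) {m : ℕ} (hP : ∀ i, 1 ≤ i → i < m → LB T h (tP h u i))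
    (hSB : SB T h (tP h u m)) (hPm : L2 T h (tP h u m)) (hP1 : L2 T h (tP h u 1)) :
    ST T h (tR h u (m + 1)) := by
  have h1 := SB.mul H.mesh hSB hP1
  have h2 : L2 T h fun n j t => |tP h u m n j t| + |tP h u 1 n j t| :=
    L2.dom H.mesh (Dom.of_le 1 fun n j t => by rw [abs_of_nonneg (by positivity)]; linarith) hPm hP1
  refine ST.dom H.mesh (fun b => ?_) h1 h2.st
  obtain ⟨C, hC, hn⟩ := H.tR_le hP b
  refine ⟨C, hC, hn.mono fun n hn j hj t ht => (hn j hj t ht).trans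
    (mul_le_mul_of_nonneg_left (le_of_eq ?_) hC)⟩
  rw [abs_mul, abs_of_nonneg (a := |tP h u m n j t| + |tP h u 1 n j t|) (by positivity)]
  ring

/-- Interior bounds for all time derivatives, by induction on the order. -/
theorem regularity (H : Approx T h N u M) (m : ℕ) :
    (∀ i, 1 ≤ i → i < m + 1 → LB T h (tD u i)) ∧ (∀ i, 1 ≤ i → i < m + 1 → LB T h (tP h u i)) ∧
      L2 T h (tD u (m + 1)) ∧ ST T h (tP h u (m + 1)) := by
  induction m with
  | zero =>
    refine ⟨fun i _ _ => by omega, fun i _ _ => by omega, H.l2_tD H.st_tD_one ?_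
      (ST.dom H.mesh (H.dom_tZ fun i _ _ => by omega) H.st_tD_one (ST.zero H.mesh))⟩
    refine ST.dom H.mesh (fun b => ⟨0, le_rfl, ?_⟩) (ST.zero H.mesh) (ST.zero H.mesh)
    filter_upwards [H.hasDerivAt_tP 0 b] with n hn j hj t ht
    have h1 := (hn j hj t ht).arctan.deriv
    rw [← iteratedDeriv_one] at h1
    rw [tR, tQ, zero_add, h1]
    simp
  | succ m ih =>
    obtain ⟨hU, hP, hUm, hPm⟩ := ih
    have hP1 : ST T h (tP h u 1) := by
      rcases Nat.eq_zero_or_pos m with rfl | hm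
      · exact hPm
      · exact ((hP 1 le_rfl (by omega)).l2 H.mesh).st
    have hZ := L2.dom H.mesh (H.dom_tZ hU) hUm (LB.zero.l2 H.mesh)
    obtain ⟨hQ, hU'⟩ := H.l2_tQ hP hPm hP1 hZ.st
    have hPm := L2.dom H.mesh (H.dom_tP hP) hQ (LB.zero.l2 H.mesh)
    have hP1 : L2 T h (tP h u 1) := by
      rcases Nat.eq_zero_or_pos m with rfl | hm
      · exact hPm
      · exact (hP 1 le_rfl (by omega)).l2 H.mesh
    have hUlb := LB.of_sobolev H.mesh (H.hmul_tP (m + 1)) hUm hPm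
    have hU2 : ∀ i, 1 ≤ i → i < m + 1 + 1 → LB T h (tD u i) := fun i hi hi' => by
      rcases Nat.lt_succ_iff_lt_or_eq.1 hi' with h | rfl
      exacts [hU i hi h, hUlb]
    have hSB := SB.of_sobolev H.mesh (H.hmul_flux (m + 1)) hQ.st
      (ST.dom H.mesh (H.flux_difference (m + 1)) (ST.shift H.mesh hU') (H.l2_tB hPm hZ).st)
    have hPSB := SB.dom (H.dom_tP hP) hSB LB.zero
    obtain ⟨hU3, hP3⟩ := H.l2_tD hU' (H.st_tR hP hPSB hPm hP1)
      (ST.dom H.mesh (H.dom_tZ hU2) hU' (ST.zero H.mesh))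
    have hQlb := LB.of_sobolev H.mesh (H.hmul_flux (m + 1)) hQ
      (L2.dom H.mesh (H.flux_difference (m + 1)) (L2.shift H.mesh hU3) (H.l2_tB hPm hZ))
    have hPlb := LB.dom (H.dom_tP hP) hQlb LB.zero
    refine ⟨hU2, fun i hi hi' => ?_, hU3, hP3⟩
    rcases Nat.lt_succ_iff_lt_or_eq.1 hi' with h | rfl
    exacts [hP i hi h, hPlb]

theorem lb_tD (H : Approx T h N u M) (m : ℕ) : LB T h (tD u m) := by
  rcases m with _ | m
  · exact H.tD_lb_zero
  · exact (H.regularity (m + 1)).1 _ (by omega) (by omega)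

theorem lb_tP (H : Approx T h N u M) (m : ℕ) : LB T h (tP h u m) := by
  rcases m with _ | m
  · exact H.slope_lb
  · exact (H.regularity (m + 1)).2.1 _ (by omega) (by omega)

theorem lb_tQ (H : Approx T h N u M) (m : ℕ) : LB T h (tQ h u m) :=
  LB.dom (H.dom_tQ fun i _ _ => H.lb_tP i) (H.lb_tP m) LB.zero

theorem lb_tB (H : Approx T h N u M) (m : ℕ) : LB T h (tB h u m) :=
  LB.dom (H.dom_tB m) (H.lb_tP m) (LB.dom (H.dom_tZ fun i _ _ => H.lb_tD i) (H.lb_tD m) LB.zero)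

end Approx

variable {L : ℝ} {f : ℝ → ℝ} {x t : ℝ}

theorem StrictSuper.barrierAt {P : ℝ → ℝ → ℝ} (H : StrictSuper L f P x t) : BarrierAt L f P x t := by
  classical
  refine ⟨{P}, by simpa using H, Eventually.of_forall fun q _ => ?_⟩
  simp

theorem BarrierAt.congr {b b' : ℝ → ℝ → ℝ} (H : BarrierAt L f b x t)
    (h : ∀ᶠ q : ℝ × ℝ in nhds (x, t), 0 < q.1 → b' q.1 q.2 = b q.1 q.2) : BarrierAt L f b' x t := by
  obtain ⟨S, hS, hb⟩ := H
  refine ⟨S, hS, ?_⟩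
  filter_upwards [hb, h] with q h1 h2 h3
  rw [h2 h3]; exact h1 h3

theorem BarrierAt.min {b b' : ℝ → ℝ → ℝ} (H : BarrierAt L f b x t) (H' : BarrierAt L f b' x t) :
    BarrierAt L f (fun y r => min (b y r) (b' y r)) x t := by
  classical
  obtain ⟨S, hS, hb⟩ := H
  obtain ⟨S', hS', hb'⟩ := H'
  refine ⟨S ∪ S', fun P hP => (Finset.mem_union.1 hP).elim (hS P) (hS' P), ?_⟩
  filter_upwards [hb, hb'] with q h1 h2 h3
  obtain ⟨⟨P, hP, e⟩, h4⟩ := h1 h3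
  obtain ⟨⟨P', hP', e'⟩, h5⟩ := h2 h3
  refine ⟨?_, fun Q hQ => (Finset.mem_union.1 hQ).elim (fun h => (min_le_left _ _).trans (h4 Q h))
    (fun h => (min_le_right _ _).trans (h5 Q h))⟩
  rcases le_total (b q.1 q.2) (b' q.1 q.2) with h | h
  · exact ⟨P, Finset.mem_union_left _ hP, by rw [min_eq_left h, e]⟩
  · exact ⟨P', Finset.mem_union_right _ hP', by rw [min_eq_right h, e']⟩

/-- The function which is `b₁` where `ρ < m₁`, `b₂` where `ρ ≥ m₂` and the minimum in between. -/
noncomputable def glue (ρ : ℝ → ℝ → ℝ) (m₁ m₂ : ℝ) (b₁ b₂ : ℝ → ℝ → ℝ) (x t : ℝ) : ℝ :=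
  if ρ x t < m₁ then b₁ x t else if ρ x t < m₂ then min (b₁ x t) (b₂ x t) else b₂ x t

theorem glue_cases (ρ : ℝ → ℝ → ℝ) (m₁ m₂ : ℝ) (b₁ b₂ : ℝ → ℝ → ℝ) (x t : ℝ) :
    (ρ x t < m₂ ∨ ρ x t < m₁) ∧ glue ρ m₁ m₂ b₁ b₂ x t = b₁ x t ∨
      m₁ ≤ ρ x t ∧ glue ρ m₁ m₂ b₁ b₂ x t = b₂ x t := by
  unfold glue
  split_ifs with h1 h2
  · exact Or.inl ⟨Or.inr h1, rfl⟩
  · rcases le_total (b₁ x t) (b₂ x t) with h | h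
    · exact Or.inl ⟨Or.inl h2, min_eq_left h⟩
    · exact Or.inr ⟨not_lt.1 h1, min_eq_right h⟩
  · exact Or.inr ⟨not_lt.1 h1, rfl⟩

theorem glue_of_le {ρ : ℝ → ℝ → ℝ} {m₁ m₂ : ℝ} (b₁ b₂ : ℝ → ℝ → ℝ) (hm : m₁ ≤ m₂)
    (h : m₂ ≤ ρ x t) : glue ρ m₁ m₂ b₁ b₂ x t = b₂ x t := by
  rw [glue, if_neg (not_lt.2 (hm.trans h)), if_neg (not_lt.2 h)]

theorem glue_le_left {ρ : ℝ → ℝ → ℝ} {m₁ m₂ : ℝ} {b₁ b₂ : ℝ → ℝ → ℝ}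
    (h : m₂ ≤ ρ x t → b₂ x t ≤ b₁ x t) : glue ρ m₁ m₂ b₁ b₂ x t ≤ b₁ x t := by
  unfold glue
  split_ifs with h1 h2
  · exact le_rfl
  · exact min_le_left _ _
  · exact h (not_lt.1 h2)

theorem glue_le_right {ρ : ℝ → ℝ → ℝ} {m₁ m₂ : ℝ} {b₁ b₂ : ℝ → ℝ → ℝ}
    (h : m₁ ≤ ρ x t) : glue ρ m₁ m₂ b₁ b₂ x t ≤ b₂ x t := by
  unfold glue
  rw [if_neg (not_lt.2 h)]
  split_ifs
  · exact min_le_right _ _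
  · exact le_rfl

theorem BarrierAt.glue {ρ : ℝ → ℝ → ℝ} {α m₁ m₂ β : ℝ} {b₁ b₂ : ℝ → ℝ → ℝ} (hα : α < m₁)
    (hm : m₁ ≤ m₂) (hβ : m₂ < β) (hρ : ContinuousAt (fun q : ℝ × ℝ => ρ q.1 q.2) (x, t))
    (h1 : ρ x t < β → BarrierAt L f b₁ x t) (h2 : α < ρ x t → BarrierAt L f b₂ x t)
    (h12 : ∀ᶠ q : ℝ × ℝ in nhds (x, t), 0 < q.1 → α < ρ q.1 q.2 → ρ q.1 q.2 < m₁ →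
      b₁ q.1 q.2 ≤ b₂ q.1 q.2)
    (h21 : ∀ᶠ q : ℝ × ℝ in nhds (x, t), 0 < q.1 → m₂ ≤ ρ q.1 q.2 → ρ q.1 q.2 < β →
      b₂ q.1 q.2 ≤ b₁ q.1 q.2) :
    BarrierAt L f (glue ρ m₁ m₂ b₁ b₂) x t := by
  rcases lt_or_ge (ρ x t) m₁ with h | h
  · refine (h1 (h.trans (hm.trans_lt hβ))).congr ?_
    filter_upwards [hρ.eventually (gt_mem_nhds h)] with q hq _
    exact if_pos hq
  rcases lt_or_ge m₂ (ρ x t) with h' | h'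
  · refine (h2 (hα.trans_le h)).congr ?_
    filter_upwards [hρ.eventually (lt_mem_nhds h')] with q hq _
    exact glue_of_le _ _ hm hq.le
  · refine ((h1 (h'.trans_lt hβ)).min (h2 (hα.trans_le h))).congr ?_
    filter_upwards [hρ.eventually (lt_mem_nhds (hα.trans_le h)),
      hρ.eventually (gt_mem_nhds (h'.trans_lt hβ)), h12, h21] with q a1 a2 a3 a4 hq
    unfold Lattice.glue
    split_ifs with c1 c2
    · exact (min_eq_left (a3 hq a1 c1)).symm
    · rfl
    · exact (min_eq_right (a4 hq (not_lt.1 c2) a2)).symm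

/-- Away from the axis, a strict differential inequality for a smooth function suffices. -/
theorem StrictSuper.of_contDiffAt {P : ℝ → ℝ → ℝ} {Px : ℝ → ℝ} {Pxx Pt : ℝ} (hx : 0 < x)
    (hP : ContDiffAt ℝ 3 (fun q : ℝ × ℝ => P q.1 q.2) (x, t))
    (h1 : ∀ᶠ y in nhds x, HasDerivAt (fun y => P y t) (Px y) y) (h2 : HasDerivAt Px Pxx x)
    (h3 : HasDerivAt (fun r => P x r) Pt t) (hL : |Px x| < L)
    (hlt : Pxx / (1 + Px x ^ 2) + 3 * (Px x / x) - f (P x t) < Pt) : StrictSuper L f P x t := by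
  set G : ℝ × ℝ → ℝ := fun q => P q.1 q.2 with hG
  set Gx : ℝ × ℝ → ℝ := fun q => fderiv ℝ G q (1, 0) with hGx
  have cGx : ContDiffAt ℝ 2 Gx (x, t) :=
    (hP.fderiv_right (m := 2) (by norm_num)).clm_apply contDiffAt_const
  have cGt : ContDiffAt ℝ 2 (fun q => fderiv ℝ G q (0, 1)) (x, t) :=
    (hP.fderiv_right (m := 2) (by norm_num)).clm_apply contDiffAt_const
  have cGxx : ContDiffAt ℝ 1 (fun q => fderiv ℝ Gx q (1, 0)) (x, t) :=
    (cGx.fderiv_right (m := 1) (by norm_num)).clm_apply contDiffAt_const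
  have dx : ∀ (F : ℝ × ℝ → ℝ) (q : ℝ × ℝ), DifferentiableAt ℝ F q →
      HasDerivAt (fun y => F (y, q.2)) (fderiv ℝ F q (1, 0)) q.1 := fun F q h =>
    h.hasFDerivAt.comp_hasDerivAt q.1 ((hasDerivAt_id q.1).prodMk (hasDerivAt_const q.1 q.2))
  have dt : ∀ (F : ℝ × ℝ → ℝ) (q : ℝ × ℝ), DifferentiableAt ℝ F q →
      HasDerivAt (fun r => F (q.1, r)) (fderiv ℝ F q (0, 1)) q.2 := fun F q h =>
    h.hasFDerivAt.comp_hasDerivAt q.2 ((hasDerivAt_const q.2 q.1).prodMk (hasDerivAt_id q.2))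
  have evG : ∀ᶠ q in nhds (x, t), DifferentiableAt ℝ G q :=
    (hP.eventually (by norm_num)).mono fun q h => h.differentiableAt (by norm_num)
  have evGx : ∀ᶠ q in nhds (x, t), DifferentiableAt ℝ Gx q :=
    (cGx.eventually (by norm_num)).mono fun q h => h.differentiableAt (by norm_num)
  have evx : ∀ᶠ q : ℝ × ℝ in nhds (x, t), 0 < q.1 :=
    (continuous_fst.tendsto (x, t)).eventually (lt_mem_nhds hx)
  have ePx : Gx (x, t) = Px x :=
    (dx G (x, t) evG.self_of_nhds).unique h1.self_of_nhds
  have ePxx : fderiv ℝ Gx (x, t) (1, 0) = Pxx := by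
    refine (dx Gx (x, t) evGx.self_of_nhds).unique (h2.congr_of_eventuallyEq ?_)
    have : Tendsto (fun y : ℝ => (y, t)) (nhds x) (nhds (x, t)) :=
      (Continuous.prodMk_left t).tendsto x
    filter_upwards [h1, this.eventually evG] with y a b
    exact (dx G (y, t) b).unique a
  have ePt : fderiv ℝ G (x, t) (0, 1) = Pt := (dt G (x, t) evG.self_of_nhds).unique h3
  refine ⟨fun y r => Gx (y, r), fun y r => fderiv ℝ Gx (y, r) (1, 0), fun y r => Gx (y, r) / y,
    fun y r => fderiv ℝ G (y, r) (0, 1), ?_, hP.continuousAt, cGx.continuousAt, cGxx.continuousAt,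
    cGx.continuousAt.div continuousAt_fst hx.ne', cGt.continuousAt, fun h => absurd h hx.ne', ?_, ?_⟩
  · filter_upwards [evG, evGx, evx] with q a b c
    exact ⟨dx G q a, dx Gx q b, dt G q a, by field_simp⟩
  · beta_reduce; rwa [ePx]
  · beta_reduce; rw [ePx, ePxx, ePt]; exact hlt

end Lattice

theorem eventually_mul_rpow_le {a b : ℝ} (hab : b < a) (A : ℝ) {c : ℝ} (hc : 0 < c) :
    ∀ᶠ t : ℝ in 𝓝[>] 0, A * t ^ a ≤ c * t ^ b := by
  have h1 : Tendsto (fun t : ℝ => A * t ^ (a - b)) (𝓝[>] 0) (nhds (A * 0)) := by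
    refine Tendsto.const_mul A ?_
    have := (continuousAt_rpow_const 0 (a - b) (Or.inr (by linarith))).tendsto
    rw [zero_rpow (by linarith)] at this
    exact this.mono_left nhdsWithin_le_nhds
  rw [mul_zero] at h1
  filter_upwards [h1.eventually (gt_mem_nhds hc), self_mem_nhdsWithin] with t ht ht0
  have ht0 : (0:ℝ) < t := ht0
  rw [show a = (a - b) + b by ring, rpow_add ht0, ← mul_assoc]
  exact mul_le_mul_of_nonneg_right ht.le (by positivity)

theorem eventually_mul_pow_le {a b : ℕ} (hab : b < a) (A : ℝ) {c : ℝ} (hc : 0 < c) :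
    ∀ᶠ t : ℝ in 𝓝[>] 0, A * t ^ a ≤ c * t ^ b := by
  have := eventually_mul_rpow_le (a := a) (b := b) (by exact_mod_cast hab) A hc
  simpa only [rpow_natCast] using this

namespace Lattice

/-- The length scale `θ t^{k/3}` of the inner region. -/
noncomputable def scl (k : ℕ) (θ t : ℝ) : ℝ := θ * t ^ ((k : ℝ) / 3)

theorem scl_pos (k : ℕ) {θ t : ℝ} (hθ : 0 < θ) (ht : 0 < t) : 0 < scl k θ t := by
  unfold scl; positivity

theorem scl_cube (k : ℕ) {θ t : ℝ} (ht : 0 < t) : scl k θ t ^ 3 = θ ^ 3 * t ^ k := by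
  rw [scl, mul_pow, ← rpow_natCast (t ^ _), ← rpow_mul ht.le, ← rpow_natCast t k]
  congr 2; push_cast; ring

theorem hasDerivAt_scl (k : ℕ) (θ : ℝ) {t : ℝ} (ht : 0 < t) :
    HasDerivAt (scl k θ) (k / 3 * (scl k θ t / t)) t := by
  refine ((hasDerivAt_rpow_const (p := (k : ℝ) / 3) (Or.inl ht.ne')).const_mul
    θ).congr_deriv ?_
  rw [scl, rpow_sub ht, rpow_one]; ring

theorem continuousAt_scl (k : ℕ) (θ : ℝ) {q : ℝ × ℝ} (hq : 0 < q.2) :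
    ContinuousAt (fun q : ℝ × ℝ => scl k θ q.2) q :=
  ContinuousAt.comp (f := Prod.snd) (hasDerivAt_scl k θ hq).continuousAt continuousAt_snd

/-- The rescaled Alencar profile, with a small shift (multiplied by the sign `σ`). -/
noncomputable def inner (k : ℕ) (W : ℝ → ℝ) (σ θ Γ x t : ℝ) : ℝ :=
  σ * (scl k θ t * W (x / scl k θ t)) - Γ * t ^ (k - 1)

variable {K : ℝ} {W p p' B : ℝ → ℝ}

theorem strictSuper_inner_of_lt (hW : AlencarProfile K W p p' B) {k : ℕ} {σ θ Γ : ℝ}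
    (hσ : σ ^ 2 = 1) (hθ : 0 < θ) {L : ℝ} (hL : 1 < L) {f : ℝ → ℝ} {x t : ℝ} (hx : 0 ≤ x)
    (ht : 0 < t) (hlt : 3 * σ / (scl k θ t * W (x / scl k θ t)) - σ * f (σ * inner k W σ θ Γ x t)
      < σ * (k / 3 * (scl k θ t / t) * (W (x / scl k θ t) - x / scl k θ t * p (x / scl k θ t)))
        - Γ * ((k - 1 : ℕ) * t ^ (k - 1 - 1))) :
    StrictSuper L (fun v => σ * f (σ * v)) (inner k W σ θ Γ) x t := by
  have hW0 : ∀ z ≥ 0, 0 < W z := fun z hz => hz.trans_lt (hW.gt z hz)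
  have cW : Continuous W := continuous_iff_continuousAt.2 fun z => (hW.hasDerivAt z).continuousAt
  have cp : Continuous p :=
    continuous_iff_continuousAt.2 fun z => (hW.hasDerivAt_slope z).continuousAt
  have ev : ∀ᶠ q : ℝ × ℝ in nhds (x, t), 0 < q.2 :=
    (continuous_snd.tendsto (x, t)).eventually (lt_mem_nhds ht)
  have cs : ContinuousAt (fun q : ℝ × ℝ => scl k θ q.2) (x, t) := continuousAt_scl k θ ht
  have hs : scl k θ t ≠ 0 := (scl_pos k hθ ht).ne'
  have cz : ContinuousAt (fun q : ℝ × ℝ => q.1 / scl k θ q.2) (x, t) :=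
    continuousAt_fst.div cs hs
  have cc : ∀ {g : ℝ → ℝ}, Continuous g →
      ContinuousAt (fun q : ℝ × ℝ => g (q.1 / scl k θ q.2)) (x, t) := fun hg =>
    ContinuousAt.comp (f := fun q : ℝ × ℝ => q.1 / scl k θ q.2) hg.continuousAt cz
  have ct : ContinuousAt (fun q : ℝ × ℝ => q.2) (x, t) := continuousAt_snd
  set z := x / scl k θ t with hz
  have hz0 : 0 ≤ z := div_nonneg hx (scl_pos k hθ ht).le
  have hp : |σ * p z| ≤ 1 := by
    have : |σ| = 1 := by rw [← abs_one, ← sq_eq_sq_iff_abs_eq_abs]; simpa using hσ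
    rw [abs_mul, this, one_mul, abs_of_nonneg (hW.slope_nonneg z hz0)]
    exact hW.slope_le z hz0
  refine ⟨fun x t => σ * p (x / scl k θ t), fun x t => σ * (p' (x / scl k θ t) / scl k θ t),
    fun x t => σ * (B (x / scl k θ t) / scl k θ t),
    fun x t => σ * (k / 3 * (scl k θ t / t) * (W (x / scl k θ t)
      - x / scl k θ t * p (x / scl k θ t))) - Γ * ((k - 1 : ℕ) * t ^ (k - 1 - 1)),
    ?_, ?_, ?_, ?_, ?_, ?_, ?_, ?_, ?_⟩
  · filter_upwards [ev] with q hq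
    have hs' : scl k θ q.2 ≠ 0 := (scl_pos k hθ hq).ne'
    have hd : HasDerivAt (fun y : ℝ => y / scl k θ q.2) (1 / scl k θ q.2) q.1 :=
      (hasDerivAt_id q.1).div_const _
    refine ⟨?_, ?_, ?_, ?_⟩
    · refine (((((hW.hasDerivAt _).comp q.1 hd).const_mul (scl k θ q.2)).const_mul σ).sub_const
        _).congr_deriv ?_
      field_simp
    · refine (((hW.hasDerivAt_slope _).comp q.1 hd).const_mul σ).congr_deriv ?_
      field_simp
    · have h1 := hasDerivAt_scl k θ hq
      have h2 : HasDerivAt (fun r : ℝ => q.1 / scl k θ r)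
        (-(q.1 * (k / 3 * (scl k θ q.2 / q.2))) / scl k θ q.2 ^ 2) q.2 := by
        refine ((hasDerivAt_const q.2 q.1).div h1 hs').congr_deriv ?_
        ring
      refine (((h1.mul ((hW.hasDerivAt _).comp q.2 h2)).const_mul σ).sub
        ((hasDerivAt_pow (k - 1) q.2).const_mul Γ)).congr_deriv ?_
      simp only [Function.comp]
      field_simp
      ring
    · rw [hW.slope_eq]; field_simp
  · exact (continuousAt_const.mul (cs.mul (cc cW))).sub (continuousAt_const.mul (ct.pow _))
  · exact continuousAt_const.mul (cc cp)
  · exact continuousAt_const.mul ((cc hW.continuous_curv).div cs hs)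
  · exact continuousAt_const.mul ((cc hW.continuous_quot).div cs hs)
  · exact (continuousAt_const.mul ((continuousAt_const.mul (cs.div ct ht.ne')).mul
      ((cc cW).sub (cz.mul (cc cp))))).sub (continuousAt_const.mul
        (continuousAt_const.mul (ct.pow _)))
  · intro _
    refine Eventually.of_forall fun q => ?_
    simp only [inner, neg_div, hW.even]
  · exact hp.trans_lt hL
  · beta_reduce
    refine lt_of_eq_of_lt ?_ hlt
    have e := hW.equation z
    rw [mul_pow, hσ, one_mul]
    have hWz := (hW0 z hz0).ne'
    have : σ * (p' z / scl k θ t) / (1 + p z ^ 2) + 3 * (σ * (B z / scl k θ t))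
        = σ / scl k θ t * (p' z / (1 + p z ^ 2) + 3 * B z) := by ring
    rw [this, show p' z / (1 + p z ^ 2) + 3 * B z = 3 / W z by linarith]
    field_simp

/-- Bounds for the Alencar profile in the form used for barriers. -/
theorem exists_profile_bounds (hW : AlencarProfile K W p p' B) (hK : 0 < K) :
    ∃ c > 0, ∃ C > 0, ∀ z ≥ 0, c ≤ W z ∧ W z ≤ z + C ∧ (W z - z * p z) * W z ^ 2 ≤ C ∧
      c ≤ (W z - z * p z) * (1 + z ^ 2) ∧ W z - z ≤ C / (1 + z ^ 2) := by
  obtain ⟨c, hc, C, hC, h⟩ := hW.gap_bounds hK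
  obtain ⟨Cb, hCb⟩ : ∃ Cb : ℝ, Cb = max C (7 / 2 * C * (2 + 2 * C ^ 2)) := ⟨_, rfl⟩
  have hW0 : 0 < W 0 := hW.gt 0 le_rfl
  have hmono : ∀ z ≥ 0, W 0 ≤ W z := by
    have := monotoneOn_of_deriv_nonneg (convex_Ici 0)
      (fun z _ => (hW.hasDerivAt z).continuousAt.continuousWithinAt)
      (fun z _ => (hW.hasDerivAt z).differentiableAt.differentiableWithinAt)
      (fun z hz => by
        rw [interior_Ici] at hz
        rw [(hW.hasDerivAt z).deriv]; exact hW.slope_nonneg z (le_of_lt hz))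
    exact fun z hz => this (le_refl (0:ℝ)) hz hz
  refine ⟨min c (W 0), lt_min hc hW0, Cb, by rw [hCb]; positivity, fun z hz => ?_⟩
  obtain ⟨h1, h2⟩ := h z hz
  have hg := hW.gt z hz
  have h3 : W z - z ≤ C / (1 + z ^ 2) := by rw [le_div_iff₀ (by positivity)]; linarith
  have h4 : W z - z ≤ C := by nlinarith [sq_nonneg z]
  have h5 := hW.slope_defect z hz
  have h6 := hW.slope_le z hz
  have h7 : 0 ≤ z * (1 - p z) := mul_nonneg hz (by linarith)
  have hCb1 : C ≤ Cb := hCb ▸ le_max_left _ _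
  refine ⟨(min_le_right _ _).trans (hmono z hz), by linarith, ?_, ?_, ?_⟩
  · refine le_trans ?_ (hCb ▸ le_max_right _ _ : _ ≤ Cb)
    have h8 : W z ^ 2 ≤ (2 + 2 * C ^ 2) * (1 + z ^ 2) := by
      have : W z ^ 2 ≤ (z + C) ^ 2 := by
        apply pow_le_pow_left₀ <;> linarith
      nlinarith [sq_nonneg (z - C), sq_nonneg (z * C), sq_nonneg z, sq_nonneg C]
    have h9 : W z - z * p z ≤ 7 / 2 * (W z - z) := by linarith
    calc (W z - z * p z) * W z ^ 2 ≤ 7 / 2 * (W z - z) * ((2 + 2 * C ^ 2) * (1 + z ^ 2)) := by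
          apply mul_le_mul h9 h8 (by positivity); linarith
      _ = 7 / 2 * (2 + 2 * C ^ 2) * ((1 + z ^ 2) * (W z - z)) := by ring
      _ ≤ 7 / 2 * (2 + 2 * C ^ 2) * C := mul_le_mul_of_nonneg_left h2 (by positivity)
      _ = _ := by ring
  · refine (min_le_left _ _).trans (h1.trans ?_)
    rw [mul_comm]
    exact mul_le_mul_of_nonneg_right (by linarith) (by positivity)
  · exact h3.trans (div_le_div_of_nonneg_right hCb1 (by positivity))

set_option maxHeartbeats 400000 in
/-- The rescaled profiles are strict supersolutions where `x ≤ y √t`, `y` small. -/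
theorem exists_strictSuper_inner (hW : AlencarProfile K W p p' B) (hK : 0 < K) {k : ℕ}
    (hk : 4 ≤ k) : ∃ Γ > 0, ∀ σ θ : ℝ, σ ^ 2 = 1 → 1 / 2 ≤ θ → θ ≤ 2 → ∀ y > (0 : ℝ),
    4 * y ^ 2 * k ≤ 1 → ∀ᶠ t in 𝓝[>] 0, ∀ x ≥ 0, x < y * √t →
      t ^ k ≤ σ * inner k W σ θ Γ x t ∧ ∀ L > 1, ∀ f : ℝ → ℝ,
      f (σ * inner k W σ θ Γ x t) = 3 / (σ * inner k W σ θ Γ x t) →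
      StrictSuper L (fun v => σ * f (σ * v)) (inner k W σ θ Γ) x t := by
  obtain ⟨c, hc, C, hC, hb⟩ := exists_profile_bounds hW hK
  have hk0 : (4:ℝ) ≤ k := by exact_mod_cast hk
  refine ⟨k / 3 * 8 * C, by positivity, fun σ θ hσ hθ1 hθ2 y hy hyk => ?_⟩
  set Γ : ℝ := k / 3 * 8 * C with hΓ
  have hΓ0 : 0 < Γ := by positivity
  have hθ0 : 0 < θ := by linarith
  have e1 := eventually_mul_rpow_le (a := ((k - 1 : ℕ) : ℝ)) (b := (k : ℝ) / 3) (by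
    rw [Nat.cast_sub (by omega)]; push_cast; linarith) Γ (show 0 < c / 4 by linarith)
  have e2 := eventually_mul_rpow_le (a := (k : ℝ) / 3) (b := (1 / 2 : ℝ)) (by linarith) (2 * C) (c := y) hy
  have e3 := eventually_mul_rpow_le (a := (k : ℝ)) (b := (k : ℝ) / 3) (by linarith) 1
    (show 0 < c / 4 by linarith)
  filter_upwards [e1, e2, e3, self_mem_nhdsWithin] with t h1 h2 h3 ht x hx hxy
  have ht : 0 < t := ht
  rw [rpow_natCast] at h1 h3
  rw [← sqrt_eq_rpow] at h2
  have hs := scl_pos k hθ0 ht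
  have ht3 : 0 < t ^ ((k : ℝ) / 3) := by positivity
  set s := scl k θ t with hsdef
  have hs2 : s ≤ 2 * t ^ ((k : ℝ) / 3) := mul_le_mul_of_nonneg_right hθ2 ht3.le
  have hs1 : 1 / 2 * t ^ ((k : ℝ) / 3) ≤ s := mul_le_mul_of_nonneg_right hθ1 ht3.le
  obtain ⟨b1, b2, b3, -⟩ := hb (x / s) (by positivity)
  set w := W (x / s) with hw
  have hw0 : 0 < w := hc.trans_le b1
  set γ := Γ * t ^ (k - 1) with hγ
  have hγ0 : 0 < γ := by positivity
  set P := s * w with hP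
  have hP0 : 0 < P := by positivity
  have hPc : 1 / 2 * t ^ ((k : ℝ) / 3) * c ≤ P := mul_le_mul hs1 b1 hc.le hs.le
  have hγP : γ ≤ P / 2 := by linarith
  have hσe : σ * inner k W σ θ Γ x t = P - σ * γ := by
    simp only [inner, ← hsdef, ← hw, ← hP, ← hγ]
    linear_combination P * hσ
  have hσ1 : |σ| = 1 := by
    rw [← abs_one, ← sq_eq_sq_iff_abs_eq_abs]; simpa using hσ
  have hσγ : |σ * γ| = γ := by rw [abs_mul, hσ1, one_mul, abs_of_pos hγ0]
  have hle := abs_le.1 hσγ.le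
  have hI0 : 0 < P - σ * γ := by linarith [hle.2]
  refine ⟨by rw [hσe]; linarith [hle.2], fun L hL f hf => ?_⟩
  refine strictSuper_inner_of_lt hW hσ hθ0 hL hx ht ?_
  rw [hf, hσe, ← hsdef, ← hw, ← hP]
  have hPy : P ≤ 2 * y * √t := by
    have : P ≤ x + s * C := by
      calc P ≤ s * (x / s + C) := mul_le_mul_of_nonneg_left b2 hs.le
        _ = _ := by field_simp
    nlinarith only [this, mul_le_mul_of_nonneg_right hs2 hC.le, h2, hxy]
  have hP2 : P ^ 2 ≤ 4 * y ^ 2 * t := by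
    calc P ^ 2 ≤ (2 * y * √t) ^ 2 := pow_le_pow_left₀ hP0.le hPy 2
      _ = _ := by rw [mul_pow, sq_sqrt ht.le]; ring
  have hk1 : ((k - 1 : ℕ) : ℝ) = k - 1 := by rw [Nat.cast_sub (by omega)]; simp
  have htk : t ^ (k - 1) = t * t ^ (k - 1 - 1) := by
    rw [← pow_succ']; congr 1; omega
  have key1 : Γ * (((k - 1 : ℕ) : ℝ) * t ^ (k - 1 - 1)) < γ / P ^ 2 := by
    rw [lt_div_iff₀ (by positivity), hγ, htk, hk1]
    have h0 : 0 < Γ * t ^ (k - 1 - 1) := by positivity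
    have : (k - 1 : ℝ) * P ^ 2 < t := by
      calc (k - 1 : ℝ) * P ^ 2 ≤ (k - 1) * (4 * y ^ 2 * t) :=
            mul_le_mul_of_nonneg_left hP2 (by linarith)
        _ < k * (4 * y ^ 2 * t) := by
            apply mul_lt_mul_of_pos_right _ (by positivity); linarith
        _ = 4 * y ^ 2 * k * t := by ring
        _ ≤ 1 * t := mul_le_mul_of_nonneg_right hyk ht.le
        _ = t := one_mul t
    nlinarith only [mul_lt_mul_of_pos_left this h0]
  have key2 : k / 3 * (s / t) * (w - x / s * p (x / s)) ≤ γ / P ^ 2 := by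
    rw [le_div_iff₀ (by positivity), hγ, htk]
    have hs3 : s ^ 3 ≤ 8 * (t * t * t ^ (k - 1 - 1)) := by
      rw [hsdef, scl_cube k ht, mul_assoc t t, ← htk, ← pow_succ', show k - 1 + 1 = k by omega]
      apply mul_le_mul_of_nonneg_right _ (by positivity)
      calc θ ^ 3 ≤ 2 ^ 3 := pow_le_pow_left₀ hθ0.le hθ2 3
        _ = 8 := by norm_num
    calc k / 3 * (s / t) * (w - x / s * p (x / s)) * P ^ 2
        = k / 3 * (s ^ 3 / t) * ((w - x / s * p (x / s)) * w ^ 2) := by rw [hP]; ring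
      _ ≤ k / 3 * (s ^ 3 / t) * C := mul_le_mul_of_nonneg_left b3 (by positivity)
      _ ≤ k / 3 * (8 * (t * t * t ^ (k - 1 - 1)) / t) * C := by gcongr
      _ = _ := by rw [hΓ]; field_simp
  have hnn : 0 ≤ k / 3 * (s / t) * (w - x / s * p (x / s)) := by
    have hz : 0 ≤ x / s := by positivity
    have := hW.gt _ hz
    have := mul_le_mul_of_nonneg_left (hW.slope_le _ hz) hz
    apply mul_nonneg (by positivity); rw [hw]; linarith
  have key3 : 3 * σ / P - σ * (3 / (P - σ * γ)) = -(3 * γ / (P * (P - σ * γ))) := by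
    field_simp
    linear_combination -γ * hσ
  have key4 : 2 * (γ / P ^ 2) ≤ 3 * γ / (P * (P - σ * γ)) := by
    rw [← mul_div_assoc, div_le_div_iff₀ (by positivity) (by positivity)]
    have : P - σ * γ ≤ 3 / 2 * P := by linarith [hle.1]
    have h0 : 0 ≤ 2 * γ * P := by positivity
    nlinarith only [mul_le_mul_of_nonneg_left this h0]
  have hσle : -(k / 3 * (s / t) * (w - x / s * p (x / s)))
      ≤ σ * (k / 3 * (s / t) * (w - x / s * p (x / s))) := by
    rw [neg_eq_neg_one_mul]
    exact mul_le_mul_of_nonneg_right (neg_le_of_abs_le hσ1.le) hnn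
  rw [key3]
  linarith

/-- The homogeneous polynomial `∑ a_j x^{2j} t^{k-j}`. -/
noncomputable def hsum (k : ℕ) (a : ℕ → ℝ) (x t : ℝ) : ℝ :=
  ∑ j ∈ range (k + 1), a j * x ^ (2 * j) * t ^ (k - j)

theorem hsum_combo (k : ℕ) (a b : ℕ → ℝ) (α β x t : ℝ) :
    α * hsum k a x t + β * hsum k b x t = hsum k (fun j => α * a j + β * b j) x t := by
  simp only [hsum, mul_sum, ← sum_add_distrib]
  grind

theorem hasDerivAt_hsum (k : ℕ) (a : ℕ → ℝ) {x : ℝ} (hx : x ≠ 0) (t : ℝ) :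
    HasDerivAt (fun y => hsum k a y t) (hsum k (fun j => 2 * j * a j) x t / x) x := by
  have : HasDerivAt (fun y => ∑ j ∈ range (k + 1), a j * y ^ (2 * j) * t ^ (k - j))
      (∑ j ∈ range (k + 1), a j * ((2 * j : ℕ) * x ^ (2 * j - 1)) * t ^ (k - j)) x :=
    HasDerivAt.fun_sum fun j _ => ((hasDerivAt_pow (2 * j) x).const_mul (a j)).mul_const _
  refine this.congr_deriv ?_
  rw [hsum, sum_div]
  refine sum_congr rfl fun j _ => ?_
  rcases j with _ | j
  · simp
  grind

/-- Differentiation in time, for coefficients satisfying the recursion of the linearised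
equation. -/
theorem hasDerivAt_hsum_time (k : ℕ) {a : ℕ → ℝ}
    (ha : ∀ j < k, a j * (k - j) = a (j + 1) * (j + 1) * (2 * j + 3)) {x : ℝ} (hx : x ≠ 0) (t : ℝ) :
    HasDerivAt (fun r => hsum k a x r) (hsum k (fun j => j * (2 * j + 1) * a j) x t / x ^ 2) t := by
  have : HasDerivAt (fun r => ∑ j ∈ range (k + 1), a j * x ^ (2 * j) * r ^ (k - j))
      (∑ j ∈ range (k + 1), a j * x ^ (2 * j) * ((k - j : ℕ) * t ^ (k - j - 1))) t :=
    HasDerivAt.fun_sum fun j _ => (hasDerivAt_pow (k - j) t).const_mul _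
  refine this.congr_deriv ?_
  rw [hsum, sum_div, sum_range_succ, sum_range_succ']
  simp only [Nat.sub_self, Nat.cast_zero, zero_mul, mul_zero, add_zero, zero_div]
  refine sum_congr rfl fun j hj => ?_
  have hj := mem_range.1 hj
  rw [Nat.cast_sub hj.le, show k - j - 1 = k - (j + 1) by omega, mul_add 2 j 1, pow_add]
  grind

theorem contDiff_hsum (k : ℕ) (a : ℕ → ℝ) : ContDiff ℝ 3 (fun q : ℝ × ℝ => hsum k a q.1 q.2) := by
  unfold hsum; fun_prop

theorem abs_hsum_le (k : ℕ) (a : ℕ → ℝ) {τ : ℝ} {x t : ℝ} (ht : 0 ≤ t)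
    (h : t ≤ τ * x ^ 2) :
    |hsum k a x t| ≤ (∑ j ∈ range (k + 1), |a j| * τ ^ (k - j)) * x ^ (2 * k) := by
  rw [hsum, sum_mul]
  refine (abs_sum_le_sum_abs _ _).trans (sum_le_sum fun j hj => ?_)
  have hj : j ≤ k := by grind
  have hx : 0 ≤ x ^ (2 * j) := by rw [pow_mul]; positivity
  rw [abs_mul, abs_mul, abs_of_nonneg hx, abs_of_nonneg (pow_nonneg ht _)]
  calc |a j| * x ^ (2 * j) * t ^ (k - j) ≤ |a j| * x ^ (2 * j) * (τ * x ^ 2) ^ (k - j) := by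
        gcongr
    _ = |a j| * τ ^ (k - j) * (x ^ (2 * j) * x ^ (2 * (k - j))) := by
        rw [mul_pow, ← pow_mul]; ring
    _ = _ := by rw [← pow_add]; congr 2; omega

theorem le_hsum {k : ℕ} (hk : 0 < k) {a : ℕ → ℝ} (ha : ∀ j, 0 ≤ a j) (x : ℝ) {t : ℝ} (ht : 0 ≤ t) :
    a 0 * t ^ k + a k * x ^ (2 * k) ≤ hsum k a x t := by
  obtain ⟨n, rfl⟩ : ∃ n, k = n + 1 := ⟨k - 1, by omega⟩
  rw [hsum, sum_range_succ, sum_range_succ']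
  have : 0 ≤ ∑ j ∈ range n, a (j + 1) * x ^ (2 * (j + 1)) * t ^ (n + 1 - (j + 1)) :=
    sum_nonneg fun j _ => by
      have := ha (j + 1)
      have : 0 ≤ x ^ (2 * (j + 1)) := by rw [pow_mul]; positivity
      positivity
  grind

/-- The coefficients of the outer expansion. -/
noncomputable def coef (K : ℝ) (k j : ℕ) : ℝ :=
  K * (k.choose j * ((Nat.doubleFactorial (2 * k + 1) : ℝ) / Nat.doubleFactorial (2 * j + 1)))

theorem coef_nonneg {K : ℝ} (hK : 0 ≤ K) (k j : ℕ) : 0 ≤ coef K k j := by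
  unfold coef; positivity

theorem coef_self (K : ℝ) (k : ℕ) : coef K k k = K := by
  have : ((Nat.doubleFactorial (2 * k + 1) : ℕ) : ℝ) ≠ 0 := by positivity
  simp [coef, div_self this]

theorem coef_zero (K : ℝ) (k : ℕ) : coef K k 0 = Nat.doubleFactorial (2 * k + 1) * K := by
  simp [coef, mul_comm]

theorem coef_succ (K : ℝ) {k j : ℕ} (hj : j < k) :
    coef K k j * (k - j) = coef K k (j + 1) * (j + 1) * (2 * j + 3) := by
  have h : (k.choose (j + 1) : ℝ) * (j + 1) = k.choose j * (k - j) := by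
    have := Nat.choose_succ_right_eq k j
    rw [← Nat.cast_sub hj.le]; exact_mod_cast this
  have h2 : ((Nat.doubleFactorial (2 * j + 1) : ℕ) : ℝ) ≠ 0 := by positivity
  have h3 : (0:ℝ) < 2 * j + 3 := by positivity
  rw [coef, coef, show 2 * (j + 1) + 1 = 2 * j + 1 + 2 by ring, Nat.doubleFactorial_add_two]
  push_cast
  rw [show (2 * (j:ℝ) + 1 + 2) = 2 * j + 3 by ring]
  field_simp
  grind

/-- Size of the nonlinear remainder around the cone. -/
theorem remainder_le {x a b d A X : ℝ} (hx : 0 < x) (hx1 : x ≤ 1) (hX : 0 ≤ X) (hX3 : X ≤ x ^ 3)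
    (hA : 0 ≤ A) (ha : |a| ≤ A * X) (hb : |b| ≤ A * X / x) (hd : |d| ≤ A * X / x ^ 2)
    (hax : |a| ≤ x / 2) :
    |d / (1 + (1 + b) ^ 2) + 3 * ((1 + b) / x) - 3 / (x + a)
      - (d / 2 + 3 * (b / x) + 3 * (a / x ^ 2))| ≤ (A ^ 2 * (2 + A) + 6 * A ^ 2) * X := by
  have hxa : x / 2 ≤ x + a := by grind
  have hxa0 : 0 < x + a := by linarith
  have h1 : (1:ℝ) ≤ 2 * (1 + (1 + b) ^ 2) := by nlinarith [sq_nonneg (1 + b)]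
  have e : d / (1 + (1 + b) ^ 2) + 3 * ((1 + b) / x) - 3 / (x + a)
      - (d / 2 + 3 * (b / x) + 3 * (a / x ^ 2))
      = -(d * b * (2 + b) / (2 * (1 + (1 + b) ^ 2))) - 3 * a ^ 2 / (x ^ 2 * (x + a)) := by grind
  have hXX : X * X ≤ X * x ^ 3 := by gcongr
  have hbA : |b| ≤ A := by
    refine hb.trans ?_
    rw [div_le_iff₀ hx]
    refine mul_le_mul_of_nonneg_left (hX3.trans ?_) hA
    nlinarith [mul_le_one₀ hx1 hx.le hx1]
  have p1 : |d * b * (2 + b) / (2 * (1 + (1 + b) ^ 2))| ≤ A ^ 2 * (2 + A) * X := by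
    rw [abs_div, abs_of_nonneg (by positivity : 0 ≤ 2 * (1 + (1 + b) ^ 2))]
    refine (div_le_self (abs_nonneg _) h1).trans ?_
    rw [abs_mul, abs_mul]
    have : |2 + b| ≤ 2 + A := by grind
    calc |d| * |b| * |2 + b| ≤ A * X / x ^ 2 * (A * X / x) * (2 + A) := by gcongr
      _ = A ^ 2 * (2 + A) * ((X * X) / x ^ 3) := by field_simp
      _ ≤ A ^ 2 * (2 + A) * X := by
          apply mul_le_mul_of_nonneg_left _ (by positivity)
          rwa [div_le_iff₀ (by positivity)]
  have p2 : |3 * a ^ 2 / (x ^ 2 * (x + a))| ≤ 6 * A ^ 2 * X := by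
    rw [abs_of_nonneg (by positivity), div_le_iff₀ (by positivity)]
    have h2 : a ^ 2 ≤ (A * X) ^ 2 := sq_le_sq' (by grind) (abs_le.1 ha).2
    have h3 : x ^ 2 * (x / 2) ≤ x ^ 2 * (x + a) := by gcongr
    have h4 := mul_le_mul_of_nonneg_left h3 (by positivity : 0 ≤ 6 * A ^ 2 * X)
    nlinarith only [h2, h4, mul_le_mul_of_nonneg_left hXX (sq_nonneg A)]
  rw [e]
  refine (abs_sub _ _).trans ?_
  grind

/-- The barrier in the outer region (multiplied by the sign `σ`). -/
noncomputable def outer (k : ℕ) (K σ ε C δ x t : ℝ) : ℝ :=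
  σ * (x + (1 + σ * (ε + C * t)) * (hsum k (coef K k) x t / x ^ 2)) + δ * (t ^ k * √t / x ^ 3)

theorem hasDerivAt_hsum_div (k : ℕ) (a : ℕ → ℝ) (m : ℕ) {x : ℝ} (hx : x ≠ 0) (t : ℝ) :
    HasDerivAt (fun y => hsum k a y t / y ^ m)
      (hsum k (fun j => (2 * j - m) * a j) x t / x ^ (m + 1)) x := by
  refine ((hasDerivAt_hsum k a hx t).div (hasDerivAt_pow m x) (pow_ne_zero m hx)).congr_deriv ?_
  have h := hsum_combo k (fun j => 2 * j * a j) a 1 (-m) x t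
  rw [show (fun j : ℕ => (2 * (j:ℝ) - m) * a j) = fun j => 1 * (2 * j * a j) + -m * a j from
    (by grind), ← h]
  rcases m with _ | m
  · simp
  grind

theorem hasDerivAt_const_div_pow (c : ℝ) (m : ℕ) {x : ℝ} (hx : x ≠ 0) :
    HasDerivAt (fun y => c / y ^ m) (-m * c / x ^ (m + 1)) x := by
  refine ((hasDerivAt_const x c).div (hasDerivAt_pow m x) (pow_ne_zero m hx)).congr_deriv ?_
  rcases m with _ | m
  · simp
  grind

set_option maxHeartbeats 400000 in
/-- The outer barrier is a strict supersolution between the parabolic scale and a fixed small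
radius. -/
theorem exists_strictSuper_outer {k : ℕ} (hk : 4 ≤ k) {K : ℝ} (hK : 0 < K) {y δ : ℝ} (hy : 0 < y)
    (hδ : 0 ≤ δ) : ∃ C > 0, ∃ r > 0, ∀ σ ε : ℝ, σ ^ 2 = 1 → 0 ≤ ε → ε ≤ 1 / 2 → ∀ x t : ℝ, 0 < t →
      C * t ≤ 1 / 2 → y * √t ≤ x → 0 < x → x ≤ r → |σ * outer k K σ ε C δ x t - x| ≤ x / 2 ∧
      ∀ L ≥ 2, ∀ f : ℝ → ℝ,
      f (σ * outer k K σ ε C δ x t) = 3 / (σ * outer k K σ ε C δ x t) →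
      StrictSuper L (fun v => σ * f (σ * v)) (outer k K σ ε C δ) x t := by
  obtain ⟨τ, hτ⟩ : ∃ τ, τ = (1 / y) ^ 2 := ⟨_, rfl⟩
  have hτ0 : 0 ≤ τ := hτ ▸ sq_nonneg _
  set c := coef K k with hc
  set c1 : ℕ → ℝ := fun j => (2 * j - (2:ℕ)) * c j with hc1
  set c2 : ℕ → ℝ := fun j => (2 * j - (2 + 1 : ℕ)) * c1 j with hc2
  set S : (ℕ → ℝ) → ℝ := fun a => ∑ j ∈ range (k + 1), |a j| * τ ^ (k - j) with hS
  have hS0 : ∀ a, 0 ≤ S a := fun a => by positivity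
  obtain ⟨q, hq⟩ : ∃ q, q = τ ^ k * (1 / y) := ⟨_, rfl⟩
  have hq0 : 0 ≤ q := by rw [hq]; positivity
  obtain ⟨A, hA⟩ : ∃ A, A = 2 * (S c + S c1 + S c2) + 12 * δ * q := ⟨_, rfl⟩
  have hA0 : 0 ≤ A := by rw [hA]; positivity
  obtain ⟨A', hA'⟩ : ∃ A', A' = A ^ 2 * (2 + A) + 6 * A ^ 2 := ⟨_, rfl⟩
  have hA'0 : 0 ≤ A' := by rw [hA']; positivity
  obtain ⟨C, hC⟩ : ∃ C, C = A' / K + 1 := ⟨_, rfl⟩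
  have hC0 : 0 < C := by rw [hC]; positivity
  refine ⟨C, hC0, min 1 (1 / (2 * A + 1)), by positivity,
    fun σ ε hσ hε0 hε1 x t ht htC hyx hx hxr => ?_⟩
  have hx1 : x ≤ 1 := by grind
  have hxA : A * x ≤ 1 / 2 := by
    have := hxr.trans (min_le_right _ _)
    rw [le_div_iff₀ (by positivity)] at this
    linarith
  have hσ1 : |σ| = 1 := by grind
  obtain ⟨X, hX⟩ : ∃ X, X = x ^ (2 * k) / x ^ 2 := ⟨_, rfl⟩
  have hX0 : 0 < X := by rw [hX]; positivity
  have hXe : X = x ^ 2 * x ^ (2 * k - 4) := by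
    rw [hX, div_eq_iff (by positivity), ← pow_add, ← pow_add]; congr 1; omega
  have hX2 : X ≤ x ^ 3 := by
    rw [hXe, show 2 * k - 4 = 1 + (2 * k - 5) by omega, pow_add, pow_one, ← mul_assoc]
    calc x ^ 2 * x * x ^ (2 * k - 5) ≤ x ^ 2 * x * 1 := by
          gcongr; exact pow_le_one₀ hx.le hx1
      _ = x ^ 3 := by ring
  have hsx : √t ≤ 1 / y * x := by
    rw [one_div, ← div_eq_inv_mul, le_div_iff₀ hy]; linarith
  have hs0 : 0 < √t := sqrt_pos.2 ht
  have htx : t ≤ τ * x ^ 2 := by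
    calc t = √t ^ 2 := by grind
      _ ≤ (1 / y * x) ^ 2 := by gcongr
      _ = _ := by grind
  have hE : ∀ a, |hsum k a x t| ≤ S a * (X * x ^ 2) := fun a => by
    have := abs_hsum_le k a ht.le htx
    rwa [hX, div_mul_cancel₀ _ (by positivity)]
  obtain ⟨Q, hQ⟩ : ∃ Q, Q = t ^ k * √t := ⟨_, rfl⟩
  have hQ0 : 0 < Q := by rw [hQ]; positivity
  have hQle : Q ≤ q * (X * x ^ 3) := by
    rw [hQ]
    calc t ^ k * √t ≤ (τ * x ^ 2) ^ k * (1 / y * x) :=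
          by gcongr
      _ = q * (x ^ (2 * k) * x) := by rw [mul_pow, ← pow_mul, hq]; ring
      _ = _ := by grind
  set κ := 1 + σ * (ε + C * t) with hκ
  have hκ2 : |κ| ≤ 2 := by
    refine (abs_add_le _ _).trans ?_
    rw [abs_one, abs_mul, hσ1, one_mul, abs_of_nonneg (by positivity)]
    linarith
  set w : ℝ → ℝ := fun y => κ * (hsum k c y t / y ^ 2) + σ * δ * (Q / y ^ 3) with hw
  set w1 : ℝ → ℝ := fun y => κ * (hsum k c1 y t / y ^ 3) + σ * δ * (-(3:ℕ) * Q / y ^ 4) with hw1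
  set w2 : ℝ := κ * (hsum k c2 x t / x ^ 4) + σ * δ * (-(4:ℕ) * (-(3:ℕ) * Q) / x ^ 5) with hw2
  have d1 : ∀ y : ℝ, y ≠ 0 → HasDerivAt w (w1 y) y := fun y hy =>
    ((hasDerivAt_hsum_div k c 2 hy t).const_mul κ).add
      ((hasDerivAt_const_div_pow Q 3 hy).const_mul (σ * δ))
  have d2 : HasDerivAt w1 w2 x :=
    ((hasDerivAt_hsum_div k c1 3 hx.ne' t).const_mul κ).add
      ((hasDerivAt_const_div_pow (-(3:ℕ) * Q) 4 hx.ne').const_mul (σ * δ))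
  have bd : ∀ (a : ℕ → ℝ) (m : ℕ) (e : ℝ), |e| ≤ 12 * Q → S a ≤ S c + S c1 + S c2 →
      |κ * (hsum k a x t / x ^ (m + 2)) + σ * δ * (e / x ^ (m + 3))| ≤ A * X / x ^ m := by
    intro a m e he ha
    refine (abs_add_le _ _).trans ?_
    rw [abs_mul, abs_mul, abs_mul, hσ1, one_mul, abs_of_nonneg hδ, abs_div, abs_div,
      abs_of_pos (pow_pos hx (m + 2)), abs_of_pos (pow_pos hx (m + 3))]
    calc |κ| * (|hsum k a x t| / x ^ (m + 2)) + δ * (|e| / x ^ (m + 3))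
        ≤ 2 * (S a * (X * x ^ 2) / x ^ (m + 2)) + δ * (12 * (q * (X * x ^ 3)) / x ^ (m + 3)) := by
          gcongr
          · exact hE a
          · linarith
      _ = (2 * S a + 12 * δ * q) * X / x ^ m := by
          rw [pow_add x m 2, pow_add x m 3]; field_simp
      _ ≤ A * X / x ^ m := by
          apply div_le_div_of_nonneg_right _ (by positivity)
          apply mul_le_mul_of_nonneg_right _ hX0.le
          linarith
  have := hS0 c; have := hS0 c1; have := hS0 c2
  have b0 : |w x| ≤ A * X := by
    have := bd c 0 Q (by rw [abs_of_pos hQ0]; linarith) (by linarith)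
    grind
  have b1 : |w1 x| ≤ A * X / x := by
    have : |w1 x| ≤ A * X / x ^ 1 := bd c1 1 (-(3:ℕ) * Q) (by grind) (by linarith)
    grind
  have b2 : |w2| ≤ A * X / x ^ 2 := by
    exact bd c2 2 (-(4:ℕ) * (-(3:ℕ) * Q)) (by
      rw [abs_mul, abs_mul, abs_of_pos hQ0]; norm_num; linarith) (by linarith)
  have bx : ∀ m : ℕ, m ≤ 2 → A * X / x ^ m ≤ A * x := fun m hm => by
    rw [div_le_iff₀ (by positivity), mul_assoc]
    refine mul_le_mul_of_nonneg_left (hX2.trans ?_) hA0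
    rw [← pow_succ']
    exact pow_le_pow_of_le_one hx.le hx1 (by omega)
  have bax : |w x| ≤ x / 2 := by
    refine b0.trans ?_
    calc A * X ≤ A * (x * x) := by
          apply mul_le_mul_of_nonneg_left (hX2.trans _) hA0; nlinarith only [mul_pos hx hx, hx1]
      _ = (A * x) * x := by ring
      _ ≤ 1 / 2 * x := by gcongr
      _ = x / 2 := by ring
  have bb : |w1 x| ≤ 1 / 2 := b1.trans (by have := bx 1 (by norm_num); grind)
  have hO : ∀ y, outer k K σ ε C δ y t = σ * (y + w y) := fun y => by
    simp only [outer, hw, hκ, hQ]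
    grind
  have hσO : σ * outer k K σ ε C δ x t = x + w x := by grind
  refine ⟨by grind, fun L hL f hf => ?_⟩
  have h3 : HasDerivAt (fun r => outer k K σ ε C δ x r)
      (σ * (σ * C * (hsum k c x t / x ^ 2)
        + κ * (hsum k (fun j => j * (2 * j + 1) * c j) x t / x ^ 2 / x ^ 2))
        + δ * ((k * t ^ (k - 1) * √t + t ^ k * (1 / (2 * √t))) / x ^ 3)) t := by
    have e1 : HasDerivAt (fun r => 1 + σ * (ε + C * r)) (σ * C) t := by
      refine ((((hasDerivAt_id t).const_mul C).const_add ε).const_mul σ).const_add 1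
        |>.congr_deriv ?_
      ring
    have e2 := (hasDerivAt_hsum_time k (a := c) (fun j hj => coef_succ K hj) hx.ne' t).div_const
      (x ^ 2)
    exact (((e1.mul e2).const_add x).const_mul σ).add
      ((((hasDerivAt_pow k t).mul (hasDerivAt_sqrt ht.ne')).div_const (x ^ 3)).const_mul δ)
  refine StrictSuper.of_contDiffAt (Px := fun y => σ * (1 + w1 y)) (Pxx := σ * w2) hx ?_ ?_ ?_ h3 ?_ ?_
  · have h0 : ContDiffAt ℝ 3 (fun q : ℝ × ℝ => √q.2) (x, t) := contDiffAt_snd.sqrt ht.ne'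
    have h1 := (contDiff_hsum k (coef K k)).contDiffAt (x := (x, t))
    have h2 : ContDiffAt ℝ 3 (fun q : ℝ × ℝ => q.1 ^ 2) (x, t) := contDiffAt_fst.pow 2
    have h3 : ContDiffAt ℝ 3 (fun q : ℝ × ℝ => q.1 ^ 3) (x, t) := contDiffAt_fst.pow 3
    have h4 : ContDiffAt ℝ 3 (fun q : ℝ × ℝ => 1 + σ * (ε + C * q.2)) (x, t) := by fun_prop
    exact (contDiffAt_const.mul (contDiffAt_fst.add (h4.mul (h1.div h2 (by positivity))))).add
      (contDiffAt_const.mul (((contDiffAt_snd.pow k).mul h0).div h3 (by positivity)))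
  · filter_upwards [lt_mem_nhds hx] with y hy
    rw [show (fun y => outer k K σ ε C δ y t) = fun y => σ * (y + w y) from funext hO]
    exact ((hasDerivAt_id y).add (d1 y hy.ne')).const_mul σ
  · exact (d2.const_add 1).const_mul σ
  · rw [abs_mul, hσ1, one_mul]
    have := abs_add_le 1 (w1 x)
    rw [abs_one] at this
    linarith
  · rw [hf, hσO]
    have hR := remainder_le hx hx1 hX0.le hX2 hA0 b0 b1 b2 bax
    have hlin : w2 / 2 + 3 * (w1 x / x) + 3 * (w x / x ^ 2)
        = κ * (hsum k (fun j => j * (2 * j + 1) * c j) x t / x ^ 2 / x ^ 2) := by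
      have h := hsum_combo k c2 c1 (1 / 2) 3 x t
      have h' := hsum_combo k (fun j => 1 / 2 * c2 j + 3 * c1 j) c 1 3 x t
      rw [show (fun j : ℕ => (j:ℝ) * (2 * j + 1) * c j)
        = fun j => 1 * (1 / 2 * c2 j + 3 * c1 j) + 3 * c j from (by grind), ← h', ← h]
      simp only [hw2, hw1, hw]
      push_cast
      field_simp
      ring
    have hV : K * X ≤ hsum k c x t / x ^ 2 := by
      have := le_hsum (k := k) (by omega) (coef_nonneg hK.le k) x ht.le
      rw [coef_self] at this
      rw [hX, ← mul_div_assoc]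
      apply div_le_div_of_nonneg_right _ (by positivity)
      have := mul_nonneg (coef_nonneg hK.le k 0) (pow_nonneg ht.le k)
      linarith
    have hQt : 0 ≤ δ * ((k * t ^ (k - 1) * √t + t ^ k * (1 / (2 * √t))) / x ^ 3) := by positivity
    have hCV : C * (K * X) ≤ C * (hsum k c x t / x ^ 2) := by gcongr
    have hCK : C * (K * X) = A' * X + K * X := by rw [hC]; field_simp
    have hKX : 0 < K * X := by positivity
    rw [mul_pow, hσ, one_mul]
    have hσR : σ * (w2 / (1 + (1 + w1 x) ^ 2) + 3 * ((1 + w1 x) / x) - 3 / (x + w x)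
        - (w2 / 2 + 3 * (w1 x / x) + 3 * (w x / x ^ 2))) ≤ A' * X := by
      refine (le_abs_self _).trans ?_
      rw [abs_mul, hσ1, one_mul]; grind
    rw [hlin] at hσR
    have e : σ * (σ * C * (hsum k c x t / x ^ 2)) = C * (hsum k c x t / x ^ 2) := by grind
    grind

variable {W p p' B : ℝ → ℝ} {K : ℝ}

/-- The rescaled profile beyond the parabolic scale. -/
theorem eventually_profile_expansion (hW : AlencarProfile K W p p' B) {k : ℕ} (hk : 4 ≤ k)
    {θ y η : ℝ} (hθ : 0 < θ) (hy : 0 < y) (hη : 0 < η) : ∀ᶠ t in 𝓝[>] 0,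
    ∀ x, y * √t ≤ x → |scl k θ t * W (x / scl k θ t) - x - θ ^ 3 * K * (t ^ k / x ^ 2)|
      ≤ η * (t ^ k / x ^ 2) := by
  have hk0 : (4:ℝ) ≤ k := by exact_mod_cast hk
  have h1 : ∀ᶠ z in atTop, |z ^ 2 * (W z - z) - K| ≤ η / θ ^ 3 := by
    have h0 : 0 < η / θ ^ 3 := by positivity
    filter_upwards [(tendsto_iff_dist_tendsto_zero.1 hW.tendsto).eventually (gt_mem_nhds h0)] with z hz
    exact hz.le
  obtain ⟨Z, hZ⟩ := eventually_atTop.1 h1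
  filter_upwards [eventually_mul_rpow_le (a := (k : ℝ) / 3) (b := (1 / 2 : ℝ)) (by linarith)
    (θ * Z) (c := y) hy, self_mem_nhdsWithin] with t h2 ht x hx
  have ht : 0 < t := ht
  rw [← sqrt_eq_rpow] at h2
  have hs := scl_pos k hθ ht
  have hx0 : 0 < x := lt_of_lt_of_le (by have := sqrt_pos.2 ht; positivity) hx
  have hz : Z ≤ x / scl k θ t := by
    rw [le_div_iff₀ hs, scl]; linarith
  have h3 := scl_cube k (θ := θ) ht
  have h4 := hZ _ hz
  have e : scl k θ t * W (x / scl k θ t) - x - θ ^ 3 * K * (t ^ k / x ^ 2)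
      = θ ^ 3 * (t ^ k / x ^ 2) * ((x / scl k θ t) ^ 2 * (W (x / scl k θ t) - x / scl k θ t) - K) := by
    have : θ ^ 3 * (t ^ k / x ^ 2) = scl k θ t ^ 3 / x ^ 2 := by rw [h3]; ring
    rw [mul_right_comm, this]
    field_simp
  rw [e, abs_mul, abs_of_pos (by positivity)]
  calc θ ^ 3 * (t ^ k / x ^ 2) * _ ≤ θ ^ 3 * (t ^ k / x ^ 2) * (η / θ ^ 3) :=
        mul_le_mul_of_nonneg_left h4 (by positivity)
    _ = _ := by field_simp

theorem hsum_le {k : ℕ} {a : ℕ → ℝ} (ha : ∀ j, 0 ≤ a j) {x t y : ℝ} (ht : 0 ≤ t)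
    (hy1 : y ^ 2 ≤ 1) (h : x ^ 2 ≤ y ^ 2 * t) :
    hsum k a x t ≤ (a 0 + y ^ 2 * ∑ j ∈ range (k + 1), a j) * t ^ k := by
  have e : ∀ j ∈ range k, a (j + 1) * x ^ (2 * (j + 1)) * t ^ (k - (j + 1))
      ≤ y ^ 2 * a (j + 1) * t ^ k := fun j hj => by
    have hj : j + 1 ≤ k := mem_range.1 hj
    have h1 : x ^ (2 * (j + 1)) ≤ y ^ 2 * t ^ (j + 1) := by
      rw [pow_mul]
      calc (x ^ 2) ^ (j + 1) ≤ (y ^ 2 * t) ^ (j + 1) := pow_le_pow_left₀ (sq_nonneg x) h _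
        _ = (y ^ 2) ^ j * y ^ 2 * t ^ (j + 1) := by rw [mul_pow, pow_succ (y ^ 2)]
        _ ≤ 1 * y ^ 2 * t ^ (j + 1) := by
            gcongr; exact pow_le_one₀ (sq_nonneg y) hy1
        _ = _ := by ring
    calc a (j + 1) * x ^ (2 * (j + 1)) * t ^ (k - (j + 1))
        ≤ a (j + 1) * (y ^ 2 * t ^ (j + 1)) * t ^ (k - (j + 1)) := by
          have := ha (j + 1); gcongr
      _ = y ^ 2 * a (j + 1) * (t ^ (j + 1) * t ^ (k - (j + 1))) := by ring
      _ = _ := by rw [← pow_add]; congr 2; omega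
  rw [hsum, sum_range_succ', sum_range_succ']
  have := sum_le_sum e
  rw [← sum_mul, ← mul_sum] at this
  have h0 : 0 ≤ y ^ 2 * a 0 * t ^ k := by have := ha 0; positivity
  simp only [mul_zero, pow_zero, mul_one, Nat.sub_zero]
  linarith

set_option maxHeartbeats 400000 in
/-- The order relations between the inner and the outer barrier. -/
theorem eventually_inner_outer {k : ℕ} (hk : 4 ≤ k) {K0 : ℝ} (hK : 0 < K0)
    (hW : AlencarProfile (coef K0 k 0) W p p' B) {Γ ε σ : ℝ} (hΓ : 0 ≤ Γ) (hε : 0 < ε)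
    (hε1 : ε ≤ 1 / 6) (hσ : σ ^ 2 = 1) : ∀ᶠ y : ℝ in 𝓝[>] 0, ∀ C > 0,
    ∀ᶠ t in 𝓝[>] 0, ∀ x,
    (ε * y / 512 * √t < x → x < ε * y / 256 * √t → inner k W σ (1 + σ * ε) Γ x t
      ≤ outer k K0 σ ε C (16 * coef K0 k 0 * (ε * y / 256)) x t) ∧
    (y / 2 * √t ≤ x → x < y * √t → outer k K0 σ ε C (16 * coef K0 k 0 * (ε * y / 256)) x t
      ≤ inner k W σ (1 + σ * ε) Γ x t) ∧
    (y / 2 * √t ≤ x → 16 * coef K0 k 0 * (ε * y / 256) * (t ^ k * √t / x ^ 3)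
      ≤ hsum k (coef K0 k) x t / x ^ 2 / 2) := by
  obtain ⟨c, hc⟩ : ∃ c, c = coef K0 k := ⟨_, rfl⟩
  have hc0 : ∀ j, 0 ≤ c j := fun j => hc ▸ coef_nonneg hK.le k j
  obtain ⟨K1, hK1⟩ : ∃ K1, K1 = c 0 := ⟨_, rfl⟩
  have hK1p : 0 < K1 := by
    rw [hK1, hc, coef_zero]; have := Nat.doubleFactorial_pos (2 * k + 1); positivity
  rw [← hc, ← hK1] at hW ⊢
  obtain ⟨S, hS⟩ : ∃ S, S = ∑ j ∈ range (k + 1), c j := ⟨_, rfl⟩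
  have hσ1 : |σ| = 1 := by rw [← abs_one, ← sq_eq_sq_iff_abs_eq_abs]; simpa using hσ
  have q1 := eventually_mul_pow_le (a := 2) (b := 0) (by norm_num) S
    (show 0 < ε * K1 / 16 by positivity)
  have q2 := eventually_mul_pow_le (a := 2) (b := 0) (by norm_num) Γ
    (show 0 < ε * K1 / 8 by positivity)
  have q3 := eventually_mul_pow_le (a := 2) (b := 0) (by norm_num) 1 (show (0:ℝ) < 1 by norm_num)
  filter_upwards [q1, q2, q3, self_mem_nhdsWithin] with y q1 q2 q3 hy C hC
  have hy : 0 < y := hy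
  simp only [pow_zero, mul_one, one_mul] at q1 q2 q3
  obtain ⟨θ, hθ⟩ : ∃ θ, θ = 1 + σ * ε := ⟨_, rfl⟩
  have hσε : |σ * ε| = ε := by rw [abs_mul, hσ1, one_mul, abs_of_pos hε]
  have hσε' := abs_le.1 hσε.le
  have hθ0 : 0 < θ := by rw [hθ]; linarith [hσε'.1]
  have hθ3 : θ ^ 3 ≤ 2 := by
    calc θ ^ 3 ≤ (7 / 6) ^ 3 := pow_le_pow_left₀ hθ0.le (by rw [hθ]; linarith [hσε'.2]) 3
      _ ≤ 2 := by norm_num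
  have hσθ : σ + 5 / 2 * ε ≤ σ * θ ^ 3 := by
    have h0 : σ * θ ^ 3 = σ + 3 * ε + 3 * (σ * ε) * ε + ε ^ 2 * ε := by
      rw [hθ]; linear_combination (3 * ε + 3 * σ * ε ^ 2 + (σ ^ 2 + 1) * ε ^ 3) * hσ
    nlinarith only [hσε'.1, hε, hε1, h0, pow_pos hε 3]
  have t1 := eventually_mul_pow_le (a := 1) (b := 0) (by norm_num) C
    (show 0 < ε / 16 by positivity)
  have t2 := eventually_profile_expansion hW hk hθ0 (show 0 < ε * y / 512 by positivity)
    (show 0 < ε * K1 / 8 by positivity)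
  filter_upwards [t1, t2, self_mem_nhdsWithin] with t t1 t2 ht x
  have ht : 0 < t := ht
  simp only [pow_zero, mul_one, pow_one] at t1
  have hs0 : 0 < √t := sqrt_pos.2 ht
  have main : ∀ x, ε * y / 512 * √t < x → ∃ r, 0 < x ∧ |r| ≤ ε * K1 / 8 ∧
      inner k W σ θ Γ x t - σ * x = (σ * (θ ^ 3 * K1 + r) - Γ * (x ^ 2 / t)) * (t ^ k / x ^ 2) ∧
      K1 * (t ^ k / x ^ 2) ≤ hsum k c x t / x ^ 2 ∧ 0 < t ^ k / x ^ 2 ∧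
      (x ≤ y * √t → hsum k c x t / x ^ 2 ≤ K1 * (1 + ε / 16) * (t ^ k / x ^ 2)) ∧
      t ^ k * √t / x ^ 3 = √t / x * (t ^ k / x ^ 2) := by
    intro x hx
    have hx0 : 0 < x := lt_trans (by positivity) hx
    refine ⟨(scl k θ t * W (x / scl k θ t) - x - θ ^ 3 * K1 * (t ^ k / x ^ 2)) / (t ^ k / x ^ 2),
      hx0, ?_, ?_, ?_, by positivity, ?_, ?_⟩
    · rw [abs_div, abs_of_pos (show 0 < t ^ k / x ^ 2 by positivity), div_le_iff₀ (by positivity)]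
      exact t2 x hx.le
    · have : t ^ k = t * t ^ (k - 1) := by rw [← pow_succ']; congr 1; omega
      rw [inner, this]; field_simp; ring
    · have := le_hsum (k := k) (by omega) hc0 x ht.le
      rw [← mul_div_assoc]
      apply div_le_div_of_nonneg_right _ (by positivity)
      have h0 : 0 ≤ c k * x ^ (2 * k) := mul_nonneg (hc0 k) (by positivity)
      rw [hK1]; linarith
    · intro hxy
      have hx2 : x ^ 2 ≤ y ^ 2 * t := by
        calc x ^ 2 ≤ (y * √t) ^ 2 := pow_le_pow_left₀ hx0.le hxy 2
          _ = _ := by rw [mul_pow, sq_sqrt ht.le]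
      have := hsum_le (k := k) hc0 ht.le q3 hx2
      rw [← mul_div_assoc]
      apply div_le_div_of_nonneg_right (this.trans _) (by positivity)
      apply mul_le_mul_of_nonneg_right _ (by positivity)
      rw [← hS, ← hK1]; linarith
    · field_simp
  have hκ : ∀ v, σ * (x + (1 + σ * (ε + C * t)) * v) = σ * x + σ * v + (ε + C * t) * v := fun v => by
    linear_combination ((ε + C * t) * v) * hσ
  have hCt : 0 < C * t := by positivity
  refine ⟨fun hx1 hx2 => ?_, fun hx1 hx2 => ?_, fun hx1 => ?_⟩
  · obtain ⟨r, hx0, hr, hI, hv1, hG, hv2, hQ⟩ := main x hx1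
    have hv2 := hv2 (hx2.le.trans (by
      apply mul_le_mul_of_nonneg_right _ hs0.le; nlinarith only [hy, hε1]))
    rw [outer, hκ, hQ, ← hc, ← hθ]
    obtain ⟨G, hGe⟩ : ∃ G, G = t ^ k / x ^ 2 := ⟨_, rfl⟩
    obtain ⟨v, hve⟩ : ∃ v, v = hsum k c x t / x ^ 2 := ⟨_, rfl⟩
    rw [← hGe] at hI hv1 hG hv2 ⊢
    rw [← hve] at hv1 hv2 ⊢
    have hd : 16 * K1 ≤ 16 * K1 * (ε * y / 256) * (√t / x) := by
      rw [mul_assoc (16 * K1)]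
      apply le_mul_of_one_le_right (by positivity)
      rw [← mul_div_assoc, le_div_iff₀ hx0]; linarith
    have hd' := mul_le_mul_of_nonneg_right hd hG.le
    have h1 : σ * (θ ^ 3 * K1 + r) ≤ 3 * K1 := by
      refine (le_abs_self _).trans ?_
      rw [abs_mul, hσ1, one_mul]
      refine (abs_add_le _ _).trans ?_
      rw [abs_of_pos (by positivity)]
      nlinarith only [mul_le_mul_of_nonneg_right hθ3 hK1p.le, hr,
        mul_le_mul_of_nonneg_right hε1 hK1p.le, hK1p]
    have h1' := mul_le_mul_of_nonneg_right h1 hG.le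
    have hv0 : 0 ≤ v := le_trans (by positivity) hv1
    have h2 : -v ≤ σ * v := by
      have := neg_abs_le (σ * v); rwa [abs_mul, hσ1, one_mul, abs_of_nonneg hv0] at this
    have h3 : 0 ≤ Γ * (x ^ 2 / t) * G := by positivity
    have h4 : 0 ≤ (ε + C * t) * v := by positivity
    have h5 : K1 * (1 + ε / 16) * G ≤ 2 * (K1 * G) := by
      have : 0 < K1 * G := by positivity
      nlinarith only [this, mul_le_mul_of_nonneg_right hε1 this.le]
    have : 0 < K1 * G := by positivity
    linarith
  · have hx1' : ε * y / 512 * √t < x := lt_of_lt_of_le (by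
      apply mul_lt_mul_of_pos_right _ hs0; nlinarith only [hy, hε1]) hx1
    obtain ⟨r, hx0, hr, hI, hv1, hG, hv2, hQ⟩ := main x hx1'
    have hv2 := hv2 hx2.le
    have hY : Γ * (x ^ 2 / t) ≤ ε * K1 / 8 := by
      refine le_trans (mul_le_mul_of_nonneg_left ?_ hΓ) q2
      rw [div_le_iff₀ ht]
      calc x ^ 2 ≤ (y * √t) ^ 2 := pow_le_pow_left₀ hx0.le hx2.le 2
        _ = _ := by rw [mul_pow, sq_sqrt ht.le]
    rw [outer, hκ, hQ, ← hc, ← hθ]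
    obtain ⟨G, hGe⟩ : ∃ G, G = t ^ k / x ^ 2 := ⟨_, rfl⟩
    obtain ⟨v, hve⟩ : ∃ v, v = hsum k c x t / x ^ 2 := ⟨_, rfl⟩
    rw [← hGe] at hI hv1 hG hv2 ⊢
    rw [← hve] at hv1 hv2 ⊢
    have hd : 16 * K1 * (ε * y / 256) * (√t / x) ≤ ε * K1 / 8 := by
      rw [← mul_div_assoc, div_le_iff₀ hx0]
      nlinarith only [mul_le_mul_of_nonneg_left hx1 (by positivity : 0 ≤ ε * K1)]
    have hd' := mul_le_mul_of_nonneg_right hd hG.le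
    have hr' : -(ε * K1 / 8) ≤ σ * r := by
      have := neg_abs_le (σ * r); rw [abs_mul, hσ1, one_mul] at this; linarith
    have h1 : σ * K1 + 5 / 2 * ε * K1 - ε * K1 / 8 - ε * K1 / 8
        ≤ σ * (θ ^ 3 * K1 + r) - Γ * (x ^ 2 / t) := by
      nlinarith only [mul_le_mul_of_nonneg_right hσθ hK1p.le, hr', hY]
    have h1' := mul_le_mul_of_nonneg_right h1 hG.le
    have h2 : σ * v ≤ σ * (K1 * G) + (v - K1 * G) := by
      have := le_abs_self (σ * (v - K1 * G))
      rw [abs_mul, hσ1, one_mul, abs_of_nonneg (by linarith)] at this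
      linarith
    have h3 : (ε + C * t) * v ≤ 17 / 16 * ε * (K1 * (1 + ε / 16) * G) := by
      apply mul_le_mul (by linarith) hv2 (le_trans (by positivity) hv1) (by positivity)
    have hKG : 0 < ε * (K1 * G) := by positivity
    have h4 : ε * (ε * (K1 * G)) ≤ 1 / 6 * (ε * (K1 * G)) := mul_le_mul_of_nonneg_right hε1 hKG.le
    nlinarith only [h1', h2, h3, hI, hv2, hd', hKG, h4]
  · have hx1' : ε * y / 512 * √t < x := lt_of_lt_of_le (by
      apply mul_lt_mul_of_pos_right _ hs0; nlinarith only [hy, hε1]) hx1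
    obtain ⟨r, hx0, hr, hI, hv1, hG, hv2, hQ⟩ := main x hx1'
    rw [hQ]
    have hd : 16 * K1 * (ε * y / 256) * (√t / x) ≤ K1 / 2 := by
      rw [← mul_div_assoc, div_le_iff₀ hx0]
      have : ε * K1 * (y / 2 * √t) ≤ 1 * K1 * x := by
        gcongr; linarith
      nlinarith only [this, mul_pos hK1p hx0]
    have := mul_le_mul_of_nonneg_right hd hG.le
    linarith

/-- The barrier away from the origin (multiplied by the sign `σ`). -/
noncomputable def far (u0 : ℝ → ℝ) (σ m C x t : ℝ) : ℝ := σ * u0 x + m + C * t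

/-- The assumptions on the initial datum `u0`, together with a profile of matching decay. -/
structure Datum (k : ℕ) (K0 C0 : ℝ) (u0 W p p' B : ℝ → ℝ) : Prop where
  le_k : 4 ≤ k
  K_pos : 0 < K0
  C_pos : 0 < C0
  smooth : ContDiffOn ℝ ∞ u0 (Ioi 0)
  pos : ∀ x > (0:ℝ), 0 < u0 x
  asym : (fun x => u0 x - x - K0 * x ^ (2 * (k - 1)))
    =o[𝓝[>] 0] fun x : ℝ => x ^ (2 * (k - 1))
  slope : ∀ x > (0:ℝ), 0 ≤ deriv u0 x ∧ deriv u0 x ≤ C0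
  curv : ∀ x > (0:ℝ), |deriv (deriv u0) x| ≤ C0
  profile : AlencarProfile (coef K0 k 0) W p p' B

variable {u0 W p p' B : ℝ → ℝ} {K0 C0 : ℝ} {k : ℕ}

theorem Datum.monotoneOn (H : Datum k K0 C0 u0 W p p' B) : MonotoneOn u0 (Ioi 0) :=
  monotoneOn_of_deriv_nonneg (convex_Ioi 0) H.smooth.continuousOn
    (by rw [interior_Ioi]; exact H.smooth.differentiableOn (by simp))
    (by rw [interior_Ioi]; exact fun x hx => (H.slope x hx).1)

theorem Datum.exists_strictSuper_far (H : Datum k K0 C0 u0 W p p' B) {r : ℝ} (hr : 0 < r) :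
    ∃ C > 0, ∀ σ m t : ℝ, σ ^ 2 = 1 → 0 ≤ m → 0 ≤ t → m + C * t ≤ u0 r / 2 → ∀ x, r ≤ x →
      u0 r / 2 ≤ σ * far u0 σ m C x t ∧ ∀ L > C0, ∀ f : ℝ → ℝ,
      f (σ * far u0 σ m C x t) = 3 / (σ * far u0 σ m C x t) →
      StrictSuper L (fun v => σ * f (σ * v)) (far u0 σ m C) x t := by
  obtain ⟨-, -, hC0, hs, hpos, -, hd1, hd2, -⟩ := id H
  have hur := hpos r hr
  obtain ⟨C, hC⟩ : ∃ C, C = C0 + 3 * (C0 / r) + 6 / u0 r + 1 := ⟨_, rfl⟩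
  have hCp : 0 < C := by rw [hC]; positivity
  refine ⟨C, hCp, fun σ m t hσ hm ht hmt x hx => ?_⟩
  have hx0 : 0 < x := hr.trans_le hx
  have hσ1 : |σ| = 1 := by rw [← abs_one, ← sq_eq_sq_iff_abs_eq_abs]; simpa using hσ
  have hmono : u0 r ≤ u0 x := H.monotoneOn hr hx0 hx
  have hv : σ * far u0 σ m C x t = u0 x + σ * (m + C * t) := by
    rw [far]; linear_combination u0 x * hσ
  have hlow : u0 r / 2 ≤ σ * far u0 σ m C x t := by
    have := neg_abs_le (σ * (m + C * t))
    rw [abs_mul, hσ1, one_mul, abs_of_nonneg (by positivity)] at this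
    rw [hv]; linarith
  refine ⟨hlow, fun L hL f hf => ?_⟩
  have hcd : ∀ y : ℝ, 0 < y → ContDiffAt ℝ ∞ u0 y := fun y hy =>
    hs.contDiffAt (Ioi_mem_nhds hy)
  have hD : ∀ y : ℝ, 0 < y → HasDerivAt u0 (deriv u0 y) y := fun y hy =>
    ((hcd y hy).differentiableAt (by simp)).hasDerivAt
  have hD2 : HasDerivAt (deriv u0) (deriv (deriv u0) x) x := by
    have := ((contDiffOn_infty_iff_deriv_of_isOpen isOpen_Ioi).1 hs).2
    exact ((this.contDiffAt (Ioi_mem_nhds hx0)).differentiableAt (by simp)).hasDerivAt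
  refine StrictSuper.of_contDiffAt (Px := fun y => σ * deriv u0 y) (Pxx := σ * deriv (deriv u0) x)
    (Pt := C) hx0 ?_ ?_ (hD2.const_mul σ) ?_ ?_ ?_
  · have h1 : ContDiffAt ℝ 3 (fun q : ℝ × ℝ => u0 q.1) (x, t) :=
      ContDiffAt.comp (f := Prod.fst) (x, t) (contDiffAt_infty.1 (hcd x hx0) 3) contDiffAt_fst
    exact ((contDiffAt_const.mul h1).add contDiffAt_const).add (contDiffAt_const.mul contDiffAt_snd)
  · filter_upwards [lt_mem_nhds hx0] with y hy
    exact (((hD y hy).const_mul σ).add_const m).add_const (C * t)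
  · exact ((hasDerivAt_id t).const_mul C).const_add _ |>.congr_deriv (mul_one C)
  · rw [abs_mul, hσ1, one_mul, abs_of_nonneg (hd1 x hx0).1]; exact (hd1 x hx0).2.trans_lt hL
  · beta_reduce
    rw [hf, mul_pow, hσ, one_mul]
    have b1 : |σ * deriv (deriv u0) x / (1 + deriv u0 x ^ 2)| ≤ C0 := by
      rw [abs_div, abs_mul, hσ1, one_mul, abs_of_pos (show 0 < 1 + deriv u0 x ^ 2 by positivity)]
      exact (div_le_self (abs_nonneg _) (by nlinarith [sq_nonneg (deriv u0 x)])).trans (hd2 x hx0)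
    have b2 : |3 * (σ * deriv u0 x / x)| ≤ 3 * (C0 / r) := by
      rw [abs_mul, abs_div, abs_mul, hσ1, one_mul, abs_of_nonneg (hd1 x hx0).1, abs_of_pos hx0]
      norm_num
      exact div_le_div₀ hC0.le (hd1 x hx0).2 hr hx
    have b3 : |σ * (3 / (σ * far u0 σ m C x t))| ≤ 6 / u0 r := by
      rw [abs_mul, hσ1, one_mul, abs_of_pos (show 0 < 3 / (σ * far u0 σ m C x t) from div_pos (by norm_num) (by linarith))]
      rw [div_le_div_iff₀ (by linarith) hur]; linarith
    have := (abs_le.1 b1).2; have := (abs_le.1 b2).2; have := (abs_le.1 b3).1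
    linarith

theorem hsum_time_zero (k : ℕ) (a : ℕ → ℝ) (x : ℝ) : hsum k a x 0 = a k * x ^ (2 * k) := by
  rw [hsum, Finset.sum_eq_single k]
  · simp
  · intro j hj hjk
    have := mem_range.1 hj
    rw [zero_pow (by omega), mul_zero]
  · simp

theorem continuousAt_outer (k : ℕ) (K σ ε C δ : ℝ) {x : ℝ} (hx : 0 < x) (t : ℝ) :
    ContinuousAt (fun q : ℝ × ℝ => outer k K σ ε C δ q.2 q.1) (t, x) := by
  have h1 : Continuous (fun q : ℝ × ℝ => hsum k (coef K k) q.2 q.1) := by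
    unfold hsum; fun_prop
  unfold outer
  have h2 : ContinuousAt (fun q : ℝ × ℝ => hsum k (coef K k) q.2 q.1 / q.2 ^ 2) (t, x) :=
    h1.continuousAt.div (by fun_prop) (by positivity)
  have h3 : ContinuousAt (fun q : ℝ × ℝ => q.1 ^ k * √q.1 / q.2 ^ 3) (t, x) :=
    ContinuousAt.div (by fun_prop) (by fun_prop) (by positivity)
  fun_prop

/-- The order relations between the outer barrier and the far one. -/
theorem eventually_outer_far (hk : 4 ≤ k) (hK : 0 < K0) {r ε σ : ℝ} (hr : 0 < r)
    (hε : 0 < ε) (hσ : σ ^ 2 = 1) (hc : ContinuousOn u0 (Ioi 0))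
    (hu : ∀ x, 0 < x → x ≤ r → |u0 x - x - K0 * x ^ (2 * (k - 1))|
      ≤ ε / 4 * (K0 * x ^ (2 * (k - 1)))) (C C' δ : ℝ) :
    ∀ᶠ t in 𝓝[>] 0, ∀ x,
      (r / 2 ≤ x → x ≤ 5 * r / 8 → outer k K0 σ ε C δ x t
        ≤ far u0 σ (ε * (K0 * (3 * r / 4) ^ (2 * (k - 1)))) C' x t) ∧
      (7 * r / 8 ≤ x → x ≤ r → far u0 σ (ε * (K0 * (3 * r / 4) ^ (2 * (k - 1)))) C' x t
        ≤ outer k K0 σ ε C δ x t) := by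
  have hσ1 : |σ| = 1 := by rw [← abs_one, ← sq_eq_sq_iff_abs_eq_abs]; simpa using hσ
  obtain ⟨m, hm⟩ : ∃ m, m = ε * (K0 * (3 * r / 4) ^ (2 * (k - 1))) := ⟨_, rfl⟩
  rw [← hm]
  have o0 : ∀ x : ℝ, 0 < x → outer k K0 σ ε C δ x 0
      = σ * x + σ * (K0 * x ^ (2 * (k - 1))) + ε * (K0 * x ^ (2 * (k - 1))) := fun x hx => by
    have : x ^ (2 * k) = x ^ (2 * (k - 1)) * x ^ 2 := by rw [← pow_add]; congr 1; omega
    rw [outer, hsum_time_zero, coef_self, this, zero_pow (by omega)]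
    rw [show K0 * (x ^ (2 * (k - 1)) * x ^ 2) / x ^ 2 = K0 * x ^ (2 * (k - 1)) by field_simp]
    simp only [zero_mul, zero_div, mul_zero, add_zero]
    linear_combination (x ^ (2 * (k - 1)) * K0 * ε) * hσ
  have f0 : ∀ x, far u0 σ m C' x 0 = σ * u0 x + m := fun x => by rw [far]; ring
  have cf : ∀ x : ℝ, 0 < x → ContinuousAt (fun q : ℝ × ℝ => far u0 σ m C' q.2 q.1) (0, x) := fun x hx => by
    have h1 : ContinuousAt (fun q : ℝ × ℝ => u0 q.2) (0, x) :=
      ContinuousAt.comp (f := Prod.snd) (hc.continuousAt (Ioi_mem_nhds hx)) continuousAt_snd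
    exact ((continuousAt_const.mul h1).add continuousAt_const).add
      (continuousAt_const.mul continuousAt_fst)
  have us : ∀ x, 0 < x → x ≤ r → |σ * u0 x - σ * x - σ * (K0 * x ^ (2 * (k - 1)))|
      ≤ ε / 4 * (K0 * x ^ (2 * (k - 1))) := fun x hx hxr => by
    have := hu x hx hxr
    rw [← mul_sub, ← mul_sub, abs_mul, hσ1, one_mul]; exact this
  have hmp : 0 < m := by rw [hm]; positivity
  have A : ∀ᶠ t in nhds (0:ℝ), ∀ x ∈ Icc (r / 2) (5 * r / 8),
      outer k K0 σ ε C δ x t ≤ far u0 σ m C' x t := by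
    refine isCompact_Icc.eventually_forall_of_forall_eventually fun x hx => ?_
    have hx0 : 0 < x := by linarith [hx.1]
    have h : outer k K0 σ ε C δ x 0 < far u0 σ m C' x 0 := by
      rw [o0 x hx0, f0]
      have h1 : x ^ (2 * (k - 1)) ≤ (5 / 6) ^ (2 * (k - 1)) * (3 * r / 4) ^ (2 * (k - 1)) := by
        rw [← mul_pow]; exact pow_le_pow_left₀ hx0.le (by linarith [hx.2]) _
      have h2 : (5 / 6 : ℝ) ^ (2 * (k - 1)) ≤ 1 / 2 :=
        (pow_le_pow_of_le_one (by norm_num) (by norm_num) (show 6 ≤ 2 * (k - 1) by omega)).trans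
          (by norm_num)
      have h3 : ε * (K0 * x ^ (2 * (k - 1))) ≤ m / 2 := by
        calc ε * (K0 * x ^ (2 * (k - 1))) ≤ ε * (K0 * (1 / 2 * (3 * r / 4) ^ (2 * (k - 1)))) := by
              gcongr; exact h1.trans (mul_le_mul_of_nonneg_right h2 (by positivity))
          _ = m / 2 := by rw [hm]; ring
      have := (abs_le.1 (us x hx0 (by linarith [hx.2]))).1
      linarith
    exact ((continuousAt_outer k K0 σ ε C δ hx0 0).eventually_lt (cf x hx0) h).mono fun _ h => h.le
  have B : ∀ᶠ t in nhds (0:ℝ), ∀ x ∈ Icc (7 * r / 8) r,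
      far u0 σ m C' x t ≤ outer k K0 σ ε C δ x t := by
    refine isCompact_Icc.eventually_forall_of_forall_eventually fun x hx => ?_
    have hx0 : 0 < x := by linarith [hx.1]
    have h : far u0 σ m C' x 0 < outer k K0 σ ε C δ x 0 := by
      rw [o0 x hx0, f0]
      have h1 : (7 / 6) ^ (2 * (k - 1)) * (3 * r / 4) ^ (2 * (k - 1)) ≤ x ^ (2 * (k - 1)) := by
        rw [← mul_pow]; exact pow_le_pow_left₀ (by positivity) (by linarith [hx.1]) _
      have h2 : 2 ≤ (7 / 6 : ℝ) ^ (2 * (k - 1)) :=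
        le_trans (by norm_num) (pow_le_pow_right₀ (by norm_num) (show 6 ≤ 2 * (k - 1) by omega))
      have h3 : 2 * m ≤ ε * (K0 * x ^ (2 * (k - 1))) := by
        calc 2 * m = ε * (K0 * (2 * (3 * r / 4) ^ (2 * (k - 1)))) := by rw [hm]; ring
          _ ≤ _ := by
            gcongr; exact le_trans (mul_le_mul_of_nonneg_right h2 (by positivity)) h1
      have := (abs_le.1 (us x hx0 hx.2)).2
      linarith
    exact ((cf x hx0).eventually_lt (continuousAt_outer k K0 σ ε C δ hx0 0) h).mono fun _ h => h.le
  filter_upwards [A.filter_mono nhdsWithin_le_nhds, B.filter_mono nhdsWithin_le_nhds] with t a b x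
  exact ⟨fun h1 h2 => a x ⟨h1, h2⟩, fun h1 h2 => b x ⟨h1, h2⟩⟩

variable {W p p' B u0 : ℝ → ℝ} {K K0 : ℝ} {k : ℕ}

/-- The intermediate terms of the outer expansion, frozen for `x ≥ 1`. -/
noncomputable def mid (k : ℕ) (K s x : ℝ) : ℝ :=
  ∑ j ∈ range (k - 1), coef K k (j + 1) * min x 1 ^ (2 * j) * s ^ (k - (j + 1))

/-- Initial data at the small time `s`. -/
noncomputable def data (k : ℕ) (K : ℝ) (W u0 : ℝ → ℝ) (s x : ℝ) : ℝ :=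
  scl k 1 s * W (x / scl k 1 s) - x + u0 x + mid k K s x

theorem mid_nonneg (hK : 0 ≤ K) {s x : ℝ} (hs : 0 ≤ s) : 0 ≤ mid k K s x :=
  sum_nonneg fun j _ => by
    have := coef_nonneg hK k (j + 1)
    rw [pow_mul]; positivity

theorem mid_le (hK : 0 ≤ K) {s x : ℝ} (hs : 0 ≤ s) (hx : 0 ≤ x) (h : x ^ 2 ≤ s) :
    mid k K s x ≤ (∑ j ∈ range (k - 1), coef K k (j + 1)) * s ^ (k - 1) := by
  rw [mid, sum_mul]
  refine sum_le_sum fun j hj => ?_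
  have hj := mem_range.1 hj
  have hc := coef_nonneg hK k (j + 1)
  have h1 : min x 1 ^ (2 * j) ≤ s ^ j := by
    rw [pow_mul]
    refine pow_le_pow_left₀ (sq_nonneg _) (le_trans ?_ h) j
    exact pow_le_pow_left₀ (le_min hx zero_le_one) (min_le_left _ _) 2
  calc _ ≤ coef K k (j + 1) * s ^ j * s ^ (k - (j + 1)) := by gcongr
    _ = _ := by rw [mul_assoc, ← pow_add]; congr 2; omega

theorem mid_le_of_le_one (hK : 0 ≤ K) {s x : ℝ} (hs : 0 ≤ s) (hs1 : s ≤ 1) (hx : 0 ≤ x) :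
    mid k K s x ≤ (∑ j ∈ range (k - 1), coef K k (j + 1)) * s := by
  rw [mid, sum_mul]
  refine sum_le_sum fun j hj => ?_
  have hj := mem_range.1 hj
  have hc := coef_nonneg hK k (j + 1)
  have h1 : min x 1 ^ (2 * j) ≤ 1 := pow_le_one₀ (le_min hx zero_le_one) (min_le_right _ _)
  have h2 : s ^ (k - (j + 1)) ≤ s := by
    simpa using pow_le_pow_of_le_one hs hs1 (show 1 ≤ k - (j + 1) by omega)
  calc _ ≤ coef K k (j + 1) * 1 * s := by gcongr
    _ = _ := by ring

theorem mid_eq (hk : 2 ≤ k) {s x : ℝ} (hx : 0 < x) (hx1 : x ≤ 1) :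
    mid k K s x = hsum k (coef K k) x s / x ^ 2 - coef K k 0 * (s ^ k / x ^ 2)
      - K * x ^ (2 * (k - 1)) := by
  obtain ⟨n, rfl⟩ : ∃ n, k = n + 1 := ⟨k - 1, by omega⟩
  have h : hsum (n + 1) (coef K (n + 1)) x s = x ^ 2 * mid (n + 1) K s x
      + coef K (n + 1) 0 * s ^ (n + 1) + K * x ^ (2 * n) * x ^ 2 := by
    rw [hsum, sum_range_succ, sum_range_succ', mid, mul_sum, min_eq_left hx1,
      coef_self]
    simp only [Nat.add_sub_cancel, mul_zero, pow_zero, mul_one, Nat.sub_zero, Nat.sub_self]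
    rw [show x ^ (2 * (n + 1)) = x ^ (2 * n) * x ^ 2 by rw [← pow_add]; rfl, ← mul_assoc]
    congr 2
    exact sum_congr rfl fun j _ => by
      rw [show 2 * (j + 1) = 2 * j + 2 by ring, pow_add]; ring
  rw [h, Nat.add_sub_cancel]
  field_simp
  ring

theorem abs_mid_sub_le (hK : 0 ≤ K) {s x y : ℝ} (hs : 0 ≤ s) (hs1 : s ≤ 1) (hx : 0 ≤ x) (hy : 0 ≤ y) :
    |mid k K s x - mid k K s y| ≤ (∑ j ∈ range (k - 1), coef K k (j + 1) * (2 * j)) * |x - y| := by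
  rw [mid, mid, ← sum_sub_distrib, sum_mul]
  refine (abs_sum_le_sum_abs _ _).trans (sum_le_sum fun j hj => ?_)
  have hc := coef_nonneg hK k (j + 1)
  have h2 : s ^ (k - (j + 1)) ≤ 1 := pow_le_one₀ hs hs1
  have h3 : |min x 1 ^ (2 * j) - min y 1 ^ (2 * j)| ≤ |x - y| * (2 * j) := by
    have := abs_pow_sub_pow_le (min x 1) (min y 1) (2 * j)
    refine this.trans ?_
    have h4 : |min x 1 - min y 1| ≤ |x - y| := by
      have := abs_min_sub_min_le_max x 1 y 1
      simpa using this
    have h5 : max |min x 1| |min y 1| ≤ 1 := by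
      rw [abs_of_nonneg (le_min hx zero_le_one), abs_of_nonneg (le_min hy zero_le_one)]
      exact max_le (min_le_right _ _) (min_le_right _ _)
    have h6 : max |min x 1| |min y 1| ^ (2 * j - 1) ≤ 1 :=
      pow_le_one₀ (le_max_of_le_left (abs_nonneg _)) h5
    push_cast
    calc |min x 1 - min y 1| * (2 * (j:ℝ)) * max |min x 1| |min y 1| ^ (2 * j - 1)
        ≤ |x - y| * (2 * (j:ℝ)) * 1 := by gcongr
      _ = _ := by ring
  rw [← sub_mul, ← mul_sub, abs_mul, abs_mul, abs_of_nonneg hc, abs_of_nonneg (pow_nonneg hs _)]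
  calc _ ≤ coef K k (j + 1) * (|x - y| * (2 * j)) * 1 := by gcongr
    _ = _ := by ring

theorem profile_gain (hW : AlencarProfile K W p p' B) {c : ℝ} (hc : 0 ≤ c)
    (h : ∀ z ≥ 0, c ≤ (W z - z * p z) * (1 + z ^ 2)) {a b x : ℝ} (ha : 0 < a) (hab : a < b)
    (hx : 0 ≤ x) : (b - a) * (c / (1 + (x / a) ^ 2)) ≤ b * W (x / b) - a * W (x / a) := by
  have hd : ∀ r : ℝ, 0 < r → HasDerivAt (fun r => r * W (x / r)) (W (x / r) - x / r * p (x / r)) r :=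
    fun r hr => by
      have h1 : HasDerivAt (fun r : ℝ => x / r) (-(x / r ^ 2)) r :=
        ((hasDerivAt_const r x).div (hasDerivAt_id r) hr.ne').congr_deriv (by simp; ring)
      refine ((hasDerivAt_id r).mul ((hW.hasDerivAt (x / r)).comp r h1)).congr_deriv ?_
      simp only [id, Function.comp]
      field_simp
      ring
  obtain ⟨r, hr, e⟩ := exists_hasDerivAt_eq_slope (fun r => r * W (x / r)) _ hab
    (fun r hr => (hd r (ha.trans_le hr.1)).continuousAt.continuousWithinAt)
    (fun r hr => hd r (ha.trans hr.1))
  have hr0 : 0 < r := ha.trans hr.1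
  rw [eq_div_iff (by linarith)] at e
  rw [← e, mul_comm]
  refine mul_le_mul_of_nonneg_right ?_ (by linarith)
  have h1 := h (x / r) (by positivity)
  rw [← div_le_iff₀ (by positivity)] at h1
  refine le_trans ?_ h1
  have : x / r ≤ x / a := div_le_div_of_nonneg_left hx ha hr.1.le
  gcongr

theorem eventually_data_lt_inner (hk : 4 ≤ k) (hK : 0 < K0)
    (hW : AlencarProfile (coef K0 k 0) W p p' B) {Γ ε σ r : ℝ} (hε : 0 < ε)
    (hε1 : ε ≤ 1 / 6) (hσ : σ ^ 2 = 1) (hr : 0 < r)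
    (hu : ∀ x, 0 < x → x ≤ r → |u0 x - x| ≤ 2 * K0 * x ^ (2 * (k - 1))) :
    ∀ᶠ y : ℝ in 𝓝[>] 0, ∀ᶠ s in 𝓝[>] 0, ∀ x, 0 < x → x < y * √s →
      σ * data k K0 W u0 s x < inner k W σ (1 + σ * ε) Γ x s := by
  have hK1p : 0 < coef K0 k 0 := by
    rw [coef_zero]; have := Nat.doubleFactorial_pos (2 * k + 1); positivity
  obtain ⟨c, hc, C', -, hb⟩ := exists_profile_bounds hW hK1p
  have hgain : ∀ z ≥ 0, c ≤ (W z - z * p z) * (1 + z ^ 2) := fun z hz => (hb z hz).2.2.2.1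
  obtain ⟨S, hS⟩ : ∃ S, S = ∑ j ∈ range (k - 1), coef K0 k (j + 1) := ⟨_, rfl⟩
  have hS0 : 0 ≤ S := hS ▸ sum_nonneg fun j _ => coef_nonneg hK.le k _
  have hk0 : (4:ℝ) ≤ k := by exact_mod_cast hk
  filter_upwards [eventually_mul_pow_le (a := 2) (b := 0) (by norm_num) (5 * (2 * K0 + S + Γ))
    (show 0 < ε * c / 2 by positivity), Ioo_mem_nhdsGT (show (0:ℝ) < 1 by norm_num)] with y q1 hy
  simp only [pow_zero, mul_one] at q1
  have hy0 := hy.1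
  filter_upwards [eventually_mul_rpow_le (a := (k : ℝ) / 3) (b := (1 / 2 : ℝ)) (by linarith) 1 hy0,
    eventually_mul_rpow_le (a := (1/2 : ℝ)) (b := 0) (by norm_num) y hr,
    self_mem_nhdsWithin] with s h1 h2 hs x hx hxy
  have hs : 0 < s := hs
  rw [← sqrt_eq_rpow] at h1 h2
  rw [rpow_zero, mul_one] at h2
  obtain ⟨l, hl⟩ : ∃ l, l = scl k 1 s := ⟨_, rfl⟩
  have hlp : 0 < l := hl ▸ scl_pos k one_pos hs
  have hl1 : l ≤ y * √s := by rw [hl, scl]; exact h1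
  have hl3 : l ^ 3 = s * s ^ (k - 1) := by
    rw [hl, scl_cube k hs, one_pow, one_mul, ← pow_succ']; congr 1; omega
  have hsθ : ∀ θ, scl k θ s = θ * l := fun θ => by rw [hl, scl, scl, one_mul]
  have hsq : ∀ a, 0 ≤ a → a ≤ y * √s → a ^ 2 ≤ y ^ 2 * s := fun a ha h => by
    calc a ^ 2 ≤ (y * √s) ^ 2 := pow_le_pow_left₀ ha h 2
      _ = _ := by rw [mul_pow, sq_sqrt hs.le]
  have hx2 := hsq x hx.le hxy.le
  have hl2 := hsq l hlp.le hl1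
  obtain ⟨P, hP⟩ : ∃ P, P = s ^ (k - 1) := ⟨_, rfl⟩
  have hPp : 0 < P := hP ▸ pow_pos hs _
  have hG : ε * c * P / (5 * y ^ 2) ≤
      σ * (scl k (1 + σ * ε) s * W (x / scl k (1 + σ * ε) s) - l * W (x / l)) := by
    have g0 : ε * c * P / (5 * y ^ 2) ≤ ε * l * (c / (1 + (2 * x / l) ^ 2)) := by
      have e : ε * l * (c / (1 + (2 * x / l) ^ 2)) = ε * c * (s * P) / (l ^ 2 + 4 * x ^ 2) := by
        rw [hP, ← hl3]; field_simp; ring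
      rw [e, div_le_div_iff₀ (by positivity) (by positivity)]
      have : l ^ 2 + 4 * x ^ 2 ≤ 5 * y ^ 2 * s := by linarith
      calc ε * c * P * (l ^ 2 + 4 * x ^ 2) ≤ ε * c * P * (5 * y ^ 2 * s) := by gcongr
        _ = _ := by ring
    refine g0.trans ?_
    have hmono : ∀ a, l / 2 ≤ a → 0 < a →
        c / (1 + (2 * x / l) ^ 2) ≤ c / (1 + (x / a) ^ 2) := fun a ha ha0 => by
      have : x / a ≤ 2 * x / l := by
        rw [div_le_div_iff₀ ha0 hlp]; nlinarith only [mul_le_mul_of_nonneg_left ha hx.le]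
      gcongr
    rcases (mul_self_eq_one_iff.1 ((sq σ).symm.trans hσ)) with rfl | rfl
    · rw [hsθ]
      have := profile_gain hW hc.le hgain hlp (show l < (1 + 1 * ε) * l by nlinarith) hx.le
      have h3 := mul_le_mul_of_nonneg_left (hmono l (by linarith) hlp)
        (show 0 ≤ ε * l by positivity)
      rw [one_mul, one_mul] at *
      calc _ ≤ _ := h3
        _ = ((1 + ε) * l - l) * (c / (1 + (x / l) ^ 2)) := by ring
        _ ≤ _ := this
    · rw [hsθ]
      have ha0 : 0 < (1 + -1 * ε) * l := mul_pos (by linarith) hlp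
      have := profile_gain hW hc.le hgain ha0 (show (1 + -1 * ε) * l < l by nlinarith) hx.le
      have h3 := mul_le_mul_of_nonneg_left (hmono ((1 + -1 * ε) * l)
        (by nlinarith only [hε1, hlp, mul_le_mul_of_nonneg_right hε1 hlp.le]) ha0)
        (show 0 ≤ ε * l by positivity)
      calc _ ≤ _ := h3
        _ = (l - (1 + -1 * ε) * l) * (c / (1 + (x / ((1 + -1 * ε) * l)) ^ 2)) := by ring
        _ ≤ _ := this
        _ = _ := by ring
  have hxs : x ^ 2 ≤ s := hx2.trans (mul_le_of_le_one_left hs.le (pow_le_one₀ hy0.le hy.2.le))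
  have hm := mid_le (k := k) hK.le hs.le hx.le hxs
  have hm0 := mid_nonneg (k := k) hK.le hs.le (x := x)
  rw [← hS, ← hP] at hm
  have hX : x ^ (2 * (k - 1)) ≤ P := by
    rw [pow_mul, hP]; exact pow_le_pow_left₀ (sq_nonneg x) hxs _
  have hu' := hu x hx (hxy.le.trans h2)
  have hσ1 : |σ| = 1 := by rw [← abs_one, ← sq_eq_sq_iff_abs_eq_abs]; simpa using hσ
  have hr1 : σ * (u0 x - x + mid k K0 s x) ≤ (2 * K0 + S) * P := by
    refine (le_abs_self _).trans ?_
    rw [abs_mul, hσ1, one_mul]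
    refine (abs_add_le _ _).trans ?_
    rw [abs_of_nonneg hm0]
    nlinarith only [hu', hm, mul_le_mul_of_nonneg_left hX hK.le]
  have hlast : (2 * K0 + S + Γ) * P < ε * c * P / (5 * y ^ 2) := by
    rw [lt_div_iff₀ (by positivity)]
    have : 0 < ε * c * P := by positivity
    nlinarith only [mul_le_mul_of_nonneg_right q1 hPp.le, this]
  rw [inner, data, ← hl, ← hP]
  linarith

theorem eventually_data_lt_outer (hk : 4 ≤ k) (hK : 0 < K0)
    (hW : AlencarProfile (coef K0 k 0) W p p' B) {ε σ r y C δ : ℝ} (hε : 0 < ε)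
    (hσ : σ ^ 2 = 1) (hr1 : r ≤ 1) (hy : 0 < y) (hC : 0 ≤ C) (hδ : 0 ≤ δ)
    (hu : ∀ x, 0 < x → x ≤ r → |u0 x - x - K0 * x ^ (2 * (k - 1))|
      ≤ ε / 4 * (K0 * x ^ (2 * (k - 1)))) :
    ∀ᶠ s in 𝓝[>] 0, ∀ x, y * √s ≤ x → x ≤ r →
      σ * data k K0 W u0 s x < outer k K0 σ ε C δ x s := by
  have hK1p : 0 < coef K0 k 0 := by
    rw [coef_zero]; have := Nat.doubleFactorial_pos (2 * k + 1); positivity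
  have hσ1 : |σ| = 1 := by rw [← abs_one, ← sq_eq_sq_iff_abs_eq_abs]; simpa using hσ
  filter_upwards [eventually_profile_expansion hW hk one_pos hy
    (show 0 < ε * coef K0 k 0 / 4 by positivity), self_mem_nhdsWithin] with s h1 hs x hx hxr
  have hs : 0 < s := hs
  have hx0 : 0 < x := lt_of_lt_of_le (by have := sqrt_pos.2 hs; positivity) hx
  have h1 := h1 x hx
  have h2 := hu x hx0 hxr
  have hv := le_hsum (k := k) (by omega) (coef_nonneg hK.le k) x hs.le
  have h3 := mid_eq (K := K0) (s := s) (by omega : 2 ≤ k) hx0 (hxr.trans hr1)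
  obtain ⟨v, hve⟩ : ∃ v, v = hsum k (coef K0 k) x s / x ^ 2 := ⟨_, rfl⟩
  obtain ⟨G, hGe⟩ : ∃ G, G = s ^ k / x ^ 2 := ⟨_, rfl⟩
  obtain ⟨X, hXe⟩ : ∃ X, X = x ^ (2 * (k - 1)) := ⟨_, rfl⟩
  have hv' : coef K0 k 0 * G + K0 * X ≤ v := by
    rw [hve, hGe, le_div_iff₀ (by positivity)]
    rw [coef_self, show x ^ (2 * k) = X * x ^ 2 by
      rw [hXe, ← pow_add]; congr 1; omega] at hv
    calc _ = coef K0 k 0 * s ^ k + K0 * (X * x ^ 2) := by field_simp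
      _ ≤ _ := hv
  have hG : 0 < G := by rw [hGe]; positivity
  have hX : 0 < X := by rw [hXe]; positivity
  have hQ : 0 ≤ δ * (s ^ k * √s / x ^ 3) := by positivity
  rw [outer, data, h3]
  rw [← hve, ← hGe, ← hXe]
  rw [← hGe] at h1
  rw [← hXe] at h2
  rw [one_pow, one_mul] at h1
  have e : σ * (scl k 1 s * W (x / scl k 1 s) - x + u0 x + (v - coef K0 k 0 * G - K0 * X))
      = σ * x + σ * v + σ * ((scl k 1 s * W (x / scl k 1 s) - x - coef K0 k 0 * G)
        + (u0 x - x - K0 * X)) := by ring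
  have h4 : σ * ((scl k 1 s * W (x / scl k 1 s) - x - coef K0 k 0 * G)
        + (u0 x - x - K0 * X)) ≤ ε / 4 * v := by
    refine (le_abs_self _).trans ?_
    rw [abs_mul, hσ1, one_mul]
    refine (abs_add_le _ _).trans ?_
    nlinarith only [h1, h2, mul_le_mul_of_nonneg_left hv' hε.le]
  have e2 : σ * (x + (1 + σ * (ε + C * s)) * v) = σ * x + σ * v + (ε + C * s) * v := by
    linear_combination ((ε + C * s) * v) * hσ
  have hvp : 0 < v := lt_of_lt_of_le (by positivity) hv'
  have : 0 ≤ C * s * v := by positivity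
  rw [e, e2]
  nlinarith only [h4, hQ, this, mul_pos hε hvp]

theorem eventually_data_near (hk : 4 ≤ k) (hK : 0 < K0)
    (hW : AlencarProfile (coef K0 k 0) W p p' B) {m : ℝ} (hm : 0 < m) :
    ∀ᶠ s in 𝓝[>] 0, ∀ x, 0 < x → |data k K0 W u0 s x - u0 x| < m := by
  have hK1p : 0 < coef K0 k 0 := by
    rw [coef_zero]; have := Nat.doubleFactorial_pos (2 * k + 1); positivity
  obtain ⟨c, -, C, hC, hb⟩ := exists_profile_bounds hW hK1p
  have hk0 : (4:ℝ) ≤ k := by exact_mod_cast hk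
  obtain ⟨S, hS⟩ : ∃ S, S = ∑ j ∈ range (k - 1), coef K0 k (j + 1) := ⟨_, rfl⟩
  filter_upwards [eventually_mul_rpow_le (a := (k : ℝ) / 3) (b := 0) (by linarith) C
    (show 0 < m / 4 by positivity), eventually_mul_pow_le (a := 1) (b := 0) (by norm_num) S
    (show 0 < m / 4 by positivity), Ioo_mem_nhdsGT (show (0:ℝ) < 1 by norm_num)] with s h1 h2 hs x hx
  rw [rpow_zero, mul_one] at h1
  rw [pow_one, pow_zero, mul_one] at h2
  have hl : 0 < scl k 1 s := scl_pos k one_pos hs.1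
  have hz : 0 ≤ x / scl k 1 s := by positivity
  have g1 := mul_le_mul_of_nonneg_left (hb _ hz).2.1 hl.le
  have g2 := mul_lt_mul_of_pos_left (hW.gt _ hz) hl
  rw [mul_add, mul_div_cancel₀ _ hl.ne'] at g1
  rw [mul_div_cancel₀ _ hl.ne'] at g2
  have g3 : scl k 1 s * C ≤ m / 4 := by rw [scl, one_mul, mul_comm]; exact h1
  have g4 := mid_le_of_le_one (k := k) hK.le hs.1.le hs.2.le hx.le
  have g5 := mid_nonneg (k := k) hK.le hs.1.le (x := x)
  rw [← hS] at g4
  rw [data, abs_lt]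
  constructor <;> linarith

theorem exists_data_lipschitz {C0 : ℝ} (hK : 0 ≤ K0) (hW : AlencarProfile K W p p' B)
    (hs : ContDiffOn ℝ ∞ u0 (Ioi 0))
    (hd1 : ∀ x > (0:ℝ), 0 ≤ deriv u0 x ∧ deriv u0 x ≤ C0) :
    ∃ M, ∀ s ∈ Ioc (0:ℝ) 1, ∀ x > 0, ∀ y > x,
      |data k K0 W u0 s y - data k K0 W u0 s x| ≤ M * (y - x) := by
  refine ⟨1 + C0 + ∑ j ∈ range (k - 1), coef K0 k (j + 1) * (2 * j), fun s h x hx y hxy => ?_⟩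
  have hl : 0 < scl k 1 s := scl_pos k one_pos h.1
  have hD : ∀ z, 0 < z → HasDerivAt (fun z => scl k 1 s * W (z / scl k 1 s) - z + u0 z)
      (p (z / scl k 1 s) - 1 + deriv u0 z) z := fun z hz => by
    have h1 := ((hW.hasDerivAt (z / scl k 1 s)).comp z ((hasDerivAt_id z).div_const _)).const_mul
      (scl k 1 s)
    have h2 := ((hs.contDiffAt (Ioi_mem_nhds hz)).differentiableAt (by simp)).hasDerivAt
    refine ((h1.sub (hasDerivAt_id z)).add h2).congr_deriv ?_
    field_simp
  obtain ⟨z, hz, e⟩ := exists_hasDerivAt_eq_slope _ _ hxy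
    (fun r hr => (hD r (hx.trans_le hr.1)).continuousAt.continuousWithinAt)
    (fun r hr => hD r (hx.trans hr.1))
  rw [eq_div_iff (by linarith)] at e
  have hz0 := hx.trans hz.1
  have hp0 := hW.slope_nonneg (z / scl k 1 s) (by positivity)
  have hp1 := hW.slope_le (z / scl k 1 s) (by positivity)
  have hm := abs_mid_sub_le (k := k) hK h.1.le h.2 (hx.trans hxy).le hx.le
  rw [abs_of_pos (sub_pos.2 hxy)] at hm
  have e2 : data k K0 W u0 s y - data k K0 W u0 s x
      = (p (z / scl k 1 s) - 1 + deriv u0 z) * (y - x) + (mid k K0 s y - mid k K0 s x) := by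
    rw [e, data, data]; ring
  rw [e2, add_mul (1 + C0)]
  refine (abs_add_le _ _).trans (add_le_add ?_ hm)
  rw [abs_mul, abs_of_pos (sub_pos.2 hxy)]
  refine mul_le_mul_of_nonneg_right ?_ (by linarith)
  have := hd1 z hz0
  rw [abs_le]; constructor <;> linarith

variable {W p p' B u0 : ℝ → ℝ} {K0 C0 : ℝ} {k : ℕ}

/-- A family of supersolutions trapping, up to `ε`, the flow starting from `u0` from one side. -/
structure Barrier (k : ℕ) (K0 C0 : ℝ) (W u0 : ℝ → ℝ) (ε σ T y r c : ℝ) (g : ℝ → ℝ)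
    (b : ℝ → ℝ → ℝ) : Prop where
  le_initial : ∀ x > 0, ∀ t ∈ Ioc 0 T, b x t ≤ σ * u0 x + ε
  le_profile : ∀ x > 0, ∀ t ∈ Ioc 0 T, x < y * √t →
    b x t ≤ σ * (scl k (1 + σ * ε) t * W (x / scl k (1 + σ * ε) t))
  eq_far : ∀ x ≥ 1, ∀ t ∈ Ioc 0 T, b x t = σ * u0 x + g t
  ge : ∀ x > 0, ∀ t ∈ Ioc 0 T, t ^ k ≤ σ * b x t
  le_axis : σ = -1 → ∀ x > 0, ∀ t ∈ Ioc 0 T, x ≤ r → b x t ≤ -x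
  le_away : σ = -1 → ∀ x ≥ r, ∀ t ∈ Ioc 0 T, b x t ≤ -c
  barrierAt : ∀ L ≥ 2, C0 < L → ∀ s ∈ Ioc 0 T, ∀ f : ℝ → ℝ, (∀ v ≥ s ^ k, f v = 3 / v) →
    ∀ x ≥ 0, ∀ t ∈ Icc s T, BarrierAt L (fun v => σ * f (σ * v)) b x t
  initial : ∀ᶠ s in 𝓝[>] 0, ∀ x > 0, σ * data k K0 W u0 s x < b x s

set_option maxHeartbeats 1000000 in
theorem Datum.exists_barrier (H : Datum k K0 C0 u0 W p p' B) {ε σ : ℝ} (hε : 0 < ε)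
    (hε1 : ε ≤ 1 / 6) (hσ : σ ^ 2 = 1) :
    ∃ T > 0, ∃ y > 0, ∃ r > 0, ∃ c > 0, ∃ g b, Barrier k K0 C0 W u0 ε σ T y r c g b := by
  obtain ⟨hk, hK, hC0, hs, hpos, hasym, hd1, hd2, hW⟩ := id H
  have hK1p : 0 < coef K0 k 0 := by
    rw [coef_zero]; have := Nat.doubleFactorial_pos (2 * k + 1); positivity
  have hk0 : (4:ℝ) ≤ k := by exact_mod_cast hk
  have hσ1 : |σ| = 1 := by rw [← abs_one, ← sq_eq_sq_iff_abs_eq_abs]; simpa using hσ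
  have hσε : |σ * ε| = ε := by rw [abs_mul, hσ1, one_mul, abs_of_pos hε]
  have hσε' := abs_le.1 hσε.le
  obtain ⟨θ, hθ⟩ := exists_eq (a' := 1 + σ * ε)
  have hθ1 : 1 / 2 ≤ θ := by rw [hθ]; linarith [hσε'.1]
  have hθ2 : θ ≤ 2 := by rw [hθ]; linarith [hσε'.2]
  have hσle : ∀ v, σ * v ≤ |v| := fun v => by
    have := le_abs_self (σ * v); rwa [abs_mul, hσ1, one_mul] at this
  have hσcancel : ∀ v, σ * (σ * v) = v := fun v => by linear_combination v * hσ
  -- closeness of the initial datum to its expansion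
  obtain ⟨r0, hr0, hcl⟩ : ∃ r0 > 0, ∀ x, 0 < x → x ≤ r0 →
      |u0 x - x - K0 * x ^ (2 * (k - 1))| ≤ ε / 4 * (K0 * x ^ (2 * (k - 1))) := by
    obtain ⟨r0, hr0, h⟩ := mem_nhdsGT_iff_exists_Ioc_subset.1
      (hasym.def (show 0 < ε / 4 * K0 by positivity))
    refine ⟨r0, hr0, fun x hx hxr => ?_⟩
    have := h ⟨hx, hxr⟩
    simp only [mem_setOf_eq, norm_eq_abs] at this
    rw [abs_of_pos (show 0 < x ^ (2 * (k - 1)) by positivity)] at this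
    linarith
  have hcl2 : ∀ x, 0 < x → x ≤ r0 → |u0 x - x| ≤ 2 * K0 * x ^ (2 * (k - 1)) := fun x hx hxr => by
    have h1 := hcl x hx hxr
    have h2 : 0 < K0 * x ^ (2 * (k - 1)) := by positivity
    rw [abs_le] at *
    constructor <;> nlinarith only [h1.1, h1.2, h2, hε1]
  obtain ⟨Γ, hΓ, hInner⟩ := exists_strictSuper_inner hW hK1p hk
  obtain ⟨cW, -, CW, hCW, hWb⟩ := exists_profile_bounds hW hK1p
  obtain ⟨y, hio, hdi, hyk, hy⟩ := ((eventually_inner_outer hk hK hW hΓ.le hε hε1 hσ).and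
    ((eventually_data_lt_inner (Γ := Γ) hk hK hW hε hε1 hσ hr0 hcl2).and
    ((eventually_mul_pow_le (a := 2) (b := 0) (by norm_num) (4 * k)
      (show (0:ℝ) < 1 by norm_num)).and self_mem_nhdsWithin))).exists
  have hy : 0 < y := hy
  rw [pow_zero, mul_one] at hyk
  obtain ⟨δ, hδ⟩ := exists_eq (a' := 16 * coef K0 k 0 * (ε * y / 256))
  have hδ0 : 0 ≤ δ := by rw [hδ]; positivity
  obtain ⟨y1, hy1⟩ := exists_eq (a' := ε * y / 512)
  have hy1p : 0 < y1 := by rw [hy1]; positivity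
  have hy1' : ε * y / 256 = 2 * y1 := by rw [hy1]; ring
  have hy1y : 2 * y1 ≤ y / 2 := by rw [hy1]; nlinarith only [hy, hε1]
  obtain ⟨C, hC, rO, hrO, hOuter⟩ := exists_strictSuper_outer hk hK hy1p hδ0
  have hio := hio C hC
  rw [← hδ, hy1', ← hy1, ← hθ] at hio
  rw [← hθ] at hdi
  set I := inner k W σ θ Γ with hI
  set O := outer k K0 σ ε C δ with hO
  obtain ⟨x0, hx0, hx0r, hx0O, hx01, hx0ε, hx0K⟩ : ∃ x0 > 0, x0 ≤ r0 ∧ x0 ≤ rO ∧ x0 ≤ 1 ∧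
      x0 ≤ ε / 2 ∧ 2 * K0 * x0 ≤ 1 / 16 := by
    obtain ⟨x, h, h'⟩ := exists_between (show 0 < min (min r0 rO) (min (min 1 (ε / 2))
      (1 / (32 * K0))) by positivity)
    simp only [lt_min_iff, lt_div_iff₀ (show 0 < 32 * K0 by positivity)] at h'
    grind
  have hnear : ∀ x, 0 < x → x ≤ x0 → K0 * x ^ (2 * (k - 1)) ≤ x / 32 ∧ |u0 x - x| ≤ x / 16 := by
    intro x hx hxx
    have h1 := hcl2 x hx (hxx.trans hx0r)
    have h2 : x ^ (2 * (k - 1)) ≤ x ^ 2 :=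
      pow_le_pow_of_le_one hx.le (hxx.trans hx01) (by omega)
    have h3 : 2 * K0 * x ^ (2 * (k - 1)) ≤ x / 16 := by
      have := mul_le_mul_of_nonneg_left hxx hK.le
      nlinarith only [this, hx, hx0K, mul_le_mul_of_nonneg_left h2 hK.le]
    exact ⟨by linarith, h1.trans h3⟩
  have hclx : ∀ x, 0 < x → x ≤ x0 → |u0 x - x - K0 * x ^ (2 * (k - 1))|
      ≤ ε / 4 * (K0 * x ^ (2 * (k - 1))) := fun x hx hxx => hcl x hx (hxx.trans hx0r)
  obtain ⟨C', hC', hFar⟩ := H.exists_strictSuper_far (half_pos hx0)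
  obtain ⟨m, hm⟩ := exists_eq (a' := ε * (K0 * (3 * x0 / 4) ^ (2 * (k - 1))))
  have hm0 : 0 < m := by rw [hm]; positivity
  obtain ⟨ur, hur⟩ := exists_eq (a' := u0 (x0 / 2))
  have hurx : 15 / 32 * x0 ≤ ur := by
    have := (abs_le.1 (hnear (x0 / 2) (by positivity) (by linarith)).2).1
    rw [hur]; linarith
  have hmx : m ≤ ε * x0 / 32 := by
    have := mul_le_mul_of_nonneg_left (hnear (3 * x0 / 4) (by positivity) (by linarith)).1 hε.le
    rw [hm]; nlinarith only [this, mul_pos hε hx0]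
  have hmx2 : m ≤ x0 / 32 := by nlinarith only [hmx, hx0, hε1]
  have hof := eventually_outer_far hk hK hx0 hε hσ hs.continuousOn hclx C C' δ
  rw [← hm] at hof
  set R := far u0 σ m C' with hR
  have hur0 : 0 < ur := by linarith
  have hevT : ∀ᶠ t in 𝓝[>] (0:ℝ),
      (∀ x ≥ 0, x < y * √t → t ^ k ≤ σ * I x t ∧ ∀ L > 1, ∀ f : ℝ → ℝ,
        f (σ * I x t) = 3 / (σ * I x t) →
        StrictSuper L (fun v => σ * f (σ * v)) I x t) ∧
      (∀ x, (y1 * √t < x → x < 2 * y1 * √t → I x t ≤ O x t) ∧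
        (y / 2 * √t ≤ x → x < y * √t → O x t ≤ I x t) ∧
        (y / 2 * √t ≤ x → δ * (t ^ k * √t / x ^ 3) ≤ hsum k (coef K0 k) x t / x ^ 2 / 2)) ∧
      (∀ x, (x0 / 2 ≤ x → x ≤ 5 * x0 / 8 → O x t ≤ R x t) ∧
        (7 * x0 / 8 ≤ x → x ≤ x0 → R x t ≤ O x t)) ∧
      y * √t ≤ x0 / 2 ∧ C * t ≤ 1 / 3 ∧ C' * t ≤ ε * x0 / 32 ∧ t ^ k ≤ y1 / 2 * √t ∧
      t ^ k ≤ ur / 2 ∧ 2 * CW * t ^ ((k:ℝ) / 3) ≤ ε / 4 := by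
    have a1 := hInner σ θ hσ hθ1 hθ2 y hy (by linarith)
    have a4 := eventually_mul_rpow_le (a := (1/2 : ℝ)) (b := 0) (by norm_num) y (half_pos hx0)
    have a5 := eventually_mul_pow_le (a := 1) (b := 0) (by norm_num) C
      (show (0:ℝ) < 1 / 3 by norm_num)
    have a6 := eventually_mul_pow_le (a := 1) (b := 0) (by norm_num) C'
      (show 0 < ε * x0 / 32 by positivity)
    have a7 := eventually_mul_rpow_le (a := (k : ℝ)) (b := (1 / 2 : ℝ)) (by linarith) 1
      (half_pos hy1p)
    have a8 := eventually_mul_pow_le (a := k) (b := 0) (by omega) 1 (half_pos hur0)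
    have a9 := eventually_mul_rpow_le (a := (k : ℝ) / 3) (b := 0) (by linarith) (2 * CW)
      (show 0 < ε / 4 by positivity)
    filter_upwards [a1, hio, hof, a4, a5, a6, a7, a8, a9] with t b1 b2 b3 b4 b5 b6 b7 b8 b9
    simp only [← sqrt_eq_rpow, rpow_natCast, rpow_zero, pow_zero, pow_one, mul_one,
      one_mul] at b4 b5 b6 b7 b8 b9
    exact ⟨b1, b2, b3, b4, b5, b6, b7, b8, b9⟩
  obtain ⟨T', hT', hT⟩ := mem_nhdsGT_iff_exists_Ioo_subset.1 hevT
  have hT' : 0 < T' := hT'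
  have hT : ∀ t, 0 < t → t < T' → _ := fun t h h' => hT ⟨h, h'⟩
  simp only [mem_setOf_eq] at hT
  -- pointwise facts on the pieces
  have outerOK : ∀ x t, 0 < t → t < T' → y1 * √t ≤ x → x ≤ x0 →
      t ^ k ≤ σ * O x t ∧ |σ * O x t - x| ≤ x / 2 ∧ ∀ L ≥ 2,
      ∀ f : ℝ → ℝ, f (σ * O x t) = 3 / (σ * O x t) →
      StrictSuper L (fun v => σ * f (σ * v)) O x t := by
    intro x t ht htT h1 h2
    obtain ⟨-, -, -, -, b5, -, b7, -, -⟩ := hT t ht htT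
    have hx : 0 < x := lt_of_lt_of_le (by have := sqrt_pos.2 ht; positivity) h1
    obtain ⟨g1, g2⟩ := hOuter σ ε hσ hε.le (by linarith) x t ht (by linarith) h1 hx (h2.trans hx0O)
    exact ⟨by linarith [(abs_le.1 g1).1], g1, g2⟩
  have farOK : ∀ x t, 0 < t → t < T' → x0 / 2 ≤ x →
      ur / 2 ≤ σ * R x t ∧ ∀ L > C0, ∀ f : ℝ → ℝ,
      f (σ * R x t) = 3 / (σ * R x t) →
      StrictSuper L (fun v => σ * f (σ * v)) R x t := by
    intro x t ht htT h1
    obtain ⟨-, -, -, -, -, b6, -, -, -⟩ := hT t ht htT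
    rw [hur]
    refine hFar σ m t hσ hm0.le ht.le ?_ x h1
    rw [← hur]; nlinarith only [b6, hmx2, hurx, hx0, hε1]
  set ρ : ℝ → ℝ → ℝ := fun x t => x / √t with hρ
  obtain ⟨b₁, hb₁⟩ := exists_eq (a' := glue ρ (2 * y1) (y / 2) I O)
  obtain ⟨b, hb⟩ := exists_eq (a' := glue (fun x _ => x) (5 * x0 / 8) (7 * x0 / 8) b₁ R)
  have hρlt : ∀ {x t a : ℝ}, 0 < t → (ρ x t < a ↔ x < a * √t) := fun ht =>
    div_lt_iff₀ (sqrt_pos.2 ht)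
  have hρle : ∀ {x t a : ℝ}, 0 < t → (a ≤ ρ x t ↔ a * √t ≤ x) := fun ht =>
    le_div_iff₀ (sqrt_pos.2 ht)
  have hρlt' : ∀ {x t a : ℝ}, 0 < t → (a < ρ x t ↔ a * √t < x) := fun ht =>
    lt_div_iff₀ (sqrt_pos.2 ht)
  have cases₁ : ∀ x t, 0 < t → (x < y * √t ∧ b₁ x t = I x t) ∨
      (y1 * √t ≤ x ∧ b₁ x t = O x t) := fun x t ht => by
    have hst := sqrt_pos.2 ht
    rcases glue_cases ρ (2 * y1) (y / 2) I O x t with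
      ⟨h, e⟩ | ⟨h, e⟩
    · rw [hρlt ht, hρlt ht] at h
      exact Or.inl ⟨by rcases h with h | h <;> nlinarith, hb₁ ▸ e⟩
    · rw [hρle ht] at h
      exact Or.inr ⟨by nlinarith only [hst, hy1p, h], hb₁ ▸ e⟩
  have cases₂ : ∀ x t, (x < 7 * x0 / 8 ∧ b x t = b₁ x t) ∨
      (5 * x0 / 8 ≤ x ∧ b x t = R x t) := fun x t => by
    rcases glue_cases (fun x _ => x) (5 * x0 / 8) (7 * x0 / 8) b₁ R x t with
      ⟨h, e⟩ | ⟨h, e⟩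
    · exact Or.inl ⟨by rcases h with h | h <;> linarith, hb ▸ e⟩
    · exact Or.inr ⟨h, hb ▸ e⟩
  have hbsmall : ∀ x t, x < 5 * x0 / 8 → b x t = b₁ x t := fun x t h => by
    rw [hb]; exact if_pos h
  have b₁inner : ∀ x t, 0 < t → t < T' → x < y * √t → b₁ x t ≤ I x t := by
    intro x t ht htT hx
    rw [hb₁]
    refine glue_le_left fun h => ?_
    rw [hρle ht] at h
    exact ((hT t ht htT).2.1 x).2.1 h hx
  have b₁neg : σ = -1 → ∀ x t, 0 < x → 0 < t → t < T' → b₁ x t ≤ -x := by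
    intro hσm x t hx ht htT
    have hst := sqrt_pos.2 ht
    rcases lt_or_ge x (y * √t) with h | h
    · refine (b₁inner x t ht htT h).trans ?_
      have hl : 0 < scl k θ t := scl_pos k (by linarith) ht
      have h1 := mul_lt_mul_of_pos_left (hW.gt (x / scl k θ t) (by positivity)) hl
      rw [mul_div_cancel₀ _ hl.ne'] at h1
      have h2 : 0 ≤ Γ * t ^ (k - 1) := by positivity
      rw [hI, inner, hσm]; linarith
    · have h2 : y / 2 * √t ≤ x := by nlinarith only [h, hy, hst]
      have e : b₁ x t = O x t := by
        rw [hb₁]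
        exact glue_of_le _ _ hy1y ((hρle ht).2 h2)
      obtain ⟨-, b2, -, -, b5, -⟩ := hT t ht htT
      have h3 := (b2 x).2.2 h2
      have hv : 0 ≤ hsum k (coef K0 k) x t / x ^ 2 :=
        div_nonneg (sum_nonneg fun j _ => by
          have := coef_nonneg hK.le k j; positivity) (by positivity)
      rw [e, hO, outer, hσm]
      have h4 : (ε + C * t) * (hsum k (coef K0 k) x t / x ^ 2)
          ≤ 1 / 2 * (hsum k (coef K0 k) x t / x ^ 2) :=
        mul_le_mul_of_nonneg_right (by linarith) hv
      linarith
  have hTh : ∀ t, t ≤ T' / 2 → t < T' := fun t h => by linarith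
  refine ⟨T' / 2, half_pos hT', y, hy, x0 / 2, half_pos hx0, min (x0 / 2) (ur / 2),
    lt_min (half_pos hx0) (half_pos hur0), fun t => m + C' * t, b, ?_, ?_, ?_, ?_, ?_, ?_, ?_, ?_⟩
  · intro x hx t ht
    have htT := hTh t ht.2
    obtain ⟨-, -, -, b4, -, b6, -, -, b9⟩ := hT t ht.1 htT
    have hxu : x ≤ x0 → σ * x ≤ σ * u0 x + x / 16 := fun h => by
      have h1 := hσle (x - u0 x)
      rw [abs_sub_comm] at h1
      have := (hnear x hx h).2
      linarith
    rcases cases₂ x t with ⟨h, e⟩ | ⟨h, e⟩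
    · rw [e]
      have hxx : x ≤ x0 := by linarith
      have hxu := hxu hxx
      rcases cases₁ x t ht.1 with ⟨h', e'⟩ | ⟨h', e'⟩
      · rw [e', hI, inner]
        have hl : 0 < scl k θ t := scl_pos k (by linarith) ht.1
        have hz : 0 ≤ x / scl k θ t := by positivity
        have g1 := mul_le_mul_of_nonneg_left (hWb _ hz).2.1 hl.le
        have g2 := mul_lt_mul_of_pos_left (hW.gt _ hz) hl
        rw [mul_add, mul_div_cancel₀ _ hl.ne'] at g1
        rw [mul_div_cancel₀ _ hl.ne'] at g2
        have g3 : scl k θ t * CW ≤ ε / 4 := by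
          refine le_trans ?_ b9
          rw [scl, mul_right_comm]
          have : 0 < t ^ ((k:ℝ) / 3) := rpow_pos_of_pos ht.1 _
          gcongr
        have g4 := hσle (scl k θ t * W (x / scl k θ t) - x)
        rw [abs_of_pos (by linarith)] at g4
        have : 0 ≤ Γ * t ^ (k - 1) := by have := ht.1; positivity
        linarith
      · rw [e']
        have g1 := (outerOK x t ht.1 htT h' hxx).2.1
        have g2 := hσle (σ * O x t - x)
        rw [mul_sub, hσcancel] at g2
        linarith
    · rw [e, hR, far]; nlinarith only [b6, hmx, hx01, hε, mul_le_mul_of_nonneg_left hx01 hε.le]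
  · intro x hx t ht hxy
    have htT := hTh t ht.2
    have b4 := (hT t ht.1 htT).2.2.2.1
    rw [hbsmall x t (by linarith), ← hθ]
    refine (b₁inner x t ht.1 htT hxy).trans ?_
    have : 0 ≤ Γ * t ^ (k - 1) := by have := ht.1; positivity
    rw [hI, inner]; linarith
  · intro x hx t ht
    rw [hb, glue_of_le _ _ (by linarith) (by linarith), hR, far]; ring
  · intro x hx t ht
    have htT := hTh t ht.2
    rcases cases₂ x t with ⟨h, e⟩ | ⟨h, e⟩
    · rw [e]
      rcases cases₁ x t ht.1 with ⟨h', e'⟩ | ⟨h', e'⟩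
      · rw [e']; exact ((hT t ht.1 htT).1 x hx.le h').1
      · rw [e']; exact (outerOK x t ht.1 htT h' (by linarith)).1
    · rw [e]
      exact (hT t ht.1 htT).2.2.2.2.2.2.2.1.trans (farOK x t ht.1 htT (by linarith)).1
  · intro hσm x hx t ht hxr
    rw [hbsmall x t (by linarith)]
    exact b₁neg hσm x t hx ht.1 (hTh t ht.2)
  · intro hσm x hx t ht
    have htT := hTh t ht.2
    have hx' : x0 / 2 ≤ x := hx
    rcases cases₂ x t with ⟨h, e⟩ | ⟨h, e⟩
    · rw [e]
      have := b₁neg hσm x t (by linarith) ht.1 htT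
      have := min_le_left (x0 / 2) (ur / 2)
      linarith
    · rw [e]
      have h1 := (farOK x t ht.1 htT hx).1
      rw [hσm] at h1
      have := min_le_right (x0 / 2) (ur / 2)
      linarith
  · intro L hL hL' s hs' f hf x hx t ht
    have ht0 : 0 < t := hs'.1.trans_le ht.1
    have htT := hTh t ht.2
    have hst : s ^ k ≤ t ^ k := pow_le_pow_left₀ hs'.1.le ht.1 k
    have hevt : ∀ᶠ q : ℝ × ℝ in nhds (x, t), 0 < q.2 ∧ q.2 < T' :=
      (continuous_snd.tendsto (x, t)).eventually (Ioo_mem_nhds ht0 htT)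
    have b8 := (hT t ht0 htT).2.2.2.2.2.2.2.1
    rw [hb]
    refine BarrierAt.glue (α := x0 / 2) (β := x0) (by linarith) (by linarith) (by linarith)
      continuousAt_fst ?_ ?_ ?_ ?_
    · intro hxx
      rw [hb₁]
      refine BarrierAt.glue (α := y1) (β := y) (by linarith) hy1y (by linarith) ?_ ?_ ?_ ?_ ?_
      · rw [hρ]
        exact continuousAt_fst.div (by fun_prop) (sqrt_pos.2 ht0).ne'
      · intro h
        rw [hρlt ht0] at h
        obtain ⟨g1, g2⟩ := (hT t ht0 htT).1 x hx h
        exact (g2 L (by linarith) f (hf _ (hst.trans g1))).barrierAt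
      · intro h
        rw [hρlt' ht0] at h
        obtain ⟨g1, -, g2⟩ := outerOK x t ht0 htT h.le hxx.le
        exact (g2 L hL f (hf _ (hst.trans g1))).barrierAt
      · filter_upwards [hevt] with q hq _ h1 h2
        rw [hρlt' hq.1] at h1
        rw [hρlt hq.1] at h2
        exact ((hT q.2 hq.1 hq.2).2.1 q.1).1 h1 h2
      · filter_upwards [hevt] with q hq _ h1 h2
        rw [hρle hq.1] at h1
        rw [hρlt hq.1] at h2
        exact ((hT q.2 hq.1 hq.2).2.1 q.1).2.1 h1 h2
    · intro hxx
      obtain ⟨g1, g2⟩ := farOK x t ht0 htT hxx.le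
      exact (g2 L hL' f (hf _ (hst.trans (b8.trans g1)))).barrierAt
    · filter_upwards [hevt] with q hq hq0 h1 h2
      rcases cases₁ q.1 q.2 hq.1 with ⟨h', e'⟩ | ⟨h', e'⟩
      · have := (hT q.2 hq.1 hq.2).2.2.2.1
        linarith
      · rw [e']; exact ((hT q.2 hq.1 hq.2).2.2.1 q.1).1 h1.le h2.le
    · filter_upwards [hevt] with q hq hq0 h1 h2
      have hy4 := (hT q.2 hq.1 hq.2).2.2.2.1
      rcases cases₁ q.1 q.2 hq.1 with ⟨h', e'⟩ | ⟨h', e'⟩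
      · linarith
      · rw [e']; exact ((hT q.2 hq.1 hq.2).2.2.1 q.1).2 h1 h2.le
  · filter_upwards [hdi, eventually_data_lt_outer hk hK hW hε hσ hx01 hy1p hC.le hδ0 hclx,
      eventually_data_near hk hK hW hm0, self_mem_nhdsWithin] with s h1 h2 h3 hs' x hx
    have hs' : 0 < s := hs'
    rcases cases₂ x s with ⟨h, e⟩ | ⟨h, e⟩
    · rw [e]
      rcases cases₁ x s hs' with ⟨h', e'⟩ | ⟨h', e'⟩
      · rw [e']; exact h1 x hx h'
      · rw [e']; exact h2 x h' (by linarith)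
    · rw [e, hR, far]
      have g := hσle (data k K0 W u0 s x - u0 x)
      have := h3 x hx
      have : 0 ≤ C' * s := by positivity
      linarith

variable {W p p' B u0 : ℝ → ℝ} {K0 C0 : ℝ} {k : ℕ}

theorem Solution.mono {N : ℕ} {h d L : ℝ} {f : ℝ → ℝ} {s T s' T' : ℝ} {u : ℕ → ℝ → ℝ}
    (H : Solution N h d L f s T u) (hs : s ≤ s') (hT : T' ≤ T) : Solution N h d L f s' T' u where
  ghost := H.ghost
  deriv j hj t ht :=
    (H.deriv j hj t (Icc_subset_Icc hs hT ht)).mono (Icc_subset_Icc hs hT)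

theorem Solution.sign {N : ℕ} {h d L σ : ℝ} (hL : 0 ≤ L) (hσ : σ ^ 2 = 1) {f : ℝ → ℝ} {s T : ℝ}
    {u : ℕ → ℝ → ℝ} (H : Solution N h d L f s T u) :
    Solution N h (σ * d) L (fun v => σ * f (σ * v)) s T (fun i t => σ * u i t) := by
  rcases mul_self_eq_one_iff.1 ((sq σ).symm.trans hσ) with rfl | rfl
  · simpa using H
  · simpa using H.neg hL

/-- Lattice approximations of the flow, starting at time `s` from the regularized datum. -/
structure Flow (k : ℕ) (K0 : ℝ) (W u0 : ℝ → ℝ) (L s T h : ℝ) (N : ℕ) (u : ℕ → ℝ → ℝ) : Prop where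
  h_pos : 0 < h
  h_le : h ≤ 1
  two_le : 2 ≤ pt h N
  sol : Solution N h ((u0 (pt h N) - u0 (pt h (N - 1))) / h) L (fun v => 3 / max v (s ^ k)) s T u
  init : ∀ j < N, u j s = data k K0 W u0 s (pt h j)

theorem Flow.one_le {L s T h : ℝ} {N : ℕ} {u : ℕ → ℝ → ℝ} (H : Flow k K0 W u0 L s T h N u) :
    0 < N ∧ 1 ≤ pt h (N - 1) := by
  have h2 := H.two_le
  have h1 := H.h_le
  rcases N with _ | N
  · simp only [pt, Nat.cast_zero, zero_add] at h2
    linarith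
  · rw [pt_succ] at h2
    exact ⟨by omega, by rw [Nat.add_sub_cancel]; linarith⟩

theorem abs_inv_max_sub_le {m : ℝ} (hm : 0 < m) (x y : ℝ) :
    |3 / max x m - 3 / max y m| ≤ 3 / m ^ 2 * |x - y| := by
  have hx : m ≤ max x m := le_max_right _ _
  have hy : m ≤ max y m := le_max_right _ _
  have hx0 := hm.trans_le hx
  have hy0 := hm.trans_le hy
  rw [div_sub_div _ _ hx0.ne' hy0.ne', abs_div, abs_of_pos (mul_pos hx0 hy0), div_mul_eq_mul_div]
  refine div_le_div₀ (by positivity) ?_ (by positivity) (by nlinarith)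
  rw [mul_comm (max x m), ← mul_sub, abs_mul, abs_of_pos (show (0:ℝ) < 3 by norm_num), abs_sub_comm]
  exact mul_le_mul_of_nonneg_left (abs_max_sub_max_le_abs _ _ _) (by norm_num)

theorem continuous_inv_max {m : ℝ} (hm : 0 < m) : Continuous fun v : ℝ => 3 / max v m :=
  continuous_const.div (by fun_prop) fun v => (hm.trans_le (le_max_right v m)).ne'

theorem exists_flow {L s T h : ℝ} (hL : 0 ≤ L) (hs : 0 < s) (hT : s ≤ T)
    (hh : 0 < h) (h1 : h ≤ 1) {N : ℕ} (h2 : 2 ≤ pt h N) :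
    ∃ u, Flow k K0 W u0 L s T h N u := by
  have hN : 0 < N := by
    rcases N with _ | N
    · simp only [pt, Nat.cast_zero, zero_add] at h2; linarith
    · omega
  have hm : 0 < s ^ k := by positivity
  obtain ⟨u, h3, h4⟩ := exists_solution hN hh hL ((u0 (pt h N) - u0 (pt h (N - 1))) / h)
    (f := fun v => 3 / max v (s ^ k)) (Mf := 3 / s ^ k) (by positivity) (abs_inv_max_sub_le hm)
    (fun x => by
      rw [abs_of_pos (by have := hm.trans_le (le_max_right x (s ^ k)); positivity)]
      exact div_le_div_of_nonneg_left (by norm_num) hm (le_max_right _ _))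
    (fun j => data k K0 W u0 s (pt h j)) hT
  exact ⟨u, hh, h1, h2, h3, h4⟩

/-- Lattice approximations respect barriers. -/
theorem Datum.eventually_trapped (H : Datum k K0 C0 u0 W p p' B) {ε σ : ℝ} (hε : 0 < ε)
    (hε1 : ε ≤ 1 / 6) (hσ : σ ^ 2 = 1) :
    ∃ T' > 0, ∃ y > 0, ∃ c > 0, ∀ᶠ s in 𝓝[>] 0, ∀ L ≥ 2, C0 < L → ∀ T R : ℝ,
      ∀ᶠ h in 𝓝[>] 0, ∀ N u, pt h N ≤ R → Flow k K0 W u0 L s T h N u →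
        ∀ t ∈ Icc s T, t ≤ T' → ∀ j < N, σ * u j t ≤ σ * u0 (pt h j) + ε ∧
          (pt h j < y * √t →
            σ * u j t ≤ σ * (scl k (1 + σ * ε) t * W (pt h j / scl k (1 + σ * ε) t))) ∧
          (σ = -1 → min (pt h j) c ≤ u j t ∧ t ^ k ≤ u j t) := by
  obtain ⟨T', hT', y, hy, r, hr, c, hc, g, b, hB⟩ := H.exists_barrier hε hε1 hσ
  refine ⟨T', hT', y, hy, c, hc, ?_⟩
  filter_upwards [hB.initial, Ioo_mem_nhdsGT hT'] with s hi hs1 L hL2 hL T R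
  have hm : 0 < s ^ k := pow_pos hs1.1 k
  obtain ⟨h₀, hh₀, hcmp⟩ := lt_barrier (L := L) (f := fun v => σ * (3 / max (σ * v) (s ^ k)))
    (b := b) (R := R) (s := s) (T := min T T')
    (continuous_const.mul ((continuous_inv_max hm).comp (by fun_prop)))
    fun x hx t ht => hB.barrierAt L hL2 hL s ⟨hs1.1, hs1.2.le⟩ (fun v => 3 / max v (s ^ k))
      (fun v hv => by rw [max_eq_left hv]) x hx.1 t ⟨ht.1, ht.2.trans (min_le_right _ _)⟩
  filter_upwards [Ioo_mem_nhdsGT hh₀] with h hh N u hR H t ht htT j hj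
  have hp := pt_pos hh.1 j
  have ht0 : t ∈ Ioc 0 T' := ⟨hs1.1.trans_le ht.1, htT⟩
  obtain ⟨hN, h1⟩ := H.one_le
  have hlt : σ * u j t < b (pt h j) t := by
    refine hcmp h hh.1 hh.2 N _ (fun i t => σ * u i t) hN hR
      ((H.sol.mono le_rfl (min_le_left T T')).sign (by linarith) hσ) (fun i hi' => ?_)
      (fun r hr => ?_) t ⟨ht.1, le_min ht.2 htT⟩ j hj
    · rw [H.init i hi']; exact hi _ (pt_pos hh.1 i)
    · have hr' : r ∈ Ioc 0 T' := ⟨hs1.1.trans_le hr.1, hr.2.trans (min_le_right _ _)⟩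
      rw [hB.eq_far _ h1 _ hr', hB.eq_far _ (by linarith [H.two_le]) _ hr']
      refine le_of_eq ?_
      have := hh.1.ne'
      field_simp
      ring
  refine ⟨hlt.le.trans (hB.le_initial _ hp _ ht0),
    fun hy' => hlt.le.trans (hB.le_profile _ hp _ ht0 hy'), fun h' => ?_⟩
  have e := hB.ge _ hp _ ht0
  have e1 := hB.le_axis h' _ hp _ ht0
  have e2 := fun hx => hB.le_away h' (pt h j) hx _ ht0
  subst h'
  refine ⟨?_, by linarith⟩
  rcases le_total (pt h j) r with hx | hx
  · exact (min_le_left _ _).trans (by linarith [e1 hx])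
  · exact (min_le_right _ _).trans (by linarith [e2 hx])

variable {W p p' B u0 : ℝ → ℝ} {K0 C0 : ℝ} {k : ℕ}

theorem coupling_le {a h m : ℝ} (hh : 0 < h) (ha : h ≤ a) (hm : 0 < m) (hma : m ≤ a + h)
    (hs : 8 * h ≤ m ^ 3) : 1 / ((a - h / 2) * (a + h / 2)) ≤ 1 / (a * (a + h)) + 1 := by
  have ha0 : 0 < a := hh.trans_le ha
  have h1 : 0 < a - h / 2 := by linarith
  have h2 : m ^ 3 ≤ 4 * (a ^ 2 * (a + h)) := by
    have : m ^ 2 ≤ (2 * a) ^ 2 := by gcongr; linarith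
    nlinarith only [mul_le_mul this hma hm.le (by positivity)]
  have h3 : a * h + h ^ 2 / 4 ≤ (a - h / 2) * (a + h / 2) * (a * (a + h)) := by
    have e1 : 3 / 4 * a ^ 2 ≤ (a - h / 2) * (a + h / 2) := by nlinarith
    have e2 := mul_le_mul_of_nonneg_right e1 (show 0 ≤ a * (a + h) by positivity)
    nlinarith only [e2, mul_le_mul_of_nonneg_left (hs.trans h2) ha0.le, mul_le_mul_of_nonneg_left ha hh.le]
  rw [div_add_one (by positivity), div_le_div_iff₀ (by positivity) (by positivity)]
  nlinarith only [h3]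

/-- The gradient bound for lattice approximations. -/
theorem Flow.slope_le {L s T h c M G : ℝ} {N : ℕ} {u : ℕ → ℝ → ℝ} (H : Flow k K0 W u0 L s T h N u)
    (hs : 0 < s) (hT : T ≤ 1) (hsT : s ≤ T) (hc : 0 < c)
    (hlow : ∀ t ∈ Icc s T, ∀ j < N, min (pt h j) c ≤ u j t ∧ t ^ k ≤ u j t)
    (hM : 0 < M) (hd : ∀ x > 0, ∀ y > x, |data k K0 W u0 s y - data k K0 W u0 s x| < M * (y - x))
    (hu0 : ∀ x > 0, ∀ y > x, |u0 y - u0 x| < M * (y - x)) (hhc : h ≤ c / 2)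
    (hhs : 8 * h ≤ (s ^ k) ^ 3) (hG : G = M * exp (3 * (1 + 2 / c ^ 2) + 1)) (hL : G ≤ L) :
    ∀ t ∈ Icc s T, ∀ i ≤ N, |slope h (fun j => u j t) i| ≤ G := by
  have hh := H.h_pos
  have hN := H.one_le.1
  have hm : 0 < s ^ k := pow_pos hs k
  have hle : ∀ t ∈ Icc s T, M * exp ((3 * (1 + 2 / c ^ 2) + 1) * (t - s)) ≤ G := fun t ht => by
    rw [hG]
    refine mul_le_mul_of_nonneg_left (exp_le_exp.2 ?_) hM.le
    exact mul_le_of_le_one_right (by positivity) (by linarith [ht.2])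
  have hge : ∀ t ∈ Icc s T, ∀ j < N, s ^ k ≤ u j t := fun t ht j hj =>
    (pow_le_pow_left₀ hs.le ht.1 k).trans (hlow t ht j hj).2
  intro t ht i hi
  refine (H.sol.slope_bound hN hh (Λ := 1 + 2 / c ^ 2) (M := M) (by positivity) hM
    (fun j hj t ht => ⟨hm.trans_le (hge t ht j hj), by simp only [max_eq_left (hge t ht j hj)]⟩)
    (fun i hi t ht => ?_) (fun i hi => ?_) ((hle T ⟨hsT, le_rfl⟩).trans hL) t ht i hi).trans
    (hle t ht)
  · have a1 := hge t ht i (by omega)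
    have a2 := hge t ht (i + 1) hi
    have b1 := (hlow t ht i (by omega)).1
    have b2 := (hlow t ht (i + 1) hi).1
    have hp := pt_pos hh i
    rw [pt_succ] at b2
    have e1 : pt h i = (i + 1) * h - h / 2 := by rw [pt]; ring
    have ha : h ≤ (i + 1) * h := by nlinarith [Nat.cast_nonneg (α := ℝ) i]
    rw [show ((i:ℝ) + 1) * (i + 2) * h ^ 2 = (i + 1) * h * ((i + 1) * h + h) by ring]
    rcases lt_or_ge c (pt h i + h) with hx | hx
    · rw [min_eq_right hx.le] at b2
      have b3 : c / 2 ≤ u i t := (le_min (by linarith) (by linarith)).trans b1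
      calc 1 / (u i t * u (i + 1) t) ≤ 1 / (c / 2 * c) := by gcongr; linarith
        _ = 2 / c ^ 2 := by field_simp
        _ ≤ _ := by
          have : 0 < 1 / ((i + 1) * h * ((i + 1) * h + h)) := by positivity
          linarith
    · rw [min_eq_left hx] at b2
      rw [min_eq_left (by linarith)] at b1
      have h2c : 0 < 2 / c ^ 2 := by positivity
      rcases le_total ((i + 1) * h + h) (s ^ k) with hx' | hx'
      · calc 1 / (u i t * u (i + 1) t) ≤ 1 / ((i + 1) * h * ((i + 1) * h + h)) := by
              gcongr <;> linarith
          _ ≤ _ := by linarith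
      · have := coupling_le hh ha hm hx' hhs
        calc 1 / (u i t * u (i + 1) t) ≤ 1 / (((i + 1) * h - h / 2) * ((i + 1) * h + h / 2)) := by
              have : 0 < (i + 1) * h - h / 2 := by linarith
              gcongr <;> linarith
          _ ≤ _ := by linarith
  · simp only [slope]
    rw [abs_div, abs_of_pos hh, div_lt_iff₀ hh]
    rcases Nat.lt_or_ge (i + 1) N with hi' | hi'
    · rw [H.init _ hi', H.init _ hi]
      refine (hd _ (pt_pos hh i) _ (by rw [pt_succ]; linarith)).trans_eq ?_
      rw [pt_succ]; ring
    · obtain rfl : N = i + 1 := by omega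
      have h3 := hu0 _ (pt_pos hh i) (pt h (i + 1)) (by rw [pt_succ]; linarith)
      rw [H.sol.ghost, Nat.add_sub_cancel, add_sub_cancel_left, mul_div_cancel₀ _ hh.ne']
      refine h3.trans_eq ?_
      rw [pt_succ]; ring

/-- In the range where the truncations are inactive, lattice approximations are smooth in time. -/
theorem Solution.contDiffOn {N : ℕ} {h d L : ℝ} {f : ℝ → ℝ} {s T : ℝ} {u : ℕ → ℝ → ℝ}
    (H : Solution N h d L f s T u) (hN : 0 < N)
    (hf : ∀ j < N, ∀ t ∈ Ioo s T, u j t ≠ 0 ∧ f (u j t) = 3 / u j t)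
    (hL : ∀ t ∈ Ioo s T, ∀ i ≤ N, |slope h (fun j => u j t) i| ≤ L) :
    (∀ j < N, ∀ t ∈ Ioo s T, HasDerivAt (u j)
      ((arctan (slope h (fun i => u i t) (j + 1)) - arctan (slope h (fun i => u i t) j)) / h
        + 3 * slope h (fun i => u i t) (j + 1) / ((j + 1) * h) - 3 / u j t) t) ∧
    ∀ j ≤ N, ContDiffOn ℝ ∞ (u j) (Ioo s T) := by
  have hd : ∀ j < N, ∀ t ∈ Ioo s T, HasDerivAt (u j)
      ((arctan (slope h (fun i => u i t) (j + 1)) - arctan (slope h (fun i => u i t) j)) / h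
        + 3 * slope h (fun i => u i t) (j + 1) / ((j + 1) * h) - 3 / u j t) t := fun j hj t ht => by
    refine ((H.deriv j hj t ⟨ht.1.le, ht.2.le⟩).hasDerivAt (Icc_mem_nhds ht.1 ht.2)).congr_deriv ?_
    rw [rhs, clamp_eq (hL t ht _ (by omega)), (hf j hj t ht).2]
  refine ⟨hd, fun j hj => contDiffOn_infty.2 fun m => ?_⟩
  induction m generalizing j with
  | zero =>
    have hcont : ∀ j < N, ContinuousOn (u j) (Ioo s T) := fun j hj t ht =>
      (hd j hj t ht).continuousAt.continuousWithinAt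
    rw [Nat.cast_zero, contDiffOn_zero]
    rcases hj.lt_or_eq with hj | rfl
    · exact hcont j hj
    · exact ((hcont _ (by omega)).add continuousOn_const).congr fun t _ => H.ghost t
  | succ m ih =>
    have key : ∀ j < N, ContDiffOn ℝ ((m + 1 : ℕ) : WithTop ℕ∞) (u j) (Ioo s T) := fun j hj => by
      have hsl : ∀ i ≤ N, ContDiffOn ℝ m (fun t => slope h (fun l => u l t) i) (Ioo s T) :=
        fun i hi => by
          rcases i with _ | i
          · exact contDiffOn_const
          · exact ((ih _ hi).sub (ih _ (by omega))).div_const h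
      rw [Nat.cast_add, Nat.cast_one, contDiffOn_succ_iff_deriv_of_isOpen isOpen_Ioo]
      refine ⟨fun t ht => (hd j hj t ht).differentiableAt.differentiableWithinAt, by simp, ?_⟩
      refine ContDiffOn.congr ?_ fun t ht => (hd j hj t ht).deriv
      have a1 := contDiff_arctan.comp_contDiffOn (hsl (j + 1) (by omega))
      have a2 := contDiff_arctan.comp_contDiffOn (hsl j (by omega))
      exact (((a1.sub a2).div_const h).add ((contDiffOn_const.mul (hsl (j + 1) (by omega))).div_const _)).sub
        (contDiffOn_const.div (ih j hj.le) fun t ht => (hf j hj t ht).1)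
    rcases hj.lt_or_eq with hj | rfl
    · exact key j hj
    · exact ((key _ (by omega)).add contDiffOn_const).congr fun t _ => H.ghost t

end Lattice

/-- A class of continuous functions which is closed under partial derivatives consists of smooth
functions. -/
theorem contDiffOn_of_closed {Ω : Set (ℝ × ℝ)} (hΩ : IsOpen Ω) {S : (ℝ → ℝ → ℝ) → Prop}
    (hc : ∀ G, S G → ContinuousOn (fun q : ℝ × ℝ => G q.1 q.2) Ω)
    (hx : ∀ G, S G → ∃ G', S G' ∧ ∀ q ∈ Ω, HasDerivAt (fun y => G y q.2) (G' q.1 q.2) q.1)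
    (ht : ∀ G, S G → ∃ G', S G' ∧ ∀ q ∈ Ω, HasDerivAt (G q.1) (G' q.1 q.2) q.2)
    {G : ℝ → ℝ → ℝ} (hG : S G) : ContDiffOn ℝ ∞ (fun q : ℝ × ℝ => G q.1 q.2) Ω := by
  refine contDiffOn_infty.2 fun m => ?_
  induction m generalizing G with
  | zero => exact contDiffOn_zero.2 (hc G hG)
  | succ m ih =>
    obtain ⟨X, hX, dX⟩ := hx G hG
    obtain ⟨Y, hY, dY⟩ := ht G hG
    rw [Nat.cast_add, Nat.cast_one, contDiffOn_succ_iff_hasFDerivWithinAt_of_uniqueDiffOn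
      hΩ.uniqueDiffOn]
    refine ⟨by simp, fun q => X q.1 q.2 • ContinuousLinearMap.fst ℝ ℝ ℝ
      + Y q.1 q.2 • ContinuousLinearMap.snd ℝ ℝ ℝ, ?_, fun q hq => ?_⟩
    · exact ((ih hX).smul contDiffOn_const).add ((ih hY).smul contDiffOn_const)
    · have hn := hΩ.mem_nhds hq
      have hs : Continuous fun a : ℝ => ContinuousLinearMap.toSpanSingleton ℝ a :=
        (ContinuousLinearMap.toSpanSingletonCLE (𝕜 := ℝ) (E := ℝ)).continuous
      have := hasStrictFDerivAt_uncurry_coprod (𝕜 := ℝ) (f := G) (u := q)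
        (f₁ := fun x t => ContinuousLinearMap.toSpanSingleton ℝ (X x t))
        (f₂ := fun x t => ContinuousLinearMap.toSpanSingleton ℝ (Y x t))
        (eventually_of_mem hn fun v hv => (dX v hv).hasFDerivAt)
        (eventually_of_mem hn fun v hv => (dY v hv).hasFDerivAt)
        (hs.continuousAt.comp ((hc X hX).continuousAt hn))
        (hs.continuousAt.comp ((hc Y hY).continuousAt hn))
      refine (this.hasFDerivAt.congr_fderiv ?_).hasFDerivWithinAt
      ext <;> simp [Function.HasUncurry.uncurry]

/-- Symmetry of mixed partial derivatives, as an existence statement. -/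
theorem hasDerivAt_of_mixed {Ω : Set (ℝ × ℝ)} (hΩ : IsOpen Ω) {G X Y Z : ℝ → ℝ → ℝ}
    (hZ : ContinuousOn (fun q : ℝ × ℝ => Z q.1 q.2) Ω)
    (hX : ∀ q ∈ Ω, HasDerivAt (fun y => G y q.2) (X q.1 q.2) q.1)
    (hY : ∀ q ∈ Ω, HasDerivAt (G q.1) (Y q.1 q.2) q.2)
    (hXZ : ∀ q ∈ Ω, HasDerivAt (X q.1) (Z q.1 q.2) q.2) {q : ℝ × ℝ} (hq : q ∈ Ω) :
    HasDerivAt (fun y => Y y q.2) (Z q.1 q.2) q.1 := by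
  obtain ⟨e, he, he0⟩ : ∃ e : ℕ → ℝ, (∀ n, 0 < e n) ∧ Tendsto e atTop (nhds 0) :=
    ⟨fun n => 1 / (n + 1), fun n => Nat.one_div_pos_of_nat, tendsto_one_div_add_atTop_nhds_zero_nat⟩
  have he' : Tendsto e atTop (𝓝[>] 0) :=
    tendsto_nhdsWithin_iff.2 ⟨he0, Eventually.of_forall he⟩
  refine hasDerivAt_of_tendsto_prod (Ω := {y | (y, q.2) ∈ Ω}) (hΩ.preimage (by fun_prop))
    (f := fun n y => (e n)⁻¹ * (G y (q.2 + e n) - G y q.2))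
    (f' := fun n y => (e n)⁻¹ * (X y (q.2 + e n) - X y q.2)) (F' := fun y => Z y q.2)
    (fun y hy => ?_) (fun y hy => ?_) (fun y hy => ?_) hq
  · exact (hY (y, q.2) hy).tendsto_slope_zero_right.comp he'
  · rw [Metric.tendsto_nhds]
    intro ε hε
    obtain ⟨r, hr, hb⟩ := Metric.eventually_nhds_iff_ball.1
      ((hΩ.eventually_mem hy).and (Metric.tendsto_nhds.1 (hZ.continuousAt (hΩ.mem_nhds hy)) ε hε))
    filter_upwards [(he0.eventually (gt_mem_nhds hr)).prod_mk (ball_mem_nhds y hr)]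
      with ⟨n, z⟩ ⟨hn, hz⟩
    have hmem : ∀ τ ∈ Icc q.2 (q.2 + e n), (z, τ) ∈ ball (y, q.2) r := fun τ hτ => by
      rw [mem_ball, Prod.dist_eq]
      refine max_lt hz ?_
      rw [dist_eq, abs_of_nonneg (by linarith [hτ.1])]
      simp only at hn ⊢
      linarith [hτ.2]
    have hlt : q.2 < q.2 + e n := by linarith [he n]
    obtain ⟨τ, hτ, h1⟩ := exists_hasDerivAt_eq_slope (X z) (Z z) hlt
      (fun τ hτ => (hXZ _ (hb _ (hmem τ hτ)).1).continuousAt.continuousWithinAt)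
      (fun τ hτ => hXZ _ (hb _ (hmem τ (Ioo_subset_Icc_self hτ))).1)
    have h2 := (hb _ (hmem τ (Ioo_subset_Icc_self hτ))).2
    rwa [h1, add_sub_cancel_left, div_eq_inv_mul] at h2
  · obtain ⟨r, hr, hb⟩ := Metric.eventually_nhds_iff_ball.1 (hΩ.mem_nhds hy)
    filter_upwards [(he0.eventually (gt_mem_nhds hr)).prod_mk (ball_mem_nhds y hr)]
      with ⟨n, z⟩ ⟨hn, hz⟩
    have hmem : ∀ τ ∈ Icc q.2 (q.2 + e n), (z, τ) ∈ Ω := fun τ hτ => hb _ (by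
      rw [mem_ball, Prod.dist_eq]
      refine max_lt hz ?_
      rw [dist_eq, abs_of_nonneg (by linarith [hτ.1])]
      simp only at hn ⊢
      linarith [hτ.2])
    have hle := (he n).le
    have a := hX _ (hmem (q.2 + e n) ⟨by linarith, le_rfl⟩)
    have b := hX _ (hmem q.2 ⟨le_rfl, by linarith⟩)
    exact (a.sub b).const_mul _

/-- The algebra of functions generated by the time derivatives of the solution and its flux. -/
inductive Gen (U Q : ℕ → ℝ → ℝ → ℝ) : (ℝ → ℝ → ℝ) → Prop
  | sol (m) : Gen U Q (U m)
  | flux (m) : Gen U Q (Q m)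
  | slope : Gen U Q fun x t => tan (Q 0 x t)
  | inv : Gen U Q fun x t => (U 0 x t)⁻¹
  | pos : Gen U Q fun x _ => x⁻¹
  | const (c) : Gen U Q fun _ _ => c
  | add {G G'} : Gen U Q G → Gen U Q G' → Gen U Q fun x t => G x t + G' x t
  | mul {G G'} : Gen U Q G → Gen U Q G' → Gen U Q fun x t => G x t * G' x t

/-- Solutions which are smooth in time and satisfy the profile equation in flux form are smooth. -/
theorem contDiffOn_of_flux {Ω : Set (ℝ × ℝ)} (hΩ : IsOpen Ω) {U Q : ℕ → ℝ → ℝ → ℝ}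
    (hx0 : ∀ q ∈ Ω, q.1 ≠ 0) (hU0 : ∀ q ∈ Ω, U 0 q.1 q.2 ≠ 0)
    (hQ0 : ∀ q ∈ Ω, cos (Q 0 q.1 q.2) ≠ 0)
    (hU : ∀ m, ContinuousOn (fun q : ℝ × ℝ => U m q.1 q.2) Ω)
    (hQ : ∀ m, ContinuousOn (fun q : ℝ × ℝ => Q m q.1 q.2) Ω)
    (hUt : ∀ m, ∀ q ∈ Ω, HasDerivAt (U m q.1) (U (m + 1) q.1 q.2) q.2)
    (hQt : ∀ m, ∀ q ∈ Ω, HasDerivAt (Q m q.1) (Q (m + 1) q.1 q.2) q.2)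
    (hUx : ∀ q ∈ Ω, HasDerivAt (fun y => U 0 y q.2) (tan (Q 0 q.1 q.2)) q.1)
    (hQx : ∀ q ∈ Ω, HasDerivAt (fun y => Q 0 y q.2) (U 1 q.1 q.2
      + (-3 * (q.1⁻¹ * tan (Q 0 q.1 q.2)) + 3 * (U 0 q.1 q.2)⁻¹)) q.1) :
    ContDiffOn ℝ ∞ (fun q : ℝ × ℝ => U 0 q.1 q.2) Ω ∧
    ∀ q ∈ Ω, HasDerivAt (fun y => tan (Q 0 y q.2)) ((1 + tan (Q 0 q.1 q.2) ^ 2) *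
      (U 1 q.1 q.2 + (-3 * (q.1⁻¹ * tan (Q 0 q.1 q.2)) + 3 * (U 0 q.1 q.2)⁻¹))) q.1 := by
  have hc : ∀ G, Gen U Q G → ContinuousOn (fun q : ℝ × ℝ => G q.1 q.2) Ω := by
    intro G hG
    induction hG with
    | sol m => exact hU m
    | flux m => exact hQ m
    | slope =>
      intro q hq
      exact ContinuousAt.comp_continuousWithinAt (f := fun q : ℝ × ℝ => Q 0 q.1 q.2)
        (continuousAt_tan.2 (hQ0 q hq)) (hQ 0 q hq)
    | inv => exact (hU 0).inv₀ hU0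
    | pos => exact continuousOn_fst.inv₀ hx0
    | const c => exact continuousOn_const
    | add _ _ h1 h2 => exact h1.add h2
    | mul _ _ h1 h2 => exact h1.mul h2
  have htan : ∀ {a : ℝ → ℝ} {a' z : ℝ}, cos (a z) ≠ 0 → HasDerivAt a a' z →
      HasDerivAt (fun z => tan (a z)) ((1 + tan (a z) ^ 2) * a') z := fun h h' => by
    refine ((hasDerivAt_tan h).comp _ h').congr_deriv ?_
    rw [← inv_one_add_tan_sq h, one_div, inv_inv]
  have gtan : ∀ {X}, Gen U Q X → Gen U Q fun x t => (1 + tan (Q 0 x t) ^ 2) * X x t :=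
    fun h => .mul (by simpa only [sq] using Gen.add (.const 1) (.mul .slope .slope)) h
  have ginv : ∀ {X}, Gen U Q X → Gen U Q fun x t => -X x t / (U 0 x t) ^ 2 := fun {X} h => by
    have := Gen.mul (.const (-1)) (.mul h (.mul (.inv (U := U) (Q := Q)) .inv))
    refine (funext₂ fun x t => ?_ : _ = fun x t => -X x t / (U 0 x t) ^ 2) ▸ this
    rw [div_eq_mul_inv, sq, mul_inv]; ring
  have ht : ∀ G, Gen U Q G → ∃ G', Gen U Q G' ∧ ∀ q ∈ Ω, HasDerivAt (G q.1) (G' q.1 q.2) q.2 := by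
    intro G hG
    induction hG with
    | sol m => exact ⟨_, .sol (m + 1), hUt m⟩
    | flux m => exact ⟨_, .flux (m + 1), hQt m⟩
    | slope => exact ⟨_, gtan (.flux 1), fun q hq => htan (hQ0 q hq) (hQt 0 q hq)⟩
    | inv => exact ⟨_, ginv (.sol 1), fun q hq => (hUt 0 q hq).inv (hU0 q hq)⟩
    | pos => exact ⟨_, .const 0, fun q _ => hasDerivAt_const _ _⟩
    | const c => exact ⟨_, .const 0, fun q _ => hasDerivAt_const _ _⟩
    | add _ _ h1 h2 =>
      obtain ⟨X, hX, h1⟩ := h1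
      obtain ⟨Y, hY, h2⟩ := h2
      exact ⟨_, hX.add hY, fun q hq => (h1 q hq).add (h2 q hq)⟩
    | mul g1 g2 h1 h2 =>
      obtain ⟨X, hX, h1⟩ := h1
      obtain ⟨Y, hY, h2⟩ := h2
      exact ⟨_, (hX.mul g2).add (g1.mul hY), fun q hq => (h1 q hq).mul (h2 q hq)⟩
  have hB := Gen.add (.sol (U := U) (Q := Q) 1)
    (.add (.mul (.const (-3)) (.mul .pos .slope)) (.mul (.const 3) .inv))
  have up : ∀ {F : ℕ → ℝ → ℝ → ℝ}, (∀ m, ∀ q ∈ Ω, HasDerivAt (F m q.1) (F (m + 1) q.1 q.2) q.2) →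
      (∃ X, Gen U Q X ∧ ∀ q ∈ Ω, HasDerivAt (fun y => F 0 y q.2) (X q.1 q.2) q.1) → ∀ m,
      ∃ X, Gen U Q X ∧ ∀ q ∈ Ω, HasDerivAt (fun y => F m y q.2) (X q.1 q.2) q.1 := by
    intro F hF h0 m
    induction m with
    | zero => exact h0
    | succ m ih =>
      obtain ⟨X, hX, h1⟩ := ih
      obtain ⟨Z, hZ, h2⟩ := ht X hX
      exact ⟨Z, hZ, fun q hq => hasDerivAt_of_mixed hΩ (hc Z hZ) h1 (hF m) h2 hq⟩
  refine ⟨contDiffOn_of_closed hΩ hc (fun G hG => ?_) ht (.sol 0),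
    fun q hq => htan (a := fun y => Q 0 y q.2) (hQ0 q hq) (hQx q hq)⟩
  induction hG with
  | sol m => exact up hUt ⟨_, .slope, hUx⟩ m
  | flux m => exact up hQt ⟨_, hB, hQx⟩ m
  | slope => exact ⟨_, gtan hB, fun q hq => htan (a := fun y => Q 0 y q.2) (hQ0 q hq) (hQx q hq)⟩
  | inv => exact ⟨_, ginv .slope, fun q hq => (hUx q hq).inv (hU0 q hq)⟩
  | pos =>
    refine ⟨fun x t => -1 * (x⁻¹ * x⁻¹), .mul (.const _) (.mul .pos .pos), fun q hq => ?_⟩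
    refine (hasDerivAt_inv (hx0 q hq)).congr_deriv ?_
    rw [sq, mul_inv]; ring
  | const c => exact ⟨_, .const 0, fun q _ => hasDerivAt_const _ _⟩
  | add _ _ h1 h2 =>
    obtain ⟨X, hX, h1⟩ := h1
    obtain ⟨Y, hY, h2⟩ := h2
    exact ⟨_, hX.add hY, fun q hq => (h1 q hq).add (h2 q hq)⟩
  | mul g1 g2 h1 h2 =>
    obtain ⟨X, hX, h1⟩ := h1
    obtain ⟨Y, hY, h2⟩ := h2
    exact ⟨_, (hX.mul g2).add (g1.mul hY), fun q hq => (h1 q hq).mul (h2 q hq)⟩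

namespace Lattice

variable {T M : ℝ} {h : ℕ → ℝ} {N : ℕ → ℕ} {u F F' D : ℕ → ℕ → ℝ → ℝ} {q : ℝ × ℝ}

theorem Box.exists_mem_nhds (hq : q ∈ Ioi (0 : ℝ) ×ˢ Ioo 0 T) :
    ∃ b : Box T, Icc b.X₁ b.X₂ ×ˢ Icc b.t₁ b.t₂ ∈ nhds q := by
  obtain ⟨h1 : 0 < q.1, h2 : 0 < q.2, h3 : q.2 < T⟩ := hq
  exact ⟨⟨q.1 / 2, 2 * q.1, q.2 / 2, (q.2 + T) / 2, by linarith, by linarith, by linarith,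
    by linarith, by linarith⟩, prod_mem_nhds (Icc_mem_nhds (by grind)
      (by grind)) (Icc_mem_nhds (by grind) (by grind))⟩

/-- The filter of lattice points close to `q`. -/
def lat (h : ℕ → ℝ) (q : ℝ × ℝ) : Filter (ℕ × ℕ × ℝ) :=
  comap (fun r => (r.1, (r.2.1 * h r.1, r.2.2))) (atTop ×ˢ nhds q)

theorem floor_mul_mem {x a : ℝ} (hx : 0 ≤ x) (ha : 0 < a) : (⌊x / a⌋₊ : ℝ) * a ∈ Ioc (x - a) x := by
  have h1 := Nat.floor_le (div_nonneg hx ha.le)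
  have h2 := Nat.lt_floor_add_one (x / a)
  rw [le_div_iff₀ ha] at h1
  rw [div_lt_iff₀ ha] at h2
  grind

theorem Mesh.tendsto_floor (H : Mesh h N) {x : ℝ} (hx : 0 < x) :
    Tendsto (fun n => (⌊x / h n⌋₊ : ℝ) * h n) atTop (nhds x) :=
  tendsto_of_tendsto_of_tendsto_of_le_of_le (g := fun n => x - h n)
    (by simpa using H.tendsto.const_sub x) tendsto_const_nhds
    (fun n => (floor_mul_mem hx.le (H.pos n)).1.le) fun n => (floor_mul_mem hx.le (H.pos n)).2

theorem Mesh.tendsto_lat (H : Mesh h N) {x : ℝ} (hx : 0 < x) (t : ℝ) :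
    Tendsto (fun r : ℕ × ℝ => (r.1, ⌊x / h r.1⌋₊, r.2)) (atTop ×ˢ nhds t) (lat h (x, t)) :=
  tendsto_comap_iff.2 (tendsto_fst.prodMk
    (((H.tendsto_floor hx).comp tendsto_fst).prodMk_nhds tendsto_snd))

theorem Mesh.tendsto_lat_succ (H : Mesh h N) :
    Tendsto (fun r : ℕ × ℕ × ℝ => (r.1, r.2.1 + 1, r.2.2)) (lat h q) (lat h q) := by
  have h0 : Tendsto (fun r : ℕ × ℕ × ℝ => (r.1, (r.2.1 * h r.1, r.2.2))) (lat h q)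
    (atTop ×ˢ nhds q) := tendsto_comap
  have h1 := tendsto_fst.comp h0
  have h2 := tendsto_snd.comp h0
  refine tendsto_comap_iff.2 (h1.prodMk ?_)
  have h3 := ((continuous_fst.tendsto q).comp h2).add (H.tendsto.comp h1)
  rw [add_zero] at h3
  refine (h3.prodMk_nhds ((continuous_snd.tendsto q).comp h2)).congr fun r => ?_
  simp only [Function.comp]
  push_cast
  rw [add_one_mul]

theorem tendsto_lat_pos : Tendsto (fun r : ℕ × ℕ × ℝ => (r.2.1 : ℝ) * h r.1) (lat h q)
    (nhds q.1) :=
  (continuous_fst.tendsto q).comp (tendsto_snd.comp tendsto_comap)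

theorem Ev.lat (H : Mesh h N) {p : ℕ → ℕ → ℝ → Prop} (hp : Ev T h p)
    (hq : q ∈ Ioi (0 : ℝ) ×ˢ Ioo 0 T) : ∀ᶠ r in lat h q, p r.1 r.2.1 r.2.2 := by
  obtain ⟨b, hb⟩ := Box.exists_mem_nhds hq
  filter_upwards [((hp b).prod_mk hb).comap fun r : ℕ × ℕ × ℝ => (r.1, (r.2.1 * h r.1, r.2.2))]
    with r hr
  exact hr.1 _ ((Box.mem_idx (H.pos _)).2 hr.2.1) _ hr.2.2

theorem abs_telescope_le {f d : ℕ → ℝ} {a g ε : ℝ} (ha : 0 ≤ a) {i j : ℕ} (hij : i ≤ j)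
    (hd : ∀ l ∈ Ico i j, a * d l = f (l + 1) - f l ∧ |d l - g| ≤ ε) :
    |f j - f i - (j * a - i * a) * g| ≤ ε * (j * a - i * a) := by
  induction j, hij using Nat.le_induction with
  | base => simp
  | succ j hij ih =>
    have h1 := ih fun l hl => hd l ⟨hl.1, hl.2.trans j.lt_succ_self⟩
    obtain ⟨h2, h3⟩ := hd j (by grind)
    have h4 : |a * (d j - g)| ≤ a * ε := by
      rw [abs_mul, abs_of_nonneg ha]; gcongr
    push_cast
    rw [show f (j + 1) - f i - ((j + 1) * a - i * a) * g
      = (f j - f i - (j * a - i * a) * g) + a * (d j - g) by linarith]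
    grind

/-- Local equicontinuity, up to an error of the size of the mesh. -/
theorem LB.equicontinuous (H : Mesh h N) (hF : LB T h F) (hF' : LB T h F') (hD : LB T h D)
    (ht : Ev T h fun n j t => HasDerivAt (F n j) (F' n j t) t)
    (hx : Ev T h fun n j t => h n * D n j t = F n (j + 1) t - F n j t)
    (hq : q ∈ Ioi (0 : ℝ) ×ˢ Ioo 0 T) : ∃ C : ℝ, ∃ r > 0, ∃ e : ℕ → ℝ, Tendsto e atTop (nhds 0) ∧
      ∀ᶠ n in atTop, ∀ y ∈ ball q r, ∀ z ∈ ball q r,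
        |F n ⌊y.1 / h n⌋₊ y.2| ≤ C ∧
        |F n ⌊y.1 / h n⌋₊ y.2 - F n ⌊z.1 / h n⌋₊ z.2| ≤ C * dist y z + e n := by
  obtain ⟨b, hb⟩ := Box.exists_mem_nhds hq
  obtain ⟨r, hr, hrb⟩ := Metric.mem_nhds_iff.1 hb
  obtain ⟨c0, h0, hF⟩ := hF b.wide
  obtain ⟨c1, h1, hF'⟩ := hF' b.wide
  obtain ⟨c2, h2, hD⟩ := hD b.wide
  refine ⟨c0 + c1 + c2, r, hr, fun n => c2 * h n, by simpa using H.tendsto.const_mul c2, ?_⟩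
  filter_upwards [hF, hF', hD, ht b.wide, hx b.wide, H.le (half_pos b.X₁_pos), H.le one_pos]
    with n hF hF' hD ht hx hn hn1 y hy z hz
  have hpos := H.pos n
  have mem : ∀ y ∈ ball q r, ⌊y.1 / h n⌋₊ ∈ b.wide.idx (h n) ∧
      y.2 ∈ Icc b.wide.t₁ b.wide.t₂ := fun y hy => by
    obtain ⟨a1, a2⟩ := hrb hy
    have a3 := floor_mul_mem (b.X₁_pos.le.trans a1.1) hpos
    refine ⟨(Box.mem_idx hpos).2 ⟨?_, ?_⟩, b.Icc_subset_wide a2⟩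
    · simp only [Box.wide]; grind
    · simp only [Box.wide]; grind
  obtain ⟨my, ty⟩ := mem y hy
  obtain ⟨mz, tz⟩ := mem z hz
  refine ⟨by grind, ?_⟩
  have e1 : |F n ⌊y.1 / h n⌋₊ y.2 - F n ⌊y.1 / h n⌋₊ z.2| ≤ c1 * |y.2 - z.2| := by
    simpa only [norm_eq_abs] using (convex_Icc _ _).norm_image_sub_le_of_norm_hasDerivWithin_le
      (fun t h => (ht _ my t h).hasDerivWithinAt) (fun t h => hF' _ my t h) tz ty
  have key : ∀ i ∈ b.wide.idx (h n), ∀ j ∈ b.wide.idx (h n), i ≤ j →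
      |F n i z.2 - F n j z.2| ≤ c2 * (j * h n - i * h n) := fun i hi j hj hij => by
    rw [Box.mem_idx hpos] at hi hj
    rw [abs_sub_comm]
    have := abs_telescope_le (f := fun i => F n i z.2) (d := fun i => D n i z.2) (g := 0) (ε := c2)
      hpos.le hij fun l hl => by
        have hl' : l ∈ b.wide.idx (h n) := (Box.mem_idx hpos).2
          ⟨hi.1.trans (by gcongr; grind),
            le_trans (by gcongr; grind) hj.2⟩
        grind
    grind
  have py := floor_mul_mem (b.X₁_pos.le.trans (hrb hy).1.1) hpos
  have pz := floor_mul_mem (b.X₁_pos.le.trans (hrb hz).1.1) hpos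
  have d1 : |y.1 - z.1| ≤ dist y z := le_max_left _ _
  have d2 : |y.2 - z.2| ≤ dist y z := le_max_right _ _
  have e2 : |F n ⌊y.1 / h n⌋₊ z.2 - F n ⌊z.1 / h n⌋₊ z.2| ≤ c2 * (|y.1 - z.1| + h n) := by
    rcases le_total ⌊y.1 / h n⌋₊ ⌊z.1 / h n⌋₊ with hij | hij
    · refine (key _ my _ mz hij).trans (mul_le_mul_of_nonneg_left ?_ h2)
      linarith [neg_abs_le (y.1 - z.1), py.1, pz.2]
    · rw [abs_sub_comm]
      refine (key _ mz _ my hij).trans (mul_le_mul_of_nonneg_left ?_ h2)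
      linarith [le_abs_self (y.1 - z.1), py.2, pz.1]
  have e3 := abs_sub_le (F n ⌊y.1 / h n⌋₊ y.2) (F n ⌊y.1 / h n⌋₊ z.2) (F n ⌊z.1 / h n⌋₊ z.2)
  have e4 := mul_le_mul_of_nonneg_left d1 h2
  have e5 := mul_le_mul_of_nonneg_left d2 h1
  have e6 := mul_nonneg h0 (dist_nonneg (x := y) (y := z))
  linarith

/-- Convergence of lattice families. -/
def Lim (T : ℝ) (h : ℕ → ℝ) (F : ℕ → ℕ → ℝ → ℝ) (G : ℝ → ℝ → ℝ) : Prop :=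
  ∀ q ∈ Ioi (0 : ℝ) ×ˢ Ioo 0 T,
    Tendsto (fun r : ℕ × ℕ × ℝ => F r.1 r.2.1 r.2.2) (lat h q) (nhds (G q.1 q.2))

variable {A B : ℝ → ℝ → ℝ}

theorem Lim.tendsto (hF : Lim T h F A) (H : Mesh h N) {x t : ℝ} (hx : 0 < x) (ht : t ∈ Ioo 0 T) :
    Tendsto (fun r : ℕ × ℝ => F r.1 ⌊x / h r.1⌋₊ r.2) (atTop ×ˢ nhds t) (nhds (A x t)) :=
  (hF (x, t) ⟨hx, ht⟩).comp (H.tendsto_lat hx t)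

theorem Lim.tendsto_nat (hF : Lim T h F A) (H : Mesh h N) {x t : ℝ} (hx : 0 < x)
    (ht : t ∈ Ioo 0 T) : Tendsto (fun n => F n ⌊x / h n⌋₊ t) atTop (nhds (A x t)) :=
  (hF.tendsto H hx ht).comp (tendsto_id.prodMk tendsto_const_nhds)

theorem Lim.hasDerivAt_time (hF : Lim T h F A) (hF' : Lim T h F' B) (H : Mesh h N)
    (ht : Ev T h fun n j t => HasDerivAt (F n j) (F' n j t) t)
    (hq : q ∈ Ioi (0 : ℝ) ×ˢ Ioo 0 T) : HasDerivAt (A q.1) (B q.1 q.2) q.2 :=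
  hasDerivAt_of_tendsto_prod (f' := fun n t => F' n ⌊q.1 / h n⌋₊ t) isOpen_Ioo (fun _ ht => hF.tendsto_nat H hq.1 ht)
    (fun _ ht => hF'.tendsto H hq.1 ht)
    (fun t h' => (H.tendsto_lat hq.1 t).eventually (ht.lat H (q := (q.1, t)) ⟨hq.1, h'⟩)) hq.2

theorem Lim.hasDerivAt_space (hF : Lim T h F A) (hD : Lim T h D B) (H : Mesh h N)
    (hx : Ev T h fun n j t => h n * D n j t = F n (j + 1) t - F n j t)
    (hq : q ∈ Ioi (0 : ℝ) ×ˢ Ioo 0 T) : HasDerivAt (fun y => A y q.2) (B q.1 q.2) q.1 := by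
  refine hasDerivAt_iff_isLittleO.2 (isLittleO_iff.2 fun ε hε => ?_)
  obtain ⟨pa, ha, pb, hb, hab⟩ := eventually_prod_iff.1 (eventually_comap.1
    ((hx.lat H hq).and ((Metric.tendsto_nhds.1 (hD q hq)) ε hε)))
  obtain ⟨r, hr, hrb⟩ := Metric.eventually_nhds_iff_ball.1 hb
  have key : ∀ a > 0, ∀ b > 0, a ≤ b → q.1 - r < a → b < q.1 + r →
      |A b q.2 - A a q.2 - (b - a) * B q.1 q.2| ≤ ε * (b - a) := by
    intro a ha0 b hb0 hle h1 h2
    have fl := fun c hc => H.tendsto_floor (x := c) hc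
    refine le_of_tendsto_of_tendsto (((hF.tendsto_nat H hb0 hq.2).sub
      (hF.tendsto_nat H ha0 hq.2)).sub (((fl b hb0).sub (fl a ha0)).mul_const _)).abs
      (((fl b hb0).sub (fl a ha0)).const_mul ε) ?_
    filter_upwards [ha, (fl a ha0).eventually (lt_mem_nhds h1)] with n hn h3
    refine abs_telescope_le (f := fun i => F n i q.2) (d := fun i => D n i q.2) (H.pos n).le
      (Nat.floor_mono (div_le_div_of_nonneg_right hle (H.pos n).le)) fun l hl => ?_
    have h4 : (l * h n, q.2) ∈ ball q r := by
      rw [mem_ball, Prod.dist_eq, dist_self, max_eq_left dist_nonneg, dist_eq, abs_lt]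
      have i1 : (⌊a / h n⌋₊ : ℝ) * h n ≤ l * h n :=
        mul_le_mul_of_nonneg_right (by exact_mod_cast hl.1) (H.pos n).le
      have i2 : (l : ℝ) * h n ≤ ⌊b / h n⌋₊ * h n :=
        mul_le_mul_of_nonneg_right (by exact_mod_cast hl.2.le) (H.pos n).le
      have i3 := (floor_mul_mem hb0.le (H.pos n)).2
      grind
    have h5 := hab hn (hrb _ h4) (n, l, q.2) rfl
    exact ⟨h5.1, h5.2.le⟩
  have hq1 : 0 < q.1 := hq.1
  filter_upwards [ball_mem_nhds q.1 hr, Ioi_mem_nhds hq1] with y hy (hy0 : 0 < y)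
  rw [mem_ball, dist_eq, abs_lt] at hy
  rw [norm_eq_abs, norm_eq_abs, smul_eq_mul]
  rcases le_total q.1 y with hle | hle
  · rw [abs_of_nonneg (sub_nonneg.2 hle)]
    grind
  · rw [abs_of_nonpos (sub_nonpos.2 hle), neg_sub, ← abs_neg]
    grind

theorem Approx.comp (H : Approx T h N u M) {φ : ℕ → ℕ} (hφ : StrictMono φ) :
    Approx T (h ∘ φ) (N ∘ φ) (u ∘ φ) M where
  mesh := ⟨fun n => H.mesh.pos _, H.mesh.tendsto.comp hφ.tendsto_atTop,
    H.mesh.top.comp hφ.tendsto_atTop⟩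
  smooth b := hφ.tendsto_atTop.eventually (H.smooth b)
  eqn b := hφ.tendsto_atTop.eventually (H.eqn b)
  slope_le b := hφ.tendsto_atTop.eventually (H.slope_le b)
  range b := by
    obtain ⟨c, C, hc, h⟩ := H.range b
    exact ⟨c, C, hc, hφ.tendsto_atTop.eventually h⟩

theorem Approx.exists_lim (H : Approx T h N u M) : ∃ φ : ℕ → ℕ, StrictMono φ ∧
    ∃ U Q : ℕ → ℝ → ℝ → ℝ,
    (∀ m, ContinuousOn (fun q : ℝ × ℝ => U m q.1 q.2) (Ioi (0 : ℝ) ×ˢ Ioo 0 T)) ∧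
    (∀ m, ContinuousOn (fun q : ℝ × ℝ => Q m q.1 q.2) (Ioi (0 : ℝ) ×ˢ Ioo 0 T)) ∧
    (∀ m, Lim T (h ∘ φ) (tD (u ∘ φ) m) (U m)) ∧ ∀ m, Lim T (h ∘ φ) (tQ (h ∘ φ) (u ∘ φ) m) (Q m) := by
  have hΩ : IsOpen (Ioi (0 : ℝ) ×ˢ Ioo 0 T) := isOpen_Ioi.prod isOpen_Ioo
  obtain ⟨φ, hφ, F, hF⟩ := exists_subseq_locallyUniform hΩ (ι := ℕ ⊕ ℕ)
    (fun n i q => Sum.elim (tD u) (tQ h u) i n ⌊q.1 / h n⌋₊ q.2) (by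
      rintro (m | m) q hq
      · exact LB.equicontinuous H.mesh (H.lb_tD m) (H.lb_tD (m + 1)) (H.lb_tP m) (H.hasDerivAt_tD m)
          (H.hmul_tP m) hq
      · refine LB.equicontinuous H.mesh (H.lb_tQ m) (H.lb_tQ (m + 1)) (fun b => ?_)
          (H.hasDerivAt_tQ m) (H.hmul_flux m) hq
        exact LB.dom (H.flux_difference m) ((H.lb_tD (m + 1)).shift H.mesh)
          ((H.lb_tB m).shift H.mesh) b)
  have key : ∀ i, Lim T (h ∘ φ) (fun n => Sum.elim (tD u) (tQ h u) i (φ n))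
      fun x t => F i (x, t) := fun i q hq => by
    refine (((hF i).2.tendsto_prod hΩ (hF i).1 hq).comp tendsto_comap).congr fun r => ?_
    simp only [Function.comp, mul_div_cancel_right₀ _ (H.mesh.pos (φ r.1)).ne', Nat.floor_natCast]
  exact ⟨φ, hφ, fun m x t => F (.inl m) (x, t), fun m x t => F (.inr m) (x, t),
    fun m => (hF _).1, fun m => (hF _).1, fun m => key (.inl m), fun m => key (.inr m)⟩

/-- Smooth limits of semi-discrete solutions. -/
theorem Approx.exists_limit (H : Approx T h N u M) : ∃ φ : ℕ → ℕ, StrictMono φ ∧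
    ∃ U P : ℝ → ℝ → ℝ,
    ContDiffOn ℝ ∞ (fun q : ℝ × ℝ => U q.1 q.2) (Ioi (0 : ℝ) ×ˢ Ioo 0 T) ∧
    ∀ x > 0, ∀ t ∈ Ioo 0 T, 0 < U x t ∧ HasDerivAt (fun y => U y t) (P x t) x ∧
      (∃ D, HasDerivAt (fun y => P y t) D x ∧
        HasDerivAt (U x) (D / (1 + P x t ^ 2) + 3 / x * P x t - 3 / U x t) t) ∧
      Tendsto (fun n => u (φ n) ⌊x / h (φ n)⌋₊ t) atTop (nhds (U x t)) ∧
      Tendsto (fun n => tP h u 0 (φ n) ⌊x / h (φ n)⌋₊ t) atTop (nhds (P x t)) := by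
  obtain ⟨φ, hφ, U, Q, cU, cQ, lU, lQ⟩ := H.exists_lim
  have H' := H.comp hφ
  have hne : ∀ q ∈ Ioi (0 : ℝ) ×ˢ Ioo 0 T, (lat (h ∘ φ) q).NeBot := fun q hq =>
    (H'.mesh.tendsto_lat hq.1 q.2).neBot
  have hpos : ∀ q ∈ Ioi (0 : ℝ) ×ˢ Ioo 0 T, 0 < U 0 q.1 q.2 := fun q hq => by
    obtain ⟨b, hb⟩ := Box.exists_mem_nhds hq
    obtain ⟨c, C, hc, h1⟩ := H'.range b
    have := hne q hq
    refine hc.trans_le (ge_of_tendsto (lU 0 q hq)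
      (?_ : ∀ᶠ r in lat (h ∘ φ) q, c ≤ tD (u ∘ φ) 0 r.1 r.2.1 r.2.2))
    filter_upwards [(h1.prod_mk hb).comap fun r : ℕ × ℕ × ℝ =>
      (r.1, (r.2.1 * (h ∘ φ) r.1, r.2.2))] with r hr
    simpa [tD] using (hr.1 _ ((Box.mem_idx (H'.mesh.pos _)).2 hr.2.1) _ hr.2.2).1
  have hcos : ∀ q ∈ Ioi (0 : ℝ) ×ˢ Ioo 0 T, cos (Q 0 q.1 q.2) ≠ 0 := fun q hq => by
    have := hne q hq
    have hb : ∀ᶠ r in lat (h ∘ φ) q, tQ (h ∘ φ) (u ∘ φ) 0 r.1 r.2.1 r.2.2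
        ∈ Icc (-arctan M) (arctan M) := by
      filter_upwards [H'.slope_le.lat H'.mesh hq] with r hr
      rw [← arctan_neg, tQ, iteratedDeriv_zero]
      exact ⟨arctan_mono (abs_le.1 hr).1, arctan_mono (abs_le.1 hr).2⟩
    have h1 := isClosed_Icc.mem_of_tendsto (lQ 0 q hq) hb
    exact (cos_pos_of_mem_Ioo ⟨by linarith [h1.1, arctan_lt_pi_div_two M],
      by linarith [h1.2, arctan_lt_pi_div_two M]⟩).ne'
  have lP : Lim T (h ∘ φ) (tP (h ∘ φ) (u ∘ φ) 0) fun x t => tan (Q 0 x t) := fun q hq =>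
    (((continuousAt_tan.2 (hcos q hq)).tendsto.comp (lQ 0 q hq))).congr fun r => by
      simp only [Function.comp, tQ, iteratedDeriv_zero, tan_arctan]
  have hUx := fun q hq => (lU 0).hasDerivAt_space lP H'.mesh (H'.hmul_tP 0) (q := q) hq
  have hQx : ∀ q ∈ Ioi (0 : ℝ) ×ˢ Ioo 0 T, HasDerivAt (fun y => Q 0 y q.2) (U 1 q.1 q.2
      + (-3 * (q.1⁻¹ * tan (Q 0 q.1 q.2)) + 3 * (U 0 q.1 q.2)⁻¹)) q.1 := fun q hq => by
    refine (lQ 0).hasDerivAt_space (B := fun x t => U 1 x t + (-3 * (x⁻¹ * tan (Q 0 x t))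
      + 3 * (U 0 x t)⁻¹)) (fun q hq => ?_) H'.mesh (H'.hmul_flux 0) hq
    have hs := H'.mesh.tendsto_lat_succ (q := q)
    have l1 := ((lU 1 q hq).comp hs).add (((((tendsto_lat_pos.comp (hs.comp hs)).inv₀
      (ne_of_gt hq.1)).mul ((lP q hq).comp hs)).const_mul (-3)).add
      ((((lU 0 q hq).comp hs).inv₀ (hpos q hq).ne').const_mul 3))
    refine l1.congr' ?_
    filter_upwards [(H'.eqn_tD 0).lat H'.mesh hq] with r hr
    rw [← sub_eq_iff_eq_add] at hr
    simp only [Function.comp] at hr ⊢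
    rw [← hr, tB, tZ]
    simp only [tD, iteratedDeriv_zero, Function.comp, div_eq_mul_inv]
    grind
  obtain ⟨h1, h2⟩ := contDiffOn_of_flux (isOpen_Ioi.prod isOpen_Ioo) (by grind)
    (by grind) hcos cU cQ
    (fun m q hq => (lU m).hasDerivAt_time (lU (m + 1)) H'.mesh (H'.hasDerivAt_tD m) hq)
    (fun m q hq => (lQ m).hasDerivAt_time (lQ (m + 1)) H'.mesh (H'.hasDerivAt_tQ m) hq) hUx hQx
  refine ⟨φ, hφ, U 0, fun x t => tan (Q 0 x t), h1, fun x hx t ht => ⟨hpos (x, t) ⟨hx, ht⟩,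
    hUx (x, t) ⟨hx, ht⟩, ⟨_, h2 (x, t) ⟨hx, ht⟩, ?_⟩, ?_, lP.tendsto_nat H'.mesh hx ht⟩⟩
  · refine ((lU 0).hasDerivAt_time (lU 1) H'.mesh (H'.hasDerivAt_tD 0) (q := (x, t))
      ⟨hx, ht⟩).congr_deriv ?_
    rw [mul_div_cancel_left₀ _ (by positivity)]
    ring
  · simpa [tD] using (lU 0).tendsto_nat H'.mesh hx ht

variable {k : ℕ} {K0 C0 : ℝ} {W p p' B u0 : ℝ → ℝ}

/-- Two-sided bounds for lattice approximations. -/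
def Close (k : ℕ) (W u0 : ℝ → ℝ) (ε τ y c s T h : ℝ) (N : ℕ) (u : ℕ → ℝ → ℝ) : Prop :=
  ∀ t ∈ Icc s T, t ≤ τ → ∀ j < N, |u j t - u0 (pt h j)| ≤ ε ∧
    (pt h j < y * √t → scl k (1 - ε) t * W (pt h j / scl k (1 - ε) t) ≤ u j t ∧
      u j t ≤ scl k (1 + ε) t * W (pt h j / scl k (1 + ε) t)) ∧
    min (pt h j) c ≤ u j t ∧ t ^ k ≤ u j t

theorem Datum.eventually_close (H : Datum k K0 C0 u0 W p p' B) {ε : ℝ} (hε : 0 < ε)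
    (hε1 : ε ≤ 1 / 6) :
    ∃ τ > 0, ∃ y > 0, ∃ c > 0, ∀ᶠ s in 𝓝[>] 0, ∀ L ≥ 2, C0 < L → ∀ T R : ℝ,
      ∀ᶠ h in 𝓝[>] 0, ∀ N u, pt h N ≤ R → Flow k K0 W u0 L s T h N u →
        Close k W u0 ε τ y c s T h N u := by
  obtain ⟨τ, hτ, y, hy, _, -, h1⟩ := H.eventually_trapped hε hε1 (one_pow 2)
  obtain ⟨τ', hτ', y', hy', c, hc, h2⟩ := H.eventually_trapped hε hε1 (σ := -1) (by norm_num)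
  refine ⟨min τ τ', lt_min hτ hτ', min y y', lt_min hy hy', c, hc, ?_⟩
  filter_upwards [h1, h2] with s h1 h2 L hL hCL T R
  filter_upwards [h1 L hL hCL T R, h2 L hL hCL T R] with h h1 h2 N u hR H t ht htτ j hj
  obtain ⟨a1, a2, -⟩ := h1 N u hR H t ht (htτ.trans (min_le_left _ _)) j hj
  obtain ⟨b1, b2, b3⟩ := h2 N u hR H t ht (htτ.trans (min_le_right _ _)) j hj
  refine ⟨abs_le.2 ⟨by linarith, by linarith⟩, fun hlt => ⟨?_, ?_⟩, b3 rfl⟩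
  · have := b2 (hlt.trans_le (by gcongr; exact min_le_right _ _))
    rw [neg_one_mul, neg_one_mul, neg_one_mul, neg_le_neg_iff, ← sub_eq_add_neg] at this
    exact this
  · simpa only [one_mul] using a2 (hlt.trans_le (by gcongr; exact min_le_left _ _))

/-- Lattice approximations on finer and finer lattices, starting at earlier and earlier times. -/
structure FlowSeq (k : ℕ) (K0 : ℝ) (W u0 : ℝ → ℝ) (T G L : ℝ) (τ y c s h : ℕ → ℝ) (N : ℕ → ℕ)
    (u : ℕ → ℕ → ℝ → ℝ) : Prop where
  flow : ∀ n, Flow k K0 W u0 L (s n) T (h n) (N n) (u n)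
  s_pos : ∀ n, 0 < s n
  s_le : ∀ n : ℕ, s n ≤ 1 / (n + 1)
  h_le : ∀ n : ℕ, h n ≤ 1 / (n + 1)
  top : ∀ n : ℕ, n + 2 ≤ pt (h n) (N n)
  slope_le : ∀ n, ∀ t ∈ Icc (s n) T, ∀ i ≤ N n, |slope (h n) (fun j => u n j t) i| ≤ G
  le : T ≤ τ 0
  close : ∀ n : ℕ, ∀ i ≤ n,
    Close k W u0 (1 / ((i : ℝ) + 6)) (τ i) (y i) (c i) (s n) T (h n) (N n) (u n)

theorem Datum.exists_flowSeq (H : Datum k K0 C0 u0 W p p' B) :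
    ∃ T > 0, ∃ G > 0, ∃ L ≥ G, ∃ τ y c s h N u, (∀ i, 0 < τ i) ∧ (∀ i, 0 < y i) ∧
      (∀ i, 0 < c i) ∧ FlowSeq k K0 W u0 T G L τ y c s h N u := by
  obtain ⟨hk, hK, hC0, hs, hpos, -, hd1, -, hW⟩ := id H
  choose τ hτ y hy c hc hev using fun i : ℕ => H.eventually_close
    (ε := 1 / ((i : ℝ) + 6)) (by positivity) (by gcongr; linarith [i.cast_nonneg (α := ℝ)])
  obtain ⟨M, hM⟩ := exists_data_lipschitz (k := k) hK.le hW hs hd1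
  obtain ⟨M', hM', hM0, hMC⟩ : ∃ M', M < M' ∧ 0 < M' ∧ C0 < M' :=
    ⟨max M C0 + 1, by linarith [le_max_left M C0], by linarith [le_max_right M C0],
      by linarith [le_max_right M C0]⟩
  obtain ⟨T, hT, hT1, hTτ⟩ : ∃ T > 0, T ≤ 1 ∧ T ≤ τ 0 :=
    ⟨min 1 (τ 0), lt_min one_pos (hτ 0), min_le_left _ _, min_le_right _ _⟩
  obtain ⟨G, hG⟩ : ∃ G, G = M' * exp (3 * (1 + 2 / c 0 ^ 2) + 1) := ⟨_, rfl⟩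
  have hG0 : 0 < G := by rw [hG]; positivity
  have hu0 : ∀ x > 0, ∀ y > x, |u0 y - u0 x| < M' * (y - x) := fun x hx y hxy => by
    obtain ⟨z, hz, h1⟩ := exists_deriv_eq_slope u0 hxy
      (hs.continuousOn.mono fun z hz => hx.trans_le hz.1)
      ((hs.differentiableOn (by simp)).mono fun z hz => hx.trans hz.1)
    obtain ⟨h2, h3⟩ := hd1 z (hx.trans hz.1)
    have hp : 0 < y - x := sub_pos.2 hxy
    rw [h1] at h2 h3
    rw [abs_of_nonneg (by simpa using (le_div_iff₀ hp).1 h2)]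
    exact ((div_le_iff₀ hp).1 h3).trans_lt (by gcongr)
  have hsn : ∀ n : ℕ, ∃ s, 0 < s ∧ s ≤ 1 / ((n : ℝ) + 1) ∧ s ≤ T ∧ ∀ i ∈ range (n + 1),
      ∀ L ≥ 2, C0 < L → ∀ T R : ℝ, ∀ᶠ h in 𝓝[>] 0, ∀ N u, pt h N ≤ R →
        Flow k K0 W u0 L s T h N u → Close k W u0 (1 / ((i : ℝ) + 6)) (τ i) (y i) (c i) s T h N u := fun n =>
    ((eventually_mem_nhdsWithin (a := (0 : ℝ)) (s := Ioi 0)).and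
      ((Eventually.filter_mono nhdsWithin_le_nhds
        (eventually_le_nhds (Nat.one_div_pos_of_nat (n := n)))).and
      ((Eventually.filter_mono nhdsWithin_le_nhds (eventually_le_nhds hT)).and
      ((Finset.eventually_all _).2 fun i _ => hev i)))).exists
  choose s hs0 hs1 hsT hs2 using hsn
  have hL2 : G + C0 + 2 ≥ 2 := by linarith
  have hhn : ∀ n : ℕ, ∃ h, ∃ N : ℕ, ∃ u, 0 < h ∧ h ≤ 1 / ((n : ℝ) + 1) ∧ h ≤ c 0 / 2 ∧
      8 * h ≤ (s n ^ k) ^ 3 ∧ n + 2 ≤ pt h N ∧ Flow k K0 W u0 (G + C0 + 2) (s n) T h N u ∧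
      ∀ i ∈ range (n + 1), Close k W u0 (1 / ((i : ℝ) + 6)) (τ i) (y i) (c i) (s n) T h N u := fun n => by
    have hle : ∀ a > 0, ∀ᶠ h in 𝓝[>] (0 : ℝ), h ≤ a := fun a ha =>
      Eventually.filter_mono nhdsWithin_le_nhds (eventually_le_nhds ha)
    have hsk : 0 < (s n ^ k) ^ 3 / 8 := by have := hs0 n; positivity
    obtain ⟨h, h0 : 0 < h, h1, h2, h3, h4⟩ := (eventually_mem_nhdsWithin.and
      ((hle _ (Nat.one_div_pos_of_nat (n := n))).and ((hle _ (half_pos (hc 0))).and ((hle _ hsk).and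
      ((Finset.eventually_all _).2 fun i hi =>
        hs2 n i hi (G + C0 + 2) hL2 (by linarith) T (n + 4)))))).exists
    have h1' : h ≤ 1 := h1.trans (div_le_one_of_le₀ (by simp) (by positivity))
    have e1 := (div_le_iff₀ h0).1 (Nat.le_ceil (((n : ℝ) + 2) / h))
    have e2 := (lt_div_iff₀ h0).1 (sub_lt_iff_lt_add.2
      (Nat.ceil_lt_add_one (show 0 ≤ ((n : ℝ) + 2) / h by positivity)))
    have e3 : (n : ℝ) + 2 ≤ pt h ⌈((n : ℝ) + 2) / h⌉₊ := by unfold pt; linarith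
    obtain ⟨u, hu⟩ := exists_flow (k := k) (K0 := K0) (W := W) (u0 := u0) (L := G + C0 + 2)
      (by linarith) (hs0 n) (hsT n) h0 h1' (e3.trans' (by linarith [n.cast_nonneg (α := ℝ)]))
    exact ⟨h, _, u, h0, h1, h2, by linarith, e3, hu, fun i hi => h4 i hi _ u
      (by unfold pt; linarith) hu⟩
  choose h N u h0 h1 h2 h3 h4 h5 h6 using hhn
  refine ⟨T, hT, G, hG0, G + C0 + 2, by linarith, τ, y, c, s, h, N, u, hτ, hy, hc, h5, hs0, hs1,
    h1, h4, fun n => ?_, hTτ, fun n i hi => h6 n i (Finset.mem_range_succ_iff.2 hi)⟩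
  refine (h5 n).slope_le (hs0 n) hT1 (hsT n) (hc 0)
    (fun t ht j hj => (h6 n 0 (by simp) t ht (ht.2.trans hTτ) j hj).2.2) hM0
    (fun x hx y hxy => ?_) hu0 (h2 n) (h3 n) hG (by linarith)
  exact (hM _ ⟨hs0 n, (hsT n).trans hT1⟩ x hx y hxy).trans_lt (by
    have := sub_pos.2 hxy
    gcongr)

variable {k : ℕ} {K0 C0 : ℝ} {W p p' B u0 : ℝ → ℝ} {T G L : ℝ} {τ y c s h : ℕ → ℝ} {N : ℕ → ℕ}
  {u : ℕ → ℕ → ℝ → ℝ}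

namespace FlowSeq

theorem mesh (H : FlowSeq k K0 W u0 T G L τ y c s h N u) : Mesh h N where
  pos n := (H.flow n).h_pos
  tendsto := squeeze_zero (fun n => (H.flow n).h_pos.le) H.h_le tendsto_one_div_add_atTop_nhds_zero_nat
  top := tendsto_atTop_mono (fun n => by
    have h1 := H.top n
    have h2 := (H.flow n).h_le
    rw [pt] at h1
    linarith) tendsto_natCast_atTop_atTop

theorem eventually (H : FlowSeq k K0 W u0 T G L τ y c s h N u) {t : ℝ} (ht : 0 < t) (X : ℝ) :
    ∀ᶠ n in atTop, s n < t ∧ ∀ j : ℕ, j * h n ≤ X → j + 2 < N n := by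
  filter_upwards [tendsto_natCast_atTop_atTop.eventually_gt_atTop (X + 1),
    tendsto_one_div_add_atTop_nhds_zero_nat.eventually (gt_mem_nhds ht)] with n h1 h2
  refine ⟨(H.s_le n).trans_lt h2, fun j hj => ?_⟩
  by_contra! hN
  have h3 := H.top n
  have h4 : (N n : ℝ) * h n ≤ (j + 2) * h n := by
    have := (H.flow n).h_pos
    gcongr
    exact_mod_cast hN
  have h5 := (H.flow n).h_le
  rw [pt] at h3
  linarith

theorem lower (H : FlowSeq k K0 W u0 T G L τ y c s h N u) {n : ℕ} {t : ℝ} (ht : t ∈ Icc (s n) T)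
    {j : ℕ} (hj : j < N n) : |u n j t - u0 (pt (h n) j)| ≤ 1 / 6 ∧
      min (pt (h n) j) (c 0) ≤ u n j t ∧ t ^ k ≤ u n j t ∧ 0 < u n j t ∧
      3 / max (u n j t) (s n ^ k) = 3 / u n j t := by
  obtain ⟨h1, -, h2, h3⟩ := H.close n 0 n.zero_le t ht (ht.2.trans H.le) j hj
  rw [Nat.cast_zero, zero_add] at h1
  have h4 := pow_le_pow_left₀ (H.s_pos n).le ht.1 k
  exact ⟨h1, h2, h3, (pow_pos (H.s_pos n) k).trans_le (h4.trans h3), by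
    rw [max_eq_left (h4.trans h3)]⟩

theorem tP_eq (n j : ℕ) (t : ℝ) :
    tP h u 0 n j t = slope (h n) (fun i => u n i t) (j + 1) := by
  simp [tP, tD, slope]

theorem approx (H : FlowSeq k K0 W u0 T G L τ y c s h N u) (hL : G ≤ L) (hc : 0 < c 0)
    (hu0 : MonotoneOn u0 (Ioi 0)) : Approx T h N u G := by
  have hs := fun n => (H.flow n).sol.contDiffOn (H.flow n).one_le.1
    (fun j hj t ht => ⟨(H.lower ⟨ht.1.le, ht.2.le⟩ hj).2.2.2.1.ne',
      (H.lower ⟨ht.1.le, ht.2.le⟩ hj).2.2.2.2⟩)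
    fun t ht i hi => (H.slope_le n t ⟨ht.1.le, ht.2.le⟩ i hi).trans hL
  refine ⟨H.mesh, fun b => ?_, fun b => ?_, fun b => ?_, fun b => ?_⟩
  · filter_upwards [H.eventually b.t₁_pos b.X₂] with n hn j hj t ht
    have := hn.2 j ((Box.mem_idx (H.mesh.pos n)).1 hj).2
    exact ((hs n).2 j (by omega)).contDiffAt (Ioo_mem_nhds (hn.1.trans_le ht.1)
      (ht.2.trans_lt b.t₂_lt))
  · filter_upwards [H.eventually b.t₁_pos b.X₂] with n hn j hj t ht
    have := hn.2 j ((Box.mem_idx (H.mesh.pos n)).1 hj).2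
    filter_upwards [Ioo_mem_nhds (hn.1.trans_le ht.1) (ht.2.trans_lt b.t₂_lt)] with r hr
    rw [((hs n).1 (j + 1) (by omega) r hr).deriv, tB, tZ, iteratedDeriv_zero, tP_eq, tP_eq]
    ring
  · filter_upwards [H.eventually b.t₁_pos b.X₂] with n hn j hj t ht
    have := hn.2 j ((Box.mem_idx (H.mesh.pos n)).1 hj).2
    rw [tP_eq]
    exact H.slope_le n t ⟨hn.1.le.trans ht.1, ht.2.trans b.t₂_lt.le⟩ _ (by omega)
  · refine ⟨min b.X₁ (c 0), u0 (b.X₂ + 1) + 1 / 6, lt_min b.X₁_pos hc, ?_⟩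
    filter_upwards [H.eventually b.t₁_pos b.X₂] with n hn j hj t ht
    obtain ⟨h1, h2⟩ := (Box.mem_idx (H.mesh.pos n)).1 hj
    obtain ⟨h3, h4, -⟩ := H.lower ⟨hn.1.le.trans ht.1, ht.2.trans b.t₂_lt.le⟩
      (show j < N n by have := hn.2 j h2; omega)
    have hh := H.mesh.pos n
    have hp : pt (h n) j = j * h n + h n / 2 := by rw [pt]; ring
    have := hu0 (pt_pos hh j) (show (0 : ℝ) < b.X₂ + 1 by linarith [b.X₁_pos, b.X₁_le])
      (by linarith [(H.flow n).h_le])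
    exact ⟨(min_le_min_right _ (by linarith)).trans h4, by linarith [(abs_le.1 h3).2]⟩

theorem slope_axis (H : FlowSeq k K0 W u0 T G L τ y c s h N u) (hG : 0 < G) (hL : G ≤ L) {t : ℝ}
    (ht : t ∈ Ioo 0 T) : ∃ C : ℝ, ∀ x > 0, ∀ᶠ n in atTop,
      |tP h u 0 n ⌊x / h n⌋₊ t| ≤ C * (⌊x / h n⌋₊ * h n + h n) := by
  obtain ⟨ht0, htT⟩ := ht
  have hc : 0 < (t / 2) ^ k := by positivity
  obtain ⟨S, hS⟩ : ∃ S, S = T - t / 2 + 1 := ⟨_, rfl⟩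
  have hS0 : 0 < S := by linarith
  obtain ⟨a, ha⟩ : ∃ a, a = 1 / 2 + 3 / ((t / 2) ^ k) ^ 2 * S := ⟨_, rfl⟩
  have ha0 : 0 < a := by rw [ha]; positivity
  obtain ⟨b, hb⟩ : ∃ b, b = (1 + (2 * G) ^ 2) ^ 2 := ⟨_, rfl⟩
  have hb0 : 0 < b := by rw [hb]; positivity
  obtain ⟨K, hK⟩ : ∃ K, K = 1 + G * √S + a * b := ⟨_, rfl⟩
  have hGS : 0 ≤ G * √S := by positivity
  have hab : 0 < a * b := by positivity
  have hK0 : 0 < K := by linarith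
  refine ⟨K / √(t - t / 2), fun x hx => ?_⟩
  filter_upwards [H.eventually (half_pos ht0) (x + 2)] with n hn
  have hh := H.mesh.pos n
  have hh1 := (H.flow n).h_le
  have e1 := (div_le_iff₀ hh).1 (Nat.le_ceil (1 / h n))
  have e2 := (lt_div_iff₀ hh).1 (sub_lt_iff_lt_add.2
    (Nat.ceil_lt_add_one (show 0 ≤ 1 / h n by positivity)))
  have e3 := floor_mul_mem hx.le hh
  have e4 : 0 < ⌈1 / h n⌉₊ := Nat.ceil_pos.2 (by positivity)
  have e5 : (0 : ℝ) ≤ ⌊x / h n⌋₊ * h n := by positivity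
  have hN := hn.2 (⌊x / h n⌋₊ + ⌈1 / h n⌉₊) (by push_cast; linarith [e3.2])
  have key := ((H.flow n).sol.mono (s' := t / 2) hn.1.le le_rfl).slope_axis (r := 2) (K := K) hh hG hL
    hc (fun j hj t' ht' => by
      obtain ⟨-, -, h1, -, h2⟩ := H.lower ⟨hn.1.le.trans ht'.1, ht'.2⟩ hj
      exact ⟨(pow_le_pow_left₀ (by positivity) ht'.1 k).trans h1, h2⟩)
    (fun t' ht' => H.slope_le n t' ⟨hn.1.le.trans ht'.1, ht'.2⟩) hK0 (by rw [← hS]; linarith)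
    (by
      rw [← hS, ← hb, lt_div_iff₀ hb0, show (K / 2 + 3 / ((t / 2) ^ k) ^ 2 * K * S) * b
        = K * (a * b) by rw [ha]; ring]
      have : a * b < K * K := by nlinarith
      nlinarith)
    (n := ⌊x / h n⌋₊ + ⌈1 / h n⌉₊) (by omega) (by push_cast; linarith) t ⟨by linarith, htT.le⟩
    (⌊x / h n⌋₊ + 1) (by omega)
  rw [tP_eq]
  refine key.trans_eq ?_
  push_cast
  ring

end FlowSeq

/-- Existence of the flow, with precise bounds for small times. -/
theorem Datum.exists_flow_limit (H : Datum k K0 C0 u0 W p p' B) :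
    ∃ T > 0, ∃ U P : ℝ → ℝ → ℝ,
      ContDiffOn ℝ ∞ (fun q : ℝ × ℝ => U q.1 q.2) (Ioi 0 ×ˢ Ioo 0 T) ∧
      (∀ x > 0, ∀ t ∈ Ioo 0 T, 0 < U x t ∧ HasDerivAt (fun y => U y t) (P x t) x ∧
        ∃ D, HasDerivAt (fun y => P y t) D x ∧
          HasDerivAt (U x) (D / (1 + P x t ^ 2) + 3 / x * P x t - 3 / U x t) t) ∧
      (∀ t ∈ Ioo 0 T, ∃ C, ∀ x > 0, |P x t| ≤ C * x) ∧
      ∀ i : ℕ, ∃ τ > 0, ∃ y > 0, ∀ t ∈ Ioo 0 T, t ≤ τ → ∀ x > 0,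
        |U x t - u0 x| ≤ 1 / (i + 6) ∧
        (x < y * √t → scl k (1 - 1 / (i + 6)) t * W (x / scl k (1 - 1 / (i + 6)) t) ≤ U x t ∧
          U x t ≤ scl k (1 + 1 / (i + 6)) t * W (x / scl k (1 + 1 / (i + 6)) t)) := by
  obtain ⟨T, hT, G, hG, L, hL, τ, y, c, s, h, N, u, hτ, hy, hc, HF⟩ := H.exists_flowSeq
  obtain ⟨φ, hφ, U, P, h1, h2⟩ := (HF.approx hL (hc 0) H.monotoneOn).exists_limit
  have hφt := hφ.tendsto_atTop
  have hfl : ∀ x > 0, Tendsto (fun n => (⌊x / h (φ n)⌋₊ : ℝ) * h (φ n)) atTop (nhds x) :=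
    fun x hx => (HF.mesh.tendsto_floor hx).comp hφt
  have hht : Tendsto (fun n => h (φ n)) atTop (nhds 0) := HF.mesh.tendsto.comp hφt
  have hpt : ∀ x > 0, Tendsto (fun n => pt (h (φ n)) ⌊x / h (φ n)⌋₊) atTop (nhds x) := fun x hx => by
    have := (hfl x hx).add (hht.div_const 2)
    simp only [zero_div, add_zero] at this
    exact this.congr fun n => by rw [pt]; ring
  refine ⟨T, hT, U, P, h1, fun x hx t ht => ?_, fun t ht => ?_, fun i => ⟨τ i, hτ i, y i, hy i,
    fun t ht htτ x hx => ?_⟩⟩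
  · obtain ⟨a1, a2, a3, -⟩ := h2 x hx t ht
    exact ⟨a1, a2, a3⟩
  · obtain ⟨C, hC⟩ := HF.slope_axis hG hL ht
    refine ⟨C, fun x hx => le_of_tendsto_of_tendsto (h2 x hx t ht).2.2.2.2.abs
      (by simpa using ((hfl x hx).add hht).const_mul C) (hφt.eventually (hC x hx))⟩
  · have hU := (h2 x hx t ht).2.2.2.1
    have hev : ∀ᶠ n in atTop, _ := hφt.eventually ((eventually_ge_atTop i).and (HF.eventually ht.1 x))
    have hcl : ∀ᶠ n in atTop, _ := hev.mono fun n hn =>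
      HF.close (φ n) i hn.1 t ⟨hn.2.1.le, ht.2.le⟩ htτ ⌊x / h (φ n)⌋₊
        (by have := hn.2.2 _ (floor_mul_mem hx.le (HF.mesh.pos (φ n))).2; omega)
    refine ⟨?_, fun hxy => ?_⟩
    · exact le_of_tendsto (hU.sub (((H.smooth.continuousOn.continuousAt (Ioi_mem_nhds hx)).tendsto).comp
        (hpt x hx))).abs (hcl.mono fun n hn => hn.1)
    · have hin : ∀ θ : ℝ, Tendsto (fun n => scl k θ t * W (pt (h (φ n)) ⌊x / h (φ n)⌋₊ / scl k θ t))
          atTop (nhds (scl k θ t * W (x / scl k θ t))) := fun θ =>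
        ((H.profile.hasDerivAt _).continuousAt.tendsto.comp ((hpt x hx).div_const _)).const_mul _
      have hlt := (hpt x hx).eventually (gt_mem_nhds hxy)
      exact ⟨le_of_tendsto_of_tendsto (hin _) hU
        ((hcl.and hlt).mono fun n hn => (hn.1.2.1 hn.2).1),
        le_of_tendsto_of_tendsto hU (hin _) ((hcl.and hlt).mono fun n hn => (hn.1.2.1 hn.2).2)⟩

end Lattice

theorem AlencarProfile.monotoneOn {K : ℝ} {W p p' B : ℝ → ℝ} (hW : AlencarProfile K W p p' B) :
    MonotoneOn W (Ici 0) :=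
  monotoneOn_of_deriv_nonneg (convex_Ici 0)
    (fun z _ => (hW.hasDerivAt z).continuousAt.continuousWithinAt)
    (fun z _ => (hW.hasDerivAt z).differentiableAt.differentiableWithinAt) fun z hz => by
      rw [(hW.hasDerivAt z).deriv]
      exact hW.slope_nonneg z (interior_subset hz)

/-- Rescaled profiles are close to the profile on bounded intervals. -/
theorem AlencarProfile.abs_sub_le {K : ℝ} {W p p' B : ℝ → ℝ} (hW : AlencarProfile K W p p' B)
    {ε v z Z : ℝ} (hε : 0 ≤ ε) (hε1 : ε < 1) (hz : 0 < z) (hZ : z ≤ Z)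
    (h1 : (1 - ε) * W (z / (1 - ε)) ≤ v) (h2 : v ≤ (1 + ε) * W (z / (1 + ε))) :
    |v - W z| ≤ ε * W Z := by
  have h3 := hW.monotoneOn hz.le (hz.trans_le hZ).le hZ
  have h4 := hW.monotoneOn hz.le (div_pos hz (sub_pos.2 hε1)).le
    (le_div_self hz.le (sub_pos.2 hε1) (by linarith))
  have h5 := hW.monotoneOn (show 0 ≤ z / (1 + ε) by positivity) hz.le
    (div_le_self hz.le (by linarith))
  have h6 := mul_le_mul_of_nonneg_left h3 hε
  have h7 := mul_le_mul_of_nonneg_left h4 (sub_pos.2 hε1).le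
  have h8 := mul_le_mul_of_nonneg_left h5 (show 0 ≤ 1 + ε by linarith)
  exact abs_le.2 ⟨by linarith, by linarith⟩

theorem AlencarProfile.isLittleO {K : ℝ} {W p p' B : ℝ → ℝ} (hW : AlencarProfile K W p p' B) :
    (fun z => W z - z - K * z ^ (-2 : ℤ)) =o[atTop] fun z : ℝ => z ^ (-2 : ℤ) := by
  refine isLittleO_of_tendsto' ((eventually_gt_atTop 0).mono fun z hz h => ?_) ?_
  · exact absurd h (zpow_pos hz _).ne'
  · have := hW.tendsto.sub_const K
    rw [sub_self] at this
    refine this.congr' ((eventually_gt_atTop 0).mono fun z hz => ?_)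
    simp only [zpow_neg, zpow_ofNat]
    field_simp

open Lattice

/-- Short-time existence, together with convergence of the inner rescaling
`t^{-k/3} u(t^{k/3} z, t)` to the Alencar solution `W` with `W(z) = z + K1 z^{-2} + o(z^{-2})`. -/
theorem stmt_1
    (k : ℕ) (hk : 4 ≤ k) (K0 C0 : ℝ) (hK0 : 0 < K0) (hC0 : 0 < C0)
    (K1 : ℝ) (hK1 : K1 = (Nat.doubleFactorial (2 * k + 1) : ℝ) * K0)
    (u0 : ℝ → ℝ)
    (hu0smooth : ContDiffOn ℝ (⊤ : ℕ∞) u0 (Set.Ioi 0))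
    (hu0pos : ∀ x > (0:ℝ), 0 < u0 x)
    (hu0asym : (fun x => u0 x - x - K0 * x ^ (2 * (k - 1)))
        =o[nhdsWithin 0 (Set.Ioi 0)] fun x : ℝ => x ^ (2 * (k - 1)))
    (hd1 : ∀ x > (0:ℝ), 0 ≤ deriv u0 x ∧ deriv u0 x ≤ C0)
    (hd2 : ∀ x > (0:ℝ), |deriv (deriv u0) x| ≤ C0)
    (hd2' : ∀ x > (0:ℝ), |deriv (deriv u0) x| ≤ C0 * x ^ (2 * k - 4)) :
    ∃ t0 > (0:ℝ), ∃ u : ℝ → ℝ → ℝ,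
      ContDiffOn ℝ (⊤ : ℕ∞) (fun p : ℝ × ℝ => u p.1 p.2) (Set.Ioi (0:ℝ) ×ˢ Set.Ioc (0:ℝ) t0) ∧
      (∀ x > (0:ℝ), ∀ t ∈ Set.Ioc (0:ℝ) t0, 0 < u x t) ∧
      -- the profile equation
      (∀ x > (0:ℝ), ∀ t ∈ Set.Ioc (0:ℝ) t0,
        deriv (fun s => u x s) t
          = deriv (deriv (fun y => u y t)) x / (1 + (deriv (fun y => u y t) x) ^ 2)
            + (3 / x) * deriv (fun y => u y t) x - 3 / u x t) ∧
      -- boundary condition at x = 0⁺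
      (∀ t ∈ Set.Ioc (0:ℝ) t0,
        Filter.Tendsto (fun x => deriv (fun y => u y t) x)
          (nhdsWithin 0 (Set.Ioi 0)) (nhds 0)) ∧
      -- initial condition, uniformly in x > 0
      TendstoUniformlyOn (fun t x => u x t) u0 (nhdsWithin 0 (Set.Ioi 0)) (Set.Ioi 0) ∧
      -- Alencar profile in the inner region
      (∃ W : ℝ → ℝ,
        ContDiffOn ℝ (⊤ : ℕ∞) W (Set.Ioi 0) ∧
        (∀ z > (0:ℝ), 0 < W z) ∧
        (∀ z > (0:ℝ),
          deriv (deriv W) z / (1 + (deriv W z) ^ 2) + (3 / z) * deriv W z - 3 / W z = 0) ∧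
        ((fun z => W z - z - K1 * z ^ (-2 : ℤ)) =o[Filter.atTop] fun z : ℝ => z ^ (-2 : ℤ)) ∧
        (∀ Z > (0:ℝ),
          TendstoUniformlyOn
            (fun t z => t ^ (-((k : ℝ) / 3)) * u (t ^ ((k : ℝ) / 3) * z) t) W
            (nhdsWithin 0 (Set.Ioi 0)) (Set.Ioc 0 Z))) := by
  have hK : 0 < coef K0 k 0 := by rw [coef_zero]; positivity
  obtain ⟨W, p, p', B, hW⟩ := Alencar.exists_profile hK
  obtain ⟨T, hT, U, P, h1, h2, h3, h4⟩ :=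
    Datum.exists_flow_limit ⟨hk, hK0, hC0, hu0smooth, hu0pos, hu0asym, hd1, hd2, hW⟩
  have hsub : Ioc 0 (T / 2) ⊆ Ioo 0 T := fun t ht => ⟨ht.1, by linarith [ht.2]⟩
  have hd : ∀ x > 0, ∀ t ∈ Ioo 0 T, deriv (fun y => U y t) x = P x t := fun x hx t ht =>
    (h2 x hx t ht).2.1.deriv
  have hsmall : ∀ a > 0, ∀ b > 0, ∃ i : ℕ, 1 / ((i : ℝ) + 6) * a < b := fun a ha b hb => by
    obtain ⟨i, hi⟩ := exists_nat_gt (a / b)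
    rw [div_lt_iff₀ hb] at hi
    refine ⟨i, ?_⟩
    rw [div_mul_eq_mul_div, one_mul, div_lt_iff₀ (by positivity)]
    linarith
  have hev : ∀ a > 0, ∀ᶠ t in 𝓝[>] (0 : ℝ), t ∈ Ioc 0 a := fun a ha =>
    Ioc_mem_nhdsGT ha
  refine ⟨T / 2, half_pos hT, U, h1.mono (prod_mono_right hsub), fun x hx t ht =>
    (h2 x hx t (hsub ht)).1, fun x hx t ht => ?_, fun t ht => ?_, ?_, W, hW.smooth, fun z hz =>
    hz.le.trans_lt (hW.gt z hz.le), fun z hz => ?_, ?_, fun Z hZ => ?_⟩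
  · obtain ⟨-, -, D, h5, h6⟩ := h2 x hx t (hsub ht)
    have h7 : deriv (fun y => U y t) =ᶠ[nhds x] fun y => P y t := by
      filter_upwards [Ioi_mem_nhds hx] with y hy
      exact hd y hy t (hsub ht)
    rw [h7.deriv_eq, h5.deriv, hd x hx t (hsub ht)]
    exact h6.deriv
  · obtain ⟨C, hC⟩ := h3 t (hsub ht)
    refine squeeze_zero_norm' (a := fun x => C * x) ?_ ?_
    · filter_upwards [self_mem_nhdsWithin] with x hx
      rw [hd x hx t (hsub ht)]
      exact hC x hx
    · exact ((continuous_const.mul continuous_id).tendsto' (0 : ℝ) 0 (by simp)).mono_left nhdsWithin_le_nhds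
  · rw [Metric.tendstoUniformlyOn_iff]
    intro δ hδ
    obtain ⟨i, hi⟩ := hsmall 1 one_pos δ hδ
    obtain ⟨τ, hτ, _, _, h5⟩ := h4 i
    filter_upwards [hev _ (half_pos hT), hev _ hτ] with t ht ht' x hx
    rw [dist_comm, dist_eq]
    exact ((h5 t (hsub ht) ht'.2 x hx).1).trans_lt (by simpa using hi)
  · have h5 : deriv W = p := funext fun z => (hW.hasDerivAt z).deriv
    have h6 := hW.equation z
    rw [h5, (hW.hasDerivAt_slope z).deriv, ← h6]
    nth_rw 2 [hW.slope_eq z]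
    rw [← mul_assoc, div_mul_cancel₀ _ (ne_of_gt hz)]
  · rw [hK1, ← coef_zero]
    exact hW.isLittleO
  · rw [Metric.tendstoUniformlyOn_iff]
    intro δ hδ
    obtain ⟨i, hi⟩ := hsmall (W Z) (hZ.trans (hW.gt Z hZ.le)) δ hδ
    obtain ⟨τ, hτ, y, hy, h5⟩ := h4 i
    have hk' : (4 : ℝ) ≤ k := by exact_mod_cast hk
    have hlim : Tendsto (fun t : ℝ => t ^ ((k : ℝ) / 3 - 1 / 2) * Z) (𝓝[>] 0) (nhds 0) := by
      have : ContinuousAt (fun t : ℝ => t ^ ((k : ℝ) / 3 - 1 / 2) * Z) 0 :=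
        (continuousAt_rpow_const _ _ (Or.inr (by linarith))).mul continuousAt_const
      have h6 := this.tendsto
      rw [zero_rpow (by linarith), zero_mul] at h6
      exact h6.mono_left nhdsWithin_le_nhds
    filter_upwards [hev _ (half_pos hT), hev _ hτ, hlim.eventually (gt_mem_nhds hy)] with t ht ht' hty z hz
    have ht0 := ht.1
    have hl : 0 < t ^ ((k : ℝ) / 3) := rpow_pos_of_pos ht0 _
    have hsq : t ^ ((k : ℝ) / 3) = t ^ ((k : ℝ) / 3 - 1 / 2) * √t := by
      rw [sqrt_eq_rpow, ← rpow_add ht0, sub_add_cancel]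
    have hε : 1 / ((i : ℝ) + 6) < 1 := by
      rw [div_lt_one (by positivity)]
      linarith [i.cast_nonneg (α := ℝ)]
    obtain ⟨-, h6⟩ := h5 t (hsub ht) ht'.2 (t ^ ((k : ℝ) / 3) * z) (mul_pos hl hz.1)
    obtain ⟨h7, h8⟩ := h6 (by
      calc t ^ ((k : ℝ) / 3) * z ≤ t ^ ((k : ℝ) / 3) * Z := by gcongr; exact hz.2
        _ = t ^ ((k : ℝ) / 3 - 1 / 2) * Z * √t := by rw [hsq]; ring
        _ < y * √t := by gcongr)
    have hs : ∀ θ : ℝ, t ^ ((k : ℝ) / 3) * z / scl k θ t = z / θ := fun θ => by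
      rw [scl, mul_comm, mul_div_mul_right _ _ hl.ne']
    rw [hs, scl, mul_right_comm, ← le_div_iff₀ hl] at h7
    rw [hs, scl, mul_right_comm, ← div_le_iff₀ hl] at h8
    rw [dist_comm, dist_eq, rpow_neg ht0.le, inv_mul_eq_div]
    exact (hW.abs_sub_le (by positivity) hε hz.1 hz.2 h7 h8).trans_lt hi
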